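/- ℚ-algebraic approximation along a spine with values in a ℚ-nonsingular target: Let M be a compact d-dimensional C∞ submanifold of ℝ^n, let s ≥ n, let Y ⊆ ℝ^s be a projectively ℚ-closed ℚ-nonsingular ℚ-algebraic set of dimension d with M ∩ Y = ∅ (viewing ℝ^n ⊆ ℝ^s via the first n coordinates), and let S ⊆ ℝ^{s+1} = ℝ^s × ℝ be a compact (d+1)-dimensional C∞ submanifold with S ∩ (ℝ^s × (−1,1)) = (M ∪ Y) × (−1,1). Let W ⊆ ℝ^q be a ℚ-nonsingular ℚ-algebraic set and let φ : S → W be a C∞ map whose restriction to Y × {0} is ℚ-regular. Then for every ε > 0 there exist k ∈ ℕ, a ℚ-nonsingular ℚ-algebraic set Z ⊆ ℝ^{s+1+k}, a projectively ℚ-closed ℚ-nonsingular ℚ-algebraic set M' ⊆ ℝ^{s+1+k} contained in Z, a C∞ diffeomorphism h : M → M', and a ℚ-regular map η : Z → W such that |h(x) − (x,0)| < ε and |η(h(x)) − φ(x,0)| < ε for all x ∈ M (where (x,0) denotes the image of x under the inclusions ℝ^n ⊆ ℝ^s ⊆ ℝ^{s+1} ⊆ ℝ^{s+1+k}). -/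

import Mathlib

open MvPolynomial

noncomputable section

variable {ι κ : Type*} [Fintype ι] [DecidableEq ι] [Fintype κ]

/-- `V ⊆ ℝ^ι` is a `ℚ`-algebraic set: the common zero set of finitely many
polynomials with rational coefficients. -/
def IsQAlgebraicSet (V : Set (ι → ℝ)) : Prop :=
  ∃ S : Finset (MvPolynomial ι ℚ), V = {x : ι → ℝ | ∀ p ∈ S, aeval x p = 0}

/-- The gradient of a polynomial with rational coefficients at a real point. -/
def polyGradQ (p : MvPolynomial ι ℚ) (a : ι → ℝ) : ι → ℝ :=
  fun i => aeval a (pderiv i p)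

/-- `V` is a `d`-dimensional `C^∞` submanifold of `ℝ^ι`: near each of its points it is
the regular zero set of a `C^∞` submersion with values in `ℝ^(card ι - d)`. -/
def IsSmoothSubmanifold (d : ℕ) (V : Set (ι → ℝ)) : Prop :=
  ∀ a ∈ V, ∃ (U : Set (ι → ℝ)) (f : (ι → ℝ) → (Fin (Fintype.card ι - d) → ℝ)),
    IsOpen U ∧ a ∈ U ∧ ContDiffOn ℝ (⊤ : ℕ∞) f U ∧
    (∀ x ∈ U, Function.Surjective (fderiv ℝ f x)) ∧
    V ∩ U = {x ∈ U | f x = 0}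

/-- `V` is a `ℚ`-nonsingular `ℚ`-algebraic set of dimension `d`. -/
def IsQNonsingular (d : ℕ) (V : Set (ι → ℝ)) : Prop :=
  IsQAlgebraicSet V ∧ IsSmoothSubmanifold d V ∧
    ∀ a ∈ V, ∃ q : Fin (Fintype.card ι - d) → MvPolynomial ι ℚ,
      (∀ j, ∀ x ∈ V, aeval x (q j) = 0) ∧
      LinearIndependent ℝ (fun j => polyGradQ (q j) a) ∧
      ∃ U : Set (ι → ℝ), IsOpen U ∧ a ∈ U ∧
        V ∩ U = {x ∈ U | ∀ j, aeval x (q j) = 0}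

/-- A real polynomial is overt if the zero set of its top-degree homogeneous
component is contained in `{0}`. -/
def IsOvert (p : MvPolynomial ι ℝ) : Prop :=
  ∀ x : ι → ℝ, eval x (homogeneousComponent p.totalDegree p) = 0 → x = 0

/-- `V` is projectively `ℚ`-closed: the zero set of a single overt polynomial with
rational coefficients. -/
def IsProjQClosed (V : Set (ι → ℝ)) : Prop :=
  ∃ p : MvPolynomial ι ℚ, IsOvert (MvPolynomial.map (algebraMap ℚ ℝ) p) ∧
    V = {x : ι → ℝ | aeval x p = 0}

/-- `V ⊆ ℝ^ι` is a real algebraic set. -/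
def IsRAlgebraicSet (V : Set (ι → ℝ)) : Prop :=
  ∃ S : Finset (MvPolynomial ι ℝ), V = {x : ι → ℝ | ∀ p ∈ S, eval x p = 0}

/-- The gradient of a real polynomial at a point. -/
def polyGradR (p : MvPolynomial ι ℝ) (a : ι → ℝ) : ι → ℝ :=
  fun i => eval a (pderiv i p)

/-- `V` is a nonsingular real algebraic set of dimension `d`. -/
def IsNonsingularRAlgebraic (d : ℕ) (V : Set (ι → ℝ)) : Prop :=
  IsRAlgebraicSet V ∧ IsSmoothSubmanifold d V ∧
    ∀ a ∈ V, ∃ q : Fin (Fintype.card ι - d) → MvPolynomial ι ℝ,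
      (∀ j, ∀ x ∈ V, eval x (q j) = 0) ∧
      LinearIndependent ℝ (fun j => polyGradR (q j) a) ∧
      ∃ U : Set (ι → ℝ), IsOpen U ∧ a ∈ U ∧
        V ∩ U = {x ∈ U | ∀ j, eval x (q j) = 0}

/-- The tangent space of `M` at `a`, realized as the span of the tangent cone. -/
def tangentSpan (M : Set (ι → ℝ)) (a : ι → ℝ) : Submodule ℝ (ι → ℝ) :=
  Submodule.span ℝ (tangentConeAt ℝ M a)

/-- The submanifolds `Ms i` of `M`, of codimensions `c i`, are in general position. -/
def InGeneralPosition {ℓ : ℕ} (M : Set (ι → ℝ)) (Ms : Fin ℓ → Set (ι → ℝ))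
    (c : Fin ℓ → ℕ) : Prop :=
  ∀ α : Finset (Fin ℓ), α.Nonempty → ∀ a : ι → ℝ, (∀ i ∈ α, a ∈ Ms i) →
    Module.finrank ℝ ↥(⨅ i ∈ α, tangentSpan (Ms i) a) + ∑ i ∈ α, c i
      = Module.finrank ℝ ↥(tangentSpan M a)

/-- A `ℚ`-regular map on `S`: each component is a quotient of polynomials with
rational coefficients whose denominator does not vanish on `S`. -/
def IsQRegularMap (S : Set (ι → ℝ)) (g : (ι → ℝ) → κ → ℝ) : Prop :=
  ∀ j : κ, ∃ p q : MvPolynomial ι ℚ, (∀ x ∈ S, aeval x q ≠ 0) ∧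
    ∀ x ∈ S, g x j = aeval x p / aeval x q

/-- A map whose components are restrictions of polynomials with rational coefficients. -/
def IsQPolynomialMap {κ' : Type*} (S : Set (ι → ℝ)) (g : (ι → ℝ) → κ' → ℝ) : Prop :=
  ∀ j : κ', ∃ p : MvPolynomial ι ℚ, ∀ x ∈ S, g x j = aeval x p

/-- `f` restricts to a `C^∞` diffeomorphism from `A` onto `B`. -/
def IsSmoothDiffeoOn (f : (ι → ℝ) → κ → ℝ) (A : Set (ι → ℝ)) (B : Set (κ → ℝ)) : Prop :=
  Set.BijOn f A B ∧ ContDiffOn ℝ (⊤ : ℕ∞) f A ∧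
    ∃ g : (κ → ℝ) → ι → ℝ, ContDiffOn ℝ (⊤ : ℕ∞) g B ∧ Set.InvOn g f A B

/-- `L` is a `ℚ`-nice `ℚ`-algebraic set. -/
def IsQNice (L : Set (ι → ℝ)) : Prop :=
  ∀ a ∈ L, ∃ U : Set (ι → ℝ), IsOpen U ∧ a ∈ U ∧
    ∀ f : (ι → ℝ) → ℝ, ContDiff ℝ (⊤ : ℕ∞) f → (∀ x ∈ L, f x = 0) →
      ∃ (s : ℕ) (pp : Fin s → MvPolynomial ι ℚ) (u : Fin s → (ι → ℝ) → ℝ),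
        (∀ i, ∀ x ∈ L, aeval x (pp i) = 0) ∧
        (∀ i, ContDiffOn ℝ (⊤ : ℕ∞) (u i) U) ∧
        ∀ x ∈ U, f x = ∑ i, u i x * aeval x (pp i)

/-- Inclusion `ℝ^a ⊆ ℝ^b` via the first `a` coordinates. -/
def inclZero {a b : ℕ} (_ : a ≤ b) (x : Fin a → ℝ) : Fin b → ℝ :=
  fun j => if hj : (j : ℕ) < a then x ⟨j, hj⟩ else 0

/-- Reading a point of `ℝ^(k×k)` as a `k × k` matrix. -/
def matOf {k : ℕ} (x : Fin k × Fin k → ℝ) : Matrix (Fin k) (Fin k) ℝ :=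
  Matrix.of fun i j => x (i, j)

/-- The symmetric idempotent matrices of size `k` and trace `r`. -/
def GrassMatrix (k r : ℕ) : Set (Matrix (Fin k) (Fin k) ℝ) :=
  {X | X.transpose = X ∧ X * X = X ∧ X.trace = (r : ℝ)}

/-- The Grassmannian `G_{m,n}` embedded in `ℝ^{(m+n)²}`. -/
def Grass (m n : ℕ) : Set (Fin (m + n) × Fin (m + n) → ℝ) :=
  {x | matOf x ∈ GrassMatrix (m + n) m}

/-- The diagonal matrix `D_ℓ` with `1` in the first `ℓ` diagonal entries and `0` elsewhere. -/
def stdProj (k ℓ : ℕ) : Matrix (Fin k) (Fin k) ℝ :=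
  Matrix.diagonal fun i => if (i : ℕ) < ℓ then 1 else 0

/-- The coordinate subspace `ℝ^ℓ ⊆ ℝ^k` (first `ℓ` coordinates). -/
def coordSubspace (k ℓ : ℕ) : Submodule ℝ (Fin k → ℝ) :=
  ⨅ i ∈ {i : Fin k | ℓ ≤ (i : ℕ)},
    LinearMap.ker (LinearMap.proj (R := ℝ) (φ := fun _ : Fin k => ℝ) i)

/-- The column space of a square matrix. -/
def colSpace {k : ℕ} (X : Matrix (Fin k) (Fin k) ℝ) : Submodule ℝ (Fin k → ℝ) :=
  LinearMap.range X.mulVecLin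

/-- `lam` is a partition inside the `m × n` rectangle. -/
def IsPartitionIn (n : ℕ) {m : ℕ} (lam : Fin m → ℕ) : Prop :=
  (∀ k, lam k ≤ n) ∧ Antitone lam

/-- The Schubert variety `σ_λ ⊆ G_{m,n}` with respect to the canonical complete flag. -/
def SchubertVariety (m n : ℕ) (lam : Fin m → ℕ) :
    Set (Fin (m + n) × Fin (m + n) → ℝ) :=
  {x | x ∈ Grass m n ∧ ∀ k : Fin m,
    ((matOf x - 1) * stdProj (m + n) (n + ((k : ℕ) + 1) - lam k)).rank ≤ n - lam k}

/-- `λ_{k+1}`, with the convention `λ_{m+1} = 0`. -/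
def lamNext {m : ℕ} (lam : Fin m → ℕ) (k : Fin m) : ℕ :=
  if h : (k : ℕ) + 1 < m then lam ⟨(k : ℕ) + 1, h⟩ else 0

/-- The open Schubert cell `Ω_λ ⊆ G_{m,n}` with respect to the canonical complete flag. -/
def SchubertCell (m n : ℕ) (lam : Fin m → ℕ) :
    Set (Fin (m + n) × Fin (m + n) → ℝ) :=
  {x | x ∈ Grass m n ∧ ∀ k : Fin m, ∀ ℓ : ℕ,
    n + ((k : ℕ) + 1) - lam k ≤ ℓ → ℓ ≤ n + ((k : ℕ) + 1) - lamNext lam k →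
    Module.finrank ℝ ↥(colSpace (matOf x) ⊓ coordSubspace (m + n) ℓ) = (k : ℕ) + 1}

/-- `f 0 + ⋯ + f (t-1)` for `f : Fin c → ℕ`. -/
def partialSum {c : ℕ} (f : Fin c → ℕ) (t : ℕ) : ℕ :=
  ∑ i ∈ Finset.univ.filter (fun i : Fin c => (i : ℕ) < t), f i

/-- The `j`-th matrix slot of a point of `(ℝ^{k×k})^c`. -/
def matSlot {c k : ℕ} (z : Fin c × (Fin k × Fin k) → ℝ) (j : Fin c) :
    Matrix (Fin k) (Fin k) ℝ :=
  Matrix.of fun p q => z (j, (p, q))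

/-- The embedded Bott–Samelson set `Z_λ`, with slot `0` carrying `X` and slot `k`
(`1 ≤ k ≤ c-1`) carrying `Y_k`. -/
def BottSamelson (m n c : ℕ) (hc : 0 < c) (a b : Fin c → ℕ) :
    Set (Fin c × (Fin (m + n) × Fin (m + n)) → ℝ) :=
  {z | matSlot z ⟨0, hc⟩ ∈ GrassMatrix (m + n) m ∧
    (∀ j : Fin c, 0 < (j : ℕ) →
      matSlot z j ∈ GrassMatrix (m + n) (partialSum a (j : ℕ)) ∧
      matSlot z j * stdProj (m + n) (partialSum a (j : ℕ) + partialSum b (j : ℕ))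
        = matSlot z j) ∧
    (∀ (j : Fin c), 0 < (j : ℕ) → ∀ (h2 : (j : ℕ) + 1 < c),
      matSlot z ⟨(j : ℕ) + 1, h2⟩ * matSlot z j = matSlot z j) ∧
    (∀ j : Fin c, 0 < (j : ℕ) → (j : ℕ) = c - 1 →
      matSlot z ⟨0, hc⟩ * matSlot z j = matSlot z j)}

end

set_option linter.unusedSectionVars false

/-- Polynomial functions with rational coefficients. -/
def IsQP {ι : Type*} (f : (ι → ℝ) → ℝ) : Prop :=
  ∃ p : MvPolynomial ι ℚ, ∀ x, f x = aeval x p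

namespace IsQP

variable {ι κ : Type*} {f g : (ι → ℝ) → ℝ}

theorem aeval (p : MvPolynomial ι ℚ) : IsQP (fun x : ι → ℝ => MvPolynomial.aeval x p) :=
  ⟨p, fun _ => rfl⟩

theorem proj (i : ι) : IsQP (fun x : ι → ℝ => x i) := ⟨X i, fun x => by simp⟩

theorem rat (r : ℚ) : IsQP (fun _ : ι → ℝ => (r : ℝ)) := ⟨C r, fun x => by simp⟩

theorem zero : IsQP (fun _ : ι → ℝ => (0 : ℝ)) := ⟨0, fun x => by simp⟩

theorem one : IsQP (fun _ : ι → ℝ => (1 : ℝ)) := ⟨1, fun x => by simp⟩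

theorem nat (n : ℕ) : IsQP (fun _ : ι → ℝ => (n : ℝ)) := ⟨C (n : ℚ), fun x => by simp⟩

theorem add (hf : IsQP f) (hg : IsQP g) : IsQP (fun x => f x + g x) := by
  obtain ⟨p, hp⟩ := hf; obtain ⟨r, hr⟩ := hg
  exact ⟨p + r, fun x => by simp [hp, hr]⟩

theorem mul (hf : IsQP f) (hg : IsQP g) : IsQP (fun x => f x * g x) := by
  obtain ⟨p, hp⟩ := hf; obtain ⟨r, hr⟩ := hg
  exact ⟨p * r, fun x => by simp [hp, hr]⟩

theorem neg (hf : IsQP f) : IsQP (fun x => -f x) := by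
  obtain ⟨p, hp⟩ := hf
  exact ⟨-p, fun x => by simp [hp]⟩

theorem sub (hf : IsQP f) (hg : IsQP g) : IsQP (fun x => f x - g x) := by
  simpa [sub_eq_add_neg] using hf.add hg.neg

theorem pow (hf : IsQP f) (n : ℕ) : IsQP (fun x => f x ^ n) := by
  obtain ⟨p, hp⟩ := hf
  exact ⟨p ^ n, fun x => by simp [hp]⟩

theorem sum {α : Type*} {s : Finset α} {F : α → (ι → ℝ) → ℝ} (h : ∀ a ∈ s, IsQP (F a)) :
    IsQP (fun x => ∑ a ∈ s, F a x) := by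
  classical
  induction s using Finset.induction_on with
  | empty => simpa using zero
  | insert a s ha ih =>
    simp only [Finset.sum_insert ha]
    exact (h a (by simp)).add (ih fun b hb => h b (by simp [hb]))

theorem prod {α : Type*} {s : Finset α} {F : α → (ι → ℝ) → ℝ} (h : ∀ a ∈ s, IsQP (F a)) :
    IsQP (fun x => ∏ a ∈ s, F a x) := by
  classical
  induction s using Finset.induction_on with
  | empty => simpa using one
  | insert a s ha ih =>
    simp only [Finset.prod_insert ha]
    exact (h a (by simp)).mul (ih fun b hb => h b (by simp [hb]))

theorem comp {f : (κ → ℝ) → ℝ} (hf : IsQP f) {g : (ι → ℝ) → κ → ℝ}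
    (hg : ∀ j, IsQP (fun x => g x j)) : IsQP (fun x => f (g x)) := by
  obtain ⟨p, hp⟩ := hf
  choose r hr using hg
  refine ⟨bind₁ r p, fun x => ?_⟩
  have hx : g x = fun j => MvPolynomial.aeval x (r j) := funext fun j => hr j x
  change f (g x) = _
  rw [hp, hx]
  simp [aeval_bind₁]

theorem det {m : Type*} [Fintype m] [DecidableEq m] {A : (ι → ℝ) → Matrix m m ℝ}
    (hA : ∀ i j, IsQP (fun x => A x i j)) : IsQP (fun x => (A x).det) := by
  simp only [Matrix.det_apply']
  refine sum fun σ _ => ((?_ : IsQP _).mul (prod fun i _ => hA _ _))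
  simpa using rat (ι := ι) (((Equiv.Perm.sign σ : ℤ) : ℚ))

theorem matMul {l m n : Type*} [Fintype m] {A : (ι → ℝ) → Matrix l m ℝ}
    {B : (ι → ℝ) → Matrix m n ℝ} (hA : ∀ i j, IsQP (fun x => A x i j))
    (hB : ∀ i j, IsQP (fun x => B x i j)) (i j) : IsQP (fun x => (A x * B x) i j) := by
  simp only [Matrix.mul_apply]
  exact sum fun k _ => (hA i k).mul (hB k j)

theorem adjugate {m : Type*} [Fintype m] [DecidableEq m] {A : (ι → ℝ) → Matrix m m ℝ}
    (hA : ∀ i j, IsQP (fun x => A x i j)) (i j) : IsQP (fun x => (A x).adjugate i j) := by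
  simp only [Matrix.adjugate_apply]
  refine det fun a b => ?_
  by_cases h : a = j
  · subst h
    simp only [Matrix.updateRow_self]
    by_cases hb : i = b
    · subst hb; simpa using one
    · simpa [Pi.single_apply, Ne.symm hb] using zero
  · simpa [Matrix.updateRow_ne h] using hA a b

end IsQP

section Calculus

variable {ι : Type*} [Fintype ι] [DecidableEq ι]

/-- The linear functional `v ↦ n ⬝ᵥ v`. -/
noncomputable def dotL (n : ι → ℝ) : (ι → ℝ) →L[ℝ] ℝ :=
  ∑ i, n i • ContinuousLinearMap.proj (R := ℝ) (φ := fun _ : ι => ℝ) i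

@[simp] theorem dotL_apply {ι : Type*} [Fintype ι] (n v : ι → ℝ) : dotL n v = n ⬝ᵥ v := by
  simp [dotL, dotProduct]

theorem dotL_eq (L : (ι → ℝ) →L[ℝ] ℝ) : dotL (fun i => L (Pi.single i 1)) = L := by
  ext v
  simp only [dotL_apply, dotProduct]
  conv_rhs => rw [pi_eq_sum_univ' v]
  simp [map_sum, mul_comm]

theorem hasStrictFDerivAt_aeval (p : MvPolynomial ι ℚ) (x : ι → ℝ) :
    HasStrictFDerivAt (fun x : ι → ℝ => aeval x p) (dotL (polyGradQ p x)) x := by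
  induction p using MvPolynomial.induction_on with
  | C r =>
    have h : dotL (polyGradQ (C r) x) = 0 := by ext v; simp [polyGradQ, dotProduct]
    rw [h]
    simpa using hasStrictFDerivAt_const (𝕜 := ℝ) ((r : ℝ)) x
  | add p q hp hq =>
    have h : dotL (polyGradQ (p + q) x) = dotL (polyGradQ p x) + dotL (polyGradQ q x) := by
      ext v
      simp [polyGradQ, dotProduct, add_mul, Finset.sum_add_distrib]
    rw [h]
    exact (hp.add hq).congr_of_eventuallyEq (Filter.Eventually.of_forall fun x => by simp)
  | mul_X p i hp =>
    have h : dotL (polyGradQ (p * X i) x) =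
        aeval x p • ContinuousLinearMap.proj (R := ℝ) (φ := fun _ : ι => ℝ) i
          + x i • dotL (polyGradQ p x) := by
      ext v
      simp only [polyGradQ, Derivation.leibniz, dotL_apply, dotProduct, map_add, pderiv_X,
        smul_eq_mul, map_mul, aeval_X, add_apply,
        smul_apply, ContinuousLinearMap.proj_apply, add_mul,
        Finset.sum_add_distrib, Finset.mul_sum]
      congr 1
      · rw [Finset.sum_eq_single i]
        · simp
        · intro j _ hj; simp [hj]
        · simp
      · exact Finset.sum_congr rfl fun j _ => by ring
    rw [h]
    have := hp.mul ((ContinuousLinearMap.proj (R := ℝ) (φ := fun _ : ι => ℝ) i).hasStrictFDerivAt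
      (x := x))
    exact this.congr_of_eventuallyEq (Filter.Eventually.of_forall fun x => by simp)

theorem IsQP.contDiff {ι : Type*} [Fintype ι] {f : (ι → ℝ) → ℝ} (hf : IsQP f)
    {n : WithTop ℕ∞} : ContDiff ℝ n f := by
  obtain ⟨p, hp⟩ := hf
  rw [funext hp]
  clear hp
  induction p using MvPolynomial.induction_on with
  | C r => simpa using contDiff_const
  | add p q hp hq => simpa using hp.add hq
  | mul_X p i hp => simpa using hp.mul (contDiff_apply ℝ ℝ i)

theorem IsQP.continuous {ι : Type*} [Fintype ι] {f : (ι → ℝ) → ℝ} (hf : IsQP f) :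
    Continuous f :=
  (hf.contDiff (n := 0)).continuous

end Calculus

section Approximation

open MeasureTheory Metric Set ContinuousLinearMap
open scoped Convolution

variable {ι : Type*} [Fintype ι]

theorem exists_contDiff_bump {E : Type*} [NormedAddCommGroup E] [NormedSpace ℝ E]
    [FiniteDimensional ℝ E] {s t : Set E} (hs : IsClosed s) (ht : IsClosed t)
    (hd : Disjoint s t) :
    ∃ f : E → ℝ, ContDiff ℝ (⊤ : ℕ∞) f ∧ (∀ᶠ x in nhdsSet s, f x = 0) ∧
      (∀ᶠ x in nhdsSet t, f x = 1) ∧ ∀ x, f x ∈ Icc (0 : ℝ) 1 := by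
  obtain ⟨f, h0, h1, h2⟩ := exists_contMDiffMap_zero_one_nhds_of_isClosed
    (n := (⊤ : ℕ∞)) (modelWithCornersSelf ℝ E) hs ht hd
  exact ⟨f, f.contMDiff.contDiff, h0, h1, h2⟩

theorem norm_convolution_sub_le {F : Type*} [NormedAddCommGroup F] [NormedSpace ℝ F]
    {g : (ι → ℝ) → F} (hg : Continuous g) {R R' δ : ℝ}
    (hsupp : ∀ x ∉ closedBall (0 : ι → ℝ) R', g x = 0) {p K : (ι → ℝ) → ℝ}
    (hp : Continuous p) (hK : Continuous K)
    (hpK : ∀ u ∈ closedBall (0 : ι → ℝ) (R + R'), |p u - K u| ≤ δ)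
    {x : ι → ℝ} (hx : x ∈ closedBall (0 : ι → ℝ) R) :
    ‖(p ⋆[lsmul ℝ ℝ, volume] g) x - (K ⋆[lsmul ℝ ℝ, volume] g) x‖ ≤ δ * ∫ t, ‖g t‖ := by
  have hgc : HasCompactSupport g :=
    HasCompactSupport.intro (isCompact_closedBall (0 : ι → ℝ) R') hsupp
  have hmint : ∀ r : (ι → ℝ) → ℝ, Continuous r → Integrable (fun t => r (x - t) • g t) := by
    intro r hr
    refine Continuous.integrable_of_hasCompactSupport (by fun_prop) ?_
    exact HasCompactSupport.smul_left hgc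
  simp only [convolution_eq_swap, lsmul_apply]
  rw [← integral_sub (hmint p hp) (hmint K hK), ← integral_const_mul]
  refine norm_integral_le_of_norm_le
    ((hg.norm.integrable_of_hasCompactSupport hgc.norm).const_mul δ) ?_
  refine Filter.Eventually.of_forall fun t => ?_
  rw [← sub_smul, norm_smul]
  by_cases ht : t ∈ closedBall (0 : ι → ℝ) R'
  · refine mul_le_mul_of_nonneg_right (hpK _ ?_) (norm_nonneg _)
    simp only [mem_closedBall, dist_zero_right] at *
    exact (norm_sub_le _ _).trans (add_le_add hx ht)
  · simp [hsupp t ht]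

/-- Separation of variables for a difference. -/
theorem exists_eval_sub_eq_sum (p : MvPolynomial ι ℝ) :
    ∃ (n : ℕ) (a : Fin n → (ι → ℝ) → ℝ) (b : Fin n → (ι → ℝ) → ℝ),
      (∀ i, IsQP (a i)) ∧ (∀ i, Continuous (b i)) ∧
      ∀ x y, eval (x - y) p = ∑ i, a i x * b i y := by
  have key : ∃ (α : Type) (_ : Fintype α) (a : α → (ι → ℝ) → ℝ) (b : α → (ι → ℝ) → ℝ),
      (∀ i, IsQP (a i)) ∧ (∀ i, Continuous (b i)) ∧
      ∀ x y, eval (x - y) p = ∑ i, a i x * b i y := by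
    induction p using MvPolynomial.induction_on with
    | C r => exact ⟨Unit, inferInstance, fun _ _ => 1, fun _ _ => r, fun _ => IsQP.one,
        fun _ => continuous_const, fun x y => by simp⟩
    | add p q hp hq =>
      obtain ⟨α, _, a, b, ha, hb, h⟩ := hp
      obtain ⟨α', _, a', b', ha', hb', h'⟩ := hq
      refine ⟨α ⊕ α', inferInstance, Sum.elim a a', Sum.elim b b', ?_, ?_, ?_⟩
      · rintro (i | i) <;> simp [ha, ha']
      · rintro (i | i) <;> simp [hb, hb']
      · intro x y; simp [h, h']
    | mul_X p i hp =>
      obtain ⟨α, _, a, b, ha, hb, h⟩ := hp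
      refine ⟨α ⊕ α, inferInstance, Sum.elim (fun j x => a j x * x i) a,
        Sum.elim b (fun j y => b j y * (-y i)), ?_, ?_, ?_⟩
      · rintro (j | j)
        · exact (ha j).mul (IsQP.proj i)
        · exact ha j
      · rintro (j | j)
        · exact hb j
        · have := hb j
          simp only [Sum.elim_inr]
          fun_prop
      · intro x y
        simp only [map_mul, eval_X, Pi.sub_apply, h, Fintype.sum_sum_type, Sum.elim_inl,
          Sum.elim_inr, Finset.sum_mul, ← Finset.sum_add_distrib]
        exact Finset.sum_congr rfl fun j _ => by ring
  obtain ⟨α, _, a, b, ha, hb, h⟩ := key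
  let e := (Fintype.equivFin α).symm
  refine ⟨_, fun i => a (e i), fun i => b (e i), fun i => ha _, fun i => hb _, fun x y => ?_⟩
  rw [h, ← e.sum_comp]

/-- Finite real combinations of rational polynomials are `C¹`-approximable by rational
polynomials on balls. -/
theorem exists_isQP_near_sum {n : ℕ} (a : Fin n → (ι → ℝ) → ℝ) (ha : ∀ i, IsQP (a i))
    (c : Fin n → ℝ) (R : ℝ) {ε : ℝ} (hε : 0 < ε) :
    ∃ g : (ι → ℝ) → ℝ, IsQP g ∧ ∀ x ∈ closedBall (0 : ι → ℝ) R,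
      |g x - ∑ i, c i * a i x| ≤ ε ∧
      ‖fderiv ℝ g x - fderiv ℝ (fun x => ∑ i, c i * a i x) x‖ ≤ ε := by
  have hbd : ∀ i, ∃ B : ℝ, 0 ≤ B ∧ ∀ x ∈ closedBall (0 : ι → ℝ) R,
      |a i x| ≤ B ∧ ‖fderiv ℝ (a i) x‖ ≤ B := by
    intro i
    have h0 : Continuous (fderiv ℝ (a i)) :=
      ((ha i).contDiff (n := 1)).continuous_fderiv one_ne_zero
    obtain ⟨B1, h1⟩ := (isCompact_closedBall (0 : ι → ℝ) R).exists_bound_of_continuousOn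
      (ha i).continuous.continuousOn
    obtain ⟨B2, h2⟩ := (isCompact_closedBall (0 : ι → ℝ) R).exists_bound_of_continuousOn
      h0.continuousOn
    refine ⟨|B1| + |B2|, by positivity, fun x hx => ⟨(h1 x hx).trans ?_, (h2 x hx).trans ?_⟩⟩
    · linarith [le_abs_self B1, abs_nonneg B2]
    · linarith [le_abs_self B2, abs_nonneg B1]
  choose B hB0 hB using hbd
  set T : ℝ := ∑ i, B i with hT
  have hT0 : 0 ≤ T := Finset.sum_nonneg fun i _ => hB0 i
  have hr : ∀ i, ∃ r : ℚ, |(r : ℝ) - c i| < ε / (T + 1) := by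
    intro i
    obtain ⟨r, hr⟩ := exists_rat_near (c i) (div_pos hε (by linarith : 0 < T + 1))
    exact ⟨r, by rwa [abs_sub_comm]⟩
  choose r hr using hr
  have hd : ∀ (i : Fin n) (x : ι → ℝ), DifferentiableAt ℝ (a i) x := fun i x =>
    ((ha i).contDiff (n := 1)).differentiable one_ne_zero x
  refine ⟨fun x => ∑ i, (r i : ℝ) * a i x, IsQP.sum fun i _ => (IsQP.rat (r i)).mul (ha i),
    fun x hx => ?_⟩
  have hfin : ∑ i, |(r i : ℝ) - c i| * B i ≤ ε := by
    calc ∑ i, |(r i : ℝ) - c i| * B i ≤ ∑ i, ε / (T + 1) * B i :=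
          Finset.sum_le_sum fun i _ => mul_le_mul_of_nonneg_right (hr i).le (hB0 i)
      _ = ε * (T / (T + 1)) := by rw [← Finset.mul_sum]; ring
      _ ≤ ε * 1 := by
          refine mul_le_mul_of_nonneg_left ?_ hε.le
          rw [div_le_one (by linarith)]; linarith
      _ = ε := mul_one _
  constructor
  · rw [← Finset.sum_sub_distrib]
    refine (Finset.abs_sum_le_sum_abs _ _).trans (le_trans ?_ hfin)
    refine Finset.sum_le_sum fun i _ => ?_
    rw [← sub_mul, abs_mul]
    exact mul_le_mul_of_nonneg_left (hB i x hx).1 (abs_nonneg _)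
  · rw [fderiv_fun_sum fun i _ => (hd i x).const_mul _,
      fderiv_fun_sum fun i _ => (hd i x).const_mul _, ← Finset.sum_sub_distrib]
    refine (norm_sum_le _ _).trans (le_trans ?_ hfin)
    refine Finset.sum_le_sum fun i _ => ?_
    rw [fderiv_const_mul (hd i x), fderiv_const_mul (hd i x),
      show (r i : ℝ) • fderiv ℝ (a i) x - c i • fderiv ℝ (a i) x
        = ((r i : ℝ) - c i) • fderiv ℝ (a i) x by ext v; simp; ring, norm_smul]
    exact mul_le_mul_of_nonneg_left (hB i x hx).2 (abs_nonneg _)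

theorem exists_polynomial_near (K : (ι → ℝ) → ℝ) (hK : Continuous K) (R : ℝ) {δ : ℝ}
    (hδ : 0 < δ) : ∃ p : MvPolynomial ι ℝ, ∀ x ∈ closedBall (0 : ι → ℝ) R,
      |eval x p - K x| ≤ δ := by
  let Φ : MvPolynomial ι ℝ →ₐ[ℝ] C(ι → ℝ, ℝ) :=
    MvPolynomial.aeval fun i => ⟨fun x => x i, continuous_apply i⟩
  have hΦ : ∀ p x, Φ p x = eval x p := by
    intro p x
    induction p using MvPolynomial.induction_on with
    | C r => simp [Φ]
    | add p q hp hq => simp [hp, hq]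
    | mul_X p i hp => simp [Φ] at hp ⊢; simp [hp]
  have hsep : (Φ.range).SeparatesPoints := by
    intro x y hxy
    obtain ⟨i, hi⟩ := Function.ne_iff.1 hxy
    exact ⟨fun x => x i, ⟨Φ (X i), ⟨X i, rfl⟩, by ext z; simp [hΦ]⟩, hi⟩
  obtain ⟨g, ⟨p, rfl⟩, hg⟩ :=
    ContinuousMap.exists_mem_subalgebra_near_continuous_of_isCompact_of_separatesPoints hsep
      ⟨K, hK⟩ (isCompact_closedBall (0 : ι → ℝ) R) hδ
  refine ⟨p, fun x hx => ?_⟩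
  have := (hg x hx).le
  simpa [hΦ] using this

theorem exists_dist_le_of_continuous {F : Type*} [PseudoMetricSpace F] {g : (ι → ℝ) → F}
    (hg : Continuous g) (R : ℝ) {ε : ℝ} (hε : 0 < ε) :
    ∃ r > 0, ∀ x ∈ closedBall (0 : ι → ℝ) R, ∀ y ∈ ball x r, dist (g y) (g x) ≤ ε := by
  have h1 := (isCompact_closedBall (0 : ι → ℝ) (R + 1)).uniformContinuousOn_of_continuous
    hg.continuousOn
  obtain ⟨r, hr, h⟩ := Metric.uniformContinuousOn_iff.1 h1 ε hε
  refine ⟨min r 1, lt_min hr one_pos, fun x hx y hy => (h y ?_ x ?_ ?_).le⟩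
  · have h2 : dist y x < 1 := lt_of_lt_of_le hy (min_le_right _ _)
    simp only [mem_closedBall] at hx ⊢
    linarith [dist_triangle y x 0]
  · exact closedBall_subset_closedBall (by linarith) hx
  · exact lt_of_lt_of_le hy (min_le_left _ _)

theorem exists_isQP_C1_near_of_hasCompactSupport {f : (ι → ℝ) → ℝ} (hf : ContDiff ℝ 1 f)
    (hfc : HasCompactSupport f) (R : ℝ) {ε : ℝ} (hε : 0 < ε) :
    ∃ g : (ι → ℝ) → ℝ, IsQP g ∧ ∀ x ∈ closedBall (0 : ι → ℝ) R,
      |g x - f x| ≤ ε ∧ ‖fderiv ℝ g x - fderiv ℝ f x‖ ≤ ε := by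
  have hDc : Continuous (fderiv ℝ f) := hf.continuous_fderiv one_ne_zero
  obtain ⟨R', hR'⟩ : ∃ R', ∀ x ∉ closedBall (0 : ι → ℝ) R', f x = 0 ∧ fderiv ℝ f x = 0 := by
    obtain ⟨R', h⟩ := hfc.isCompact.isBounded.subset_closedBall (0 : ι → ℝ)
    refine ⟨R', fun x hx => ⟨?_, ?_⟩⟩
    · by_contra h0
      exact hx (h (subset_tsupport f h0))
    · by_contra h0
      exact hx (h (support_fderiv_subset ℝ h0))
  obtain ⟨r1, hr1, h1⟩ := exists_dist_le_of_continuous hf.continuous R (by linarith : 0 < ε / 3)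
  obtain ⟨r2, hr2, h2⟩ := exists_dist_le_of_continuous hDc R (by linarith : 0 < ε / 3)
  set r := min r1 r2 with hr
  have hr0 : 0 < r := lt_min hr1 hr2
  let φ : ContDiffBump (0 : ι → ℝ) := ⟨r / 2, r, by linarith, by linarith⟩
  set K := φ.normed volume with hK
  have hKc : Continuous K := φ.continuous_normed
  set I1 := ∫ t, ‖f t‖ with hI1
  set I2 := ∫ t, ‖fderiv ℝ f t‖ with hI2
  have hI1' : 0 ≤ I1 := integral_nonneg fun _ => norm_nonneg _
  have hI2' : 0 ≤ I2 := integral_nonneg fun _ => norm_nonneg _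
  set δ := ε / (3 * (I1 + I2 + 1)) with hδ
  have hδ0 : 0 < δ := by positivity
  have hδ1 : δ * I1 ≤ ε / 3 ∧ δ * I2 ≤ ε / 3 := by
    constructor <;>
    · rw [hδ, div_mul_eq_mul_div, div_le_div_iff₀ (by positivity) (by norm_num)]
      nlinarith
  obtain ⟨p, hp⟩ := exists_polynomial_near K hKc (R + R') hδ0
  have hpc : Continuous (fun x => eval x p) := by
    have := MvPolynomial.continuous_eval p
    exact this
  set P := (fun x => eval x p) ⋆[lsmul ℝ ℝ, volume] f with hP
  have hPd : ∀ x, HasFDerivAt P (((fun x => eval x p) ⋆[lsmul ℝ ℝ, volume] fderiv ℝ f) x) x := by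
    intro x
    have := hfc.hasFDerivAt_convolution_right (lsmul ℝ ℝ) (μ := volume)
      hpc.locallyIntegrable hf x
    exact this
  obtain ⟨n, a, b, ha, hb, hab⟩ := exists_eval_sub_eq_sum p
  have hPsum : P = fun x => ∑ i, (∫ t, b i t * f t) * a i x := by
    ext x
    rw [hP, convolution_eq_swap]
    simp only [lsmul_apply, smul_eq_mul, hab, Finset.sum_mul]
    rw [integral_finsetSum]
    · refine Finset.sum_congr rfl fun i _ => ?_
      rw [mul_comm, ← integral_const_mul]
      exact integral_congr_ae (Filter.Eventually.of_forall fun t => by ring)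
    · intro i _
      refine Continuous.integrable_of_hasCompactSupport ?_ hfc.mul_left
      have := hb i
      have := hf.continuous
      fun_prop
  obtain ⟨g, hg, hgP⟩ := exists_isQP_near_sum a ha (fun i => ∫ t, b i t * f t) R
    (by linarith : 0 < ε / 3)
  refine ⟨g, hg, fun x hx => ?_⟩
  have e1 := norm_convolution_sub_le hf.continuous (fun x hx => (hR' x hx).1) hpc hKc hp hx
  have e2 := norm_convolution_sub_le hDc (fun x hx => (hR' x hx).2) hpc hKc hp hx
  have e3 : dist ((K ⋆[lsmul ℝ ℝ, volume] f) x) (f x) ≤ ε / 3 :=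
    φ.dist_normed_convolution_le hf.continuous.aestronglyMeasurable fun y hy =>
      h1 x hx y (ball_subset_ball (min_le_left _ _) hy)
  have e4 : dist ((K ⋆[lsmul ℝ ℝ, volume] fderiv ℝ f) x) (fderiv ℝ f x) ≤ ε / 3 :=
    φ.dist_normed_convolution_le hDc.aestronglyMeasurable fun y hy =>
      h2 x hx y (ball_subset_ball (min_le_right _ _) hy)
  obtain ⟨e5, e6⟩ := hgP x hx
  rw [← hPsum] at e6
  rw [← congrFun hPsum x] at e5
  rw [(hPd x).fderiv] at e6
  constructor
  · have e1' : ‖P x - (K ⋆[lsmul ℝ ℝ, volume] f) x‖ ≤ ε / 3 := e1.trans hδ1.1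
    rw [Real.dist_eq] at e3
    rw [Real.norm_eq_abs] at e1'
    have := abs_sub_le (g x) (P x) (f x)
    have := abs_sub_le (P x) ((K ⋆[lsmul ℝ ℝ, volume] f) x) (f x)
    linarith
  · have e2' := e2.trans hδ1.2
    rw [← dist_eq_norm] at e2' e6 ⊢
    refine (dist_triangle4 _ _ _ _).trans ((add_le_add (add_le_add e6 e2') e4).trans ?_)
    linarith

/-- `C¹` Weierstrass approximation on balls by polynomials with rational coefficients. -/
theorem exists_isQP_C1_near {f : (ι → ℝ) → ℝ} (hf : ContDiff ℝ 1 f) (R : ℝ) {ε : ℝ}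
    (hε : 0 < ε) :
    ∃ g : (ι → ℝ) → ℝ, IsQP g ∧ ∀ x ∈ closedBall (0 : ι → ℝ) R,
      |g x - f x| ≤ ε ∧ ‖fderiv ℝ g x - fderiv ℝ f x‖ ≤ ε := by
  obtain ⟨χ, hχ, h0, h1, -⟩ := exists_contDiff_bump (s := (ball (0 : ι → ℝ) (R + 1))ᶜ)
    (t := closedBall (0 : ι → ℝ) R) isOpen_ball.isClosed_compl isClosed_closedBall (by
      rw [Set.disjoint_left]
      intro x hx hx'
      exact hx (closedBall_subset_ball (by linarith) hx'))
  have hc : HasCompactSupport (fun x => χ x * f x) := by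
    refine HasCompactSupport.intro (isCompact_closedBall (0 : ι → ℝ) (R + 1)) fun x hx => ?_
    have : χ x = 0 := h0.self_of_nhdsSet x fun hx' => hx (ball_subset_closedBall hx')
    simp [this]
  obtain ⟨g, hg, h⟩ := exists_isQP_C1_near_of_hasCompactSupport
    ((hχ.of_le (by exact_mod_cast le_top)).mul hf) hc R hε
  refine ⟨g, hg, fun x hx => ?_⟩
  have hev : (fun x => χ x * f x) =ᶠ[nhds x] f := by
    filter_upwards [h1.filter_mono (nhds_le_nhdsSet hx)] with y hy
    simp [hy]
  have := h x hx
  rwa [hev.fderiv_eq, hev.eq_of_nhds] at this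

end Approximation

section C1Limits

open Filter Topology Metric

variable {E F G H : Type*} [NormedAddCommGroup E] [NormedSpace ℝ E]
  [NormedAddCommGroup F] [NormedSpace ℝ F] [NormedAddCommGroup G] [NormedSpace ℝ G]
  [NormedAddCommGroup H] [NormedSpace ℝ H]

/-- Smoothness on a neighbourhood of a point. -/
def SmoothNear (f : E → F) (x : E) : Prop := ∀ᶠ y in 𝓝 x, ContDiffAt ℝ (⊤ : ℕ∞) f y

/-- The functions `a k` are smooth near `z` for large `k` and converge there, together with
their derivatives, locally uniformly to `b` and `b'` at `z`. -/
def HasC1Lim (a : ℕ → E → F) (z : E) (b : F) (b' : E →L[ℝ] F) : Prop :=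
  (∀ᶠ p in (atTop : Filter ℕ) ×ˢ 𝓝 z, ContDiffAt ℝ (⊤ : ℕ∞) (a p.1) p.2) ∧
  Tendsto (fun p : ℕ × E => a p.1 p.2) (atTop ×ˢ 𝓝 z) (𝓝 b) ∧
  Tendsto (fun p : ℕ × E => fderiv ℝ (a p.1) p.2) (atTop ×ˢ 𝓝 z) (𝓝 b')

theorem infty_ne_zero' : ((⊤ : ℕ∞) : WithTop ℕ∞) ≠ 0 := by
  simp

theorem one_le_infty' : (1 : WithTop ℕ∞) ≤ ((⊤ : ℕ∞) : WithTop ℕ∞) := by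
  exact_mod_cast le_top

theorem SmoothNear.continuousAt_fderiv {f : E → F} {x : E} (h : SmoothNear f x) :
    ContinuousAt (fderiv ℝ f) x :=
  (h.self_of_nhds.fderiv_right (m := 0) (by simp)).continuousAt

theorem ContDiff.smoothNear {f : E → F} (h : ContDiff ℝ (⊤ : ℕ∞) f) (x : E) : SmoothNear f x :=
  Eventually.of_forall fun _ => h.contDiffAt

theorem SmoothNear.eventually {f : E → F} {x : E} (h : SmoothNear f x) :
    ∀ᶠ y in 𝓝 x, SmoothNear f y := h.eventually_nhds

theorem SmoothNear.comp {f : E → F} {g : F → G} {x : E} (hg : SmoothNear g (f x))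
    (hf : SmoothNear f x) : SmoothNear (fun y => g (f y)) x := by
  have hc : ContinuousAt f x := hf.self_of_nhds.continuousAt
  filter_upwards [hf, hc.eventually hg] with y h1 h2
  exact h2.comp y h1

theorem SmoothNear.congr {f g : E → F} {x : E} (hf : SmoothNear f x) (h : g =ᶠ[𝓝 x] f) :
    SmoothNear g x := by
  filter_upwards [hf, h.eventually_nhds] with y h1 h2
  exact h1.congr_of_eventuallyEq h2

theorem eventually_prod_nhds {P : ℕ → E → Prop} {z : E}
    (h : ∀ᶠ p in (atTop : Filter ℕ) ×ˢ 𝓝 z, P p.1 p.2) :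
    ∀ᶠ p in (atTop : Filter ℕ) ×ˢ 𝓝 z, ∀ᶠ z' in 𝓝 p.2, P p.1 z' := by
  obtain ⟨pa, ha, pb, hb, h⟩ := eventually_prod_iff.1 h
  rw [eventually_prod_iff]
  exact ⟨pa, ha, fun y => ∀ᶠ z' in 𝓝 y, pb z', hb.eventually_nhds,
    fun hx y hy => hy.mono fun z' hz' => h hx hz'⟩

namespace HasC1Lim

variable {a : ℕ → E → F} {z : E} {b : F} {b' : E →L[ℝ] F}

theorem tendsto (h : HasC1Lim a z b b') :
    Tendsto (fun p : ℕ × E => a p.1 p.2) (atTop ×ˢ 𝓝 z) (𝓝 b) := h.2.1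

theorem const {f : E → F} (hf : SmoothNear f z) :
    HasC1Lim (fun _ => f) z (f z) (fderiv ℝ f z) :=
  ⟨tendsto_snd.eventually hf, hf.self_of_nhds.continuousAt.tendsto.comp tendsto_snd,
    hf.continuousAt_fderiv.tendsto.comp tendsto_snd⟩

theorem comp {f : F → G} (hf : SmoothNear f b) (h : HasC1Lim a z b b') :
    HasC1Lim (fun k z => f (a k z)) z (f b) ((fderiv ℝ f b).comp b') := by
  obtain ⟨h1, h2, h3⟩ := h
  have h4 := h2.eventually hf
  refine ⟨?_, hf.self_of_nhds.continuousAt.tendsto.comp h2, ?_⟩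
  · filter_upwards [h1, h4] with p hp1 hp2
    exact hp2.comp p.2 hp1
  · have h5 : Tendsto (fun p : ℕ × E => (fderiv ℝ f (a p.1 p.2)).comp (fderiv ℝ (a p.1) p.2))
        (atTop ×ˢ 𝓝 z) (𝓝 ((fderiv ℝ f b).comp b')) :=
      (isBoundedBilinearMap_comp.continuous.tendsto
        (fderiv ℝ f b, b')).comp ((hf.continuousAt_fderiv.tendsto.comp h2).prodMk_nhds h3)
    refine h5.congr' ?_
    filter_upwards [h1, h4] with p hp1 hp2
    exact (fderiv_comp p.2 (hp2.differentiableAt infty_ne_zero')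
      (hp1.differentiableAt infty_ne_zero')).symm

theorem prodMk {c : ℕ → E → G} {d : G} {d' : E →L[ℝ] G} (h : HasC1Lim a z b b')
    (h' : HasC1Lim c z d d') :
    HasC1Lim (fun k z => (a k z, c k z)) z (b, d) (b'.prod d') := by
  refine ⟨?_, h.2.1.prodMk_nhds h'.2.1, ?_⟩
  · filter_upwards [h.1, h'.1] with p h1 h2
    exact h1.prodMk h2
  · have h5 : Tendsto (fun p : ℕ × E => (fderiv ℝ (a p.1) p.2).prod (fderiv ℝ (c p.1) p.2))
        (atTop ×ˢ 𝓝 z) (𝓝 (b'.prod d')) := by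
      have := ((ContinuousLinearMap.prodₗᵢ (𝕜 := ℝ) (E := E) (F := F) (G := G)
        ℝ).continuous.tendsto (b', d')).comp (h.2.2.prodMk_nhds h'.2.2)
      exact this
    refine h5.congr' ?_
    filter_upwards [h.1, h'.1] with p h1 h2
    exact (DifferentiableAt.fderiv_prodMk (h1.differentiableAt infty_ne_zero')
      (h2.differentiableAt infty_ne_zero')).symm

theorem comp₂ {c : ℕ → E → G} {d : G} {d' : E →L[ℝ] G} {f : F × G → H}
    (hf : SmoothNear f (b, d)) (h : HasC1Lim a z b b') (h' : HasC1Lim c z d d') :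
    HasC1Lim (fun k z => f (a k z, c k z)) z (f (b, d)) ((fderiv ℝ f (b, d)).comp (b'.prod d')) :=
  (h.prodMk h').comp hf

theorem add {c : ℕ → E → F} {d : F} {d' : E →L[ℝ] F} (h : HasC1Lim a z b b')
    (h' : HasC1Lim c z d d') : HasC1Lim (fun k z => a k z + c k z) z (b + d) (b' + d') := by
  refine ⟨?_, h.2.1.add h'.2.1, (h.2.2.add h'.2.2).congr' ?_⟩
  · filter_upwards [h.1, h'.1] with p h1 h2
    exact h1.add h2
  · filter_upwards [h.1, h'.1] with p h1 h2
    exact (fderiv_fun_add (h1.differentiableAt infty_ne_zero')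
      (h2.differentiableAt infty_ne_zero')).symm

theorem mul {a : ℕ → E → ℝ} {b : ℝ} {b' : E →L[ℝ] ℝ} {c : ℕ → E → ℝ} {d : ℝ} {d' : E →L[ℝ] ℝ}
    (h : HasC1Lim a z b b') (h' : HasC1Lim c z d d') :
    HasC1Lim (fun k z => a k z * c k z) z (b * d) (b • d' + d • b') := by
  refine ⟨?_, h.2.1.mul h'.2.1, ((h.2.1.smul h'.2.2).add (h'.2.1.smul h.2.2)).congr' ?_⟩
  · filter_upwards [h.1, h'.1] with p h1 h2
    exact h1.mul h2
  · filter_upwards [h.1, h'.1] with p h1 h2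
    exact (fderiv_fun_mul (h1.differentiableAt infty_ne_zero')
      (h2.differentiableAt infty_ne_zero')).symm

theorem clm (L : F →L[ℝ] G) (h : HasC1Lim a z b b') :
    HasC1Lim (fun k z => L (a k z)) z (L b) (L.comp b') := by
  simpa using h.comp (L.contDiff.smoothNear b)

theorem pi {κ : Type*} [Fintype κ] {a : ℕ → E → κ → ℝ} {b : κ → ℝ} {b' : E →L[ℝ] κ → ℝ}
    (h : ∀ i, HasC1Lim (fun k z => a k z i) z (b i)
      ((ContinuousLinearMap.proj i : (κ → ℝ) →L[ℝ] ℝ).comp b')) : HasC1Lim a z b b' := by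
  have h1 : ∀ᶠ p in (atTop : Filter ℕ) ×ˢ 𝓝 z, ∀ i,
      ContDiffAt ℝ (⊤ : ℕ∞) (fun z => a p.1 z i) p.2 := eventually_all.2 fun i => (h i).1
  refine ⟨?_, tendsto_pi_nhds.2 fun i => (h i).2.1, ?_⟩
  · filter_upwards [h1] with p hp
    exact contDiffAt_pi.2 hp
  · have h2 := tendsto_pi_nhds.2 fun i => (h i).2.2
    have h3 : Tendsto (fun p : ℕ × E => ContinuousLinearMap.pi
        fun i => fderiv ℝ (fun z => a p.1 z i) p.2) (atTop ×ˢ 𝓝 z) (𝓝 (ContinuousLinearMap.pi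
          fun i => (ContinuousLinearMap.proj i : (κ → ℝ) →L[ℝ] ℝ).comp b')) := by
      rw [tendsto_iff_norm_sub_tendsto_zero] at h2 ⊢
      refine squeeze_zero (fun _ => norm_nonneg _) (fun p => ?_) h2
      refine ContinuousLinearMap.opNorm_le_bound _ (norm_nonneg _) fun v => ?_
      refine (pi_norm_le_iff_of_nonneg (by positivity)).2 fun i => ?_
      refine le_trans ?_ (mul_le_mul_of_nonneg_right (norm_le_pi_norm _ i) (norm_nonneg v))
      exact ContinuousLinearMap.le_opNorm
        (fderiv ℝ (fun z => a p.1 z i) p.2 - (ContinuousLinearMap.proj i).comp b') v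
    have h4 : (ContinuousLinearMap.pi
          fun i => (ContinuousLinearMap.proj i : (κ → ℝ) →L[ℝ] ℝ).comp b') = b' := by
      ext v i; rfl
    rw [h4] at h3
    refine h3.congr' ?_
    filter_upwards [h1] with p hp
    exact (fderiv_pi fun i => (hp i).differentiableAt infty_ne_zero').symm

theorem sum {α : Type*} {s : Finset α} {a : α → ℕ → E → F} {b : α → F} {b' : α → E →L[ℝ] F}
    (h : ∀ i ∈ s, HasC1Lim (a i) z (b i) (b' i)) :
    HasC1Lim (fun k z => ∑ i ∈ s, a i k z) z (∑ i ∈ s, b i) (∑ i ∈ s, b' i) := by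
  classical
  induction s using Finset.induction_on with
  | empty => simpa using const (z := z) ((contDiff_const (c := (0 : F))).smoothNear z)
  | insert i s hi ih =>
    simp only [Finset.sum_insert hi]
    exact (h i (by simp)).add (ih fun j hj => h j (by simp [hj]))

theorem reindex (h : HasC1Lim a z b b') {m : ℕ → ℕ} (hm : Tendsto m atTop atTop) :
    HasC1Lim (fun k => a (m k)) z b b' := by
  have : Tendsto (fun p : ℕ × E => (m p.1, p.2)) (atTop ×ˢ 𝓝 z) (atTop ×ˢ 𝓝 z) :=
    (hm.comp tendsto_fst).prodMk tendsto_snd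
  exact ⟨this.eventually h.1, h.2.1.comp this, h.2.2.comp this⟩

theorem pow_zero_of_abs_lt {u : E → ℝ} (hu : SmoothNear u z) (hz : |u z| < 1) :
    HasC1Lim (fun k z => u z ^ k) z 0 0 := by
  obtain ⟨r, hr1, hr2⟩ := exists_between hz
  have hr0 : 0 < r := (abs_nonneg _).trans_lt hr1
  have hc := hu.self_of_nhds.continuousAt
  have hlt : ∀ᶠ z' in 𝓝 z, |u z'| < r := hc.abs.eventually (gt_mem_nhds hr1)
  have h1 : Tendsto (fun p : ℕ × E => r ^ p.1) (atTop ×ˢ 𝓝 z) (𝓝 0) :=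
    (tendsto_pow_atTop_nhds_zero_of_lt_one hr0.le hr2).comp tendsto_fst
  have h2 : Tendsto (fun p : ℕ × E => ((p.1 : ℝ) * r ^ p.1 / r) * ‖fderiv ℝ u p.2‖)
      (atTop ×ˢ 𝓝 z) (𝓝 0) := by
    have h3 : Tendsto (fun k : ℕ => (k : ℝ) * r ^ k) atTop (𝓝 0) :=
      tendsto_self_mul_const_pow_of_lt_one hr0.le hr2
    have h4 := ((h3.div_const r).comp (tendsto_fst (f := (atTop : Filter ℕ)) (g := 𝓝 z))).mul
      (hu.continuousAt_fderiv.norm.tendsto.comp (tendsto_snd (f := (atTop : Filter ℕ))))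
    simpa using h4
  refine ⟨?_, ?_, ?_⟩
  · filter_upwards [tendsto_snd.eventually hu] with p hp
    exact hp.pow _
  · refine squeeze_zero_norm' ?_ h1
    filter_upwards [tendsto_snd.eventually hlt] with p hp
    rw [norm_pow, Real.norm_eq_abs]
    exact pow_le_pow_left₀ (abs_nonneg _) hp.le _
  · refine squeeze_zero_norm' ?_ h2
    filter_upwards [tendsto_snd.eventually hlt, tendsto_snd.eventually hu,
      tendsto_fst.eventually (eventually_ge_atTop 1)] with p hp hp2 hp3
    rw [fderiv_fun_pow p.1 (hp2.differentiableAt infty_ne_zero'), norm_smul]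
    refine mul_le_mul_of_nonneg_right ?_ (norm_nonneg _)
    rw [nsmul_eq_mul, norm_mul, norm_pow, Real.norm_natCast, Real.norm_eq_abs, mul_div_assoc]
    refine mul_le_mul_of_nonneg_left ?_ (Nat.cast_nonneg _)
    rw [le_div_iff₀ hr0, ← Nat.sub_add_cancel hp3, pow_succ, Nat.add_sub_cancel]
    exact mul_le_mul_of_nonneg_right (pow_le_pow_left₀ (abs_nonneg _) hp.le _) hr0.le

end HasC1Lim

variable {ι : Type*} [Fintype ι]

theorem exists_isQP_seq {f : (ι → ℝ) → ℝ} (hf : ContDiff ℝ (⊤ : ℕ∞) f) :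
    ∃ g : ℕ → (ι → ℝ) → ℝ, (∀ k, IsQP (g k)) ∧
      ∀ z, HasC1Lim g z (f z) (fderiv ℝ f z) := by
  have h1 : ∀ k : ℕ, ∃ g : (ι → ℝ) → ℝ, IsQP g ∧ ∀ x ∈ closedBall (0 : ι → ℝ) k,
      |g x - f x| ≤ 1 / ((k : ℝ) + 1) ∧ ‖fderiv ℝ g x - fderiv ℝ f x‖ ≤ 1 / ((k : ℝ) + 1) :=
    fun k => exists_isQP_C1_near (hf.of_le one_le_infty') k (by positivity)
  choose g hg hgf using h1
  refine ⟨g, hg, fun z => ?_⟩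
  have hball : ∀ᶠ p in (atTop : Filter ℕ) ×ˢ 𝓝 z, p.2 ∈ closedBall (0 : ι → ℝ) p.1 := by
    obtain ⟨n, hn⟩ := exists_nat_gt ‖z‖
    filter_upwards [tendsto_fst.eventually (eventually_ge_atTop n),
      tendsto_snd.eventually (continuous_norm.continuousAt.eventually (gt_mem_nhds hn))]
      with p h1 h2
    simp only [mem_closedBall, dist_zero_right]
    exact h2.le.trans (by exact_mod_cast h1)
  have hlim : Tendsto (fun p : ℕ × (ι → ℝ) => 1 / ((p.1 : ℝ) + 1)) (atTop ×ˢ 𝓝 z) (𝓝 0) :=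
    tendsto_one_div_add_atTop_nhds_zero_nat.comp tendsto_fst
  refine ⟨Eventually.of_forall fun p => (hg p.1).contDiff.contDiffAt, ?_, ?_⟩
  · have h2 : Tendsto (fun p : ℕ × (ι → ℝ) => g p.1 p.2 - f p.2) (atTop ×ˢ 𝓝 z) (𝓝 0) :=
      squeeze_zero_norm' (hball.mono fun p hp => (hgf p.1 p.2 hp).1) hlim
    simpa using h2.add (hf.continuous.continuousAt.tendsto.comp tendsto_snd)
  · have h2 : Tendsto (fun p : ℕ × (ι → ℝ) => fderiv ℝ (g p.1) p.2 - fderiv ℝ f p.2)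
        (atTop ×ˢ 𝓝 z) (𝓝 0) :=
      squeeze_zero_norm' (hball.mono fun p hp => (hgf p.1 p.2 hp).2) hlim
    simpa using h2.add ((hf.smoothNear z).continuousAt_fderiv.tendsto.comp tendsto_snd)

/-- Relative approximation: a smooth function equal to the rational function `c / Q` near the
zero set of `pp` is a `C¹` limit of rational functions with denominator `Q` which agree with it
on that zero set. -/
theorem exists_isQP_seq_rel {f c Q pp : (ι → ℝ) → ℝ} (hf : ContDiff ℝ (⊤ : ℕ∞) f)
    (hc : IsQP c) (hQ : IsQP Q) (hpp : IsQP pp) (hQ0 : ∀ x, Q x ≠ 0)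
    (hfc : ∀ x, pp x = 0 → ∀ᶠ y in 𝓝 x, f y = c y / Q y) :
    ∃ g : ℕ → (ι → ℝ) → ℝ, (∀ k, IsQP (g k)) ∧
      (∀ k x, pp x = 0 → g k x / Q x = f x) ∧
      ∀ z, HasC1Lim (fun k x => g k x / Q x) z (f z) (fderiv ℝ f z) := by
  have hlam : ContDiff ℝ (⊤ : ℕ∞) (fun x => (Q x * f x - c x) / pp x) := by
    rw [contDiff_iff_contDiffAt]
    intro x
    by_cases hx : pp x = 0
    · refine (contDiffAt_const (c := (0 : ℝ))).congr_of_eventuallyEq ?_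
      filter_upwards [hfc x hx] with y hy
      rw [hy, mul_div_cancel₀ _ (hQ0 y), sub_self, zero_div]
    · exact ((hQ.contDiff.mul hf).sub hc.contDiff).contDiffAt.div hpp.contDiff.contDiffAt hx
  obtain ⟨l, hl, hlim⟩ := exists_isQP_seq hlam
  refine ⟨fun k x => c x + pp x * l k x, fun k => hc.add (hpp.mul (hl k)), ?_, ?_⟩
  · intro k x hx
    show (c x + pp x * l k x) / Q x = f x
    rw [(hfc x hx).self_of_nhds, hx, zero_mul, add_zero]
  · intro z
    have hsm : ContDiff ℝ (⊤ : ℕ∞)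
        (fun w : (ι → ℝ) × ℝ => (c w.1 + pp w.1 * w.2) / Q w.1) := by
      refine ContDiff.div ?_ (hQ.contDiff.comp contDiff_fst) fun w => hQ0 _
      exact (hc.contDiff.comp contDiff_fst).add ((hpp.contDiff.comp contDiff_fst).mul contDiff_snd)
    have h1 := (HasC1Lim.const (z := z) (contDiff_id.smoothNear z)).comp₂
      (f := fun w : (ι → ℝ) × ℝ => (c w.1 + pp w.1 * w.2) / Q w.1) (hsm.smoothNear _) (hlim z)
    have hfe : f = fun x => (c x + pp x * ((Q x * f x - c x) / pp x)) / Q x := by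
      ext x
      by_cases hx : pp x = 0
      · rw [(hfc x hx).self_of_nhds, hx, zero_mul, add_zero]
      · rw [mul_div_cancel₀ _ hx, add_sub_cancel, mul_div_cancel_left₀ _ (hQ0 x)]
    have h2 : fderiv ℝ f z = (fderiv ℝ (fun w : (ι → ℝ) × ℝ => (c w.1 + pp w.1 * w.2) / Q w.1)
        (z, (Q z * f z - c z) / pp z)).comp ((fderiv ℝ id z).prod
          (fderiv ℝ (fun x => (Q x * f x - c x) / pp x) z)) := by
      conv_lhs => rw [hfe]
      rw [← DifferentiableAt.fderiv_prodMk differentiableAt_id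
        (hlam.differentiable infty_ne_zero' z)]
      exact fderiv_comp (𝕜 := ℝ) (f := fun x => (id x, (Q x * f x - c x) / pp x)) z
        (hsm.differentiable infty_ne_zero' _)
        (differentiableAt_id.prodMk (hlam.differentiable infty_ne_zero' z))
    rw [h2]
    have hz : f z = (c z + pp z * ((Q z * f z - c z) / pp z)) / Q z := congrFun hfe z
    have h3 := h1
    simp only [id_eq] at h3
    rw [← hz] at h3
    exact h3

end C1Limits

section LocalSolutions

open Filter Topology Metric

variable {E F G : Type*} [NormedAddCommGroup E] [NormedSpace ℝ E] [FiniteDimensional ℝ E]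
  [NormedAddCommGroup F] [NormedSpace ℝ F] [FiniteDimensional ℝ F]
  [NormedAddCommGroup G] [NormedSpace ℝ G] [FiniteDimensional ℝ G]

/-- Smooth inverse function theorem between finite-dimensional spaces of equal dimension. -/
theorem SmoothNear.exists_localInverse {f : E → F} {a : E} (hf : SmoothNear f a)
    (hinj : Function.Injective (fderiv ℝ f a))
    (hdim : Module.finrank ℝ E = Module.finrank ℝ F) :
    ∃ g : F → E, SmoothNear g (f a) ∧ (∀ᶠ x in 𝓝 a, g (f x) = x) ∧
      ∀ᶠ y in 𝓝 (f a), f (g y) = y := by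
  have hca : ContDiffAt ℝ (⊤ : ℕ∞) f a := hf.self_of_nhds
  let A : E ≃L[ℝ] F :=
    (LinearEquiv.ofInjectiveOfFinrankEq (fderiv ℝ f a : E →ₗ[ℝ] F) hinj hdim).toContinuousLinearEquiv
  have hA : (A : E →L[ℝ] F) = fderiv ℝ f a := by ext x; rfl
  have hd : HasFDerivAt f (A : E →L[ℝ] F) a := by
    rw [hA]; exact (hca.differentiableAt infty_ne_zero').hasFDerivAt
  let e := hca.toOpenPartialHomeomorph f hd infty_ne_zero'
  have he : ∀ x, e x = f x := fun x => rfl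
  have hsrc : a ∈ e.source := hca.mem_toOpenPartialHomeomorph_source hd infty_ne_zero'
  have htgt : f a ∈ e.target := e.map_source hsrc
  have hcs : ContinuousAt e.symm (f a) := e.continuousAt_symm htgt
  have hsa : e.symm (f a) = a := e.left_inv hsrc
  refine ⟨e.symm, ?_, ?_, ?_⟩
  · have h1 : ∀ᶠ x in 𝓝 a, ∃ B : E ≃L[ℝ] F, (B : E →L[ℝ] F) = fderiv ℝ f x := by
      have h2 := A.nhds
      rw [hA] at h2
      exact hf.continuousAt_fderiv.eventually h2
    have h3 := (h1.and hf)
    rw [← hsa] at h3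
    filter_upwards [hcs.eventually h3, e.open_target.mem_nhds htgt] with y hy hyt
    obtain ⟨⟨B, hB⟩, hy2⟩ := hy
    refine e.contDiffAt_symm (f₀' := B) hyt ?_ hy2
    rw [hB]
    exact (hy2.differentiableAt infty_ne_zero').hasFDerivAt
  · filter_upwards [e.open_source.mem_nhds hsrc] with x hx using e.left_inv hx
  · filter_upwards [e.open_target.mem_nhds htgt] with y hy using e.right_inv hy

/-- Smooth implicit function theorem. -/
theorem SmoothNear.exists_solution {f : E × G → F} {a : E} {b : G} (hf : SmoothNear f (a, b))
    (h0 : f (a, b) = 0) (hinj : ∀ h : E, fderiv ℝ f (a, b) (h, 0) = 0 → h = 0)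
    (hdim : Module.finrank ℝ E = Module.finrank ℝ F) :
    ∃ ψ : G → E, ψ b = a ∧ SmoothNear ψ b ∧
      ∀ᶠ w in 𝓝 (a, b), f w = 0 ↔ w.1 = ψ w.2 := by
  have hsn : SmoothNear (fun w : E × G => (f w, w.2)) (a, b) := by
    filter_upwards [hf] with w hw using hw.prodMk contDiffAt_snd
  have hfd : fderiv ℝ (fun w : E × G => (f w, w.2)) (a, b) =
      (fderiv ℝ f (a, b)).prod (ContinuousLinearMap.snd ℝ E G) := by
    rw [DifferentiableAt.fderiv_prodMk (hf.self_of_nhds.differentiableAt infty_ne_zero')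
      differentiableAt_snd, fderiv_snd]
  obtain ⟨g, hg, hgl, hgr⟩ := hsn.exists_localInverse (by
      rw [hfd]
      refine (injective_iff_map_eq_zero _).2 fun w hw => ?_
      simp only [ContinuousLinearMap.prod_apply, ContinuousLinearMap.coe_snd', Prod.mk_eq_zero]
        at hw
      obtain ⟨w1, w2⟩ := w
      obtain ⟨hw1, rfl⟩ := hw
      rw [hinj w1 hw1]; rfl) (by simp [hdim])
  rw [h0] at hg hgr
  have hga : g (0, b) = (a, b) := by rw [← hgl.self_of_nhds, h0]
  have hc0 : Continuous fun v : G => ((0 : F), v) := by fun_prop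
  have hcg : ContinuousAt g (0, b) := hg.self_of_nhds.continuousAt
  refine ⟨fun v => (g (0, v)).1, by simp [hga], ?_, ?_⟩
  · have h1 : SmoothNear (fun v : G => ((0 : F), v)) b :=
      (contDiff_const.prodMk contDiff_id).smoothNear b
    have h2 : SmoothNear (fun v : G => g (0, v)) b := SmoothNear.comp (g := g) hg h1
    exact SmoothNear.comp (f := fun v : G => g (0, v)) (contDiff_fst.smoothNear _) h2
  · have h2 : ∀ᶠ w in 𝓝 (a, b), (f (g (0, w.2)), (g (0, w.2)).2) = ((0 : F), w.2) := by
      have : Tendsto (fun w : E × G => ((0 : F), w.2)) (𝓝 (a, b)) (𝓝 (0, b)) :=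
        (hc0.comp continuous_snd).tendsto (a, b)
      exact this.eventually hgr
    filter_upwards [hgl, h2] with w hw1 hw2
    simp only [Prod.mk.injEq] at hw2
    constructor
    · intro hw
      rw [hw] at hw1
      rw [hw1]
    · intro hw
      have : w = g (0, w.2) := Prod.ext hw hw2.2.symm
      rw [this]; exact hw2.1

/-- Local solutions of a relation along a compact set glue to a solution near the set. -/
theorem exists_glued_solution {r : E → E → Prop} {K : Set E} (hK : IsCompact K)
    (hloc : ∀ a ∈ K, ∃ ψ : E → E, ψ a = a ∧ SmoothNear ψ a ∧
      ∀ᶠ w in 𝓝 (a, a), r w.1 w.2 ↔ w.1 = ψ w.2) :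
    ∃ ρ : E → E, ∀ a ∈ K, ∃ ψ : E → E, ρ =ᶠ[𝓝 a] ψ ∧ ψ a = a ∧ SmoothNear ψ a ∧
      ∀ᶠ w in 𝓝 (a, a), r w.1 w.2 ↔ w.1 = ψ w.2 := by
  classical
  choose! ψ hψa hψs hψr using hloc
  have h1 : ∀ a ∈ K, ∃ ε > 0, ∀ y v, dist y a < ε → dist v a < ε → (r y v ↔ y = ψ a v) := by
    intro a ha
    obtain ⟨ε, hε, h⟩ := Metric.eventually_nhds_iff.1 (hψr a ha)
    refine ⟨ε, hε, fun y v hy hv => h (y := (y, v)) ?_⟩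
    rw [Prod.dist_eq]; exact max_lt hy hv
  choose! ε hε hεr using h1
  obtain ⟨δ, hδ, hleb⟩ := lebesgue_number_lemma_of_metric (c := fun a : K => ball (a : E) (ε a)) hK
    (fun a => isOpen_ball) (fun x hx => Set.mem_iUnion.2 ⟨⟨x, hx⟩, mem_ball_self (hε x hx)⟩)
  let N : E → E → Prop := fun y v => ∃ x ∈ K, dist y x < δ / 3 ∧ dist v x < δ / 3
  have huniq : ∀ y y' v, N y v → r y v → N y' v → r y' v → y = y' := by
    rintro y y' v ⟨x, hx, hy, hv⟩ hr ⟨x', hx', hy', hv'⟩ hr'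
    obtain ⟨⟨a, ha⟩, hsub⟩ := hleb x hx
    have hy1 : dist y a < ε a := hsub (by simp only [mem_ball]; linarith)
    have hv1 : dist v a < ε a := hsub (by simp only [mem_ball]; linarith)
    have hy'1 : dist y' a < ε a := hsub (by
      have e1 := dist_triangle y' x' x
      have e2 := dist_triangle_left x' x v
      simp only [mem_ball]; linarith)
    rw [(hεr a ha y v hy1 hv1).1 hr, (hεr a ha y' v hy'1 hv1).1 hr']
  let ρ : E → E := fun v => if h : ∃ y, N y v ∧ r y v then h.choose else v
  have hρ : ∀ y v, N y v → r y v → ρ v = y := by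
    intro y v hN hr
    have h : ∃ y, N y v ∧ r y v := ⟨y, hN, hr⟩
    have : ρ v = h.choose := dif_pos h
    rw [this]
    exact huniq _ _ v h.choose_spec.1 h.choose_spec.2 hN hr
  refine ⟨ρ, fun a ha => ⟨ψ a, ?_, hψa a ha, hψs a ha, hψr a ha⟩⟩
  have hc : ContinuousAt (ψ a) a := (hψs a ha).self_of_nhds.continuousAt
  have hb1 : ∀ᶠ v in 𝓝 a, dist v a < min (δ / 3) (ε a) :=
    ball_mem_nhds a (lt_min (by positivity) (hε a ha))
  have hb2 : ∀ᶠ v in 𝓝 a, dist (ψ a v) a < min (δ / 3) (ε a) := by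
    refine hc.eventually (p := fun y => dist y a < min (δ / 3) (ε a)) ?_
    rw [hψa a ha]; exact hb1
  filter_upwards [hb1, hb2] with v hv1 hv2
  rw [lt_min_iff] at hv1 hv2
  exact hρ _ _ ⟨a, ha, hv2.1, hv1.1⟩ ((hεr a ha _ _ hv2.2 hv1.2).2 rfl)

end LocalSolutions

section Tubular

open Filter Topology Metric

variable {ι κ : Type*} [Fintype ι] [DecidableEq ι] [Fintype κ]

/-- `n` is the gradient at `y` of a function vanishing on `V` near `y`. -/
def NormalAt (V : Set (ι → ℝ)) (y n : ι → ℝ) : Prop :=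
  ∃ g : (ι → ℝ) → ℝ, HasStrictFDerivAt g (dotL n) y ∧ ∀ᶠ x in 𝓝 y, x ∈ V → g x = 0

/-- The transpose of a linear map between coordinate spaces. -/
noncomputable def transL : ((ι → ℝ) →L[ℝ] κ → ℝ) →L[ℝ] (κ → ℝ) →L[ℝ] ι → ℝ :=
  LinearMap.toContinuousLinearMap
    { toFun := fun L => ContinuousLinearMap.pi fun i => dotL (L (Pi.single i 1))
      map_add' := fun L L' => by ext v i; simp [add_dotProduct]
      map_smul' := fun c L => by ext v i; simp [smul_dotProduct] }

theorem transL_apply (L : (ι → ℝ) →L[ℝ] κ → ℝ) (μ : κ → ℝ) (i : ι) :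
    transL L μ i = L (Pi.single i 1) ⬝ᵥ μ := by
  simp [transL]

theorem transL_dotProduct (L : (ι → ℝ) →L[ℝ] κ → ℝ) (μ : κ → ℝ) (v : ι → ℝ) :
    transL L μ ⬝ᵥ v = μ ⬝ᵥ L v := by
  have h : L v = ∑ i, v i • L (Pi.single i 1) := by
    conv_lhs => rw [pi_eq_sum_univ' v]
    rw [map_sum]
    refine Finset.sum_congr rfl fun i _ => ?_
    rw [map_smul]
  rw [h, dotProduct_sum]
  simp only [dotProduct_smul, smul_eq_mul]
  rw [dotProduct]
  refine Finset.sum_congr rfl fun i _ => ?_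
  rw [transL_apply, dotProduct_comm μ, mul_comm]

theorem transL_injective {L : (ι → ℝ) →L[ℝ] κ → ℝ} (hL : Function.Surjective L) :
    Function.Injective (transL L) := by
  refine (injective_iff_map_eq_zero _).2 fun μ hμ => ?_
  obtain ⟨v, hv⟩ := hL μ
  have h := transL_dotProduct L μ v
  rw [hμ, zero_dotProduct, hv] at h
  exact dotProduct_self_eq_zero.1 h.symm

theorem normalAt_iff {V : Set (ι → ℝ)} {f : (ι → ℝ) → κ → ℝ} {y : ι → ℝ}
    (hf : ContDiffAt ℝ (⊤ : ℕ∞) f y) (hs : Function.Surjective (fderiv ℝ f y)) (hy : f y = 0)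
    (hV : ∀ᶠ x in 𝓝 y, x ∈ V ↔ f x = 0) (n : ι → ℝ) :
    NormalAt V y n ↔ ∃ μ, n = transL (fderiv ℝ f y) μ := by
  classical
  have hfs : HasStrictFDerivAt f (fderiv ℝ f y) y := hf.hasStrictFDerivAt infty_ne_zero'
  constructor
  · rintro ⟨g, hg, hgV⟩
    have hex : IsLocalExtrOn g {x | f x = f y} y := by
      refine Or.inl ?_
      have : ∀ᶠ x in 𝓝[{x | f x = f y}] y, x ∈ {x | f x = f y} := self_mem_nhdsWithin
      filter_upwards [this, mem_nhdsWithin_of_mem_nhds hgV, mem_nhdsWithin_of_mem_nhds hV]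
        with x hx h1 h2
      replace hx : f x = f y := hx
      rw [hy] at hx
      rw [h1 (h2.2 hx), hgV.self_of_nhds (hV.self_of_nhds.2 hy)]
    obtain ⟨Λ, Λ0, hne, hL⟩ := hex.exists_linear_map_of_hasStrictFDerivAt hfs hg
    have hΛ0 : Λ0 ≠ 0 := by
      rintro rfl
      refine hne (Prod.ext ?_ rfl)
      ext w
      obtain ⟨v, hv⟩ := hs (Pi.single w 1)
      have := hL v
      rw [hv] at this
      simpa using this
    refine ⟨fun j => -Λ0⁻¹ * Λ (Pi.single j 1), ?_⟩
    refine dotProduct_eq _ _ fun v => ?_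
    rw [transL_dotProduct]
    have h1 := hL v
    rw [dotL_apply] at h1
    have h2 : Λ (fderiv ℝ f y v) = (fun j => Λ (Pi.single j 1)) ⬝ᵥ fderiv ℝ f y v := by
      have := congrArg (fun L => L (fderiv ℝ f y v)) (dotL_eq (LinearMap.toContinuousLinearMap Λ))
      simpa using this.symm
    have h3 : (fun j => -Λ0⁻¹ * Λ (Pi.single j 1)) = (-Λ0⁻¹) • fun j => Λ (Pi.single j 1) := rfl
    rw [h3, smul_dotProduct, ← h2, smul_eq_mul]
    simp only [smul_eq_mul] at h1
    field_simp
    linarith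
  · rintro ⟨μ, rfl⟩
    refine ⟨fun x => μ ⬝ᵥ f x, ?_, ?_⟩
    · have h1 := (dotL μ).hasStrictFDerivAt (x := f y) |>.comp y hfs
      have h2 : (dotL μ).comp (fderiv ℝ f y) = dotL (transL (fderiv ℝ f y) μ) := by
        ext1 v
        simp only [ContinuousLinearMap.comp_apply, dotL_apply, transL_dotProduct]
      rw [h2] at h1
      exact h1.congr_of_eventuallyEq (Filter.Eventually.of_forall fun x => by simp)
    · filter_upwards [hV] with x hx h1
      rw [hx.1 h1, dotProduct_zero]

theorem transL_small {f : (ι → ℝ) → κ → ℝ} {a : ι → ℝ} (hf : SmoothNear f a)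
    (hs : Function.Surjective (fderiv ℝ f a)) :
    ∃ C > 0, ∀ᶠ y in 𝓝 a, ∀ μ, ‖μ‖ ≤ C * ‖transL (fderiv ℝ f y) μ‖ := by
  obtain ⟨K, hK, hanti⟩ := (transL (fderiv ℝ f a) : (κ → ℝ) →ₗ[ℝ] ι → ℝ).exists_antilipschitzWith
    (LinearMap.ker_eq_bot.2 (transL_injective hs))
  have hK0 : (0 : ℝ) < K := by exact_mod_cast hK
  have hc : ContinuousAt (fun y => transL (fderiv ℝ f y)) a :=
    (transL (ι := ι) (κ := κ)).continuous.continuousAt.comp hf.continuousAt_fderiv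
  refine ⟨2 * K, by positivity, ?_⟩
  filter_upwards [hc.eventually (ball_mem_nhds _ (ε := 1 / (2 * K)) (by positivity))] with y hy μ
  rw [dist_eq_norm] at hy
  have h1 : ‖μ‖ ≤ K * ‖transL (fderiv ℝ f a) μ‖ := by
    simpa using hanti.le_mul_dist μ 0
  have h2 : ‖transL (fderiv ℝ f a) μ‖ ≤ ‖transL (fderiv ℝ f y) μ‖ + 1 / (2 * K) * ‖μ‖ := by
    have h3 := (transL (fderiv ℝ f y) - transL (fderiv ℝ f a)).le_opNorm μ
    rw [sub_apply] at h3
    have h4 : ‖transL (fderiv ℝ f y) - transL (fderiv ℝ f a)‖ * ‖μ‖ ≤ 1 / (2 * K) * ‖μ‖ :=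
      mul_le_mul_of_nonneg_right hy.le (norm_nonneg _)
    have h5 := norm_sub_norm_le (transL (fderiv ℝ f a) μ) (transL (fderiv ℝ f y) μ)
    rw [norm_sub_rev] at h5
    linarith
  have h3 : ‖μ‖ ≤ K * (‖transL (fderiv ℝ f y) μ‖ + 1 / (2 * K) * ‖μ‖) :=
    h1.trans (mul_le_mul_of_nonneg_left h2 hK0.le)
  have h4 : (K : ℝ) * (1 / (2 * K) * ‖μ‖) = ‖μ‖ / 2 := by field_simp
  nlinarith

theorem exists_local_retraction {f : (ι → ℝ) → κ → ℝ} {a : ι → ℝ} (hf : SmoothNear f a)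
    (hs : Function.Surjective (fderiv ℝ f a)) (ha : f a = 0) :
    ∃ ψ : (ι → ℝ) → ι → ℝ, ψ a = a ∧ SmoothNear ψ a ∧
      (∀ᶠ w in 𝓝 (a, a), (f w.1 = 0 ∧ ∃ μ, w.2 - w.1 = transL (fderiv ℝ f w.1) μ) ↔
        w.1 = ψ w.2) ∧
      ∀ᶠ p in 𝓝 a, f p = 0 →
        (∀ u w, (u - fderiv ℝ ψ p u) ⬝ᵥ w = u ⬝ᵥ (w - fderiv ℝ ψ p w)) ∧
        (∀ u, fderiv ℝ f p (fderiv ℝ ψ p u) = 0) ∧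
        (∀ u, ∃ μ, u - fderiv ℝ ψ p u = transL (fderiv ℝ f p) μ) ∧
        ∀ n, fderiv ℝ ψ p n = 0 ↔ ∃ μ, n = transL (fderiv ℝ f p) μ := by
  let T : (ι → ℝ) → (κ → ℝ) →L[ℝ] ι → ℝ := fun y => transL (fderiv ℝ f y)
  have hT : SmoothNear T a := by
    filter_upwards [hf] with y hy
    exact (transL (ι := ι) (κ := κ)).contDiff.contDiffAt.comp y
      (hy.fderiv_right (m := (⊤ : ℕ∞)) (by simp))
  let Φ : ((ι → ℝ) × (κ → ℝ)) × (ι → ℝ) → (κ → ℝ) × (ι → ℝ) :=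
    fun w => (f w.1.1, w.1.1 - w.2 + T w.1.1 w.1.2)
  have hΦ : SmoothNear Φ ((a, 0), a) := by
    have hc : ContinuousAt (fun w : ((ι → ℝ) × (κ → ℝ)) × (ι → ℝ) => w.1.1) ((a, 0), a) := by
      fun_prop
    filter_upwards [hc.eventually hf, hc.eventually hT] with w h1 h2
    have e1 : ContDiffAt ℝ (⊤ : ℕ∞) (fun w : ((ι → ℝ) × (κ → ℝ)) × (ι → ℝ) => w.1.1) w :=
      contDiffAt_fst.comp w contDiffAt_fst
    have e2 : ContDiffAt ℝ (⊤ : ℕ∞) (fun w : ((ι → ℝ) × (κ → ℝ)) × (ι → ℝ) => w.1.2) w :=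
      contDiffAt_snd.comp w contDiffAt_fst
    exact (h1.comp w e1).prodMk ((e1.sub contDiffAt_snd).add (ContDiffAt.clm_apply
      (f := fun w : ((ι → ℝ) × (κ → ℝ)) × (ι → ℝ) => T w.1.1) (ContDiffAt.comp (g := T) w h2 e1) e2))
  have hΦ0 : Φ ((a, 0), a) = 0 := by simp [Φ, ha]
  -- the derivative of the system
  have hder : ∀ p l v, ContDiffAt ℝ (⊤ : ℕ∞) f p → ContDiffAt ℝ (⊤ : ℕ∞) T p → l = 0 →
      HasFDerivAt Φ (((fderiv ℝ f p).comp ((ContinuousLinearMap.fst ℝ _ _).comp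
        (ContinuousLinearMap.fst ℝ ((ι → ℝ) × (κ → ℝ)) (ι → ℝ)))).prod
        ((ContinuousLinearMap.fst ℝ _ _).comp (ContinuousLinearMap.fst ℝ ((ι → ℝ) × (κ → ℝ)) (ι → ℝ))
          - ContinuousLinearMap.snd ℝ _ _ + (T p).comp ((ContinuousLinearMap.snd ℝ _ _).comp
            (ContinuousLinearMap.fst ℝ ((ι → ℝ) × (κ → ℝ)) (ι → ℝ))))) ((p, l), v) := by
    rintro p l v h1 h2 rfl
    have e1 : HasFDerivAt (fun w : ((ι → ℝ) × (κ → ℝ)) × (ι → ℝ) => w.1.1)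
        ((ContinuousLinearMap.fst ℝ _ _).comp (ContinuousLinearMap.fst ℝ ((ι → ℝ) × (κ → ℝ)) (ι → ℝ)))
        ((p, 0), v) := hasFDerivAt_fst.comp _ hasFDerivAt_fst
    have e2 : HasFDerivAt (fun w : ((ι → ℝ) × (κ → ℝ)) × (ι → ℝ) => w.1.2)
        ((ContinuousLinearMap.snd ℝ _ _).comp (ContinuousLinearMap.fst ℝ ((ι → ℝ) × (κ → ℝ)) (ι → ℝ)))
        ((p, 0), v) := hasFDerivAt_snd.comp _ hasFDerivAt_fst
    have e3 : HasFDerivAt f (fderiv ℝ f p) ((((p, 0), v) :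
      ((ι → ℝ) × (κ → ℝ)) × (ι → ℝ)).1.1) := (h1.differentiableAt infty_ne_zero').hasFDerivAt
    have e4 : HasFDerivAt T (fderiv ℝ T p) ((((p, 0), v) :
      ((ι → ℝ) × (κ → ℝ)) × (ι → ℝ)).1.1) := (h2.differentiableAt infty_ne_zero').hasFDerivAt
    refine (e3.comp ((p, 0), v) e1).prodMk ?_
    have e5 := (e1.sub (hasFDerivAt_snd (p := (((p, 0), v) :
      ((ι → ℝ) × (κ → ℝ)) × (ι → ℝ))))).add ((e4.comp ((p, 0), v) e1).clm_apply e2)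
    have e6 : HasFDerivAt (fun w : ((ι → ℝ) × (κ → ℝ)) × (ι → ℝ) => w.1.1 - w.2 + T w.1.1 w.1.2)
      _ ((p, 0), v) := e5
    exact e6.congr_fderiv (by ext w <;> simp)
  obtain ⟨Ψ, hΨa, hΨs, hΨ⟩ := hΦ.exists_solution hΦ0 (by
    intro h hh
    rw [(hder a 0 a hf.self_of_nhds hT.self_of_nhds rfl).fderiv] at hh
    obtain ⟨h, μ⟩ := h
    simp only [ContinuousLinearMap.prod_apply, ContinuousLinearMap.comp_apply,
      ContinuousLinearMap.coe_fst', ContinuousLinearMap.coe_snd', add_apply, sub_apply, sub_zero,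
      Prod.mk_eq_zero] at hh
    obtain ⟨hh1, hh2⟩ := hh
    have h3 : h ⬝ᵥ h = 0 := by
      have := transL_dotProduct (fderiv ℝ f a) μ h
      rw [hh1, dotProduct_zero] at this
      have h4 : h = - T a μ := eq_neg_of_add_eq_zero_left hh2
      have h5 : h ⬝ᵥ h = (- T a μ) ⬝ᵥ h := by rw [← h4]
      rw [h5, neg_dotProduct, neg_eq_zero]; exact this
    have h4 : h = 0 := dotProduct_self_eq_zero.1 h3
    rw [h4, zero_add] at hh2
    rw [h4, transL_injective hs (hh2.trans (map_zero _).symm)]; rfl) (by simp [add_comm])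
  have hcΨ : ContinuousAt Ψ a := hΨs.self_of_nhds.continuousAt
  obtain ⟨C, hC, hCs⟩ := transL_small hf hs
  have hrel : ∀ᶠ w in 𝓝 (a, a), (f w.1 = 0 ∧ ∃ μ, w.2 - w.1 = transL (fderiv ℝ f w.1) μ) ↔
        w.1 = (Ψ w.2).1 := by
    obtain ⟨δ, hδ, hball⟩ := Metric.eventually_nhds_iff.1 hΨ
    have h1 : ∀ᶠ w : (ι → ℝ) × (ι → ℝ) in 𝓝 (a, a), dist w.1 a < δ :=
      (continuous_fst.continuousAt (x := ((a, a) : (ι → ℝ) × (ι → ℝ)))).eventually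
        (ball_mem_nhds a hδ)
    have h2 : ∀ᶠ w : (ι → ℝ) × (ι → ℝ) in 𝓝 (a, a), dist w.2 a < δ :=
      (continuous_snd.continuousAt (x := ((a, a) : (ι → ℝ) × (ι → ℝ)))).eventually
        (ball_mem_nhds a hδ)
    have h3 : ∀ᶠ w : (ι → ℝ) × (ι → ℝ) in 𝓝 (a, a), C * ‖w.2 - w.1‖ < δ := by
      have : ContinuousAt (fun w : (ι → ℝ) × (ι → ℝ) => C * ‖w.2 - w.1‖) (a, a) := by fun_prop
      exact this.eventually (gt_mem_nhds (by simpa using hδ))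
    have h4 : ∀ᶠ w : (ι → ℝ) × (ι → ℝ) in 𝓝 (a, a), dist (Ψ w.2).2 0 < δ := by
      have : ContinuousAt (fun w : (ι → ℝ) × (ι → ℝ) => (Ψ w.2).2) (a, a) :=
        (ContinuousAt.comp (f := fun w : (ι → ℝ) × (ι → ℝ) => w.2) (x := (a, a)) hcΨ
          continuousAt_snd).snd
      exact this.eventually (p := fun y => dist y 0 < δ) (by
        simp only [hΨa]; exact ball_mem_nhds (0 : κ → ℝ) hδ)
    have h5 : ∀ᶠ w : (ι → ℝ) × (ι → ℝ) in 𝓝 (a, a),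
        ∀ μ, ‖μ‖ ≤ C * ‖transL (fderiv ℝ f w.1) μ‖ :=
      (continuous_fst.continuousAt (x := ((a, a) : (ι → ℝ) × (ι → ℝ)))).eventually hCs
    filter_upwards [h1, h2, h3, h4, h5] with w h1 h2 h3 h4 h5
    obtain ⟨y, v⟩ := w
    simp only at *
    have key : ∀ μ : κ → ℝ, dist μ 0 < δ →
        (f y = 0 ∧ v - y = transL (fderiv ℝ f y) μ ↔ (y, μ) = Ψ v) := by
      intro μ hμ
      have := hball (y := ((y, μ), v)) (by
        rw [Prod.dist_eq, Prod.dist_eq]; exact max_lt (max_lt h1 hμ) h2)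
      rw [← this]
      simp only [Φ, T, Prod.mk_eq_zero]
      refine and_congr_right fun _ => ?_
      rw [← neg_sub, eq_comm, ← sub_eq_zero, sub_neg_eq_add, add_comm]
    constructor
    · rintro ⟨hy, μ, hμ⟩
      have := (key μ (by rw [dist_zero_right]; exact (h5 μ).trans_lt (by rw [← hμ]; exact h3))).1
        ⟨hy, hμ⟩
      rw [← this]
    · intro hy
      have := (key (Ψ v).2 h4).2 (by rw [hy])
      exact ⟨this.1, _, this.2⟩
  refine ⟨fun v => (Ψ v).1, by simp [hΨa], (contDiff_fst.smoothNear _).comp hΨs, hrel, ?_⟩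
  have hdiag : Tendsto (fun p : ι → ℝ => ((p, (0 : κ → ℝ)), p)) (𝓝 a) (𝓝 ((a, 0), a)) :=
    Continuous.tendsto (f := fun p : ι → ℝ => ((p, (0 : κ → ℝ)), p)) (by fun_prop) a
  have hgr : Tendsto (fun v : ι → ℝ => (Ψ v, v)) (𝓝 a) (𝓝 ((a, 0), a)) := by
    have := hcΨ.tendsto.prodMk_nhds (tendsto_id (x := 𝓝 a))
    rwa [hΨa] at this
  filter_upwards [hdiag.eventually hΨ, (hgr.eventually hΨ).eventually_nhds, hf, hT, hΨs]
    with p h1 h2 hfp hTp hΨp hp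
  have hp1 : Ψ p = (p, 0) := (h1.1 (by simp [Φ, hp])).symm
  have hz : (fun v => Φ (Ψ v, v)) =ᶠ[𝓝 p] fun _ => 0 := by
    filter_upwards [h2] with v hv using hv.2 rfl
  have hdΨ : HasFDerivAt Ψ (fderiv ℝ Ψ p) p := (hΨp.differentiableAt infty_ne_zero').hasFDerivAt
  have hd0 : HasFDerivAt (fun v => Φ (Ψ v, v)) (0 : (ι → ℝ) →L[ℝ] (κ → ℝ) × (ι → ℝ)) p :=
    (hasFDerivAt_const 0 p).congr_of_eventuallyEq hz
  have hd1 := HasFDerivAt.comp (f := fun v => (Ψ v, v)) p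
    (hder (Ψ p).1 (Ψ p).2 p (by rwa [hp1]) (by rwa [hp1]) (by rw [hp1]))
    (hdΨ.prodMk (hasFDerivAt_id p))
  have heq := hd1.unique hd0
  have hfst : ∀ u, fderiv ℝ (fun v => (Ψ v).1) p u = (fderiv ℝ Ψ p u).1 := by
    intro u; rw [hdΨ.fst.fderiv]; rfl
  have hA : ∀ u, fderiv ℝ f p (fderiv ℝ Ψ p u).1 = 0 ∧
      u - (fderiv ℝ Ψ p u).1 = T p (fderiv ℝ Ψ p u).2 := by
    intro u
    have := congrArg (fun L => L u) heq
    simp only [hp1, ContinuousLinearMap.comp_apply, ContinuousLinearMap.prod_apply,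
      ContinuousLinearMap.coe_fst', ContinuousLinearMap.coe_snd', add_apply, sub_apply,
      zero_apply, Prod.mk_eq_zero, ContinuousLinearMap.coe_id', id_eq] at this
    refine ⟨this.1, ?_⟩
    rw [← sub_eq_zero, ← neg_eq_zero, ← this.2]; abel
  simp only [hfst]
  have hJN : ∀ u, fderiv ℝ f p (u - (fderiv ℝ Ψ p u).1) = fderiv ℝ f p u := by
    intro u; rw [map_sub, (hA u).1, sub_zero]
  have hsq : ∀ u w, (u - (fderiv ℝ Ψ p u).1) ⬝ᵥ w =
      (u - (fderiv ℝ Ψ p u).1) ⬝ᵥ (w - (fderiv ℝ Ψ p w).1) := by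
    intro u w
    rw [(hA u).2]
    show transL _ _ ⬝ᵥ w = transL _ _ ⬝ᵥ _
    rw [transL_dotProduct, transL_dotProduct, hJN]
  have hsym : ∀ u w, (u - (fderiv ℝ Ψ p u).1) ⬝ᵥ w = u ⬝ᵥ (w - (fderiv ℝ Ψ p w).1) := by
    intro u w
    rw [dotProduct_comm u, hsq u w, hsq w u, dotProduct_comm]
  refine ⟨hsym, fun u => (hA u).1, fun u => ⟨_, (hA u).2⟩, fun n => ⟨fun hn => ⟨_, by
    have := (hA n).2
    rw [hn, sub_zero] at this
    exact this⟩, ?_⟩⟩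
  rintro ⟨μ, rfl⟩
  refine dotProduct_eq _ _ fun w => ?_
  have h3 := hsym (transL (fderiv ℝ f p) μ) w
  rw [transL_dotProduct, hJN, sub_dotProduct, transL_dotProduct] at h3
  rw [zero_dotProduct]
  linarith

end Tubular

section Tubular

open Filter Topology Metric

variable {ι : Type*} [Fintype ι] [DecidableEq ι]

/-- `V` is near `a` the zero set of a smooth submersion onto `ℝ^c`. -/
def IsLocallyCut (c : ℕ) (V : Set (ι → ℝ)) (a : ι → ℝ) : Prop :=
  ∃ f : (ι → ℝ) → Fin c → ℝ, SmoothNear f a ∧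
    (∀ᶠ y in 𝓝 a, Function.Surjective (fderiv ℝ f y)) ∧ ∀ᶠ y in 𝓝 a, y ∈ V ↔ f y = 0

/-- A smooth retraction near `K` along the normal spaces of `V`, with its differential. -/
structure IsTubular (c : ℕ) (V : Set (ι → ℝ)) (K : Set (ι → ℝ)) (ρ : (ι → ℝ) → ι → ℝ) :
    Prop where
  self : ∀ a ∈ K, ρ a = a
  smooth : ∀ a ∈ K, SmoothNear ρ a
  rel : ∀ a ∈ K, ∀ᶠ w in 𝓝 (a, a), (w.1 ∈ V ∧ NormalAt V w.1 (w.2 - w.1)) ↔ w.1 = ρ w.2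
  symm : ∀ a ∈ K, ∀ᶠ p in 𝓝 a, p ∈ V → ∀ u w,
    (u - fderiv ℝ ρ p u) ⬝ᵥ w = u ⬝ᵥ (w - fderiv ℝ ρ p w)
  normal : ∀ a ∈ K, ∀ᶠ p in 𝓝 a, p ∈ V → ∀ n, fderiv ℝ ρ p n = 0 ↔ NormalAt V p n
  idem : ∀ a ∈ K, ∀ᶠ p in 𝓝 a, p ∈ V → ∀ u, fderiv ℝ ρ p (fderiv ℝ ρ p u) = fderiv ℝ ρ p u
  rank : ∀ a ∈ K, ∀ᶠ p in 𝓝 a, p ∈ V →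
    Module.finrank ℝ (LinearMap.ker (fderiv ℝ ρ p : (ι → ℝ) →ₗ[ℝ] ι → ℝ)) = c

theorem exists_isTubular {c : ℕ} {V K : Set (ι → ℝ)} (hK : IsCompact K) (hKV : K ⊆ V)
    (hloc : ∀ a ∈ K, IsLocallyCut c V a) : ∃ ρ, IsTubular c V K ρ := by
  have hmain : ∀ a ∈ K, ∃ ψ : (ι → ℝ) → ι → ℝ, ψ a = a ∧ SmoothNear ψ a ∧
      (∀ᶠ w in 𝓝 (a, a), (w.1 ∈ V ∧ NormalAt V w.1 (w.2 - w.1)) ↔ w.1 = ψ w.2) ∧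
      ∀ᶠ p in 𝓝 a, p ∈ V → (∀ u w, (u - fderiv ℝ ψ p u) ⬝ᵥ w = u ⬝ᵥ (w - fderiv ℝ ψ p w)) ∧
        (∀ u, fderiv ℝ ψ p (fderiv ℝ ψ p u) = fderiv ℝ ψ p u) ∧
        (∀ n, fderiv ℝ ψ p n = 0 ↔ NormalAt V p n) ∧
        Module.finrank ℝ (LinearMap.ker (fderiv ℝ ψ p : (ι → ℝ) →ₗ[ℝ] ι → ℝ)) = c := by
    intro a ha
    obtain ⟨f, hf, hs, hV⟩ := hloc a ha
    have hn : ∀ᶠ y in 𝓝 a, y ∈ V → ∀ n, NormalAt V y n ↔ ∃ μ, n = transL (fderiv ℝ f y) μ := by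
      filter_upwards [hf, hs, hV.eventually_nhds] with y h1 h2 h3 hy
      exact normalAt_iff h1 h2 (h3.self_of_nhds.1 hy) h3
    obtain ⟨ψ, h1, h2, h3, h4⟩ := exists_local_retraction hf hs.self_of_nhds
      (hV.self_of_nhds.1 (hKV ha))
    refine ⟨ψ, h1, h2, ?_, ?_⟩
    · have hc : ContinuousAt (fun w : (ι → ℝ) × (ι → ℝ) => w.1) (a, a) := continuousAt_fst
      filter_upwards [h3, hc.eventually hV, hc.eventually hn] with w h5 h6 h7
      rw [← h5, ← h6]
      exact and_congr_right fun h => h7 h _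
    · filter_upwards [h4, hV, hn, hs] with p h5 h6 h7 h8 hp
      obtain ⟨h9, h10, h12, h11⟩ := h5 (h6.1 hp)
      have hker : ∀ n, fderiv ℝ ψ p n = 0 ↔ NormalAt V p n := fun n => by rw [h11, h7 hp]
      refine ⟨h9, fun u => ?_, hker, ?_⟩
      · have hN : ∀ v, fderiv ℝ f p v = 0 → fderiv ℝ ψ p v = v := by
          intro v hv
          obtain ⟨μ, hμ⟩ := h12 v
          have h13 := transL_dotProduct (fderiv ℝ f p) μ (v - fderiv ℝ ψ p v)
          rw [map_sub, hv, h10, sub_zero, dotProduct_zero, ← hμ] at h13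
          exact (sub_eq_zero.1 (dotProduct_self_eq_zero.1 h13)).symm
        exact hN _ (h10 u)
      · have hk : LinearMap.ker (fderiv ℝ ψ p : (ι → ℝ) →ₗ[ℝ] ι → ℝ) =
            LinearMap.range (transL (fderiv ℝ f p) : (Fin c → ℝ) →ₗ[ℝ] ι → ℝ) := by
          ext n
          rw [LinearMap.mem_ker, LinearMap.mem_range]
          refine (h11 n).trans ⟨fun ⟨μ, h⟩ => ⟨μ, h.symm⟩, fun ⟨μ, h⟩ => ⟨μ, h.symm⟩⟩
        rw [hk, LinearMap.finrank_range_of_inj (transL_injective h8)]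
        simp
  obtain ⟨ρ, hρ⟩ := exists_glued_solution (r := fun y v => y ∈ V ∧ NormalAt V y (v - y)) hK
    (fun a ha => by obtain ⟨ψ, h1, h2, h3, _⟩ := hmain a ha; exact ⟨ψ, h1, h2, h3⟩)
  have hfin : ∀ a ∈ K, ∃ ψ : (ι → ℝ) → ι → ℝ, ρ =ᶠ[𝓝 a] ψ ∧ ψ a = a ∧ SmoothNear ψ a ∧
      (∀ᶠ w in 𝓝 (a, a), (w.1 ∈ V ∧ NormalAt V w.1 (w.2 - w.1)) ↔ w.1 = ψ w.2) ∧
      ∀ᶠ p in 𝓝 a, p ∈ V → (∀ u w, (u - fderiv ℝ ψ p u) ⬝ᵥ w = u ⬝ᵥ (w - fderiv ℝ ψ p w)) ∧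
        (∀ u, fderiv ℝ ψ p (fderiv ℝ ψ p u) = fderiv ℝ ψ p u) ∧
        (∀ n, fderiv ℝ ψ p n = 0 ↔ NormalAt V p n) ∧
        Module.finrank ℝ (LinearMap.ker (fderiv ℝ ψ p : (ι → ℝ) →ₗ[ℝ] ι → ℝ)) = c := by
    intro a ha
    obtain ⟨ψ, h1, h2, h3, h4⟩ := hρ a ha
    obtain ⟨ψ', h1', h2', h3', h4'⟩ := hmain a ha
    have he : ψ' =ᶠ[𝓝 a] ψ := by
      have ht : Tendsto (fun v => (ψ' v, v)) (𝓝 a) (𝓝 (a, a)) := by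
        have := h2'.self_of_nhds.continuousAt.tendsto.prodMk_nhds (tendsto_id (x := 𝓝 a))
        rwa [h1'] at this
      filter_upwards [ht.eventually h4, ht.eventually h3'] with v e1 e2
      exact e1.1 (e2.2 rfl)
    exact ⟨ψ', h1.trans he.symm, h1', h2', h3', h4'⟩
  have hder : ∀ a ∈ K, ∀ᶠ p in 𝓝 a, p ∈ V →
        (∀ u w, (u - fderiv ℝ ρ p u) ⬝ᵥ w = u ⬝ᵥ (w - fderiv ℝ ρ p w)) ∧
        (∀ u, fderiv ℝ ρ p (fderiv ℝ ρ p u) = fderiv ℝ ρ p u) ∧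
        (∀ n, fderiv ℝ ρ p n = 0 ↔ NormalAt V p n) ∧
        Module.finrank ℝ (LinearMap.ker (fderiv ℝ ρ p : (ι → ℝ) →ₗ[ℝ] ι → ℝ)) = c := by
    intro a ha
    obtain ⟨ψ, h1, h2, h3, h4, h5⟩ := hfin a ha
    filter_upwards [h1.eventually_nhds, h5] with p hp h6
    rwa [Filter.EventuallyEq.fderiv_eq hp]
  refine ⟨ρ, ⟨?_, ?_, ?_, ?_, ?_, ?_, ?_⟩⟩
  · intro a ha
    obtain ⟨ψ, h1, h2, h3, h4, h5⟩ := hfin a ha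
    rw [h1.self_of_nhds, h2]
  · intro a ha
    obtain ⟨ψ, h1, h2, h3, h4, h5⟩ := hfin a ha
    exact h3.congr h1
  · intro a ha
    obtain ⟨ψ, h1, h2, h3, h4, h5⟩ := hfin a ha
    have hc : ContinuousAt (fun w : (ι → ℝ) × (ι → ℝ) => w.2) (a, a) := continuousAt_snd
    filter_upwards [h4, hc.eventually h1] with w e1 e2
    rw [e1, e2]
  · exact fun a ha => (hder a ha).mono fun p h hp => (h hp).1
  · exact fun a ha => (hder a ha).mono fun p h hp => (h hp).2.2.1
  · exact fun a ha => (hder a ha).mono fun p h hp => (h hp).2.1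
  · exact fun a ha => (hder a ha).mono fun p h hp => (h hp).2.2.2

end Tubular

section ProjectionFormula

open Matrix

variable {σ ι : Type*} [Fintype ι] [DecidableEq ι]

theorem projection_eq_of_rows {c : ℕ} {B : Matrix (Fin c) ι ℝ} {ν : Matrix ι ι ℝ} (hν : νᵀ = ν)
    (h1 : ∀ k, ν *ᵥ B k = B k) (h2 : ∀ w, ν *ᵥ w ∈ Submodule.span ℝ (Set.range B)) :
    (B * Bᵀ).det • ν = Bᵀ * (B * Bᵀ).adjugate * B := by
  have hBν : ∀ w, B *ᵥ (ν *ᵥ w) = B *ᵥ w := by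
    intro w
    ext k
    simp only [mulVec]
    rw [dotProduct_mulVec, ← mulVec_transpose, hν]
    exact congrArg (· ⬝ᵥ w) (h1 k)
  refine Matrix.ext_of_mulVec_single fun i => ?_
  obtain ⟨μ, hμ⟩ : ∃ μ : Fin c → ℝ, ν *ᵥ Pi.single i 1 = Bᵀ *ᵥ μ := by
    obtain ⟨μ, hμ⟩ := (Submodule.mem_span_range_iff_exists_fun ℝ).1 (h2 (Pi.single i 1))
    refine ⟨μ, hμ.symm.trans ?_⟩
    ext j
    simp [mulVec, dotProduct, mul_comm]
  have h3 : B *ᵥ Pi.single i 1 = (B * Bᵀ) *ᵥ μ := by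
    rw [← hBν, hμ, mulVec_mulVec]
  rw [smul_mulVec, ← mulVec_mulVec, h3, mulVec_mulVec, Matrix.mul_assoc, adjugate_mul, hμ]
  simp [smul_mulVec]

theorem det_mul_transpose_ne_zero {c : ℕ} {B : Matrix (Fin c) ι ℝ} (h : LinearIndependent ℝ B) :
    (B * Bᵀ).det ≠ 0 := by
  intro h0
  obtain ⟨μ, hμ, h1⟩ := exists_mulVec_eq_zero_iff.2 h0
  have h2 : Bᵀ *ᵥ μ = 0 := by
    have h3 : (Bᵀ *ᵥ μ) ⬝ᵥ (Bᵀ *ᵥ μ) = 0 := by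
      rw [dotProduct_mulVec, vecMul_transpose, mulVec_mulVec, h1, zero_dotProduct]
    exact dotProduct_self_eq_zero.1 h3
  refine hμ (funext fun k => Fintype.linearIndependent_iff.1 h μ ?_ k)
  rw [← h2]
  ext j
  simp [mulVec, dotProduct, mul_comm]

theorem linearIndependent_of_det_mul_transpose {c : ℕ} {B : Matrix (Fin c) ι ℝ}
    (h : (B * Bᵀ).det ≠ 0) : LinearIndependent ℝ B := by
  refine Fintype.linearIndependent_iff.2 fun μ hμ => ?_
  have h2 : Bᵀ *ᵥ μ = 0 := by
    rw [← hμ]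
    ext j
    simp [mulVec, dotProduct, mul_comm]
  have h3 : (B * Bᵀ) *ᵥ μ = 0 := by rw [← mulVec_mulVec, h2, mulVec_zero]
  by_contra hcon
  exact h (exists_mulVec_eq_zero_iff.1 ⟨μ, fun h => hcon fun k => congrFun h k, h3⟩)

/-- The orthogonal projection onto the span of rows depending polynomially on a parameter is a
rational function of the parameter where the span has dimension `c`. -/
theorem exists_projection_formula {m : ℕ} (c : ℕ) {A : (σ → ℝ) → Matrix (Fin m) ι ℝ}
    (hA : ∀ j i, IsQP fun y => A y j i) :
    ∃ (den : (σ → ℝ) → ℝ) (U : (σ → ℝ) → Matrix ι (Fin m) ℝ), IsQP den ∧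
      (∀ i j, IsQP fun y => U y i j) ∧ ∀ y (ν : Matrix ι ι ℝ), νᵀ = ν →
        (∀ j, ν *ᵥ A y j = A y j) → (∀ w, ν *ᵥ w ∈ Submodule.span ℝ (Set.range (A y))) →
        Module.finrank ℝ (Submodule.span ℝ (Set.range (A y))) = c →
        den y ≠ 0 ∧ den y • ν = U y * A y := by
  let E : (Fin c → Fin m) → Matrix (Fin c) (Fin m) ℝ :=
    fun I => Matrix.of fun k j => if I k = j then 1 else 0
  let B : (Fin c → Fin m) → (σ → ℝ) → Matrix (Fin c) ι ℝ := fun I y => Matrix.of fun k => A y (I k)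
  have hEB : ∀ I y, E I * A y = B I y := by
    intro I y; ext k i; simp [E, B, Matrix.mul_apply]
  have hB : ∀ I k i, IsQP fun y => B I y k i := fun I k i => hA (I k) i
  have hG : ∀ I k l, IsQP fun y => (B I y * (B I y)ᵀ) k l :=
    fun I => IsQP.matMul (hB I) fun k l => hB I l k
  refine ⟨fun y => ∑ I, (B I y * (B I y)ᵀ).det ^ 2, fun y => ∑ I, (B I y * (B I y)ᵀ).det •
    ((B I y)ᵀ * (B I y * (B I y)ᵀ).adjugate * E I), ?_, ?_, ?_⟩
  · exact IsQP.sum fun I _ => (IsQP.det (hG I)).pow 2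
  · intro i j
    simp only [Matrix.sum_apply, Matrix.smul_apply, smul_eq_mul]
    refine IsQP.sum fun I _ => (IsQP.det (hG I)).mul ?_
    refine IsQP.matMul (IsQP.matMul (fun k l => hB I l k) (IsQP.adjugate (hG I))) (fun k l => ?_) i j
    by_cases h : I k = l
    · simpa [E, h] using IsQP.one
    · simpa [E, h] using IsQP.zero
  · intro y ν h1 h2 h3 h4
    have hspan : ∀ I, (B I y * (B I y)ᵀ).det ≠ 0 →
        Submodule.span ℝ (Set.range (B I y)) = Submodule.span ℝ (Set.range (A y)) := by
      intro I hI
      refine Submodule.eq_of_le_of_finrank_eq (Submodule.span_mono ?_) ?_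
      · rintro _ ⟨k, rfl⟩; exact ⟨I k, rfl⟩
      · rw [finrank_span_eq_card (linearIndependent_of_det_mul_transpose hI), h4, Fintype.card_fin]
    constructor
    · obtain ⟨κ, a, ha, hsp, hli⟩ := exists_linearIndependent' ℝ (A y)
      have : Fintype κ := Fintype.ofInjective a ha
      have hcard : Fintype.card κ = c := by
        rw [← finrank_span_eq_card hli, hsp, h4]
      let e : Fin c ≃ κ := (Fintype.equivFinOfCardEq hcard).symm
      have hdet : (B (a ∘ e) y * (B (a ∘ e) y)ᵀ).det ≠ 0 :=
        det_mul_transpose_ne_zero (hli.comp e e.injective)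
      refine ne_of_gt (Finset.sum_pos' (fun I _ => sq_nonneg _) ⟨a ∘ e, Finset.mem_univ _, ?_⟩)
      positivity
    · rw [Finset.sum_smul, Matrix.sum_mul]
      refine Finset.sum_congr rfl fun I _ => ?_
      by_cases hI : (B I y * (B I y)ᵀ).det = 0
      · simp [hI]
      · have hp := projection_eq_of_rows (B := B I y) h1 (fun k => h2 (I k))
          (fun w => by rw [hspan I hI]; exact h3 w)
        rw [Matrix.smul_mul, Matrix.mul_assoc _ (E I), hEB, ← hp, smul_smul, sq]

end ProjectionFormula

section QRegular

open Filter Topology Matrix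

variable {ι : Type*} [Fintype ι] [DecidableEq ι]

/-- Near `a`, the set `V` is cut out by `c` rational polynomials vanishing on `V` with independent
gradients at `a`. -/
def IsQRegAt (c : ℕ) (V : Set (ι → ℝ)) (a : ι → ℝ) : Prop :=
  ∃ q : Fin c → MvPolynomial ι ℚ,
    (∀ j, ∀ x ∈ V, aeval x (q j) = 0) ∧
    LinearIndependent ℝ (fun j => polyGradQ (q j) a) ∧
    ∃ U : Set (ι → ℝ), IsOpen U ∧ a ∈ U ∧ V ∩ U = {x ∈ U | ∀ j, aeval x (q j) = 0}

theorem continuous_polyGradQ (p : MvPolynomial ι ℚ) : Continuous (polyGradQ p) :=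
  continuous_pi fun i => (IsQP.aeval (pderiv i p)).continuous

theorem hasStrictFDerivAt_aeval_pi {c : ℕ} (q : Fin c → MvPolynomial ι ℚ) (y : ι → ℝ) :
    HasStrictFDerivAt (fun x j => MvPolynomial.aeval x (q j))
      (ContinuousLinearMap.pi fun j => dotL (polyGradQ (q j) y)) y :=
  hasStrictFDerivAt_pi.2 fun j => hasStrictFDerivAt_aeval (q j) y

theorem surjective_of_linearIndependent {c : ℕ} {B : Fin c → ι → ℝ} (hB : LinearIndependent ℝ B) :
    Function.Surjective (ContinuousLinearMap.pi fun j => dotL (B j)) := by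
  intro w
  have hdet := det_mul_transpose_ne_zero (B := Matrix.of B) hB
  refine ⟨(Matrix.of B)ᵀ *ᵥ ((Matrix.of B * (Matrix.of B)ᵀ)⁻¹ *ᵥ w), ?_⟩
  have h : Matrix.of B *ᵥ ((Matrix.of B)ᵀ *ᵥ ((Matrix.of B * (Matrix.of B)ᵀ)⁻¹ *ᵥ w)) = w := by
    rw [mulVec_mulVec, mulVec_mulVec, Matrix.mul_nonsing_inv _ (isUnit_iff_ne_zero.2 hdet),
      one_mulVec]
  ext j
  simpa [mulVec] using congrFun h j

theorem IsQRegAt.exists_eventually {c : ℕ} {V : Set (ι → ℝ)} {a : ι → ℝ} (h : IsQRegAt c V a) :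
    ∃ q : Fin c → MvPolynomial ι ℚ, (∀ j, ∀ x ∈ V, MvPolynomial.aeval x (q j) = 0) ∧
      (∀ᶠ y in 𝓝 a, LinearIndependent ℝ (fun j => polyGradQ (q j) y)) ∧
      ∀ᶠ y in 𝓝 a, y ∈ V ↔ (fun j => MvPolynomial.aeval y (q j)) = 0 := by
  obtain ⟨q, h1, h2, U, hU, haU, h3⟩ := h
  refine ⟨q, h1, ?_, ?_⟩
  · have hc : Continuous fun y j => polyGradQ (q j) y :=
      continuous_pi fun j => continuous_polyGradQ (q j)
    exact hc.continuousAt.eventually (LinearIndependent.eventually h2)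
  · filter_upwards [hU.mem_nhds haU] with y hy
    rw [funext_iff]
    exact ⟨fun hV => (h3.subset ⟨hV, hy⟩).2, fun hq => (h3.superset ⟨hy, hq⟩).1⟩

theorem smoothNear_aeval_pi {c : ℕ} (q : Fin c → MvPolynomial ι ℚ) (y : ι → ℝ) :
    SmoothNear (fun x j => MvPolynomial.aeval x (q j)) y :=
  (contDiff_pi.2 fun j => (IsQP.aeval (q j)).contDiff).smoothNear y

theorem IsQRegAt.isLocallyCut {c : ℕ} {V : Set (ι → ℝ)} {a : ι → ℝ} (h : IsQRegAt c V a) :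
    IsLocallyCut c V a := by
  obtain ⟨q, -, h2, h3⟩ := h.exists_eventually
  refine ⟨_, smoothNear_aeval_pi q a, h2.mono fun y hy => ?_, h3⟩
  rw [(hasStrictFDerivAt_aeval_pi q y).hasFDerivAt.fderiv]
  exact surjective_of_linearIndependent hy

theorem polyGradQ_mem_span {α : Type*} {p : α → MvPolynomial ι ℚ} {y : ι → ℝ}
    (hy : ∀ i, MvPolynomial.aeval y (p i) = 0) {f : MvPolynomial ι ℚ}
    (hf : f ∈ Ideal.span (Set.range p)) :
    polyGradQ f y ∈ Submodule.span ℝ (Set.range fun i => polyGradQ (p i) y) := by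
  have : MvPolynomial.aeval y f = 0 ∧
      polyGradQ f y ∈ Submodule.span ℝ (Set.range fun i => polyGradQ (p i) y) := by
    refine Submodule.span_induction ?_ ?_ ?_ ?_ hf
    · rintro _ ⟨i, rfl⟩
      exact ⟨hy i, Submodule.subset_span ⟨i, rfl⟩⟩
    · refine ⟨map_zero _, ?_⟩
      convert Submodule.zero_mem _
      ext i; simp [polyGradQ]
    · rintro f g - - ⟨h1, h2⟩ ⟨h3, h4⟩
      refine ⟨by rw [map_add, h1, h3, add_zero], ?_⟩
      convert Submodule.add_mem _ h2 h4
      ext i; simp [polyGradQ]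
    · rintro r f - ⟨h1, h2⟩
      refine ⟨by rw [smul_eq_mul, map_mul, h1, mul_zero], ?_⟩
      convert Submodule.smul_mem _ (MvPolynomial.aeval y r) h2
      ext i; simp [polyGradQ, h1]
  exact this.2

theorem normalAt_polyGradQ {V : Set (ι → ℝ)} {f : MvPolynomial ι ℚ}
    (hf : ∀ x ∈ V, MvPolynomial.aeval x f = 0) (y : ι → ℝ) : NormalAt V y (polyGradQ f y) :=
  ⟨_, hasStrictFDerivAt_aeval f y, Eventually.of_forall hf⟩

/-- The normal spaces of a rational algebraic set, near its regular points of codimension `c`, in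
terms of generators of its ideal. -/
theorem exists_normal_formula (c : ℕ) {V : Set (ι → ℝ)} (hV : IsQAlgebraicSet V) :
    ∃ (m : ℕ) (p : Fin m → MvPolynomial ι ℚ) (den : (ι → ℝ) → ℝ)
      (U : (ι → ℝ) → Matrix ι (Fin m) ℝ), IsQP den ∧ (∀ i j, IsQP fun y => U y i j) ∧
      (∀ x, x ∈ V ↔ ∀ i, MvPolynomial.aeval x (p i) = 0) ∧
      ∀ a, IsQRegAt c V a → ∀ᶠ y in 𝓝 a, y ∈ V →
        ∀ ν : Matrix ι ι ℝ, νᵀ = ν → (∀ n, NormalAt V y n → ν *ᵥ n = n) →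
          (∀ w, NormalAt V y (ν *ᵥ w)) →
          den y ≠ 0 ∧ den y • ν = U y * Matrix.of fun j => polyGradQ (p j) y := by
  let I : Ideal (MvPolynomial ι ℚ) :=
    { carrier := {f | ∀ x ∈ V, MvPolynomial.aeval x f = 0}
      add_mem' := fun hf hg x hx => by rw [map_add, hf x hx, hg x hx, add_zero]
      zero_mem' := fun x _ => map_zero _
      smul_mem' := fun r f hf x hx => by rw [smul_eq_mul, map_mul, hf x hx, mul_zero] }
  obtain ⟨m, p, hp⟩ := Submodule.fg_iff_exists_fin_generating_family.1
    (IsNoetherian.noetherian I)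
  have hpV : ∀ i, ∀ x ∈ V, MvPolynomial.aeval x (p i) = 0 := fun i =>
    (hp.le (Submodule.subset_span ⟨i, rfl⟩) : p i ∈ I)
  obtain ⟨den, U, h1, h2, h3⟩ := exists_projection_formula (σ := ι) (ι := ι) (m := m) c
    (A := fun y => Matrix.of fun j => polyGradQ (p j) y) (fun j i => IsQP.aeval (pderiv i (p j)))
  refine ⟨m, p, den, U, h1, h2, fun x => ⟨fun hx i => hpV i x hx, fun hx => ?_⟩, ?_⟩
  · obtain ⟨S, rfl⟩ := hV
    intro f hf
    have hfI : f ∈ Ideal.span (Set.range p) := hp.ge (fun x hx => hx f hf : f ∈ I)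
    refine Submodule.span_induction (p := fun f _ => MvPolynomial.aeval x f = 0) ?_ (map_zero _)
      ?_ ?_ hfI
    · rintro _ ⟨i, rfl⟩; exact hx i
    · intro f g _ _ h h'; rw [map_add, h, h', add_zero]
    · intro r f _ h; rw [smul_eq_mul, map_mul, h, mul_zero]
  · intro a ha
    obtain ⟨q, hq1, hq2, hq3⟩ := ha.exists_eventually
    filter_upwards [hq2, hq3, hq3.eventually_nhds] with y hy1 hy2 hy3 hyV
    have hN := fun n => normalAt_iff (n := n) (smoothNear_aeval_pi q y).self_of_nhds
      (by rw [(hasStrictFDerivAt_aeval_pi q y).hasFDerivAt.fderiv]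
          exact surjective_of_linearIndependent hy1) (hy2.1 hyV) hy3
    have hNq : ∀ n, NormalAt V y n →
        n ∈ Submodule.span ℝ (Set.range fun j => polyGradQ (q j) y) := by
      intro n hn
      obtain ⟨μ, rfl⟩ := (hN _).1 hn
      refine (Submodule.mem_span_range_iff_exists_fun ℝ).2 ⟨μ, ?_⟩
      ext i
      rw [transL_apply, (hasStrictFDerivAt_aeval_pi q y).hasFDerivAt.fderiv]
      simp [dotProduct, Pi.single_apply, mul_comm]
    have hsp : Submodule.span ℝ (Set.range fun j => polyGradQ (p j) y) =
        Submodule.span ℝ (Set.range fun j => polyGradQ (q j) y) := by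
      apply le_antisymm <;> rw [Submodule.span_le]
      · rintro _ ⟨j, rfl⟩
        exact hNq _ (normalAt_polyGradQ (hpV j) y)
      · rintro _ ⟨j, rfl⟩
        exact polyGradQ_mem_span (fun i => hpV i y hyV) (hp.ge (hq1 j : q j ∈ I))
    have hcard : Module.finrank ℝ
        (Submodule.span ℝ (Set.range fun j => polyGradQ (p j) y)) = c := by
      rw [hsp, finrank_span_eq_card hy1, Fintype.card_fin]
    intro ν hν1 hν2 hν3
    exact h3 y ν hν1 (fun j => hν2 _ (normalAt_polyGradQ (hpV j) y))
      (fun w => hsp.ge (hNq _ (hν3 w))) hcard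

end QRegular

section Target

open Filter Topology Matrix

variable {ι κ κ' J J' : Type*} [Fintype ι] [DecidableEq ι] [Fintype κ']
  [DecidableEq κ'] [Fintype κ] [DecidableEq κ]

/-- The matrix of `id - Dρ`. -/
noncomputable def conormal (ρ : (ι → ℝ) → ι → ℝ) (y : ι → ℝ) : Matrix ι ι ℝ :=
  LinearMap.toMatrix' (LinearMap.id - (fderiv ℝ ρ y : (ι → ℝ) →ₗ[ℝ] ι → ℝ))

theorem conormal_mulVec (ρ : (ι → ℝ) → ι → ℝ) (y w : ι → ℝ) :
    conormal ρ y *ᵥ w = w - fderiv ℝ ρ y w := by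
  rw [conormal, LinearMap.toMatrix'_mulVec]
  rfl

theorem conormal_apply (ρ : (ι → ℝ) → ι → ℝ) (y : ι → ℝ) (i j : ι) :
    conormal ρ y i j = (1 : Matrix ι ι ℝ) i j - fderiv ℝ ρ y (Pi.single j 1) i := by
  have h := congrFun (conormal_mulVec ρ y (Pi.single j 1)) i
  rw [mulVec_single_one] at h
  rw [show conormal ρ y i j = (conormal ρ y).col j i from rfl, h]
  simp [Matrix.one_apply, Pi.single_apply]

namespace IsTubular

variable {c : ℕ} {V K : Set (ι → ℝ)} {ρ : (ι → ℝ) → ι → ℝ}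

theorem conormal_transpose (h : IsTubular c V K ρ) {a : ι → ℝ} (ha : a ∈ K) :
    ∀ᶠ p in 𝓝 a, p ∈ V → (conormal ρ p)ᵀ = conormal ρ p := by
  filter_upwards [h.symm a ha] with p hp hpV
  ext i j
  have h1 := hp hpV (Pi.single i 1) (Pi.single j 1)
  rw [← conormal_mulVec, ← conormal_mulVec] at h1
  simpa using h1

theorem conormal_of_normalAt (h : IsTubular c V K ρ) {a : ι → ℝ} (ha : a ∈ K) :
    ∀ᶠ p in 𝓝 a, p ∈ V → ∀ n, NormalAt V p n ↔ conormal ρ p *ᵥ n = n := by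
  filter_upwards [h.normal a ha] with p hp hpV n
  rw [← hp hpV, conormal_mulVec, sub_eq_self]

theorem normalAt_conormal (h : IsTubular c V K ρ) {a : ι → ℝ} (ha : a ∈ K) :
    ∀ᶠ p in 𝓝 a, p ∈ V → ∀ w, NormalAt V p (conormal ρ p *ᵥ w) := by
  filter_upwards [h.normal a ha, h.idem a ha] with p hp hp2 hpV w
  rw [← hp hpV, conormal_mulVec, map_sub, hp2 hpV, sub_self]

end IsTubular

/-- `R` is a system of rational polynomial equations, affine in its second argument, which defines
near the diagonal of `K` the graph of the smooth map `ρ` fixing `K`. -/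
structure IsTarget (R : J → (κ → ℝ) → (κ → ℝ) → ℝ) (K : Set (κ → ℝ)) (ρ : (κ → ℝ) → κ → ℝ) :
    Prop where
  affine : ∀ j, ∃ (α : (κ → ℝ) → ℝ) (β : κ → (κ → ℝ) → ℝ), IsQP α ∧ (∀ i, IsQP (β i)) ∧
    ∀ y x, R j y x = α y + ∑ i, β i y * x i
  self : ∀ a ∈ K, ρ a = a
  smooth : ∀ a ∈ K, SmoothNear ρ a
  rel : ∀ a ∈ K, ∀ᶠ w in 𝓝 (a, a), (∀ j, R j w.1 w.2 = 0) ↔ w.1 = ρ w.2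
  inj : ∀ a ∈ K, ∀ h, (∀ j, fderiv ℝ (fun y => R j y a) a h = 0) → h = 0
  quad : ∃ L : κ → ℚ, ∀ y x, (∀ j, R j y x = 0) → ∑ i, y i ^ 2 = ∑ i, (L i : ℝ) * y i

theorem exists_isTarget_of_isQRegAt {c : ℕ} {V K : Set (κ → ℝ)} (hV : IsQAlgebraicSet V)
    (hK : IsCompact K) (hKV : K ⊆ V) (hreg : ∀ a ∈ K, IsQRegAt c V a) {L : κ → ℚ}
    (hL : ∀ y ∈ V, ∑ i, y i ^ 2 = ∑ i, (L i : ℝ) * y i) :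
    ∃ (m : ℕ) (R : Fin m ⊕ κ → (κ → ℝ) → (κ → ℝ) → ℝ) (ρ : (κ → ℝ) → κ → ℝ),
      IsTarget R K ρ ∧ ∀ y x, (∀ j, R j y x = 0) → y ∈ V := by
  obtain ⟨ρ, hρ⟩ := exists_isTubular hK hKV fun a ha => (hreg a ha).isLocallyCut
  obtain ⟨m, p, den, U, hden, hU, hp, hform⟩ := exists_normal_formula c hV
  let A : (κ → ℝ) → Matrix (Fin m) κ ℝ := fun y => Matrix.of fun j => polyGradQ (p j) y
  let τ : (κ → ℝ) → Matrix κ κ ℝ := fun y => den y • 1 - U y * A y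
  have hA : ∀ j i, IsQP fun y => A y j i := fun j i => IsQP.aeval (pderiv i (p j))
  have hτ : ∀ i j, IsQP fun y => τ y i j := by
    intro i j
    simp only [τ, Matrix.sub_apply, Matrix.smul_apply, smul_eq_mul]
    refine (hden.mul ?_).sub (IsQP.matMul hU hA i j)
    by_cases h : i = j
    · simpa [Matrix.one_apply, h] using IsQP.one
    · simpa [Matrix.one_apply, h] using IsQP.zero
  have hfm : ∀ a ∈ K, ∀ᶠ y in 𝓝 a, y ∈ V → den y ≠ 0 ∧
      den y • conormal ρ y = U y * A y := by
    intro a ha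
    filter_upwards [hform a (hreg a ha), hρ.conormal_transpose ha, hρ.conormal_of_normalAt ha,
      hρ.normalAt_conormal ha] with y h1 h2 h3 h4 hy
    exact h1 hy _ (h2 hy) (fun n hn => (h3 hy n).1 hn) (h4 hy)
  let R : Fin m ⊕ κ → (κ → ℝ) → (κ → ℝ) → ℝ :=
    Sum.elim (fun j y _ => MvPolynomial.aeval y (p j)) (fun i y x => (τ y *ᵥ (y - x)) i)
  have hRV : ∀ y x, (∀ j, R j y x = 0) → y ∈ V := fun y x h =>
    (hp y).2 fun i => h (Sum.inl i)
  refine ⟨m, R, ρ, ⟨?_, hρ.self, hρ.smooth, ?_, ?_, L, fun y x h => hL y (hRV y x h)⟩, hRV⟩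
  · rintro (j | i)
    · exact ⟨_, fun _ _ => 0, IsQP.aeval (p j), fun _ => IsQP.zero, fun y x => by simp [R]⟩
    · refine ⟨fun y => ∑ k, τ y i k * y k, fun k y => -τ y i k,
        IsQP.sum fun k _ => (hτ i k).mul (IsQP.proj k), fun k => (hτ i k).neg, fun y x => ?_⟩
      simp only [R, Sum.elim_inr, mulVec, dotProduct, Pi.sub_apply, ← Finset.sum_add_distrib]
      exact Finset.sum_congr rfl fun k _ => by ring
  · intro a ha
    have hc : ContinuousAt (fun w : (κ → ℝ) × (κ → ℝ) => w.1) (a, a) := continuousAt_fst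
    filter_upwards [hρ.rel a ha, hc.eventually (hfm a ha),
      hc.eventually (hρ.conormal_of_normalAt ha)] with w h1 h2 h3
    rw [← h1]
    have h4 : (∀ j, R j w.1 w.2 = 0) ↔ w.1 ∈ V ∧ τ w.1 *ᵥ (w.1 - w.2) = 0 := by
      rw [Sum.forall, hp, _root_.funext_iff]
      rfl
    rw [h4]
    refine and_congr_right fun hw => ?_
    obtain ⟨h5, h6⟩ := h2 hw
    rw [h3 hw]
    simp only [τ]
    rw [← h6, ← smul_sub, smul_mulVec, smul_eq_zero, or_iff_right h5, sub_mulVec, one_mulVec,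
      sub_eq_zero, ← neg_sub w.1 w.2, mulVec_neg, neg_inj, eq_comm]
  · intro a ha h hh
    obtain ⟨h5, h6⟩ := (hfm a ha).self_of_nhds (hKV ha)
    have h7 : A a *ᵥ h = 0 := by
      ext j
      have := hh (Sum.inl j)
      have e : (fun y => R (Sum.inl j) y a) = fun y => MvPolynomial.aeval y (p j) := rfl
      rw [e, (hasStrictFDerivAt_aeval (p j) a).hasFDerivAt.fderiv, dotL_apply] at this
      exact this
    have h8 : τ a *ᵥ h = 0 := by
      ext i
      have := hh (Sum.inr i)
      have e : (fun y => R (Sum.inr i) y a) = fun y => ∑ k, τ y i k * (y k - a k) := rfl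
      have hd : HasFDerivAt (fun y : κ → ℝ => ∑ k, τ y i k * (y k - a k))
          (∑ k, τ a i k • ContinuousLinearMap.proj (R := ℝ) (φ := fun _ : κ => ℝ) k) a := by
        refine HasFDerivAt.fun_sum fun k _ => ?_
        have h1 : HasFDerivAt (fun y => τ y i k) (fderiv ℝ (fun y => τ y i k) a) a :=
          ((hτ i k).contDiff (n := 1)).differentiable one_ne_zero a |>.hasFDerivAt
        have h2 : HasFDerivAt (fun y : κ → ℝ => y k - a k)
            (ContinuousLinearMap.proj (R := ℝ) (φ := fun _ : κ => ℝ) k) a :=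
          (hasFDerivAt_apply k a).sub_const _
        exact (h1.mul h2).congr_fderiv (by simp)
      rw [e, hd.fderiv] at this
      simpa [mulVec, dotProduct] using this
    simp only [τ] at h8
    rw [sub_mulVec, ← mulVec_mulVec, h7, mulVec_zero, sub_zero, smul_mulVec, one_mulVec] at h8
    exact (smul_eq_zero.1 h8).resolve_left h5

end Target

section ProjectionTarget

open Filter Topology Matrix

theorem fderiv_eq_of_quadratic {E F : Type*} [NormedAddCommGroup E] [NormedSpace ℝ E]
    [NormedAddCommGroup F] [NormedSpace ℝ F] {f : E → F} {x v : E} {L M : F}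
    (hf : DifferentiableAt ℝ f x) (h : ∀ t : ℝ, f (x + t • v) = f x + t • L + t ^ 2 • M) :
    fderiv ℝ f x v = L := by
  have h1 : HasLineDerivAt ℝ f (fderiv ℝ f x v) x v := hf.hasFDerivAt.hasLineDerivAt v
  refine HasDerivAt.unique h1 ?_
  have h2 : HasDerivAt (fun t : ℝ => f x + t • L + t ^ 2 • M) ((1 : ℝ) • L + (2 * 0 : ℝ) • M) 0 := by
    have e1 : HasDerivAt (fun t : ℝ => t • L) ((1 : ℝ) • L) 0 := (hasDerivAt_id (0 : ℝ)).smul_const L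
    have e2 : HasDerivAt (fun t : ℝ => t ^ 2 • M) ((2 * 0 : ℝ) • M) 0 := by
      have := (hasDerivAt_pow 2 (0 : ℝ)).smul_const M
      simpa using this
    exact (e1.const_add (f x)).add e2
  simp only [mul_zero, zero_smul, add_zero, one_smul] at h2
  exact h2.congr_of_eventuallyEq (Eventually.of_forall h)

variable {ι : Type*} [Fintype ι] [DecidableEq ι]

/-- A point of `ℝ^(ι × ι)` as a matrix. -/
def toMat (y : ι × ι → ℝ) : Matrix ι ι ℝ := Matrix.of fun i j => y (i, j)

/-- A matrix as a point of `ℝ^(ι × ι)`. -/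
def ofMat (A : Matrix ι ι ℝ) : ι × ι → ℝ := fun ij => A ij.1 ij.2

@[simp] theorem toMat_ofMat (A : Matrix ι ι ℝ) : toMat (ofMat A) = A := rfl

@[simp] theorem ofMat_toMat (y : ι × ι → ℝ) : ofMat (toMat y) = y := rfl

@[simp] theorem toMat_add (y z : ι × ι → ℝ) : toMat (y + z) = toMat y + toMat z := rfl

@[simp] theorem toMat_sub (y z : ι × ι → ℝ) : toMat (y - z) = toMat y - toMat z := rfl

@[simp] theorem toMat_smul (t : ℝ) (y : ι × ι → ℝ) : toMat (t • y) = t • toMat y := rfl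

@[simp] theorem toMat_zero : toMat (0 : ι × ι → ℝ) = 0 := rfl

@[simp] theorem ofMat_add (y z : Matrix ι ι ℝ) : ofMat (y + z) = ofMat y + ofMat z := rfl

@[simp] theorem ofMat_sub (y z : Matrix ι ι ℝ) : ofMat (y - z) = ofMat y - ofMat z := rfl

@[simp] theorem ofMat_smul (t : ℝ) (y : Matrix ι ι ℝ) : ofMat (t • y) = t • ofMat y := rfl

@[simp] theorem ofMat_zero : ofMat (0 : Matrix ι ι ℝ) = 0 := rfl

theorem ofMat_eq_zero {A : Matrix ι ι ℝ} : ofMat A = 0 ↔ A = 0 :=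
  ⟨fun h => by rw [← toMat_ofMat A, h, toMat_zero], fun h => by rw [h, ofMat_zero]⟩

theorem continuous_toMat : Continuous (toMat (ι := ι)) :=
  continuous_matrix fun i j => continuous_apply (i, j)

theorem continuous_ofMat : Continuous (ofMat (ι := ι)) :=
  continuous_pi fun ij => continuous_id.matrix_elem ij.1 ij.2

theorem contDiff_ofMat_mul {E : Type*} [NormedAddCommGroup E] [NormedSpace ℝ E]
    {f g : E → ι × ι → ℝ} {n : WithTop ℕ∞} (hf : ContDiff ℝ n f) (hg : ContDiff ℝ n g) :
    ContDiff ℝ n fun x => ofMat (toMat (f x) * toMat (g x)) := by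
  refine contDiff_pi.2 fun ij => ?_
  simp only [ofMat, toMat, Matrix.mul_apply, Matrix.of_apply]
  exact ContDiff.sum fun k _ => (contDiff_pi.1 hf _).mul (contDiff_pi.1 hg _)

/-- Near an idempotent `P₀`, a matrix `P` with `P² - P = [S, P]`, where `S` is close to `2 P₀`, is
idempotent. -/
theorem eventually_idempotent {P₀ : Matrix ι ι ℝ} (h0 : P₀ * P₀ = P₀) :
    ∀ᶠ w : (ι × ι → ℝ) × (ι × ι → ℝ) in 𝓝 (ofMat P₀, ofMat ((2 : ℝ) • P₀)),
      toMat w.1 * toMat w.1 - toMat w.1 + (toMat w.1 * toMat w.2 - toMat w.2 * toMat w.1) = 0 →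
        toMat w.1 * toMat w.1 = toMat w.1 := by
  let f : (ι × ι → ℝ) × ((ι × ι → ℝ) × (ι × ι → ℝ)) → ι × ι → ℝ := fun w =>
    ofMat ((2 : ℝ) • (toMat w.2.1 * toMat w.1)) - w.1 -
      (ofMat (toMat (w.2.2 - (2 : ℝ) • w.2.1) * toMat w.1) -
        ofMat (toMat w.1 * toMat (w.2.2 - (2 : ℝ) • w.2.1)))
  have hfs : ContDiff ℝ (⊤ : ℕ∞) f := by
    have e1 : ContDiff ℝ (⊤ : ℕ∞) fun w : (ι × ι → ℝ) × ((ι × ι → ℝ) × (ι × ι → ℝ)) => w.1 :=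
      contDiff_fst
    have e2 : ContDiff ℝ (⊤ : ℕ∞) fun w : (ι × ι → ℝ) × ((ι × ι → ℝ) × (ι × ι → ℝ)) => w.2.1 :=
      contDiff_fst.comp contDiff_snd
    have e3 : ContDiff ℝ (⊤ : ℕ∞) fun w : (ι × ι → ℝ) × ((ι × ι → ℝ) × (ι × ι → ℝ)) => w.2.2 :=
      contDiff_snd.comp contDiff_snd
    have e4 := e3.sub (contDiff_const (c := (2 : ℝ)) |>.smul e2)
    exact (((contDiff_const (c := (2 : ℝ))).smul (contDiff_ofMat_mul e2 e1)).sub e1).sub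
      ((contDiff_ofMat_mul e4 e1).sub (contDiff_ofMat_mul e1 e4))
  let b : (ι × ι → ℝ) × (ι × ι → ℝ) := (ofMat P₀, ofMat ((2 : ℝ) • P₀))
  have hz : ∀ p, f (0, p) = 0 := fun p => by simp [f]
  obtain ⟨ψ, -, hψ, hu⟩ := SmoothNear.exists_solution (f := f) (a := 0) (b := b)
    (hfs.smoothNear _) (hz b) (fun h hh => by
      have h1 : fderiv ℝ f (0, b) (h, 0) = f (h, b) := by
        refine fderiv_eq_of_quadratic (M := 0) (hfs.differentiable infty_ne_zero' _) fun t => ?_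
        have : ((0, b) : (ι × ι → ℝ) × _) + t • (h, 0) = (t • h, b) := by simp
        rw [this, hz]
        simp [f, smul_sub, smul_smul, mul_comm]
      rw [h1] at hh
      have h2 : (2 : ℝ) • (P₀ * toMat h) - toMat h = 0 := by
        have := congrArg toMat hh
        have e : ofMat ((2 : ℝ) • P₀) - (2 : ℝ) • ofMat P₀ = 0 := by simp
        simp only [f, b, e] at this
        simpa using this
      have h3 : P₀ * toMat h = 0 := by
        have h4 := congrArg (P₀ * ·) h2
        simp only [mul_sub, Matrix.mul_smul, ← Matrix.mul_assoc, h0, mul_zero] at h4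
        rwa [two_smul, add_sub_cancel_right] at h4
      rw [h3] at h2
      rw [← ofMat_toMat h, ofMat_eq_zero]
      simpa using h2) rfl
  have hzero : ∀ᶠ p in 𝓝 b, ψ p = 0 := by
    have ht : Tendsto (fun p : (ι × ι → ℝ) × (ι × ι → ℝ) => ((0 : ι × ι → ℝ), p)) (𝓝 b)
        (𝓝 (0, b)) := (continuous_const.prodMk continuous_id).continuousAt
    filter_upwards [ht.eventually hu] with p hp
    exact (hp.1 (hz p)).symm
  have ht : Tendsto (fun p : (ι × ι → ℝ) × (ι × ι → ℝ) =>
      (ofMat (toMat p.1 * toMat p.1 - toMat p.1), p)) (𝓝 b) (𝓝 (0, b)) := by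
    have hc : Continuous fun p : (ι × ι → ℝ) × (ι × ι → ℝ) =>
        (ofMat (toMat p.1 * toMat p.1 - toMat p.1), p) := by
      have := continuous_toMat.comp (continuous_fst (X := ι × ι → ℝ) (Y := ι × ι → ℝ))
      exact (continuous_ofMat.comp ((this.mul this).sub this)).prodMk continuous_id
    have h1 := hc.tendsto b
    simpa [b, h0] using h1
  filter_upwards [ht.eventually hu, hzero] with p h1 h2 hp
  rw [h2] at h1
  rw [← sub_eq_zero, ← ofMat_eq_zero]
  refine h1.1 ?_
  simp only [f, toMat_ofMat]
  generalize hP : toMat p.1 = P at *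
  have hS : toMat (p.2 - (2 : ℝ) • p.1) = toMat p.2 - (2 : ℝ) • P := by rw [← hP]; rfl
  rw [hS]
  generalize toMat p.2 = S at *
  have h3 : P * P = P - (P * S - S * P) := by
    rw [← sub_eq_zero]; rw [← hp]; noncomm_ring
  have : (2 : ℝ) • (P * (P * P - P)) - (P * P - P) -
      ((S - (2 : ℝ) • P) * (P * P - P) - (P * P - P) * (S - (2 : ℝ) • P)) = 0 := by
    simp only [two_smul]
    have h5 : P * P - P = S * P - P * S := by rw [h3]; noncomm_ring
    have h6 : (P + P) * (P * P - P) - (P * P - P) = S * (P * P - P) - (P * P - P) * S := by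
      calc (P + P) * (P * P - P) - (P * P - P)
          = P * (P * P - P) + (P * P - P) * P - (P * P - P) := by noncomm_ring
        _ = P * (S * P - P * S) + (S * P - P * S) * P - (S * P - P * S) := by rw [h5]
        _ = S * (P * P - P) - (P * P - P) * S := by noncomm_ring
    calc _ = ((P + P) * (P * P - P) - (P * P - P)) - (S * (P * P - P) - (P * P - P) * S) := by
          noncomm_ring
      _ = 0 := by rw [h6, sub_self]
  rw [← ofMat_eq_zero] at this
  exact this

/-- The equations `P² = P`, `P = Pᵀ`, `[P, B + Bᵀ] = 0` for a projection `P` near a matrix `B`. -/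
def projEq : (ι × ι) × Fin 3 → (ι × ι → ℝ) → (ι × ι → ℝ) → ℝ := fun j y x =>
  ![toMat y * toMat y - toMat y, toMat y - (toMat y)ᵀ,
    toMat y * (toMat x + (toMat x)ᵀ) - (toMat x + (toMat x)ᵀ) * toMat y] j.2 j.1.1 j.1.2

theorem projEq_eq_zero {y x : ι × ι → ℝ} : (∀ j, projEq j y x = 0) ↔
    toMat y * toMat y = toMat y ∧ (toMat y)ᵀ = toMat y ∧
      toMat y * (toMat x + (toMat x)ᵀ) = (toMat x + (toMat x)ᵀ) * toMat y := by
  rw [← sub_eq_zero (a := toMat y * toMat y), eq_comm (a := (toMat y)ᵀ),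
    ← sub_eq_zero (a := toMat y) (b := (toMat y)ᵀ),
    ← sub_eq_zero (a := toMat y * (toMat x + (toMat x)ᵀ))]
  constructor
  · intro h
    refine ⟨?_, ?_, ?_⟩ <;> ext i j
    · exact h ((i, j), 0)
    · exact h ((i, j), 1)
    · exact h ((i, j), 2)
  · rintro ⟨h1, h2, h3⟩ ⟨⟨i, j⟩, l⟩
    fin_cases l
    · exact congrFun (congrFun h1 i) j
    · exact congrFun (congrFun h2 i) j
    · exact congrFun (congrFun h3 i) j

theorem exists_local_projection {P₀ : Matrix ι ι ℝ} (h0 : P₀ * P₀ = P₀) (hs : P₀ᵀ = P₀) :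
    ∃ ψ : (ι × ι → ℝ) → ι × ι → ℝ, ψ (ofMat P₀) = ofMat P₀ ∧ SmoothNear ψ (ofMat P₀) ∧
      ∀ᶠ w in 𝓝 (ofMat P₀, ofMat P₀), (∀ j, projEq j w.1 w.2 = 0) ↔ w.1 = ψ w.2 := by
  let S : (ι × ι → ℝ) → ι × ι → ℝ := fun x => ofMat (toMat x + (toMat x)ᵀ)
  let f : (ι × ι → ℝ) × (ι × ι → ℝ) → ι × ι → ℝ := fun w =>
    ofMat (toMat w.1 * toMat w.1) - w.1 +
      (ofMat (toMat w.1 * toMat (S w.2)) - ofMat (toMat (S w.2) * toMat w.1))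
  have hS : ContDiff ℝ (⊤ : ℕ∞) S := by
    refine contDiff_pi.2 fun ij => ?_
    exact (contDiff_apply _ _ _).add (contDiff_apply _ _ _)
  have hfs : ContDiff ℝ (⊤ : ℕ∞) f := by
    have e1 : ContDiff ℝ (⊤ : ℕ∞) fun w : (ι × ι → ℝ) × (ι × ι → ℝ) => w.1 := contDiff_fst
    have e2 : ContDiff ℝ (⊤ : ℕ∞) fun w : (ι × ι → ℝ) × (ι × ι → ℝ) => S w.2 :=
      hS.comp contDiff_snd
    exact ((contDiff_ofMat_mul e1 e1).sub e1).add
      ((contDiff_ofMat_mul e1 e2).sub (contDiff_ofMat_mul e2 e1))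
  have hS0 : S (ofMat P₀) = ofMat ((2 : ℝ) • P₀) := by simp [S, hs, two_smul]
  have hf0 : f (ofMat P₀, ofMat P₀) = 0 := by simp [f, hS0, h0]
  obtain ⟨ψ, hψ0, hψ, hu⟩ := SmoothNear.exists_solution (f := f) (a := ofMat P₀) (b := ofMat P₀)
    (hfs.smoothNear _) hf0 (fun h hh => by
      have h1 : fderiv ℝ f (ofMat P₀, ofMat P₀) (h, 0) =
          ofMat (P₀ * toMat h + toMat h * P₀ - toMat h +
            (toMat h * ((2 : ℝ) • P₀) - ((2 : ℝ) • P₀) * toMat h)) := by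
        refine fderiv_eq_of_quadratic (M := ofMat (toMat h * toMat h))
          (hfs.differentiable infty_ne_zero' _) fun t => ?_
        have : ((ofMat P₀, ofMat P₀) : (ι × ι → ℝ) × (ι × ι → ℝ)) + t • (h, 0) =
            (ofMat P₀ + t • h, ofMat P₀) := by simp
        rw [this, hf0, zero_add]
        simp only [f, hS0, toMat_ofMat, toMat_add, toMat_smul]
        rw [← ofMat_toMat (ofMat P₀ + t • h)]
        simp only [toMat_add, toMat_smul, toMat_ofMat]
        rw [← ofMat_smul, ← ofMat_smul, ← ofMat_sub, ← ofMat_sub, ← ofMat_add, ← ofMat_add]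
        congr 1
        simp only [add_mul, mul_add, Matrix.smul_mul, Matrix.mul_smul, h0, smul_add, smul_sub,
          sq, smul_smul, mul_comm t]
        module
      rw [h1, ofMat_eq_zero] at hh
      have hX := ofMat_toMat h
      generalize toMat h = X at *
      have e1 : X = (3 : ℝ) • (X * P₀) - P₀ * X := by
        rw [← sub_eq_zero, ← neg_eq_zero, ← hh, Matrix.mul_smul, Matrix.smul_mul]; module
      have e2 : P₀ * X * P₀ = 0 := by
        have := congrArg (fun A => P₀ * A * P₀) e1
        simp only [mul_sub, sub_mul, Matrix.mul_smul, Matrix.smul_mul, Matrix.mul_assoc, h0] at this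
        rw [← Matrix.mul_assoc P₀ P₀, h0] at this
        have h4 : P₀ * (X * P₀) = 0 := by
          have h5 : (1 : ℝ) • (P₀ * (X * P₀)) = (2 : ℝ) • (P₀ * (X * P₀)) := by
            rw [one_smul]; nth_rewrite 1 [this]; module
          have h6 : (1 : ℝ) • (P₀ * (X * P₀)) = 0 := by
            calc _ = (2 : ℝ) • (P₀ * (X * P₀)) - (1 : ℝ) • (P₀ * (X * P₀)) := by module
              _ = 0 := by rw [h5, sub_self]
          rwa [one_smul] at h6
        rw [Matrix.mul_assoc, h4]
      have e3 : P₀ * X = 0 := by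
        have := congrArg (fun A => P₀ * A) e1
        simp only [mul_sub, Matrix.mul_smul, ← Matrix.mul_assoc, h0, e2, smul_zero, zero_sub] at this
        have h6 := add_eq_zero_iff_eq_neg.2 this
        rw [← two_smul ℝ] at h6
        simpa using h6
      have e4 : X * P₀ = 0 := by
        have := congrArg (fun A => A * P₀) e1
        simp only [sub_mul, Matrix.smul_mul, Matrix.mul_assoc, h0] at this
        rw [← Matrix.mul_assoc, e2, sub_zero] at this
        have h6 : (2 : ℝ) • (X * P₀) = 0 := by
          calc _ = (3 : ℝ) • (X * P₀) - X * P₀ := by module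
            _ = 0 := by rw [← this, sub_self]
        simpa using h6
      rw [e3, e4, smul_zero, sub_zero] at e1
      rw [← hX, e1, ofMat_zero]) rfl
  refine ⟨ψ, hψ0, hψ, ?_⟩
  have hfz : ∀ P B : ι × ι → ℝ, f (P, B) = 0 ↔ toMat P * toMat P - toMat P +
      (toMat P * toMat (S B) - toMat (S B) * toMat P) = 0 := by
    intro P B
    rw [← ofMat_eq_zero]
    exact Iff.rfl
  have ht1 : Tendsto (fun w : (ι × ι → ℝ) × (ι × ι → ℝ) => (w.1, S w.2))
      (𝓝 (ofMat P₀, ofMat P₀)) (𝓝 (ofMat P₀, ofMat ((2 : ℝ) • P₀))) := by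
    rw [← hS0]
    exact (continuous_fst.prodMk (hS.continuous.comp continuous_snd)).tendsto
      (ofMat P₀, ofMat P₀)
  have ht2 : Tendsto (fun w : (ι × ι → ℝ) × (ι × ι → ℝ) => (ofMat (toMat w.1)ᵀ, w.2))
      (𝓝 (ofMat P₀, ofMat P₀)) (𝓝 (ofMat P₀, ofMat P₀)) := by
    have h2 : Continuous fun w : (ι × ι → ℝ) × (ι × ι → ℝ) => (ofMat (toMat w.1)ᵀ, w.2) :=
      (continuous_ofMat.comp (continuous_toMat.comp continuous_fst).matrix_transpose).prodMk
        continuous_snd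
    have := h2.tendsto (ofMat P₀, ofMat P₀)
    simpa [hs] using this
  filter_upwards [hu, ht2.eventually hu, ht1.eventually (eventually_idempotent h0)] with w h1 h2 h3
  rw [projEq_eq_zero, ← h1]
  rw [hfz]
  constructor
  · rintro ⟨g1, -, g3⟩
    change _ + (toMat w.1 * (toMat w.2 + (toMat w.2)ᵀ) - (toMat w.2 + (toMat w.2)ᵀ) * toMat w.1) = 0
    rw [g1, g3, sub_self, sub_self, add_zero]
  · intro g
    have g1 := h3 g
    have g3 : toMat w.1 * (toMat w.2 + (toMat w.2)ᵀ) = (toMat w.2 + (toMat w.2)ᵀ) * toMat w.1 := by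
      rw [g1, sub_self, zero_add, sub_eq_zero] at g
      exact g
    refine ⟨g1, ?_, g3⟩
    have g4 : f (ofMat (toMat w.1)ᵀ, w.2) = 0 := by
      rw [hfz]
      have k1 := congrArg Matrix.transpose g1
      have k3 := congrArg Matrix.transpose g3
      simp only [Matrix.transpose_mul, Matrix.transpose_add, Matrix.transpose_transpose] at k1 k3
      change (toMat w.1)ᵀ * (toMat w.1)ᵀ - (toMat w.1)ᵀ + ((toMat w.1)ᵀ *
        (toMat w.2 + (toMat w.2)ᵀ) - (toMat w.2 + (toMat w.2)ᵀ) * (toMat w.1)ᵀ) = 0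
      rw [k1, add_comm (toMat w.2), ← k3, sub_self, sub_self, add_zero]
    have g5 := h2.1 g4
    have g6 := h1.1 ((hfz _ _).2 g)
    have := g5.trans g6.symm
    exact congrArg toMat this

theorem exists_isTarget_projEq {K : Set (ι × ι → ℝ)} (hK : IsCompact K)
    (hKP : ∀ y ∈ K, toMat y * toMat y = toMat y ∧ (toMat y)ᵀ = toMat y) :
    ∃ ρ, IsTarget (projEq (ι := ι)) K ρ := by
  obtain ⟨ρ, hρ⟩ := exists_glued_solution (r := fun y x => ∀ j, projEq (ι := ι) j y x = 0) hK
    fun a ha => exists_local_projection (P₀ := toMat a) (hKP a ha).1 (hKP a ha).2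
  have hq : ∀ j : (ι × ι) × Fin 3, ∃ (α : (ι × ι → ℝ) → ℝ) (β : ι × ι → (ι × ι → ℝ) → ℝ),
      IsQP α ∧ (∀ i, IsQP (β i)) ∧ ∀ y x, projEq j y x = α y + ∑ i, β i y * x i := by
    rintro ⟨⟨i, j⟩, l⟩
    fin_cases l
    · refine ⟨fun y => (toMat y * toMat y - toMat y) i j, fun _ _ => 0, ?_, fun _ => IsQP.zero,
        fun y x => by simp [projEq]⟩
      exact (IsQP.matMul (fun a b => IsQP.proj (a, b)) (fun a b => IsQP.proj (a, b)) i j).sub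
        (IsQP.proj (i, j))
    · exact ⟨fun y => y (i, j) - y (j, i), fun _ _ => 0, (IsQP.proj _).sub (IsQP.proj _),
        fun _ => IsQP.zero, fun y x => by simp [projEq, toMat]⟩
    · refine ⟨fun _ => 0, fun ab y => (if ab.2 = j then y (i, ab.1) else 0) +
        (if ab.1 = j then y (i, ab.2) else 0) - ((if ab.1 = i then y (ab.2, j) else 0) +
        (if ab.2 = i then y (ab.1, j) else 0)), IsQP.zero, fun ab => ?_, fun y x => ?_⟩
      · have h : ∀ (p : Prop) [Decidable p] (a : ι × ι),
            IsQP fun y : ι × ι → ℝ => if p then y a else 0 := by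
          intro p _ a
          by_cases hp : p
          · simpa [hp] using IsQP.proj a
          · simpa [hp] using IsQP.zero
        exact ((h _ _).add (h _ _)).sub ((h _ _).add (h _ _))
      · simp [projEq, toMat, Matrix.mul_apply, Fintype.sum_prod_type, sub_mul, add_mul, mul_add,
          Finset.sum_add_distrib, Finset.sum_sub_distrib, ite_mul]
        simp only [mul_comm]
  refine ⟨ρ, hq, ?_, ?_, ?_, ?_, ?_⟩
  · intro a ha
    obtain ⟨ψ, h1, h2, -, -⟩ := hρ a ha
    rw [h1.self_of_nhds, h2]
  · intro a ha
    obtain ⟨ψ, h1, -, h2, -⟩ := hρ a ha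
    exact h2.congr h1
  · intro a ha
    obtain ⟨ψ, h1, -, -, h2⟩ := hρ a ha
    have hc : ContinuousAt (fun w : (ι × ι → ℝ) × (ι × ι → ℝ) => w.2) (a, a) := continuousAt_snd
    filter_upwards [h2, hc.eventually h1] with w h3 h4
    rw [h3, h4]
  · intro a ha h hh
    obtain ⟨h1, h2⟩ := hKP a ha
    have key : ∀ (j : (ι × ι) × Fin 3) (L M : ℝ),
        (∀ t : ℝ, projEq j (a + t • h) a = projEq j a a + t • L + t ^ 2 • M) → L = 0 := by
      intro j L M hj
      rw [← hh j]
      refine (fderiv_eq_of_quadratic (M := M) ?_ hj).symm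
      obtain ⟨α, β, hα, hβ, e⟩ := hq j
      simp only [e]
      exact (((hα.contDiff (n := 1)).add (ContDiff.sum fun i _ =>
        ((hβ i).contDiff (n := 1)).mul contDiff_const)).differentiable one_ne_zero) a
    have k1 : toMat a * toMat h + toMat h * toMat a - toMat h = 0 := by
      ext i j
      refine key ((i, j), 0) _ ((toMat h * toMat h) i j) fun t => ?_
      have : toMat (a + t • h) * toMat (a + t • h) - toMat (a + t • h) =
          (toMat a * toMat a - toMat a) + t • (toMat a * toMat h + toMat h * toMat a - toMat h) +
            t ^ 2 • (toMat h * toMat h) := by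
        simp only [toMat_add, toMat_smul, mul_add, add_mul, Matrix.smul_mul, Matrix.mul_smul]
        module
      exact congrFun (congrFun this i) j
    have k2 : toMat h * toMat a = toMat a * toMat h := by
      rw [← sub_eq_zero]
      have : (2 : ℝ) • (toMat h * toMat a - toMat a * toMat h) = 0 := by
        ext i j
        refine key ((i, j), 2) _ 0 fun t => ?_
        have : toMat (a + t • h) * (toMat a + (toMat a)ᵀ) -
            (toMat a + (toMat a)ᵀ) * toMat (a + t • h) =
            (toMat a * (toMat a + (toMat a)ᵀ) - (toMat a + (toMat a)ᵀ) * toMat a) +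
            t • ((2 : ℝ) • (toMat h * toMat a - toMat a * toMat h)) + t ^ 2 • (0 : Matrix ι ι ℝ) := by
          simp only [toMat_add, toMat_smul, mul_add, add_mul, Matrix.smul_mul, Matrix.mul_smul, h2]
          module
        exact congrFun (congrFun this i) j
      simpa using this
    have k3 : toMat a * toMat h = 0 := by
      have := congrArg (fun A => toMat a * A) k1
      simp only [mul_sub, mul_add, ← Matrix.mul_assoc, h1, mul_zero, add_sub_cancel_left] at this
      rwa [Matrix.mul_assoc, k2, ← Matrix.mul_assoc, h1] at this
    rw [k2, k3, add_zero, zero_sub, neg_eq_zero] at k1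
    rw [← ofMat_toMat h, k1, ofMat_zero]
  · refine ⟨fun ij => if ij.1 = ij.2 then 1 else 0, fun y x h => ?_⟩
    obtain ⟨h1, h2, -⟩ := projEq_eq_zero.1 h
    rw [Fintype.sum_prod_type, Fintype.sum_prod_type]
    refine Finset.sum_congr rfl fun i _ => ?_
    have h3 := congrFun (congrFun h1 i) i
    rw [Matrix.mul_apply] at h3
    have h5 : ∑ j, ((if i = j then 1 else 0 : ℚ) : ℝ) * y (i, j) = y (i, i) := by
      rw [Finset.sum_eq_single i (fun b _ hb => by simp [hb.symm]) (by simp)]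
      simp
    rw [h5]
    refine Eq.trans (Finset.sum_congr rfl fun j _ => ?_) h3
    have h4 := congrFun (congrFun h2 i) j
    change y (j, i) = y (i, j) at h4
    change y (i, j) ^ 2 = y (i, j) * y (j, i)
    rw [h4, sq]

end ProjectionTarget

section ProductTarget

open Filter Topology Matrix

variable {κ κ' J J' : Type*} [Fintype κ] [Fintype κ'] [DecidableEq κ] [DecidableEq κ']

theorem IsTarget.fderiv_comp_right {τ : Type*} [Fintype τ] {R : (κ → ℝ) → (κ → ℝ) → ℝ} {σ : κ → τ}
    {a v : τ → ℝ} (h : ∃ (α : (κ → ℝ) → ℝ) (β : κ → (κ → ℝ) → ℝ), IsQP α ∧ (∀ i, IsQP (β i)) ∧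
      ∀ y x, R y x = α y + ∑ i, β i y * x i) :
    fderiv ℝ (fun y : τ → ℝ => R (y ∘ σ) (a ∘ σ)) a v =
      fderiv ℝ (fun y => R y (a ∘ σ)) (a ∘ σ) (v ∘ σ) := by
  obtain ⟨α, β, hα, hβ, e⟩ := h
  have hd : DifferentiableAt ℝ (fun y => R y (a ∘ σ)) (a ∘ σ) := by
    simp only [e]
    exact (((hα.contDiff (n := 1)).add (ContDiff.sum fun i _ =>
      ((hβ i).contDiff (n := 1)).mul contDiff_const)).differentiable one_ne_zero) _
  let T : (τ → ℝ) →L[ℝ] (κ → ℝ) :=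
    ContinuousLinearMap.pi fun i => ContinuousLinearMap.proj (σ i)
  have := hd.hasFDerivAt.comp (f := fun y : τ → ℝ => y ∘ σ) a T.hasFDerivAt
  exact congrArg (fun L => L v) this.fderiv

theorem IsTarget.sum {R : J → (κ → ℝ) → (κ → ℝ) → ℝ} {R' : J' → (κ' → ℝ) → (κ' → ℝ) → ℝ}
    {K : Set (κ → ℝ)} {K' : Set (κ' → ℝ)} {ρ : (κ → ℝ) → κ → ℝ} {ρ' : (κ' → ℝ) → κ' → ℝ}
    (h : IsTarget R K ρ) (h' : IsTarget R' K' ρ') {K'' : Set (κ ⊕ κ' → ℝ)}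
    (hK : ∀ a ∈ K'', a ∘ Sum.inl ∈ K) (hK' : ∀ a ∈ K'', a ∘ Sum.inr ∈ K') :
    IsTarget (J := J ⊕ J') (κ := κ ⊕ κ') (fun j y x => Sum.elim
      (fun j => R j (y ∘ Sum.inl) (x ∘ Sum.inl)) (fun j => R' j (y ∘ Sum.inr) (x ∘ Sum.inr)) j) K''
      (fun x => Sum.elim (ρ (x ∘ Sum.inl)) (ρ' (x ∘ Sum.inr))) := by
  have cl : Continuous fun x : κ ⊕ κ' → ℝ => x ∘ Sum.inl :=
    continuous_pi fun i => continuous_apply _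
  have cr : Continuous fun x : κ ⊕ κ' → ℝ => x ∘ Sum.inr :=
    continuous_pi fun i => continuous_apply _
  have dl : ContDiff ℝ (⊤ : ℕ∞) fun x : κ ⊕ κ' → ℝ => x ∘ Sum.inl :=
    contDiff_pi.2 fun i => contDiff_apply _ _ _
  have dr : ContDiff ℝ (⊤ : ℕ∞) fun x : κ ⊕ κ' → ℝ => x ∘ Sum.inr :=
    contDiff_pi.2 fun i => contDiff_apply _ _ _
  refine ⟨?_, ?_, ?_, ?_, ?_, ?_⟩
  · rintro (j | j)
    · obtain ⟨α, β, hα, hβ, e⟩ := h.affine j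
      refine ⟨fun y => α (y ∘ Sum.inl), fun i y => Sum.elim (fun i => β i (y ∘ Sum.inl)) 0 i,
        hα.comp fun i => IsQP.proj _, ?_, fun y x => by simp [e]⟩
      rintro (i | i)
      · exact (hβ i).comp fun i => IsQP.proj _
      · exact IsQP.zero
    · obtain ⟨α, β, hα, hβ, e⟩ := h'.affine j
      refine ⟨fun y => α (y ∘ Sum.inr), fun i y => Sum.elim 0 (fun i => β i (y ∘ Sum.inr)) i,
        hα.comp fun i => IsQP.proj _, ?_, fun y x => by simp [e]⟩
      rintro (i | i)
      · exact IsQP.zero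
      · exact (hβ i).comp fun i => IsQP.proj _
  · intro a ha
    rw [h.self _ (hK a ha), h'.self _ (hK' a ha)]
    exact Sum.elim_comp_inl_inr a
  · intro a ha
    have h1 := cl.continuousAt.eventually (h.smooth _ (hK a ha))
    have h2 := cr.continuousAt.eventually (h'.smooth _ (hK' a ha))
    filter_upwards [h1, h2] with x hx hx'
    refine contDiffAt_pi.2 ?_
    rintro (i | i)
    · exact contDiffAt_pi.1 (ContDiffAt.comp (g := ρ) x hx dl.contDiffAt) i
    · exact contDiffAt_pi.1 (ContDiffAt.comp (g := ρ') x hx' dr.contDiffAt) i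
  · intro a ha
    have t1 : Tendsto (fun w : (κ ⊕ κ' → ℝ) × (κ ⊕ κ' → ℝ) => (w.1 ∘ Sum.inl, w.2 ∘ Sum.inl))
        (𝓝 (a, a)) (𝓝 (a ∘ Sum.inl, a ∘ Sum.inl)) :=
      ((cl.comp continuous_fst).prodMk (cl.comp continuous_snd)).tendsto (a, a)
    have t2 : Tendsto (fun w : (κ ⊕ κ' → ℝ) × (κ ⊕ κ' → ℝ) => (w.1 ∘ Sum.inr, w.2 ∘ Sum.inr))
        (𝓝 (a, a)) (𝓝 (a ∘ Sum.inr, a ∘ Sum.inr)) :=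
      ((cr.comp continuous_fst).prodMk (cr.comp continuous_snd)).tendsto (a, a)
    filter_upwards [t1.eventually (h.rel _ (hK a ha)), t2.eventually (h'.rel _ (hK' a ha))]
      with w h1 h2
    rw [Sum.forall]
    simp only [Sum.elim_inl, Sum.elim_inr]
    rw [h1, h2]
    constructor
    · rintro ⟨e1, e2⟩
      rw [← e1, ← e2]
      exact (Sum.elim_comp_inl_inr w.1).symm
    · intro e
      rw [e]
      exact ⟨rfl, rfl⟩
  · intro a ha v hv
    have h1 := h.inj _ (hK a ha) (v ∘ Sum.inl) fun j => by
      rw [← fderiv_comp_right (σ := Sum.inl) (h.affine j)]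
      exact hv (Sum.inl j)
    have h2 := h'.inj _ (hK' a ha) (v ∘ Sum.inr) fun j => by
      rw [← fderiv_comp_right (σ := Sum.inr) (h'.affine j)]
      exact hv (Sum.inr j)
    ext (i | i)
    · exact congrFun h1 i
    · exact congrFun h2 i
  · obtain ⟨L, hL⟩ := h.quad
    obtain ⟨L', hL'⟩ := h'.quad
    refine ⟨Sum.elim L L', fun y x hy => ?_⟩
    rw [Fintype.sum_sum_type, Fintype.sum_sum_type]
    have := hL _ _ fun j => hy (Sum.inl j)
    have h2 := hL' _ _ fun j => hy (Sum.inr j)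
    simp only [Function.comp_apply] at this h2
    rw [this, h2]
    rfl

end ProductTarget

section InverseStereographic

open Filter Topology Matrix

variable {κ : Type*} [Fintype κ] [DecidableEq κ]

theorem isQAlgebraicSet_of_isQP {J : Type*} [Fintype J] {f : J → (κ → ℝ) → ℝ}
    (hf : ∀ j, IsQP (f j)) : IsQAlgebraicSet {x | ∀ j, f j x = 0} := by
  classical
  choose p hp using hf
  refine ⟨Finset.univ.image p, ?_⟩
  ext x
  simp [hp]

theorem exists_homogenization (r : MvPolynomial κ ℚ) :
    ∃ (k : ℕ) (g : (Option κ → ℝ) → ℝ), IsQP g ∧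
      ∀ y, y none ≠ 0 → g y = y none ^ k * aeval (fun i => y (some i) / y none) r := by
  induction r using MvPolynomial.induction_on with
  | C a => exact ⟨0, fun _ => algebraMap ℚ ℝ a, IsQP.rat a, fun y _ => by simp⟩
  | add p q hp hq =>
    obtain ⟨k, g, hg, h⟩ := hp
    obtain ⟨k', g', hg', h'⟩ := hq
    refine ⟨k + k', fun y => y none ^ k' * g y + y none ^ k * g' y,
      (((IsQP.proj none).pow k').mul hg).add (((IsQP.proj none).pow k).mul hg'), fun y hy => ?_⟩
    show y none ^ k' * g y + y none ^ k * g' y = _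
    rw [h y hy, h' y hy, map_add]
    ring
  | mul_X p i hp =>
    obtain ⟨k, g, hg, h⟩ := hp
    refine ⟨k + 1, fun y => g y * y (some i), hg.mul (IsQP.proj _), fun y hy => ?_⟩
    show g y * y (some i) = _
    rw [h y hy, map_mul, aeval_X]
    field_simp
    ring

/-- The inverse stereographic embedding of `ℝ^κ` into the sphere `|v|² + u² = u`. -/
noncomputable def stereo (w : κ → ℝ) : Option κ → ℝ := fun o => o.elim 1 w / (1 + ∑ i, w i ^ 2)

theorem stereo_den_pos (w : κ → ℝ) : 0 < 1 + ∑ i, w i ^ 2 := by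
  have : 0 ≤ ∑ i, w i ^ 2 := Finset.sum_nonneg fun i _ => sq_nonneg _
  linarith

theorem stereo_none_pos (w : κ → ℝ) : 0 < stereo w none := by
  have := stereo_den_pos w
  simp only [stereo, Option.elim_none]
  positivity

theorem stereo_div (w : κ → ℝ) : (fun i => stereo w (some i) / stereo w none) = w := by
  funext i
  have := (stereo_den_pos w).ne'
  simp only [stereo, Option.elim_none, Option.elim_some]
  field_simp

theorem contDiff_stereo {n : WithTop ℕ∞} : ContDiff ℝ n (stereo (κ := κ)) := by
  refine contDiff_pi.2 fun o => ?_
  refine ContDiff.div ?_ (contDiff_const.add (ContDiff.sum fun i _ => (contDiff_apply _ _ i).pow 2))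
    fun w => (stereo_den_pos w).ne'
  cases o with
  | none => exact contDiff_const
  | some i => exact contDiff_apply _ _ i

theorem stereo_sq_sum (w : κ → ℝ) : ∑ o, stereo w o ^ 2 = stereo w none := by
  have := (stereo_den_pos w).ne'
  simp only [Fintype.sum_option, stereo, Option.elim_none, Option.elim_some, div_pow,
    ← Finset.sum_div]
  field_simp

theorem isQP_sphere : IsQP fun y : Option κ → ℝ => ∑ o, y o ^ 2 - y none :=
  (IsQP.sum fun o _ => (IsQP.proj o).pow 2).sub (IsQP.proj none)

theorem isQRegAt_stereo {c k : ℕ} {W : Set (κ → ℝ)} {g : Fin k → (Option κ → ℝ) → ℝ}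
    (hg : ∀ y, y none ≠ 0 → ((∀ j, g j y = 0) ↔ (fun i => y (some i) / y none) ∈ W))
    {w : κ → ℝ} (hw : IsQRegAt c W w) (hwW : w ∈ W) :
    IsQRegAt (c + 1) {y | ∑ o, y o ^ 2 - y none = 0 ∧ ∀ j, g j y = 0} (stereo w) := by
  obtain ⟨q, hq, hli, U, hU, hwU, hUq⟩ := hw
  choose N G hG hGe using fun j => exists_homogenization (q j)
  obtain ⟨sp, hsp⟩ := isQP_sphere (κ := κ)
  choose Q hQ using fun j => (IsQP.proj (none : Option κ)).mul (hG j)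
  have hQ0 : ∀ j (y : Option κ → ℝ), y none ≠ 0 →
      aeval y (Q j) = y none ^ (N j + 1) * aeval (fun i => y (some i) / y none) (q j) := by
    intro j y hy
    rw [← hQ]
    show y none * G j y = _
    rw [hGe j y hy]
    ring
  have hu0 := stereo_none_pos w
  have hline : ∀ (p : MvPolynomial (Option κ) ℚ) (v : Option κ → ℝ),
      HasDerivAt (fun t : ℝ => aeval (stereo w + t • v) p) (polyGradQ p (stereo w) ⬝ᵥ v) 0 := by
    intro p v
    have := (hasStrictFDerivAt_aeval p (stereo w)).hasFDerivAt.hasLineDerivAt v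
    simpa [HasLineDerivAt] using this
  have hsphere : polyGradQ sp (stereo w) ⬝ᵥ stereo w = stereo w none := by
    refine (hline sp (stereo w)).unique ?_
    have h1 : HasDerivAt (fun t : ℝ => (1 + t) ^ 2 * stereo w none - (1 + t) * stereo w none)
        (stereo w none) 0 := by
      have h2 : HasDerivAt (fun t : ℝ => 1 + t) 1 0 := (hasDerivAt_id (0 : ℝ)).const_add 1
      have h3 := ((h2.pow 2).mul_const (stereo w none)).sub (h2.mul_const (stereo w none))
      refine h3.congr_deriv ?_
      norm_num
      ring
    refine h1.congr_of_eventuallyEq (Eventually.of_forall fun t => ?_)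
    show aeval _ sp = _
    rw [← hsp]
    have h4 := stereo_sq_sum w
    have h5 : ∀ o, (stereo w + t • stereo w) o = (1 + t) * stereo w o := fun o => by
      simp only [Pi.add_apply, Pi.smul_apply, smul_eq_mul]; ring
    simp only [h5, mul_pow, ← Finset.mul_sum, h4]
  have hrad : ∀ j, polyGradQ (Q j) (stereo w) ⬝ᵥ stereo w = 0 := by
    intro j
    refine (hline (Q j) (stereo w)).unique ?_
    refine (hasDerivAt_const (0 : ℝ) (0 : ℝ)).congr_of_eventuallyEq ?_
    have hc : ContinuousAt (fun t : ℝ => 1 + t) 0 := (continuous_const.add continuous_id).continuousAt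
    filter_upwards [hc.eventually_ne (y := 0) (by norm_num)] with t ht
    have h5 : ∀ o, (stereo w + t • stereo w) o = (1 + t) * stereo w o := fun o => by
      simp only [Pi.add_apply, Pi.smul_apply, smul_eq_mul]; ring
    rw [hQ0 j _ (by rw [h5]; exact mul_ne_zero ht hu0.ne')]
    have h6 : (fun i => (stereo w + t • stereo w) (some i) / (stereo w + t • stereo w) none) = w := by
      simp only [h5, mul_div_mul_left _ _ ht]
      exact stereo_div w
    rw [h6, hq j w hwW, mul_zero]
  have htan : ∀ j (v : κ → ℝ), polyGradQ (Q j) (stereo w) ⬝ᵥ (fun o => o.elim 0 v) =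
      stereo w none ^ N j * (polyGradQ (q j) w ⬝ᵥ v) := by
    intro j v
    refine (hline (Q j) _).unique ?_
    have h1 : HasDerivAt (fun t : ℝ => aeval (w + t • ((stereo w none)⁻¹ • v)) (q j))
        (polyGradQ (q j) w ⬝ᵥ ((stereo w none)⁻¹ • v)) 0 := by
      have := (hasStrictFDerivAt_aeval (q j) w).hasFDerivAt.hasLineDerivAt ((stereo w none)⁻¹ • v)
      simpa [HasLineDerivAt] using this
    have h2 := h1.const_mul (stereo w none ^ (N j + 1))
    have h3 : stereo w none ^ (N j + 1) * (polyGradQ (q j) w ⬝ᵥ ((stereo w none)⁻¹ • v)) =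
        stereo w none ^ N j * (polyGradQ (q j) w ⬝ᵥ v) := by
      rw [dotProduct_smul, smul_eq_mul]
      field_simp [hu0.ne']
      ring
    rw [h3] at h2
    refine h2.congr_of_eventuallyEq (Eventually.of_forall fun t => ?_)
    have h5 : (stereo w + t • fun o : Option κ => o.elim 0 v) none = stereo w none := by simp
    show aeval _ (Q j) = _
    rw [hQ0 j _ (by rw [h5]; exact hu0.ne'), h5]
    congr 3
    have h6 := congrFun (stereo_div w)
    funext i
    rw [Pi.add_apply w, ← h6 i]
    simp only [Pi.add_apply, Pi.smul_apply, Option.elim_some, smul_eq_mul]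
    ring
  refine ⟨Fin.cons sp Q, ?_, ?_, {y | y none ≠ 0 ∧ (fun i => y (some i) / y none) ∈ U}, ?_,
    ?_, ?_⟩
  · intro j x hx
    refine Fin.cases ?_ (fun j => ?_) j
    · rw [Fin.cons_zero, ← hsp]
      exact hx.1
    · rw [Fin.cons_succ]
      by_cases h0 : x none = 0
      · rw [← hQ]
        show x none * G j x = 0
        rw [h0, zero_mul]
      · rw [hQ0 j x h0, hq j _ ((hg x h0).1 hx.2), mul_zero]
  · rw [Fintype.linearIndependent_iff] at hli ⊢
    intro b hb
    rw [Fin.sum_univ_succ] at hb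
    simp only [Fin.cons_zero, Fin.cons_succ] at hb
    have h0 : b 0 = 0 := by
      have := congrArg (fun n => n ⬝ᵥ stereo w) hb
      simp only [add_dotProduct, sum_dotProduct, smul_dotProduct, hsphere, hrad, mul_zero,
        Finset.sum_const_zero, add_zero, zero_dotProduct, smul_eq_mul] at this
      exact (mul_eq_zero.1 this).resolve_right hu0.ne'
    rw [h0, zero_smul, zero_add] at hb
    have h1 := hli (fun j => b j.succ * stereo w none ^ N j) (by
      refine dotProduct_eq _ _ fun v => ?_
      have := congrArg (fun n => n ⬝ᵥ (fun o : Option κ => o.elim 0 v)) hb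
      simp only [sum_dotProduct, smul_dotProduct, htan, zero_dotProduct, smul_eq_mul] at this
      rw [zero_dotProduct, sum_dotProduct, ← this]
      exact Finset.sum_congr rfl fun j _ => by rw [smul_dotProduct, smul_eq_mul, mul_assoc])
    refine Fin.cases h0 fun j => ?_
    exact (mul_eq_zero.1 (h1 j)).resolve_right (pow_ne_zero _ hu0.ne')
  · have ho : IsOpen {y : Option κ → ℝ | y none ≠ 0} :=
      isOpen_ne_fun (continuous_apply none) continuous_const
    refine ContinuousOn.isOpen_inter_preimage (f := fun y : Option κ → ℝ => fun i =>
      y (some i) / y none) ?_ ho hU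
    exact continuousOn_pi.2 fun i => (continuous_apply (some i)).continuousOn.div
      (continuous_apply none).continuousOn fun y hy => hy
  · exact ⟨hu0.ne', by rw [stereo_div]; exact hwU⟩
  · ext y
    simp only [Set.mem_inter_iff, Set.mem_ofPred_eq, Fin.forall_fin_succ, Fin.cons_zero,
      Fin.cons_succ, ← hsp]
    rw [and_comm, and_congr_right_iff]
    rintro ⟨h0, hyU⟩
    rw [and_congr_right_iff]
    intro _
    rw [hg y h0]
    have h1 := Set.ext_iff.1 hUq fun i => y (some i) / y none
    simp only [Set.mem_inter_iff, hyU, and_true] at h1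
    rw [h1]
    simp only [hQ0 _ y h0, Set.mem_ofPred_eq, hyU, true_and, mul_eq_zero, pow_eq_zero_iff',
      h0, false_and, false_or]

theorem exists_isTarget_stereo {e : ℕ} {W K : Set (κ → ℝ)} (hW : IsQNonsingular e W)
    (hK : IsCompact K) (hKW : K ⊆ W) :
    ∃ (m : ℕ) (R : Fin m ⊕ Option κ → (Option κ → ℝ) → (Option κ → ℝ) → ℝ)
      (ρ : (Option κ → ℝ) → Option κ → ℝ), IsTarget R (stereo '' K) ρ ∧
      ∀ y x, (∀ j, R j y x = 0) → y none ≠ 0 → (fun i => y (some i) / y none) ∈ W := by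
  obtain ⟨S, hS⟩ := hW.1
  choose N g hg hge using fun r => exists_homogenization (κ := κ) r
  let gg : Fin S.card → (Option κ → ℝ) → ℝ := fun j => g (S.equivFin.symm j)
  have hgg : ∀ y, y none ≠ 0 → ((∀ j, gg j y = 0) ↔ (fun i => y (some i) / y none) ∈ W) := by
    intro y hy
    rw [hS]
    have : (∀ j, gg j y = 0) ↔ ∀ r : S, g r y = 0 :=
      (S.equivFin.symm.forall_congr_left (p := fun j => gg j y = 0)).trans (by simp [gg])
    rw [this]
    simp only [hge _ y hy, mul_eq_zero, pow_eq_zero_iff', hy, false_and, false_or]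
    simp
  have hV : IsQAlgebraicSet {y : Option κ → ℝ | ∑ o, y o ^ 2 - y none = 0 ∧ ∀ j, gg j y = 0} := by
    have := isQAlgebraicSet_of_isQP (J := Option (Fin S.card)) (f := fun j => j.elim
      (fun y : Option κ → ℝ => ∑ o, y o ^ 2 - y none) gg) (by
        rintro (_ | j)
        · exact isQP_sphere
        · exact hg _)
    simpa only [Option.forall, Option.elim_none, Option.elim_some] using this
  have hd := @contDiff_stereo κ _ _ 0
  obtain ⟨m, R, ρ, hR, hRV⟩ := exists_isTarget_of_isQRegAt (c := Fintype.card κ - e + 1) hV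
    (hK.image hd.continuous) (by
      rintro _ ⟨w, hw, rfl⟩
      refine ⟨by rw [stereo_sq_sum, sub_self], (hgg _ (stereo_none_pos w).ne').2 ?_⟩
      rw [stereo_div]
      exact hKW hw) (by
      rintro _ ⟨w, hw, rfl⟩
      exact isQRegAt_stereo hgg (hW.2.2 w (hKW hw)) (hKW hw)) (L := fun o => o.elim 1 0) (by
      rintro y ⟨hy, -⟩
      rw [sub_eq_zero] at hy
      rw [hy]
      simp [Fintype.sum_option])
  exact ⟨m, R, ρ, hR, fun y x h h0 => (hgg y h0).1 (hRV y x h).2⟩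

end InverseStereographic

section Regularity

open Filter Topology Matrix

variable {ι : Type*} [Fintype ι] [DecidableEq ι]

theorem exists_injOn_nhds {E F : Type*} [NormedAddCommGroup E] [NormedSpace ℝ E]
    [FiniteDimensional ℝ E] [NormedAddCommGroup F] [NormedSpace ℝ F] [FiniteDimensional ℝ F]
    {f : E → F} {T : E →L[ℝ] F} {a : E} (hf : HasStrictFDerivAt f T a)
    (hT : Function.Injective T) : ∃ U ∈ 𝓝 a, Set.InjOn f U := by
  obtain ⟨g, hg⟩ := LinearMap.exists_leftInverse_of_injective (T : E →ₗ[ℝ] F)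
    (LinearMap.ker_eq_bot.2 hT)
  have hcomp : HasStrictFDerivAt (fun x => LinearMap.toContinuousLinearMap g (f x))
      ((ContinuousLinearEquiv.refl ℝ E : E ≃L[ℝ] E) : E →L[ℝ] E) a := by
    have h1 := (LinearMap.toContinuousLinearMap g).hasStrictFDerivAt.comp a hf
    refine h1.congr_fderiv ?_
    ext v
    exact LinearMap.congr_fun hg v
  have : CompleteSpace E := FiniteDimensional.complete ℝ E
  refine ⟨_, hcomp.eventually_left_inverse, fun x hx y hy hxy => ?_⟩
  replace hx : hcomp.localInverse _ _ _ (LinearMap.toContinuousLinearMap g (f x)) = x := hx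
  replace hy : hcomp.localInverse _ _ _ (LinearMap.toContinuousLinearMap g (f y)) = y := hy
  rw [← hx, ← hy, hxy]

theorem IsSmoothSubmanifold.isLocallyCut {d : ℕ} {V : Set (ι → ℝ)} (hV : IsSmoothSubmanifold d V)
    {a : ι → ℝ} (ha : a ∈ V) : IsLocallyCut (Fintype.card ι - d) V a := by
  obtain ⟨U, f, hU, haU, hf, hs, hVU⟩ := hV a ha
  refine ⟨f, ?_, ?_, ?_⟩
  · filter_upwards [hU.mem_nhds haU] with x hx
    exact hf.contDiffAt (hU.mem_nhds hx)
  · filter_upwards [hU.mem_nhds haU] with x hx using hs x hx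
  · filter_upwards [hU.mem_nhds haU] with x hx
    have := Set.ext_iff.1 hVU x
    simpa [hx] using this

theorem isQNonsingular_of_isQRegAt {d : ℕ} {V : Set (ι → ℝ)} (hV : IsQAlgebraicSet V)
    (h : ∀ a ∈ V, IsQRegAt (Fintype.card ι - d) V a) : IsQNonsingular d V := by
  refine ⟨hV, fun a ha => ?_, h⟩
  obtain ⟨q, -, h2, h3⟩ := (h a ha).exists_eventually
  obtain ⟨U, hU, hUo, haU⟩ := eventually_nhds_iff.1 (h2.and h3)
  refine ⟨U, fun x j => aeval x (q j), hUo, haU, ?_, fun x hx => ?_, ?_⟩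
  · exact (contDiff_pi.2 fun j => (IsQP.aeval (q j)).contDiff).contDiffOn
  · rw [(hasStrictFDerivAt_aeval_pi q x).hasFDerivAt.fderiv]
    exact surjective_of_linearIndependent (hU x hx).1
  · ext x
    constructor
    · rintro ⟨h4, h5⟩
      exact ⟨h5, (hU x h5).2.1 h4⟩
    · rintro ⟨h5, h4⟩
      exact ⟨(hU x h5).2.2 h4, h5⟩

/-- A set with a local retraction `Ret`, such that the gradients of the rational polynomials
vanishing on it cut out at most the fixed space of the differential of `Ret`, is regular over
`ℚ`. -/
theorem isQRegAt_of_retraction {A : Set (ι → ℝ)} {a : ι → ℝ} (ha : a ∈ A)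
    {Ret : (ι → ℝ) → ι → ℝ} {T : (ι → ℝ) →L[ℝ] ι → ℝ} (hT : HasStrictFDerivAt Ret T a)
    (hmem : ∀ᶠ x in 𝓝 a, Ret x ∈ A) (hself : ∀ᶠ x in 𝓝 a, x ∈ A → Ret x = x)
    (hker : ∀ v, (∀ p : MvPolynomial ι ℚ, (∀ x ∈ A, aeval x p = 0) → polyGradQ p a ⬝ᵥ v = 0) →
      T v = v) :
    IsQRegAt (Fintype.card ι - Module.finrank ℝ (LinearMap.range (T : (ι → ℝ) →ₗ[ℝ] ι → ℝ)))
      A a := by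
  have hRa : Ret a = a := hself.self_of_nhds ha
  have hrange : ∀ v, ∀ p : MvPolynomial ι ℚ, (∀ x ∈ A, aeval x p = 0) →
      polyGradQ p a ⬝ᵥ T v = 0 := by
    intro v p hp
    have h1 := (hasStrictFDerivAt_aeval p (Ret a)).hasFDerivAt.comp a hT.hasFDerivAt
    have h2 : HasFDerivAt (fun _ : ι → ℝ => (0 : ℝ)) (0 : (ι → ℝ) →L[ℝ] ℝ) a :=
      hasFDerivAt_const 0 a
    have h3 := (h2.congr_of_eventuallyEq (hmem.mono fun x hx => hp _ hx)).unique h1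
    have h4 := congrArg (fun L => L v) h3
    rw [hRa] at h4
    simpa using h4.symm
  let G : Set (ι → ℝ) := {g | ∃ p : MvPolynomial ι ℚ, (∀ x ∈ A, aeval x p = 0) ∧ polyGradQ p a = g}
  obtain ⟨B, hBG, hBspan, hBli⟩ := Submodule.exists_fun_fin_finrank_span_eq ℝ G
  generalize Module.finrank ℝ (Submodule.span ℝ G) = c at B hBG hBspan hBli
  choose q hq hqB using hBG
  have hqB' : (fun j => polyGradQ (q j) a) = B := funext hqB
  have hkerB : ∀ v, (∀ j, B j ⬝ᵥ v = 0) → T v = v := by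
    intro v hv
    refine hker v fun p hp => ?_
    have h1 : polyGradQ p a ∈ Submodule.span ℝ (Set.range B) := by
      rw [hBspan]; exact Submodule.subset_span ⟨p, hp, rfl⟩
    refine Submodule.span_induction (p := fun g _ => g ⬝ᵥ v = 0) ?_ (zero_dotProduct _) ?_ ?_ h1
    · rintro _ ⟨j, rfl⟩; exact hv j
    · intro x y _ _ hx hy; rw [add_dotProduct, hx, hy, add_zero]
    · intro r x _ hx; rw [smul_dotProduct, hx, smul_zero]
  let D : (ι → ℝ) →L[ℝ] Fin c → ℝ := ContinuousLinearMap.pi fun j => dotL (B j)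
  have hDs : Function.Surjective D := surjective_of_linearIndependent hBli
  have hDker : LinearMap.ker (D : (ι → ℝ) →ₗ[ℝ] Fin c → ℝ) =
      LinearMap.range (T : (ι → ℝ) →ₗ[ℝ] ι → ℝ) := by
    ext v
    rw [LinearMap.mem_ker, LinearMap.mem_range]
    constructor
    · intro hv
      exact ⟨v, hkerB v fun j => by simpa [D] using congrFun hv j⟩
    · rintro ⟨w, rfl⟩
      ext j
      simpa [D, ← hqB j] using hrange w (q j) (hq j)
  have hc : Fintype.card ι - Module.finrank ℝ (LinearMap.range (T : (ι → ℝ) →ₗ[ℝ] ι → ℝ)) = c := by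
    have h1 := LinearMap.finrank_range_add_finrank_ker (D : (ι → ℝ) →ₗ[ℝ] Fin c → ℝ)
    rw [LinearMap.range_eq_top.2 hDs, finrank_top, hDker] at h1
    simp only [Module.finrank_fintype_fun_eq_card, Fintype.card_fin] at h1
    omega
  rw [hc]
  let Ψ : (ι → ℝ) → (Fin c → ℝ) × (ι → ℝ) := fun x => (fun j => aeval x (q j), Ret x)
  have hΨ : HasStrictFDerivAt Ψ (D.prod T) a := by
    have := (hasStrictFDerivAt_aeval_pi q a).prodMk hT
    simp only [hqB] at this
    exact this
  have hinj : Function.Injective (D.prod T) := by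
    refine (injective_iff_map_eq_zero _).2 fun v hv => ?_
    obtain ⟨h1, h2⟩ := Prod.mk.inj hv
    rw [← hkerB v fun j => by simpa [D] using congrFun h1 j]
    exact h2
  obtain ⟨U, hUn, hU⟩ : ∃ U ∈ 𝓝 a, Set.InjOn Ψ U := exists_injOn_nhds hΨ hinj
  have hRU : ∀ᶠ x in 𝓝 a, Ret x ∈ U := by
    have h1 : Tendsto Ret (𝓝 a) (𝓝 a) := by
      have := hT.continuousAt.tendsto
      rwa [hRa] at this
    exact h1 hUn
  have hself' : ∀ᶠ x in 𝓝 a, Ret x ∈ A → Ret (Ret x) = Ret x := by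
    have h1 : Tendsto Ret (𝓝 a) (𝓝 a) := by
      have := hT.continuousAt.tendsto
      rwa [hRa] at this
    exact h1.eventually hself
  have hev : ∀ᶠ x in 𝓝 a, x ∈ A ↔ ∀ j, aeval x (q j) = 0 := by
    filter_upwards [hUn, hRU, hself', hmem] with x h1 h2 h3 h4
    refine ⟨fun hx j => hq j x hx, fun hx => ?_⟩
    have : x = Ret x := hU h1 h2 (Prod.ext (funext fun j => by
      show aeval x (q j) = aeval (Ret x) (q j)
      rw [hx j, hq j _ h4]) (h3 h4).symm)
    rw [this]
    exact h4
  obtain ⟨V, hV, hVo, haV⟩ := eventually_nhds_iff.1 hev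
  refine ⟨q, hq, by rw [hqB']; exact hBli, V, hVo, haV, ?_⟩
  ext x
  constructor
  · rintro ⟨h4, h5⟩
    exact ⟨h5, (hV x h5).1 h4⟩
  · rintro ⟨h5, h4⟩
    exact ⟨(hV x h5).2 h4, h5⟩

end Regularity

section NewtonOrder

open Filter Topology Asymptotics

variable {E F : Type*} [NormedAddCommGroup E] [NormedSpace ℝ E] [NormedAddCommGroup F]
  [NormedSpace ℝ F]

/-- One Newton step improves the vanishing order of `q`. -/
theorem isBigO_newton_step [CompleteSpace E] {q : E → F} (hq : ContDiff ℝ (⊤ : ℕ∞) q) (hq0 : q 0 = 0)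
    (B : F →L[ℝ] E) (hB : ∀ w, fderiv ℝ q 0 (B w) = w) :
    (fun y => q (y - B (q y))) =O[𝓝 0] fun y => ‖y‖ * ‖q y‖ := by
  set A := fderiv ℝ q 0 with hA
  have hg : ContDiff ℝ (⊤ : ℕ∞) fun y => q y - A y := hq.sub A.contDiff
  have hgd : ∀ y, HasFDerivAt (fun y => q y - A y) (fderiv ℝ q y - A) y := fun y =>
    ((hq.differentiable infty_ne_zero') y).hasFDerivAt.sub A.hasFDerivAt
  have hdq : ContDiff ℝ 1 (fderiv ℝ q) := hq.fderiv_right (m := 1) (by norm_num; exact WithTop.coe_le_coe.2 (le_top : (2 : ℕ∞) ≤ ⊤))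
  obtain ⟨K, t, ht, hK⟩ := (hdq.contDiffAt (x := (0 : E))).exists_lipschitzOnWith
  obtain ⟨K', t', ht', hK'⟩ :=
    ((hq.of_le one_le_infty').contDiffAt (x := (0 : E))).exists_lipschitzOnWith
  obtain ⟨r, hr, hrt⟩ := Metric.mem_nhds_iff.1 ht
  have hcont : Continuous fun y => y - B (q y) :=
    continuous_id.sub (B.continuous.comp hq.continuous)
  have hF : Tendsto (fun y => y - B (q y)) (𝓝 0) (𝓝 0) := by
    have := hcont.tendsto 0
    simpa [hq0] using this
  refine IsBigO.of_bound (K * (1 + ‖B‖ * K') * ‖B‖) ?_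
  filter_upwards [ht', Metric.ball_mem_nhds 0 hr, hF (Metric.ball_mem_nhds 0 hr)]
    with y hy1 hy2 hy3
  have h0 : (0 : E) ∈ t' := mem_of_mem_nhds ht'
  have hqy : ‖q y‖ ≤ K' * ‖y‖ := by
    have := hK'.norm_sub_le hy1 h0
    simpa [hq0] using this
  have hBq : ‖B (q y)‖ ≤ ‖B‖ * ‖q y‖ := B.le_opNorm _
  set z := y - B (q y) with hz
  have hz3 : ‖z‖ < r := by simpa using hy3
  have hy2' : ‖y‖ < r := by simpa using hy2
  have hzn : ‖z‖ ≤ (1 + ‖B‖ * K') * ‖y‖ := by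
    calc ‖z‖ ≤ ‖y‖ + ‖B (q y)‖ := norm_sub_le _ _
      _ ≤ ‖y‖ + ‖B‖ * (K' * ‖y‖) := by gcongr; exact hBq.trans (by gcongr)
      _ = _ := by ring
  have hyn : ‖y‖ ≤ (1 + ‖B‖ * K') * ‖y‖ := by
    have : 0 ≤ ‖B‖ * K' * ‖y‖ := by positivity
    linarith
  have hdom := (convex_closedBall (0 : E) (max ‖y‖ ‖z‖)).norm_image_sub_le_of_norm_hasFDerivWithin_le
    (f := fun y => q y - A y) (f' := fun x => fderiv ℝ q x - A) (C := K * max ‖y‖ ‖z‖)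
    (fun x _ => (hgd x).hasFDerivWithinAt) (fun x hx => by
      have hx' : ‖x‖ ≤ max ‖y‖ ‖z‖ := by simpa using hx
      have hxt : x ∈ t := hrt (by simpa using hx'.trans_lt (max_lt hy2' hz3))
      have := hK.norm_sub_le hxt (mem_of_mem_nhds ht)
      rw [sub_zero] at this
      exact this.trans (by gcongr))
    (x := y) (y := z) (by simp) (by simp)
  have hkey : q z = (q z - A z) - (q y - A y) := by
    have : A z = A y - q y := by rw [hz, map_sub, hB]
    rw [this]; abel
  have hzy : ‖z - y‖ ≤ ‖B‖ * ‖q y‖ := by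
    rw [hz, sub_sub_cancel_left, norm_neg]; exact hBq
  rw [hkey]
  calc _ ≤ K * max ‖y‖ ‖z‖ * ‖z - y‖ := hdom
    _ ≤ K * ((1 + ‖B‖ * K') * ‖y‖) * (‖B‖ * ‖q y‖) := by gcongr; exact max_le hyn hzn
    _ = K * (1 + ‖B‖ * K') * ‖B‖ * (‖y‖ * ‖q y‖) := by ring
    _ = _ := by rw [Real.norm_of_nonneg (by positivity)]

/-- A smooth function vanishing on the regular zero set of `q` is dominated by `q`. -/
theorem isBigO_of_vanishing [FiniteDimensional ℝ E] {q : E → F} (hq : ContDiff ℝ (⊤ : ℕ∞) q)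
    (hq0 : q 0 = 0) (B : F →L[ℝ] E) (hB : ∀ w, fderiv ℝ q 0 (B w) = w) {j : E → ℝ}
    (hj : ContDiff ℝ (⊤ : ℕ∞) j) (hjq : ∀ᶠ y in 𝓝 0, q y = 0 → j y = 0) : j =O[𝓝 0] q := by
  set A := fderiv ℝ q 0 with hA
  set f : E → E := fun y => B (q y) + (y - B (A y)) with hf
  have hfc : ContDiff ℝ (⊤ : ℕ∞) f :=
    (B.contDiff.comp hq).add (contDiff_id.sub (B.contDiff.comp A.contDiff))
  have hf0 : f 0 = 0 := by simp [hf, hq0]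
  have hfd : HasFDerivAt f (ContinuousLinearMap.id ℝ E) 0 := by
    have h1 := (B.hasFDerivAt.comp (0 : E) ((hq.differentiable infty_ne_zero') 0).hasFDerivAt).add
      ((hasFDerivAt_id (0 : E)).sub (B.hasFDerivAt.comp (0 : E) A.hasFDerivAt))
    have h2 : HasFDerivAt f _ 0 := h1
    refine h2.congr_fderiv ?_
    ext v; simp [← hA]
  have : CompleteSpace E := FiniteDimensional.complete ℝ E
  obtain ⟨g, hg1, hg2, hg3⟩ := (hfc.smoothNear 0).exists_localInverse
    (by rw [hfd.fderiv]; exact fun _ _ h => h) rfl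
  rw [hf0] at hg1 hg3
  have hg0 : g 0 = 0 := by simpa [hf0] using hg2.self_of_nhds
  have hgt : Tendsto g (𝓝 0) (𝓝 0) := by
    have := hg1.self_of_nhds.continuousAt
    rwa [ContinuousAt, hg0] at this
  have hp : Tendsto (fun w => w - B (A w)) (𝓝 (0 : E)) (𝓝 0) := by
    have : Continuous fun w => w - B (A w) := by fun_prop
    simpa using this.tendsto 0
  have hvan : ∀ᶠ w in 𝓝 (0 : E), j (g (w - B (A w))) = 0 := by
    filter_upwards [hp (hg3 : _), (hgt.comp hp).eventually hjq] with w h1 h2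
    refine h2 ?_
    have h1 : f (g (w - B (A w))) = w - B (A w) := h1
    have h3 := congrArg A h1
    simpa [hf, hB] using h3
  have hjg : ContDiffAt ℝ 1 (fun w => j (g w)) 0 :=
    ((hj.contDiffAt).comp (0 : E) hg1.self_of_nhds).of_le one_le_infty'
  obtain ⟨K, t, ht, hK⟩ := hjg.exists_lipschitzOnWith
  have hft : Tendsto f (𝓝 0) (𝓝 0) := by simpa [hf0] using hfc.continuous.tendsto 0
  refine IsBigO.of_bound (K * ‖B‖) ?_
  filter_upwards [hg2, hft ht, (hp.comp hft) ht, hft hvan] with y h1 h2 h3 h4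
  have h5 := hK.norm_sub_le h2 h3
  have h4 : j (g (f y - B (A (f y)))) = 0 := h4
  have h6 : f y - B (A (f y)) = y - B (A y) := by simp [hf, hB]
  simp only [Function.comp_apply] at h5
  rw [h1, h4, sub_zero, sub_sub_cancel] at h5
  have h7 : A (f y) = q y := by simp [hf, hB]
  rw [h7] at h5
  calc ‖j y‖ ≤ K * ‖B (q y)‖ := h5
    _ ≤ K * (‖B‖ * ‖q y‖) := by gcongr; exact B.le_opNorm _
    _ = _ := by ring

theorem isBigO_norm_of_contDiff {f : E → F} (hf : ContDiff ℝ (⊤ : ℕ∞) f)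
    (hf0 : f 0 = 0) : f =O[𝓝 0] fun y => ‖y‖ := by
  have := ((hf.differentiable infty_ne_zero') 0).isBigO_sub
  simpa [hf0] using this.norm_right

theorem ContDiff.iterate_self {f : E → E} (hf : ContDiff ℝ (⊤ : ℕ∞) f) (n : ℕ) :
    ContDiff ℝ (⊤ : ℕ∞) (f^[n]) := by
  induction n with
  | zero => exact contDiff_id
  | succ n ih => rw [Function.iterate_succ]; exact ih.comp hf

theorem isBigO_newton_iterate [FiniteDimensional ℝ E] {q : E → F} (hq : ContDiff ℝ (⊤ : ℕ∞) q)
    (hq0 : q 0 = 0) (B : F →L[ℝ] E) (hB : ∀ w, fderiv ℝ q 0 (B w) = w) {j : E → ℝ}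
    (hj : ContDiff ℝ (⊤ : ℕ∞) j) (hjq : ∀ᶠ y in 𝓝 0, q y = 0 → j y = 0) (N : ℕ) :
    (fun y => j ((fun y => y - B (q y))^[N] y)) =O[𝓝 0] fun y => ‖y‖ ^ (N + 1) := by
  have : CompleteSpace E := FiniteDimensional.complete ℝ E
  set Fm : E → E := fun y => y - B (q y) with hFm
  have hFc : ContDiff ℝ (⊤ : ℕ∞) Fm := contDiff_id.sub (B.contDiff.comp hq)
  have hF0 : Fm 0 = 0 := by simp [hFm, hq0]
  have hFt : ∀ n, Tendsto (Fm^[n]) (𝓝 0) (𝓝 0) := fun n => by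
    have := (hFc.continuous.iterate n).tendsto 0
    rwa [Function.iterate_fixed hF0] at this
  have hFO : ∀ n, (Fm^[n]) =O[𝓝 0] fun y => ‖y‖ := fun n =>
    isBigO_norm_of_contDiff (ContDiff.iterate_self hFc n) (Function.iterate_fixed hF0 n)
  have hqO : ∀ n, (fun y => q (Fm^[n] y)) =O[𝓝 0] fun y => ‖y‖ ^ (n + 1) := by
    intro n
    induction n with
    | zero => simpa using (isBigO_norm_of_contDiff hq hq0)
    | succ n ih =>
      have h1 := (isBigO_newton_step hq hq0 B hB).comp_tendsto (hFt n)
      have h2 : (fun y => q (Fm^[n + 1] y)) = (fun y => q (y - B (q y))) ∘ Fm^[n] := by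
        ext1 y; simp only [Function.iterate_succ_apply']; rfl
      rw [h2]
      refine h1.trans ?_
      have h3 := (hFO n).norm_left.mul ih.norm_left
      refine h3.congr_right fun y => by ring
  exact ((isBigO_of_vanishing hq hq0 B hB hj hjq).comp_tendsto (hFt N)).trans (hqO N)

end NewtonOrder

section VanishingOrder

open Filter Topology Asymptotics

theorem Polynomial.X_pow_dvd_of_isBigO {p : Polynomial ℝ} {n : ℕ}
    (h : (fun t => p.eval t) =O[𝓝 0] fun t : ℝ => t ^ n) : Polynomial.X ^ n ∣ p := by
  have key : ∀ m ≤ n, Polynomial.X ^ m ∣ p := by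
    intro m
    induction m with
    | zero => intro _; simp
    | succ m ih =>
      intro hm
      obtain ⟨r, hr⟩ := ih (by omega)
      have h1 : Tendsto (fun t => r.eval t) (𝓝[≠] 0) (𝓝 0) := by
        have h2 : (fun t => r.eval t) =O[𝓝[≠] 0] fun t : ℝ => t ^ (n - m) := by
          obtain ⟨C, hC⟩ := (h.mono (nhdsWithin_le_nhds (s := {0}ᶜ))).bound
          refine IsBigO.of_bound C ?_
          filter_upwards [hC, self_mem_nhdsWithin] with t ht ht0
          have h0 : (0 : ℝ) < ‖t ^ m‖ := norm_pos_iff.2 (pow_ne_zero _ ht0)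
          rw [hr, Polynomial.eval_mul, Polynomial.eval_pow, Polynomial.eval_X, norm_mul,
            show n = m + (n - m) by omega, pow_add, norm_mul] at ht
          nlinarith
        refine h2.trans_tendsto ?_
        have : Tendsto (fun t : ℝ => t ^ (n - m)) (𝓝 0) (𝓝 (0 ^ (n - m))) :=
          (continuous_pow _).tendsto 0
        rw [zero_pow (by omega)] at this
        exact this.mono_left nhdsWithin_le_nhds
      have h3 : r.eval 0 = 0 :=
        tendsto_nhds_unique ((r.continuous.tendsto 0).mono_left nhdsWithin_le_nhds) h1
      rw [hr, pow_succ]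
      exact mul_dvd_mul_left _ (by rwa [Polynomial.X_dvd_iff, Polynomial.coeff_zero_eq_eval_zero])
  exact key n le_rfl

variable {ι : Type*} [Fintype ι] [DecidableEq ι]

theorem MvPolynomial.contDiff_eval (p : MvPolynomial ι ℝ) :
    ContDiff ℝ (⊤ : ℕ∞) fun x : ι → ℝ => eval x p := by
  induction p using MvPolynomial.induction_on with
  | C a => simpa using contDiff_const
  | add p q hp hq => simpa using hp.add hq
  | mul_X p i hp => simpa using hp.mul (contDiff_apply ℝ ℝ i)

theorem MvPolynomial.IsHomogeneous.eval_smul {p : MvPolynomial ι ℝ} {k : ℕ} (hp : p.IsHomogeneous k)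
    (t : ℝ) (v : ι → ℝ) : eval (t • v) p = t ^ k * eval v p := by
  rw [eval_eq', eval_eq', Finset.mul_sum]
  refine Finset.sum_congr rfl fun m hm => ?_
  have hk : ∑ i, m i = k := by
    have := hp (mem_support_iff.1 hm)
    simpa [Finsupp.weight_apply, Finsupp.sum_fintype] using this
  simp only [Pi.smul_apply, smul_eq_mul, mul_pow, Finset.prod_mul_distrib,
    Finset.prod_pow_eq_pow_sum, hk]
  ring

theorem MvPolynomial.mem_pow_idealOfVars_of_isBigO {p : MvPolynomial ι ℝ} {n : ℕ}
    (h : (fun x : ι → ℝ => eval x p) =O[𝓝 0] fun x => ‖x‖ ^ n) : p ∈ idealOfVars ι ℝ ^ n := by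
  rw [mem_pow_idealOfVars_iff']
  intro x hx
  suffices hk : homogeneousComponent x.degree p = 0 by
    have := congrArg (coeff x) hk
    simpa [coeff_homogeneousComponent] using this
  refine MvPolynomial.funext fun v => ?_
  rw [map_zero]
  set P : Polynomial ℝ := ∑ k ∈ Finset.range (p.totalDegree + 1),
    Polynomial.C (eval v (homogeneousComponent k p)) * Polynomial.X ^ k with hP
  have hPe : ∀ t, P.eval t = eval (t • v) p := by
    intro t
    conv_rhs => rw [← sum_homogeneousComponent p]
    rw [hP, Polynomial.eval_finsetSum, map_sum]
    refine Finset.sum_congr rfl fun k _ => ?_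
    rw [Polynomial.eval_mul, Polynomial.eval_pow, Polynomial.eval_C, Polynomial.eval_X]
    rw [(homogeneousComponent_isHomogeneous k p).eval_smul, mul_comm]
  have hPO : (fun t => P.eval t) =O[𝓝 0] fun t : ℝ => t ^ n := by
    have ht : Tendsto (fun t : ℝ => t • v) (𝓝 0) (𝓝 0) := by
      have : Continuous fun t : ℝ => t • v := by fun_prop
      simpa using this.tendsto 0
    have h1 := h.comp_tendsto ht
    simp only [hPe]
    refine h1.trans (IsBigO.of_bound (‖v‖ ^ n) (Eventually.of_forall fun t => ?_))
    simp [norm_smul, mul_pow, mul_comm]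
  have h1 := Polynomial.X_pow_dvd_iff.1 (Polynomial.X_pow_dvd_of_isBigO hPO) x.degree hx
  by_cases hd : x.degree < p.totalDegree + 1
  · rw [hP, Polynomial.finsetSum_coeff] at h1
    simpa [Polynomial.coeff_C_mul, Polynomial.coeff_X_pow, hd] using h1
  · rw [homogeneousComponent_eq_zero _ _ (by omega), map_zero]

end VanishingOrder

section ComplementOfComponent

open Filter Topology Asymptotics

variable {ι : Type*} [Fintype ι] [DecidableEq ι]

theorem aeval_real_eq_eval (y : ι → ℝ) (p : MvPolynomial ι ℝ) :
    MvPolynomial.aeval y p = eval y p := rfl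

theorem exists_mul_mem_span_of_vanishing {c : ℕ} (Q : Fin c → MvPolynomial ι ℝ)
    (hQ0 : ∀ j, eval 0 (Q j) = 0)
    (hs : Function.Surjective (fderiv ℝ (fun (y : ι → ℝ) j => eval y (Q j)) 0))
    (J : MvPolynomial ι ℝ)
    (hJ : ∀ᶠ y : ι → ℝ in 𝓝 0, (∀ j, eval y (Q j) = 0) → eval y J = 0) :
    ∃ f : MvPolynomial ι ℝ, eval 0 f = 1 ∧ f * J ∈ Ideal.span (Set.range Q) := by
  set q : (ι → ℝ) → Fin c → ℝ := fun y j => eval y (Q j) with hq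
  have hqc : ContDiff ℝ (⊤ : ℕ∞) q := contDiff_pi.2 fun j => contDiff_eval (Q j)
  obtain ⟨B₀, hB₀⟩ := (fderiv ℝ q 0).toLinearMap.exists_rightInverse_of_surjective
    (LinearMap.range_eq_top.2 hs)
  set B : (Fin c → ℝ) →L[ℝ] (ι → ℝ) := LinearMap.toContinuousLinearMap B₀ with hBdef
  have hB : ∀ w, fderiv ℝ q 0 (B w) = w := fun w => LinearMap.congr_fun hB₀ w
  set I := Ideal.span (Set.range Q) with hI
  set Φ : MvPolynomial ι ℝ →ₐ[ℝ] MvPolynomial ι ℝ :=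
    MvPolynomial.aeval fun i => X i - ∑ j, C (B (Pi.single j 1) i) * Q j with hΦ
  have hΦI : ∀ p, Φ p - p ∈ I := by
    intro p
    have : (Ideal.Quotient.mkₐ ℝ I).comp Φ = Ideal.Quotient.mkₐ ℝ I := by
      refine MvPolynomial.algHom_ext fun i => ?_
      rw [AlgHom.comp_apply, hΦ, aeval_X, Ideal.Quotient.mkₐ_eq_mk, Ideal.Quotient.eq]
      rw [sub_sub_cancel_left]
      exact I.neg_mem (I.sum_mem fun j _ => I.mul_mem_left _ (Ideal.subset_span ⟨j, rfl⟩))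
    have := AlgHom.congr_fun this p
    rwa [AlgHom.comp_apply, Ideal.Quotient.mkₐ_eq_mk, Ideal.Quotient.eq] at this
  have hΦe : ∀ (p : MvPolynomial ι ℝ) y, eval y (Φ p) = eval (y - B (q y)) p := by
    intro p y
    have hy : (y - B (q y)) = fun i => eval y (X i - ∑ j, C (B (Pi.single j 1) i) * Q j) := by
      ext i
      have : q y = ∑ j, q y j • Pi.single j (1 : ℝ) := by
        ext j; simp [Finset.sum_apply, Pi.single_apply]
      rw [Pi.sub_apply]
      conv_lhs => rw [this]
      simp [map_sum, mul_comm, hq]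
    have h1 : (MvPolynomial.aeval y : MvPolynomial ι ℝ →ₐ[ℝ] ℝ).comp Φ =
        MvPolynomial.aeval (y - B (q y)) := by
      refine MvPolynomial.algHom_ext fun i => ?_
      rw [AlgHom.comp_apply, hΦ, aeval_X, aeval_X, aeval_real_eq_eval]
      exact (congrFun hy i).symm
    have h2 := AlgHom.congr_fun h1 p
    rw [AlgHom.comp_apply] at h2
    exact h2
  have hit : ∀ N, (Φ^[N] J - J ∈ I) ∧ ∀ y, eval y (Φ^[N] J) = eval ((fun y => y - B (q y))^[N] y) J := by
    intro N
    induction N with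
    | zero => simp
    | succ N ih =>
      rw [Function.iterate_succ_apply']
      refine ⟨?_, fun y => ?_⟩
      · have := I.add_mem (hΦI (Φ^[N] J)) ih.1
        rwa [sub_add_sub_cancel] at this
      · rw [hΦe, ih.2, Function.iterate_succ_apply]
  have hpow : ∀ N, Φ^[N] J ∈ idealOfVars ι ℝ ^ (N + 1) := by
    intro N
    refine mem_pow_idealOfVars_of_isBigO ?_
    simp only [(hit N).2]
    exact isBigO_newton_iterate hqc (_root_.funext hQ0) B hB (contDiff_eval J)
      (hJ.mono fun y hy h => hy fun j => congrFun h j) N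
  have hmem : Ideal.Quotient.mk I J ∈
      (⨅ i : ℕ, idealOfVars ι ℝ ^ i • ⊤ : Submodule (MvPolynomial ι ℝ) (MvPolynomial ι ℝ ⧸ I)) := by
    rw [Submodule.mem_iInf]
    intro N
    have h1 : Ideal.Quotient.mk I J = Φ^[N] J • (1 : MvPolynomial ι ℝ ⧸ I) := by
      have h2 : Ideal.Quotient.mk I (Φ^[N] J) = Ideal.Quotient.mk I J := Ideal.Quotient.eq.2 (hit N).1
      rw [← h2]
      exact congrArg (Ideal.Quotient.mk I) (mul_one (Φ^[N] J)).symm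
    rw [h1]
    exact Submodule.smul_mem_smul (Ideal.pow_le_pow_right (Nat.le_succ N) (hpow N)) trivial
  obtain ⟨r, hr⟩ := (Ideal.mem_iInf_smul_pow_eq_bot_iff _ _).1 hmem
  refine ⟨1 - r, ?_, ?_⟩
  · have hle : idealOfVars ι ℝ ≤ RingHom.ker (eval (0 : ι → ℝ)) := by
      rw [idealOfVars, Ideal.span_le]
      rintro _ ⟨i, rfl⟩
      simp
    have := RingHom.mem_ker.1 (hle r.2)
    rw [map_sub, map_one, this, sub_zero]
  · have hr : Ideal.Quotient.mk I (r * J) = Ideal.Quotient.mk I J := hr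
    rw [Ideal.Quotient.eq] at hr
    have := I.neg_mem hr
    convert this using 1
    ring

/-- Coefficientwise application of a `ℚ`-linear functional. -/
noncomputable def coeffMap (l : ℝ →ₗ[ℚ] ℚ) (p : MvPolynomial ι ℝ) : MvPolynomial ι ℚ :=
  p.support.sum fun m => monomial m (l (coeff m p))

theorem coeff_coeffMap (l : ℝ →ₗ[ℚ] ℚ) (p : MvPolynomial ι ℝ) (m : ι →₀ ℕ) :
    coeff m (coeffMap l p) = l (coeff m p) := by
  rw [coeffMap, coeff_sum]
  simp only [coeff_monomial]
  rw [Finset.sum_ite_eq']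
  split_ifs with h
  · rfl
  · rw [notMem_support_iff.1 h, map_zero]

theorem coeffMap_mul_map (l : ℝ →ₗ[ℚ] ℚ) (p : MvPolynomial ι ℝ) (q : MvPolynomial ι ℚ) :
    coeffMap l (p * map (algebraMap ℚ ℝ) q) = coeffMap l p * q := by
  ext m
  rw [coeff_coeffMap, coeff_mul, coeff_mul, map_sum]
  refine Finset.sum_congr rfl fun x _ => ?_
  rw [coeff_map, coeff_coeffMap, mul_comm, ← Algebra.smul_def, map_smul, smul_eq_mul, mul_comm]

theorem exists_coeffMap_ne_zero {f : MvPolynomial ι ℝ} {a : ι → ℝ} (h : eval a f ≠ 0) :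
    ∃ l : ℝ →ₗ[ℚ] ℚ, MvPolynomial.aeval a (coeffMap l f) ≠ 0 := by
  by_contra! hl
  apply h
  let b := Module.Free.chooseBasis ℚ ℝ
  classical
  set T := f.support.biUnion fun m => (b.repr (coeff m f)).support with hT
  have hc : ∀ m ∈ f.support, coeff m f = ∑ k ∈ T, ((b.coord k (coeff m f) : ℚ) : ℝ) * b k := by
    intro m hm
    conv_lhs => rw [← b.linearCombination_repr (coeff m f)]
    rw [Finsupp.linearCombination_apply, Finsupp.sum_of_support_subset (s := T)]
    · refine Finset.sum_congr rfl fun k _ => ?_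
      rw [Algebra.smul_def]; rfl
    · exact Finset.subset_biUnion_of_mem (fun m => (b.repr (coeff m f)).support) hm
    · simp
  have he : ∀ k, ∑ m ∈ f.support, ((b.coord k (coeff m f) : ℚ) : ℝ) * ∏ i, a i ^ m i = 0 := by
    intro k
    have := hl (b.coord k)
    rw [coeffMap, map_sum] at this
    rw [← this]
    refine Finset.sum_congr rfl fun m _ => ?_
    rw [aeval_monomial, Finsupp.prod_fintype _ _ (by simp)]
    rfl
  rw [eval_eq']
  calc ∑ m ∈ f.support, coeff m f * ∏ i, a i ^ m i
      = ∑ m ∈ f.support, ∑ k ∈ T, b k * (((b.coord k (coeff m f) : ℚ) : ℝ) * ∏ i, a i ^ m i) := by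
        refine Finset.sum_congr rfl fun m hm => ?_
        rw [hc m hm, Finset.sum_mul]
        refine Finset.sum_congr rfl fun k _ => ?_
        rw [← hc m hm]; ring
    _ = 0 := by
        rw [Finset.sum_comm]
        refine Finset.sum_eq_zero fun k _ => ?_
        rw [← Finset.mul_sum, he, mul_zero]

end ComplementOfComponent

section ComplementOfComponent

open Filter Topology

variable {ι : Type*} [Fintype ι] [DecidableEq ι]

theorem IsQRegAt.exists_rational_multiplier {c : ℕ} {B : Set (ι → ℝ)} {a : ι → ℝ} (ha : a ∈ B)
    (h : IsQRegAt c B a) (j : MvPolynomial ι ℚ)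
    (hj : ∀ᶠ x in 𝓝 a, x ∈ B → MvPolynomial.aeval x j = 0) :
    ∃ f : MvPolynomial ι ℚ, MvPolynomial.aeval a f ≠ 0 ∧
      ∀ x ∈ B, MvPolynomial.aeval x (f * j) = 0 := by
  obtain ⟨q, hqB, hli, hloc⟩ := h.exists_eventually
  set T : MvPolynomial ι ℚ →ₐ[ℚ] MvPolynomial ι ℝ := MvPolynomial.aeval fun i => X i + C (a i)
  set T' : MvPolynomial ι ℝ →ₐ[ℝ] MvPolynomial ι ℝ := MvPolynomial.aeval fun i => X i - C (a i)
  have hT : ∀ (y : ι → ℝ) p, eval y (T p) = MvPolynomial.aeval (y + a) p := by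
    intro y p
    have : ((MvPolynomial.aeval y : MvPolynomial ι ℝ →ₐ[ℝ] ℝ).restrictScalars ℚ).comp T =
        MvPolynomial.aeval (y + a) := by
      refine MvPolynomial.algHom_ext fun i => ?_
      simp [T]
    exact AlgHom.congr_fun this p
  have hT' : ∀ (y : ι → ℝ) p, eval y (T' p) = eval (y - a) p := by
    intro y p
    have : (MvPolynomial.aeval y : MvPolynomial ι ℝ →ₐ[ℝ] ℝ).comp T' =
        MvPolynomial.aeval (y - a) := by
      refine MvPolynomial.algHom_ext fun i => ?_
      simp [T']
    exact AlgHom.congr_fun this p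
  have hTT : ∀ p, T' (T p) = map (algebraMap ℚ ℝ) p := by
    intro p
    refine MvPolynomial.funext fun y => ?_
    rw [hT', hT, sub_add_cancel, eval_map, MvPolynomial.aeval_def]
  obtain ⟨f, hf0, hf⟩ := exists_mul_mem_span_of_vanishing (fun i => T (q i))
    (fun i => by rw [hT, zero_add]; exact hqB i a ha)
    (by
      simp only [hT]
      rw [fderiv_comp_add_right (f := fun (y : ι → ℝ) i => MvPolynomial.aeval y (q i)), zero_add,
        (hasStrictFDerivAt_aeval_pi q a).hasFDerivAt.fderiv]
      exact surjective_of_linearIndependent hli.self_of_nhds)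
    (T j)
    (by
      have ht : Tendsto (fun y => y + a) (𝓝 (0 : ι → ℝ)) (𝓝 a) := by
        have : Continuous fun y : ι → ℝ => y + a := by fun_prop
        simpa using this.tendsto 0
      filter_upwards [ht.eventually (hj.and hloc)] with y hy
      simp only [hT]
      exact fun h => hy.1 (hy.2.2 (_root_.funext h)))
  have hfs : T' f * map (algebraMap ℚ ℝ) j ∈
      Ideal.span (Set.range fun i => map (algebraMap ℚ ℝ) (q i)) := by
    have := Ideal.mem_map_of_mem T' hf
    rw [map_mul, hTT, Ideal.map_span, ← Set.range_comp] at this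
    convert this using 3
    ext1 i
    exact (hTT (q i)).symm
  obtain ⟨l, hl⟩ := exists_coeffMap_ne_zero (f := T' f) (a := a)
    (by rw [hT', sub_self, hf0]; exact one_ne_zero)
  refine ⟨_, hl, fun x hx => ?_⟩
  rw [Ideal.mem_span_range_iff_exists_fun] at hfs
  obtain ⟨g, hg⟩ := hfs
  rw [← coeffMap_mul_map, ← hg]
  have hsum : coeffMap l (∑ i, g i * map (algebraMap ℚ ℝ) (q i)) = ∑ i, coeffMap l (g i) * q i := by
    ext m
    rw [coeff_coeffMap, coeff_sum, map_sum, coeff_sum]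
    exact Finset.sum_congr rfl fun i _ => by rw [← coeff_coeffMap, coeffMap_mul_map]
  rw [hsum, map_sum]
  exact Finset.sum_eq_zero fun i _ => by rw [map_mul, hqB i x hx, mul_zero]

/-- Removing a relatively open zero set of a rational polynomial from a rational algebraic set
leaves a rational algebraic set, provided the removed points are regular. -/
theorem IsQAlgebraicSet.diff_zeros {c : ℕ} {B : Set (ι → ℝ)} (hB : IsQAlgebraicSet B)
    (j : MvPolynomial ι ℚ)
    (hreg : ∀ a ∈ B, MvPolynomial.aeval a j = 0 → IsQRegAt c B a)
    (hopen : ∀ a ∈ B, MvPolynomial.aeval a j = 0 →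
      ∀ᶠ x in 𝓝 a, x ∈ B → MvPolynomial.aeval x j = 0) :
    IsQAlgebraicSet {x ∈ B | MvPolynomial.aeval x j ≠ 0} := by
  classical
  obtain ⟨S, hS⟩ := hB
  let 𝔞 : Ideal (MvPolynomial ι ℚ) :=
    { carrier := {f | ∀ x ∈ B, MvPolynomial.aeval x (f * j) = 0}
      add_mem' := fun {f g} hf hg x hx => by
        rw [add_mul, map_add, hf x hx, hg x hx, add_zero]
      zero_mem' := fun x _ => by simp
      smul_mem' := fun r f hf x hx => by
        rw [smul_eq_mul, mul_assoc, map_mul, hf x hx, mul_zero] }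
  obtain ⟨T, hT⟩ := IsNoetherian.noetherian 𝔞
  refine ⟨S ∪ T, ?_⟩
  ext x
  constructor
  · rintro ⟨hx, hjx⟩ p hp
    rcases Finset.mem_union.1 hp with hp | hp
    · exact (hS.subset hx) p hp
    · have : p ∈ 𝔞 := hT ▸ Submodule.subset_span hp
      have := this x hx
      rw [map_mul] at this
      exact (mul_eq_zero.1 this).resolve_right hjx
  · intro hx
    have hxB : x ∈ B := hS.superset fun p hp => hx p (Finset.mem_union_left _ hp)
    refine ⟨hxB, fun hjx => ?_⟩
    obtain ⟨f, hf0, hf⟩ := (hreg x hxB hjx).exists_rational_multiplier hxB j (hopen x hxB hjx)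
    have hf𝔞 : f ∈ Ideal.span (T : Set (MvPolynomial ι ℚ)) := by
      rw [Ideal.span, hT]; exact hf
    have hker : Ideal.span (T : Set (MvPolynomial ι ℚ)) ≤
        RingHom.ker (MvPolynomial.aeval x : MvPolynomial ι ℚ →ₐ[ℚ] ℝ) :=
      Ideal.span_le.2 fun p hp => hx p (Finset.mem_union_right _ hp)
    exact hf0 (hker hf𝔞)

end ComplementOfComponent

/-- Regular functions on `ℝ^ι` with rational coefficients. -/
def IsQR {ι : Type*} (f : (ι → ℝ) → ℝ) : Prop :=
  ∃ c Q : (ι → ℝ) → ℝ, IsQP c ∧ IsQP Q ∧ (∀ z, Q z ≠ 0) ∧ ∀ z, f z = c z / Q z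

theorem IsQP.isQR {ι : Type*} {f : (ι → ℝ) → ℝ} (hf : IsQP f) : IsQR f :=
  ⟨f, fun _ => 1, hf, IsQP.one, fun _ => one_ne_zero, fun z => by simp⟩

namespace IsQR

variable {ι κ : Type*} {f g : (ι → ℝ) → ℝ}

theorem add (hf : IsQR f) (hg : IsQR g) : IsQR (fun x => f x + g x) := by
  obtain ⟨c, Q, hc, hQ, h0, h⟩ := hf
  obtain ⟨c', Q', hc', hQ', h0', h'⟩ := hg
  refine ⟨fun z => c z * Q' z + Q z * c' z, fun z => Q z * Q' z, (hc.mul hQ').add (hQ.mul hc'),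
    hQ.mul hQ', fun z => mul_ne_zero (h0 z) (h0' z), fun z => ?_⟩
  simp only [h, h', div_add_div _ _ (h0 z) (h0' z)]

theorem mul (hf : IsQR f) (hg : IsQR g) : IsQR (fun x => f x * g x) := by
  obtain ⟨c, Q, hc, hQ, h0, h⟩ := hf
  obtain ⟨c', Q', hc', hQ', h0', h'⟩ := hg
  refine ⟨fun z => c z * c' z, fun z => Q z * Q' z, hc.mul hc',
    hQ.mul hQ', fun z => mul_ne_zero (h0 z) (h0' z), fun z => ?_⟩
  simp only [h, h', div_mul_div_comm]

theorem sum {α : Type*} {s : Finset α} {F : α → (ι → ℝ) → ℝ} (h : ∀ a ∈ s, IsQR (F a)) :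
    IsQR (fun x => ∑ a ∈ s, F a x) := by
  classical
  induction s using Finset.induction_on with
  | empty => simpa using IsQP.zero.isQR
  | insert a s ha ih =>
    simp only [Finset.sum_insert ha]
    exact (h a (by simp)).add (ih fun b hb => h b (by simp [hb]))

theorem comp {f : (κ → ℝ) → ℝ} (hf : IsQR f) {g : (ι → ℝ) → κ → ℝ}
    (hg : ∀ j, IsQP (fun x => g x j)) : IsQR (fun x => f (g x)) := by
  obtain ⟨c, Q, hc, hQ, h0, h⟩ := hf
  exact ⟨_, _, hc.comp hg, hQ.comp hg, fun z => h0 _, fun z => h _⟩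

variable [Fintype ι] [DecidableEq ι]

theorem isQAlgebraicSet {J : Type*} [Fintype J] {f : J → (ι → ℝ) → ℝ}
    (hf : ∀ j, IsQR (f j)) : IsQAlgebraicSet {x | ∀ j, f j x = 0} := by
  choose c Q hc hQ h0 h using hf
  have := isQAlgebraicSet_of_isQP hc
  convert this using 3 with x
  simp only [h, div_eq_zero_iff, h0, or_false]

theorem contDiff (hf : IsQR f) {n : WithTop ℕ∞} : ContDiff ℝ n f := by
  obtain ⟨c, Q, hc, hQ, h0, h⟩ := hf
  rw [_root_.funext h]
  exact hc.contDiff.div hQ.contDiff h0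

theorem fderiv_eq_zero {A : Set (ι → ℝ)} (hf : IsQR f) (hA : ∀ x ∈ A, f x = 0) {a : ι → ℝ}
    (ha : a ∈ A) {v : ι → ℝ}
    (hv : ∀ p : MvPolynomial ι ℚ, (∀ x ∈ A, aeval (x : ι → ℝ) p = 0) → polyGradQ p a ⬝ᵥ v = 0) :
    fderiv ℝ f a v = 0 := by
  have hfd : DifferentiableAt ℝ f a := (hf.contDiff (n := 1)).differentiable one_ne_zero a
  obtain ⟨c, Q, ⟨p, hp⟩, hQ, h0, h⟩ := hf
  have hQd : DifferentiableAt ℝ Q a := (hQ.contDiff (n := 1)).differentiable one_ne_zero a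
  have hcf : ∀ z, f z * Q z = aeval z p := fun z => by
    rw [h, ← hp, div_mul_cancel₀ _ (h0 z)]
  have h1 := hv p fun x hx => by rw [← hcf, hA x hx, zero_mul]
  have h2 : HasFDerivAt (fun z => f z * Q z) (dotL (polyGradQ p a)) a :=
    (hasStrictFDerivAt_aeval p a).hasFDerivAt.congr_of_eventuallyEq
      (Filter.Eventually.of_forall hcf)
  have h3 := (hfd.hasFDerivAt.mul hQd.hasFDerivAt).unique h2
  have h4 := congrArg (fun l : (ι → ℝ) →L[ℝ] ℝ => l v) h3
  simp only [add_apply, smul_apply, dotL_apply, h1, hA a ha,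
    smul_eq_mul, zero_mul, zero_add] at h4
  exact (mul_eq_zero.1 h4).resolve_left (h0 a)

end IsQR

section TopDegree

open Filter Topology

variable {ι κ : Type*}

/-- `T` is the leading part in degree `D` of the function `f`. -/
def HasTop (f : (ι → ℝ) → ℝ) (D : ℕ) (T : (ι → ℝ) → ℝ) : Prop :=
  ∀ x, Tendsto (fun l : ℝ => f (l • x) / l ^ D) atTop (𝓝 (T x))

namespace HasTop

variable {f g T T' : (ι → ℝ) → ℝ} {D D' : ℕ}

theorem add (hf : HasTop f D T) (hg : HasTop g D T') :
    HasTop (fun x => f x + g x) D (fun x => T x + T' x) := fun x => by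
  simpa [add_div] using (hf x).add (hg x)

theorem mul (hf : HasTop f D T) (hg : HasTop g D' T') :
    HasTop (fun x => f x * g x) (D + D') (fun x => T x * T' x) := fun x => by
  simpa [pow_add, mul_div_mul_comm] using (hf x).mul (hg x)

theorem pow (hf : HasTop f D T) (n : ℕ) :
    HasTop (fun x => f x ^ n) (D * n) (fun x => T x ^ n) := fun x => by
  simpa [pow_mul, div_pow] using (hf x).pow n

theorem const_mul (c : ℝ) (hf : HasTop f D T) :
    HasTop (fun x => c * f x) D (fun x => c * T x) := fun x => by
  simpa [mul_div_assoc] using (hf x).const_mul c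

theorem congr (hf : HasTop f D T) (h : ∀ x, T x = T' x) : HasTop f D T' := fun x => h x ▸ hf x

theorem lower (hf : HasTop f D T) (h : D < D') : HasTop f D' (fun _ => 0) := fun x => by
  have h1 : Tendsto (fun l : ℝ => l ^ (D' - D)) atTop atTop :=
    tendsto_pow_atTop (by omega)
  have h2 := (hf x).mul h1.inv_tendsto_atTop
  rw [mul_zero] at h2
  refine h2.congr' ?_
  filter_upwards [eventually_gt_atTop (0 : ℝ)] with l hl
  obtain ⟨m, rfl⟩ := Nat.exists_eq_add_of_lt h
  rw [show D + m + 1 - D = m + 1 by omega, show D + m + 1 = D + (m + 1) by ring, pow_add]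
  simp only [Pi.inv_apply]
  field_simp

theorem proj (i : ι) : HasTop (fun x : ι → ℝ => x i) 1 (fun x => x i) := fun x => by
  refine tendsto_const_nhds.congr' ?_
  filter_upwards [eventually_gt_atTop (0 : ℝ)] with l hl
  simp only [Pi.smul_apply, smul_eq_mul, pow_one]
  field_simp

theorem sum {α : Type*} {s : Finset α} {F T : α → (ι → ℝ) → ℝ}
    (h : ∀ a ∈ s, HasTop (F a) D (T a)) :
    HasTop (fun x => ∑ a ∈ s, F a x) D (fun x => ∑ a ∈ s, T a x) := fun x => by
  simpa [Finset.sum_div] using tendsto_finsetSum s fun a ha => h a ha x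

theorem comp_linear {f T : (κ → ℝ) → ℝ} (hf : HasTop f D T) (A : (ι → ℝ) → κ → ℝ)
    (hA : ∀ (l : ℝ) x, A (l • x) = l • A x) :
    HasTop (fun x => f (A x)) D (fun x => T (A x)) := fun x => by
  simpa only [hA] using hf (A x)

end HasTop

variable [Fintype ι] [DecidableEq ι]

theorem MvPolynomial.eval_smul_eq_sum (p : MvPolynomial ι ℝ) (l : ℝ) (x : ι → ℝ) :
    eval (l • x) p = ∑ i ∈ Finset.range (p.totalDegree + 1),
      l ^ i * eval x (homogeneousComponent i p) := by
  conv_lhs => rw [← sum_homogeneousComponent p]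
  rw [map_sum]
  exact Finset.sum_congr rfl fun i _ =>
    (homogeneousComponent_isHomogeneous i p).eval_smul l x

theorem MvPolynomial.hasTop_eval (p : MvPolynomial ι ℝ) {D : ℕ} (hD : p.totalDegree ≤ D) :
    HasTop (fun x => eval x p) D (fun x => eval x (homogeneousComponent D p)) := fun x => by
  have h1 : ∀ l : ℝ, eval (l • x) p = ∑ i ∈ Finset.range (D + 1),
      l ^ i * eval x (homogeneousComponent i p) := fun l => by
    rw [eval_smul_eq_sum]
    refine Finset.sum_subset (by simpa using hD) fun i _ hi => ?_
    rw [homogeneousComponent_eq_zero _ _ (by simpa using hi)]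
    simp
  simp only [h1, Finset.sum_range_succ, add_div, Finset.sum_div]
  have h2 : Tendsto (fun l : ℝ => ∑ i ∈ Finset.range D,
      l ^ i * eval x (homogeneousComponent i p) / l ^ D) atTop (𝓝 (∑ i ∈ Finset.range D, 0)) := by
    refine tendsto_finsetSum _ fun i hi => ?_
    have h3 : Tendsto (fun l : ℝ => l ^ i / l ^ D) atTop (𝓝 0) :=
      tendsto_pow_div_pow_atTop_zero (Finset.mem_range.1 hi)
    simpa [mul_div_right_comm] using h3.mul_const (eval x (homogeneousComponent i p))
  have h4 : Tendsto (fun l : ℝ => l ^ D * eval x (homogeneousComponent D p) / l ^ D) atTop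
      (𝓝 (eval x (homogeneousComponent D p))) := by
    refine tendsto_const_nhds.congr' ?_
    filter_upwards [eventually_gt_atTop (0 : ℝ)] with l hl
    field_simp
  simpa using h2.add h4

theorem IsQP.hasTop_zero {f : (ι → ℝ) → ℝ} (hf : IsQP f) :
    ∃ n, ∀ D, n < D → HasTop f D (fun _ => 0) := by
  obtain ⟨p, hp⟩ := hf
  have h : f = fun x => eval x (MvPolynomial.map (algebraMap ℚ ℝ) p) := _root_.funext fun x => by
    rw [hp, eval_map, aeval_def]
  exact ⟨_, fun D hD => h ▸ ((MvPolynomial.map (algebraMap ℚ ℝ) p).hasTop_eval le_rfl).lower hD⟩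

theorem MvPolynomial.totalDegree_le_of_hasTop {p : MvPolynomial ι ℝ} {D : ℕ} {T : (ι → ℝ) → ℝ}
    (h : HasTop (fun x => eval x p) D T) : p.totalDegree ≤ D := by
  by_contra! hD
  have h0 : homogeneousComponent p.totalDegree p = 0 := by
    refine MvPolynomial.funext fun x => ?_
    rw [map_zero]
    exact tendsto_nhds_unique (p.hasTop_eval le_rfl x) (h.lower hD x)
  have hp : p ≠ 0 := by rintro rfl; simp at hD
  obtain ⟨m, hm, hmd⟩ := Finset.exists_mem_eq_sup p.support
    (support_nonempty.2 hp) (fun s => s.sum fun _ e => e)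
  have h1 : coeff m (homogeneousComponent p.totalDegree p) = coeff m p := by
    rw [coeff_homogeneousComponent, if_pos]
    rw [totalDegree, hmd]
    rfl
  rw [h0, coeff_zero] at h1
  exact mem_support_iff.1 hm h1.symm

theorem HasTop.eq_eval {p : MvPolynomial ι ℝ} {D : ℕ} {T : (ι → ℝ) → ℝ}
    (h : HasTop (fun x => eval x p) D T) (x : ι → ℝ) :
    T x = eval x (homogeneousComponent D p) :=
  tendsto_nhds_unique (h x) (p.hasTop_eval (totalDegree_le_of_hasTop h) x)

theorem isOvert_of_hasTop {p : MvPolynomial ι ℝ} {D : ℕ} {T : (ι → ℝ) → ℝ}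
    (h : HasTop (fun x => eval x p) D T) (hT : ∀ x, x ≠ 0 → T x ≠ 0) : IsOvert p := by
  intro x hx
  by_contra hx0
  have h1 := h.eq_eval x
  rcases (totalDegree_le_of_hasTop h).eq_or_lt with h2 | h2
  · exact hT x hx0 (by rw [h1, ← h2, hx])
  · exact hT x hx0 (by rw [h1, homogeneousComponent_eq_zero _ _ h2, map_zero])

theorem HasTop.exists_pos {f T : (ι → ℝ) → ℝ} {D : ℕ} (hf : IsQP f) (h : HasTop f D T)
    (hT : ∀ x, x ≠ 0 → 0 < T x) : ∃ R : ℝ, 0 < R ∧ ∀ z, R ≤ ∑ i, z i ^ 2 → 0 < f z := by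
  obtain ⟨q, hq⟩ := hf
  set p := MvPolynomial.map (algebraMap ℚ ℝ) q
  have hfp : f = fun x => eval x p := _root_.funext fun x => by
    rw [hq, eval_map, aeval_def]
  subst hfp
  let F : (ι → ℝ) → ℝ → ℝ := fun x μ => ∑ i ∈ Finset.range (D + 1),
    μ ^ (D - i) * eval x (homogeneousComponent i p)
  have hFc : Continuous fun w : (ι → ℝ) × ℝ => F w.1 w.2 :=
    continuous_finsetSum _ fun i _ => (continuous_snd.pow _).mul
      ((MvPolynomial.continuous_eval _).comp continuous_fst)
  have hF0 : ∀ x, F x 0 = T x := fun x => by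
    rw [h.eq_eval]
    simp only [F, Finset.sum_range_succ, Nat.sub_self, pow_zero, one_mul]
    rw [Finset.sum_eq_zero, zero_add]
    intro i hi
    rw [zero_pow (by have := Finset.mem_range.1 hi; omega), zero_mul]
  have hFf : ∀ x (l : ℝ), 0 < l → eval (l • x) p = l ^ D * F x l⁻¹ := fun x l hl => by
    have hs : eval (l • x) p = ∑ i ∈ Finset.range (D + 1),
        l ^ i * eval x (homogeneousComponent i p) := by
      rw [eval_smul_eq_sum]
      refine Finset.sum_subset (by simpa using totalDegree_le_of_hasTop h) fun i _ hi => ?_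
      rw [homogeneousComponent_eq_zero _ _ (by simpa using hi)]
      simp
    rw [hs, Finset.mul_sum]
    refine Finset.sum_congr rfl fun i hi => ?_
    rw [← mul_assoc]
    congr 1
    have : D = i + (D - i) := by have := Finset.mem_range.1 hi; omega
    conv_rhs => rw [this, pow_add, Nat.add_sub_cancel_left, inv_pow]
    field_simp
  have hK : IsCompact (Metric.sphere (0 : ι → ℝ) 1) := isCompact_sphere 0 1
  have hev := hK.eventually_forall_of_forall_eventually (x₀ := (0 : ℝ))
    (P := fun μ x => 0 < F x μ) fun x hx => by
      have hx0 : x ≠ 0 := by rintro rfl; simp at hx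
      have h1 : 0 < F x 0 := hF0 x ▸ hT x hx0
      exact (hFc.comp continuous_swap).continuousAt.eventually (lt_mem_nhds h1)
  obtain ⟨δ, hδ, hδ'⟩ := Metric.eventually_nhds_iff.1 hev
  refine ⟨Fintype.card ι * (2 / δ) ^ 2 + 1, by positivity, fun z hz => ?_⟩
  have hzn : 2 / δ ≤ ‖z‖ := by
    by_contra! hlt
    have : ∑ i, z i ^ 2 ≤ ∑ _i : ι, (2 / δ) ^ 2 := Finset.sum_le_sum fun i _ => by
      rw [sq_le_sq, abs_of_pos (show 0 < 2 / δ by positivity)]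
      exact (norm_le_pi_norm z i).trans hlt.le
    simp at this
    linarith
  have hz0 : 0 < ‖z‖ := lt_of_lt_of_le (by positivity) hzn
  have h1 := hFf (‖z‖⁻¹ • z) ‖z‖ hz0
  rw [smul_inv_smul₀ hz0.ne'] at h1
  show 0 < eval z p
  rw [h1]
  refine mul_pos (by positivity) (hδ' ?_ _ ?_)
  · rw [Real.dist_eq, sub_zero, abs_of_pos (by positivity)]
    have : ‖z‖⁻¹ ≤ (2 / δ)⁻¹ := inv_anti₀ (by positivity) hzn
    rw [inv_div] at this
    linarith
  · rw [mem_sphere_zero_iff_norm, norm_smul, norm_inv, norm_norm, inv_mul_cancel₀ hz0.ne']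

theorem isProjQClosed_of_hasTop {V : Set (ι → ℝ)} {f T : (ι → ℝ) → ℝ} {D : ℕ}
    (hf : IsQP f) (hV : V = {x | f x = 0}) (h : HasTop f D T) (hT : ∀ x, x ≠ 0 → T x ≠ 0) :
    IsProjQClosed V := by
  obtain ⟨q, hq⟩ := hf
  refine ⟨q, isOvert_of_hasTop (D := D) (T := T) ?_ hT, ?_⟩
  · have : (fun x => eval x (MvPolynomial.map (algebraMap ℚ ℝ) q)) = f := _root_.funext fun x => by
      rw [hq, eval_map, aeval_def]
    rwa [this]
  · rw [hV]; ext x; simp [hq]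

theorem IsProjQClosed.exists_hasTop {V : Set (ι → ℝ)} (hV : IsProjQClosed V) :
    ∃ (f T : (ι → ℝ) → ℝ) (D : ℕ), IsQP f ∧ V = {x | f x = 0} ∧ HasTop f D T ∧
      ∀ x, x ≠ 0 → T x ≠ 0 := by
  obtain ⟨q, hq, rfl⟩ := hV
  refine ⟨fun x => aeval x q, fun x => eval x (homogeneousComponent
    (MvPolynomial.map (algebraMap ℚ ℝ) q).totalDegree (MvPolynomial.map (algebraMap ℚ ℝ) q)),
    (MvPolynomial.map (algebraMap ℚ ℝ) q).totalDegree, IsQP.aeval q, rfl, ?_,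
    fun x hx h => hx (hq x h)⟩
  have h := (MvPolynomial.map (algebraMap ℚ ℝ) q).hasTop_eval le_rfl
  simpa only [eval_map, ← aeval_def] using h

end TopDegree

section Glue

open Filter Topology

variable {E : Type*} [NormedAddCommGroup E] [NormedSpace ℝ E] [FiniteDimensional ℝ E]

theorem exists_glue {S Y₀ : Set E} (hS : IsCompact S) (hY : IsCompact Y₀) {f r : E → ℝ}
    (hf : ∀ a ∈ S, SmoothNear f a) (hr : ContDiff ℝ (⊤ : ℕ∞) r) {P : E → Prop}
    (h : ∀ a ∈ Y₀, ∀ᶠ z in 𝓝 a, z ∈ S → f z = r z ∧ P z) :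
    ∃ F : E → ℝ, ContDiff ℝ (⊤ : ℕ∞) F ∧ (∀ a ∈ Y₀, F =ᶠ[𝓝 a] r) ∧ ∀ a ∈ S, F a = f a ∧
      ((P a → fderiv ℝ f a = fderiv ℝ r a) → fderiv ℝ F a = fderiv ℝ f a) := by
  obtain ⟨V, hVo, hYV, hV⟩ := eventually_nhdsSet_iff_exists.1 (eventually_nhdsSet_iff_forall.2 h)
  obtain ⟨χ, hχ, hχ0, hχ1, -⟩ := exists_contDiff_bump hVo.isClosed_compl hY.isClosed
    (Set.disjoint_compl_left_iff_subset.2 hYV)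
  let U : Set E := {z | SmoothNear f z}
  have hU : IsOpen U := isOpen_setOfPred_eventually_nhds
  obtain ⟨ψ, hψ, hψ0, hψ1, -⟩ := exists_contDiff_bump hU.isClosed_compl hS.isClosed
    (Set.disjoint_compl_left_iff_subset.2 hf)
  rw [eventually_nhdsSet_iff_forall] at hχ0 hχ1 hψ0 hψ1
  have h1 : ContDiff ℝ (⊤ : ℕ∞) fun z => ψ z * f z := by
    rw [contDiff_iff_contDiffAt]
    intro z
    by_cases hz : z ∈ U
    · exact hψ.contDiffAt.mul (SmoothNear.eventually (f := f) hz).self_of_nhds.self_of_nhds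
    · refine (contDiffAt_const (c := (0 : ℝ))).congr_of_eventuallyEq ?_
      filter_upwards [hψ0 z hz] with w hw
      rw [hw, zero_mul]
  refine ⟨fun z => ψ z * f z + χ z * (r z - ψ z * f z), h1.add (hχ.mul (hr.sub h1)),
    fun a ha => ?_, fun a ha => ?_⟩
  · filter_upwards [hχ1 a ha] with z hz
    rw [hz]; ring
  · have hψf : (fun z => ψ z * f z) =ᶠ[𝓝 a] f := by
      filter_upwards [hψ1 a ha] with z hz
      rw [hz, one_mul]
    by_cases haV : a ∈ V
    · obtain ⟨hfr, hP⟩ := hV a haV ha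
      refine ⟨?_, fun hd => ?_⟩
      · show ψ a * f a + χ a * (r a - ψ a * f a) = f a
        rw [(hψ1 a ha).self_of_nhds, ← hfr]; ring
      have e1 : HasFDerivAt (fun z => ψ z * f z) (fderiv ℝ f a) a := by
        rw [← hψf.fderiv_eq]
        exact (h1.differentiable infty_ne_zero' a).hasFDerivAt
      have e2 : HasFDerivAt r (fderiv ℝ f a) a := by
        rw [hd hP]
        exact (hr.differentiable infty_ne_zero' a).hasFDerivAt
      have e3 := (hχ.differentiable infty_ne_zero' a).hasFDerivAt
      have e4 := e1.add (e3.mul (e2.sub e1))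
      have e5 : HasFDerivAt (fun z => ψ z * f z + χ z * (r z - ψ z * f z)) _ a := e4
      rw [e5.fderiv]
      have : r a - ψ a * f a = 0 := by rw [(hψ1 a ha).self_of_nhds, ← hfr]; ring
      ext v
      simp [this]
    · have e : (fun z => ψ z * f z + χ z * (r z - ψ z * f z)) =ᶠ[𝓝 a] f := by
        filter_upwards [hχ0 a haV, hψf] with z hz hz'
        rw [hz, hz']; ring
      exact ⟨e.self_of_nhds, fun _ => e.fderiv_eq⟩

end Glue

namespace IsQR

variable {ι : Type*} {f g : (ι → ℝ) → ℝ}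

theorem div (hf : IsQR f) (hg : IsQR g) (hg0 : ∀ z, g z ≠ 0) : IsQR (fun x => f x / g x) := by
  obtain ⟨c, Q, hc, hQ, h0, h⟩ := hf
  obtain ⟨c', Q', hc', hQ', h0', h'⟩ := hg
  have hc0 : ∀ z, c' z ≠ 0 := fun z hz => hg0 z (by rw [h', hz, zero_div])
  refine ⟨fun z => c z * Q' z, fun z => Q z * c' z, hc.mul hQ', hQ.mul hc',
    fun z => mul_ne_zero (h0 z) (hc0 z), fun z => ?_⟩
  simp only [h, h']
  rw [div_div_div_eq]

end IsQR

section Spine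

open Filter Topology Matrix

variable {ι : Type*} [Fintype ι] [DecidableEq ι]

/-- The projection of `ℝ^ι` onto the hyperplane on which the coordinate `t₀` vanishes. -/
noncomputable def flat (t₀ : ι) : (ι → ℝ) →L[ℝ] ι → ℝ :=
  ContinuousLinearMap.id ℝ (ι → ℝ) -
    (ContinuousLinearMap.proj (R := ℝ) (φ := fun _ : ι => ℝ) t₀).smulRight (Pi.single t₀ 1)

theorem flat_eq (t₀ : ι) (z : ι → ℝ) : flat t₀ z = z - z t₀ • Pi.single t₀ 1 := rfl

theorem flat_apply (t₀ : ι) (z : ι → ℝ) (i : ι) : flat t₀ z i = if i = t₀ then 0 else z i := by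
  by_cases h : i = t₀
  · subst h; simp [flat_eq]
  · simp [flat_eq, h]

@[simp] theorem flat_self (t₀ : ι) (z : ι → ℝ) : flat t₀ z t₀ = 0 := by simp [flat_apply]

theorem flat_add_single (t₀ : ι) (z : ι → ℝ) (s : ℝ) :
    flat t₀ (z + s • Pi.single t₀ 1) = flat t₀ z := by
  ext i
  by_cases h : i = t₀ <;> simp [flat_apply, h]

@[simp] theorem flat_flat (t₀ : ι) (z : ι → ℝ) : flat t₀ (flat t₀ z) = flat t₀ z := by
  ext i
  by_cases h : i = t₀ <;> simp [flat_apply, h]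

theorem flat_eq_iff {t₀ : ι} {z : ι → ℝ} : flat t₀ z = z ↔ z t₀ = 0 := by
  constructor
  · intro h; rw [← h]; simp
  · intro h; simp [flat_eq, h]

theorem isQP_flat (t₀ i : ι) : IsQP fun z => flat t₀ z i := by
  simp only [flat_apply]
  split_ifs
  exacts [IsQP.zero, IsQP.proj i]

/-- A compact set `S`, with tubular retraction `ρ`, which is a cylinder over the hyperplane
`t₀ = 0` near this hyperplane, together with a rational cylinder `V` whose base is a union of
components of the base of `S`. -/
structure IsSpine (t₀ : ι) (c : ℕ) (S V : Set (ι → ℝ)) (ρ : (ι → ℝ) → ι → ℝ) : Prop where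
  compact : IsCompact S
  tub : IsTubular c S S ρ
  cyl : ∀ z : ι → ℝ, |z t₀| < 1 → (z ∈ S ↔ flat t₀ z ∈ S)
  alg : IsQAlgebraicSet V
  inv : ∀ z, z ∈ V ↔ flat t₀ z ∈ V
  sub : ∀ z ∈ V, z t₀ = 0 → z ∈ S
  loc : ∀ a ∈ V, a t₀ = 0 → ∀ᶠ z in 𝓝 a, z ∈ S → z ∈ V
  reg : ∀ a ∈ V, a t₀ = 0 → IsQRegAt c V a

theorem IsQAlgebraicSet.isClosed {V : Set (ι → ℝ)} (h : IsQAlgebraicSet V) : IsClosed V := by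
  obtain ⟨T, rfl⟩ := h
  simp only [Set.ofPred_forall]
  exact isClosed_iInter fun p => isClosed_iInter fun _ =>
    isClosed_eq (IsQP.aeval p).continuous continuous_const

theorem NormalAt.of_eventually {V W : Set (ι → ℝ)} {y n : ι → ℝ} (h : NormalAt V y n)
    (hVW : ∀ᶠ x in 𝓝 y, x ∈ W → x ∈ V) : NormalAt W y n := by
  obtain ⟨g, hg, h⟩ := h
  refine ⟨g, hg, ?_⟩
  filter_upwards [h, hVW] with x h1 h2 h3 using h1 (h2 h3)

theorem NormalAt.translate {V : Set (ι → ℝ)} {y n : ι → ℝ} (h : NormalAt V y n) (u : ι → ℝ)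
    (hV : ∀ z, z ∈ V ↔ z + u ∈ V) : NormalAt V (y + u) n := by
  obtain ⟨g, hg, h⟩ := h
  refine ⟨fun x => g (x - u), ?_, ?_⟩
  · have h1 : HasStrictFDerivAt (fun x : ι → ℝ => x - u) (ContinuousLinearMap.id ℝ _) (y + u) :=
      (hasStrictFDerivAt_id _).sub_const u
    have h2 : HasStrictFDerivAt g (dotL n) ((fun x : ι → ℝ => x - u) (y + u)) := by simpa using hg
    exact h2.comp (y + u) h1
  · have h1 : Tendsto (fun x : ι → ℝ => x - u) (𝓝 (y + u)) (𝓝 y) :=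
      (continuous_id.sub continuous_const).tendsto' _ _ (by simp)
    filter_upwards [h1.eventually h] with x hx hxV
    exact hx ((hV _).2 (by simpa using hxV))

/-- The axis of a cylinder is tangent to it. -/
theorem IsTubular.conormal_single {t₀ : ι} {c : ℕ} {S : Set (ι → ℝ)} {ρ : (ι → ℝ) → ι → ℝ}
    (h : IsTubular c S S ρ) (hcyl : ∀ z : ι → ℝ, |z t₀| < 1 → (z ∈ S ↔ flat t₀ z ∈ S))
    {z : ι → ℝ} (hz : z ∈ S) (ht : |z t₀| < 1) :
    conormal ρ z *ᵥ Pi.single t₀ 1 = 0 := by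
  have hd : HasFDerivAt ρ (fderiv ℝ ρ z) z :=
    ((h.smooth z hz).self_of_nhds.differentiableAt infty_ne_zero').hasFDerivAt
  have h1 : HasDerivAt (fun s : ℝ => z + s • Pi.single t₀ (1 : ℝ)) (Pi.single t₀ 1) 0 := by
    simpa using ((hasDerivAt_id (0 : ℝ)).smul_const (Pi.single t₀ (1 : ℝ) : ι → ℝ)).const_add z
  have h2 : HasFDerivAt ρ (fderiv ℝ ρ z) (z + (0 : ℝ) • Pi.single t₀ (1 : ℝ)) := by simpa using hd
  have h3 := h2.comp_hasDerivAt (0 : ℝ) h1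
  have h4 : Tendsto (fun s : ℝ => z + s • Pi.single t₀ (1 : ℝ)) (𝓝 0) (𝓝 z) :=
    h1.continuousAt.tendsto.trans (by simp)
  have h5 : (ρ ∘ fun s : ℝ => z + s • Pi.single t₀ (1 : ℝ)) =ᶠ[𝓝 0]
      fun s : ℝ => z + s • Pi.single t₀ (1 : ℝ) := by
    have hc : ∀ᶠ w : ι → ℝ in 𝓝 z, |w t₀| < 1 :=
      ((continuous_apply t₀).abs.continuousAt (x := z)).eventually (gt_mem_nhds ht)
    filter_upwards [h4.eventually hc] with s hs
    refine h.self _ ((hcyl _ hs).2 ?_)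
    rw [flat_add_single]
    exact (hcyl z ht).1 hz
  have h6 := h3.unique (h1.congr_of_eventuallyEq h5)
  rw [conormal_mulVec, h6, sub_self]

namespace IsSpine

variable {t₀ : ι} {c : ℕ} {S V : Set (ι → ℝ)} {ρ : (ι → ℝ) → ι → ℝ}

theorem isCompact_base (h : IsSpine t₀ c S V ρ) : IsCompact {z ∈ V | z t₀ = 0} := by
  refine h.compact.of_isClosed_subset ?_ fun z hz => h.sub z hz.1 hz.2
  exact h.alg.isClosed.inter (isClosed_eq (continuous_apply t₀) continuous_const)

theorem eventually_abs_lt {a : ι → ℝ} (ha : a t₀ = 0) {r : ℝ} (hr : 0 < r) :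
    ∀ᶠ z : ι → ℝ in 𝓝 a, |z t₀| < r := by
  have : Continuous fun z : ι → ℝ => |z t₀| := (continuous_apply t₀).abs
  exact this.continuousAt.eventually (gt_mem_nhds (by simpa [ha] using hr))

theorem mem_of_mem (h : IsSpine t₀ c S V ρ) {z : ι → ℝ} (hz : z ∈ V) (ht : |z t₀| < 1) : z ∈ S :=
  (h.cyl z ht).2 (h.sub _ ((h.inv z).1 hz) (by simp))

theorem conormal_single (h : IsSpine t₀ c S V ρ) {z : ι → ℝ} (hz : z ∈ S) (ht : |z t₀| < 1) :
    conormal ρ z *ᵥ Pi.single t₀ 1 = 0 :=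
  h.tub.conormal_single h.cyl hz ht

/-- Regular functions on the base of the rational cylinder extend to the whole space, constantly
along the cylinder. -/
theorem exists_isQR (h : IsSpine t₀ c S V ρ) {b Q : (ι → ℝ) → ℝ} (hb : IsQP b) (hQ : IsQP Q)
    (hQ0 : ∀ z ∈ V, z t₀ = 0 → Q z ≠ 0) :
    ∃ r, IsQR r ∧ ∀ z ∈ V, r z = b (flat t₀ z) / Q (flat t₀ z) := by
  obtain ⟨T, hT⟩ := h.alg
  let P : (ι → ℝ) → ℝ := fun z => ∑ p ∈ T, aeval z p ^ 2
  have hP : IsQP P := IsQP.sum fun p _ => (IsQP.aeval p).pow 2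
  have hPV : ∀ z, P z = 0 ↔ z ∈ V := fun z => by
    simp only [P]
    rw [hT, Finset.sum_eq_zero_iff_of_nonneg fun p _ => sq_nonneg _]
    simp
  have hPn : ∀ z, 0 ≤ P z := fun z => Finset.sum_nonneg fun p _ => sq_nonneg _
  refine ⟨fun z => b (flat t₀ z) * Q (flat t₀ z) / (Q (flat t₀ z) ^ 2 + P (flat t₀ z)),
    ⟨_, _, (hb.comp (isQP_flat t₀)).mul (hQ.comp (isQP_flat t₀)),
      ((hQ.comp (isQP_flat t₀)).pow 2).add (hP.comp (isQP_flat t₀)), fun z hz => ?_,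
      fun z => rfl⟩, fun z hz => ?_⟩
  · have h1 := hPn (flat t₀ z)
    have h2 := sq_nonneg (Q (flat t₀ z))
    exact hQ0 _ ((hPV _).1 (by linarith)) (by simp) (pow_eq_zero_iff two_ne_zero |>.1 (by linarith))
  · have h1 := (hPV _).2 ((h.inv z).1 hz)
    have h2 := hQ0 _ ((h.inv z).1 hz) (by simp)
    show b (flat t₀ z) * Q (flat t₀ z) / (Q (flat t₀ z) ^ 2 + P (flat t₀ z)) = _
    rw [h1]
    field_simp
    ring

end IsSpine

end Spine

section SpineBase

open Filter Topology Matrix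

variable {ι : Type*} [Fintype ι] [DecidableEq ι]

theorem SmoothNear.fderiv_apply {E F : Type*} [NormedAddCommGroup E] [NormedSpace ℝ E]
    [NormedAddCommGroup F] [NormedSpace ℝ F] {f : E → F} {x : E} (h : SmoothNear f x) (v : E) :
    SmoothNear (fun y => fderiv ℝ f y v) x := by
  filter_upwards [h] with y hy
  exact (hy.fderiv_right (m := ((⊤ : ℕ∞) : WithTop ℕ∞)) (by simp)).clm_apply contDiffAt_const

theorem SmoothNear.apply {E κ : Type*} [NormedAddCommGroup E] [NormedSpace ℝ E] [Fintype κ]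
    {f : E → κ → ℝ} {x : E} (h : SmoothNear f x) (i : κ) : SmoothNear (fun y => f y i) x := by
  filter_upwards [h] with y hy
  exact contDiffAt_pi.1 hy i

theorem smoothNear_pi {E κ : Type*} [NormedAddCommGroup E] [NormedSpace ℝ E] [Fintype κ]
    {f : E → κ → ℝ} {x : E} (h : ∀ i, SmoothNear (fun y => f y i) x) : SmoothNear f x := by
  filter_upwards [eventually_all.2 h] with y hy
  exact contDiffAt_pi.2 hy

theorem SmoothNear.sub {E F : Type*} [NormedAddCommGroup E] [NormedSpace ℝ E]
    [NormedAddCommGroup F] [NormedSpace ℝ F] {f g : E → F} {x : E} (hf : SmoothNear f x)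
    (hg : SmoothNear g x) : SmoothNear (fun y => f y - g y) x := by
  filter_upwards [hf, hg] with y h1 h2 using h1.sub h2

theorem smoothNear_conormal {ρ : (ι → ℝ) → ι → ℝ} {a : ι → ℝ} (h : SmoothNear ρ a) (i j : ι) :
    SmoothNear (fun z => conormal ρ z i j) a := by
  simp only [conormal_apply]
  exact (contDiff_const.smoothNear a).sub ((h.fderiv_apply (Pi.single j 1)).apply i)

namespace IsSpine

variable {t₀ : ι} {c : ℕ} {S V : Set (ι → ℝ)} {ρ : (ι → ℝ) → ι → ℝ}

theorem exists_conormal_eq (h : IsSpine t₀ c S V ρ) :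
    ∃ (m : ℕ) (p : Fin m → MvPolynomial ι ℚ) (A : ι → Fin m → (ι → ℝ) → ℝ),
      (∀ i j, IsQR (A i j)) ∧ (∀ x : ι → ℝ, x ∈ V ↔ ∀ j, aeval x (p j) = 0) ∧
      ∀ a ∈ V, a t₀ = 0 → ∀ᶠ z in 𝓝 a, z ∈ S → z ∈ V ∧
        conormal ρ z = (Matrix.of fun i j => A i j z) *
          Matrix.of fun j => polyGradQ (p j) (flat t₀ z) := by
  obtain ⟨m, p, den, U, hden, hU, hp, hf⟩ := exists_normal_formula c h.alg
  have key : ∀ a ∈ V, a t₀ = 0 → ∀ᶠ z in 𝓝 a, z ∈ S → z ∈ V ∧ den (flat t₀ z) ≠ 0 ∧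
      den (flat t₀ z) • conormal ρ z =
        U (flat t₀ z) * Matrix.of fun j => polyGradQ (p j) (flat t₀ z) := by
    intro a ha ha0
    have haS := h.sub a ha ha0
    have hfl : Tendsto (flat t₀) (𝓝 a) (𝓝 a) :=
      (flat t₀).continuous.tendsto' _ _ (flat_eq_iff.2 ha0)
    filter_upwards [hfl.eventually (hf a (h.reg a ha ha0)), (h.loc a ha ha0).eventually_nhds,
      (eventually_abs_lt ha0 one_pos).eventually_nhds, h.tub.conormal_transpose haS,
      h.tub.conormal_of_normalAt haS, h.tub.normalAt_conormal haS] with z h1 h2 h3 h4 h5 h6 hzS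
    have hzV := h2.self_of_nhds hzS
    have hfz := (h.inv z).1 hzV
    have e1 : flat t₀ z + z t₀ • Pi.single t₀ (1 : ℝ) = z := by rw [flat_eq]; abel
    have e2 : z + -(z t₀ • Pi.single t₀ (1 : ℝ)) = flat t₀ z := by rw [flat_eq]; abel
    refine ⟨hzV, h1 hfz _ (h4 hzS) (fun n hn => ?_) fun w => ?_⟩
    · have := hn.translate (z t₀ • Pi.single t₀ 1) fun x => by
        rw [h.inv, h.inv (x + _), flat_add_single]
      rw [e1] at this
      exact (h5 hzS n).1 (this.of_eventually h2)
    · have := ((h6 hzS w).of_eventually (W := V) (h3.mono fun x hx hxV => h.mem_of_mem hxV hx)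
        ).translate (-(z t₀ • Pi.single t₀ 1)) fun x => by
          rw [h.inv, h.inv (x + _), ← neg_smul, flat_add_single]
      rwa [e2] at this
  have hd0 : ∀ z ∈ V, z t₀ = 0 → den z ≠ 0 := fun z hz h0 => by
    have := ((key z hz h0).self_of_nhds (h.sub z hz h0)).2.1
    rwa [flat_eq_iff.2 h0] at this
  choose A hA hAV using fun i j => h.exists_isQR (hU i j) hden hd0
  refine ⟨m, p, A, hA, hp, fun a ha ha0 => ?_⟩
  filter_upwards [key a ha ha0] with z hz hzS
  obtain ⟨hzV, h1, h2⟩ := hz hzS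
  refine ⟨hzV, ?_⟩
  have h3 : (Matrix.of fun i j => A i j z) = (den (flat t₀ z))⁻¹ • U (flat t₀ z) := by
    ext i j
    rw [of_apply, hAV i j z hzV, Matrix.smul_apply, smul_eq_mul, div_eq_inv_mul]
  rw [h3, smul_mul, ← h2, smul_smul, inv_mul_cancel₀ h1, one_smul]

/-- The field of projections onto the normal spaces of a spine extends to a smooth map which is
rational near the rational part of the base. -/
theorem exists_normal_field (h : IsSpine t₀ c S V ρ) :
    ∃ N : (ι → ℝ) → ι × ι → ℝ, ContDiff ℝ (⊤ : ℕ∞) N ∧ (∀ a ∈ S, N a = ofMat (conormal ρ a)) ∧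
      ∀ ij, ∃ r, IsQR r ∧ ∀ a ∈ V, a t₀ = 0 → ∀ᶠ z in 𝓝 a, N z ij = r z := by
  obtain ⟨m, p, A, hA, hp, hf⟩ := h.exists_conormal_eq
  have : ∀ ij : ι × ι, ∃ r F : (ι → ℝ) → ℝ, IsQR r ∧ ContDiff ℝ (⊤ : ℕ∞) F ∧
      (∀ a ∈ V, a t₀ = 0 → ∀ᶠ z in 𝓝 a, F z = r z) ∧
      ∀ a ∈ S, F a = conormal ρ a ij.1 ij.2 := fun ij => by
    have hr : IsQR fun z => ∑ j, A ij.1 j z * polyGradQ (p j) (flat t₀ z) ij.2 :=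
      IsQR.sum fun j _ => (hA ij.1 j).mul
        (((IsQP.aeval (pderiv ij.2 (p j))).comp (isQP_flat t₀)).isQR)
    obtain ⟨F, hF, hF1, hF2⟩ := exists_glue h.compact h.isCompact_base (P := fun _ => True)
      (fun a ha => smoothNear_conormal (h.tub.smooth a ha) ij.1 ij.2) hr.contDiff
      (fun a ha => by
        filter_upwards [hf a ha.1 ha.2] with z hz hzS
        refine ⟨?_, trivial⟩
        rw [(hz hzS).2]
        rfl)
    exact ⟨_, F, hr, hF, fun a ha ha0 => hF1 a ⟨ha, ha0⟩, fun a ha => (hF2 a ha).1⟩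
  choose r F hr hF hFr hFS using this
  refine ⟨fun z ij => F ij z, contDiff_pi.2 hF, fun a ha => _root_.funext fun ij => hFS ij a ha,
    fun ij => ⟨r ij, hr ij, hFr ij⟩⟩

/-- The displacement `z ↦ z - ρ z` of a spine agrees to first order with a smooth map which is
rational near the rational part of the base. -/
theorem exists_displacement (h : IsSpine t₀ c S V ρ) :
    ∃ G : (ι → ℝ) → ι → ℝ, ContDiff ℝ (⊤ : ℕ∞) G ∧
      (∀ a ∈ S, G a = 0 ∧ ∀ v, fderiv ℝ G a v = conormal ρ a *ᵥ v) ∧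
      ∀ i, ∃ r, IsQR r ∧ ∀ a ∈ V, a t₀ = 0 → ∀ᶠ z in 𝓝 a, G z i = r z := by
  obtain ⟨m, p, A, hA, hp, hf⟩ := h.exists_conormal_eq
  have hfd : ∀ i, ∀ a ∈ S, HasFDerivAt (fun z => z i - ρ z i)
      ((ContinuousLinearMap.proj (R := ℝ) (φ := fun _ : ι => ℝ) i).comp
        (ContinuousLinearMap.id ℝ _ - fderiv ℝ ρ a)) a := fun i a ha => by
    have hd : HasFDerivAt ρ (fderiv ℝ ρ a) a :=
      ((h.tub.smooth a ha).self_of_nhds.differentiableAt infty_ne_zero').hasFDerivAt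
    exact (ContinuousLinearMap.proj (R := ℝ) (φ := fun _ : ι => ℝ) i).hasFDerivAt.comp a
      ((hasFDerivAt_id a).sub hd)
  have : ∀ i : ι, ∃ r F : (ι → ℝ) → ℝ, IsQR r ∧ ContDiff ℝ (⊤ : ℕ∞) F ∧
      (∀ a ∈ V, a t₀ = 0 → ∀ᶠ z in 𝓝 a, F z = r z) ∧
      ∀ a ∈ S, F a = 0 ∧ ∀ v, fderiv ℝ F a v = (conormal ρ a *ᵥ v) i := fun i => by
    have hr : IsQR fun z => ∑ j, A i j z * aeval (flat t₀ z) (p j) :=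
      IsQR.sum fun j _ => (hA i j).mul ((IsQP.aeval (p j)).comp (isQP_flat t₀)).isQR
    have hrd : ∀ z ∈ V, ∀ v, fderiv ℝ (fun z => ∑ j, A i j z * aeval (flat t₀ z) (p j)) z v =
        (((Matrix.of fun i j => A i j z) * Matrix.of fun j => polyGradQ (p j) (flat t₀ z)) *ᵥ
          flat t₀ v) i := fun z hz v => by
      have h0 := (hp _).1 ((h.inv z).1 hz)
      have e1 : ∀ j, HasFDerivAt (fun z => aeval (flat t₀ z) (p j))
          ((dotL (polyGradQ (p j) (flat t₀ z))).comp (flat t₀)) z := fun j =>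
        (hasStrictFDerivAt_aeval (p j) (flat t₀ z)).hasFDerivAt.comp z (flat t₀).hasFDerivAt
      have e2 : HasFDerivAt (fun z => ∑ j, A i j z * aeval (flat t₀ z) (p j)) _ z :=
        HasFDerivAt.fun_sum fun j (_ : j ∈ Finset.univ) =>
          (((hA i j).contDiff.differentiable infty_ne_zero' z).hasFDerivAt.mul (e1 j))
      rw [e2.fderiv, ← mulVec_mulVec]
      simp only [_root_.sum_apply, _root_.smul_apply, h0, zero_smul, add_zero, smul_eq_mul,
        ContinuousLinearMap.comp_apply, dotL_apply, mulVec, dotProduct, of_apply]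
    obtain ⟨F, hF, hF1, hF2⟩ := exists_glue h.compact h.isCompact_base
      (P := fun z => fderiv ℝ (fun z => z i - ρ z i) z =
        fderiv ℝ (fun z => ∑ j, A i j z * aeval (flat t₀ z) (p j)) z)
      (f := fun z => z i - ρ z i)
      (fun a ha => ((contDiff_apply ℝ ℝ i).smoothNear a).sub ((h.tub.smooth a ha).apply i))
      hr.contDiff (fun a ha => by
        filter_upwards [hf a ha.1 ha.2, eventually_abs_lt ha.2 one_pos] with z hz ht hzS
        obtain ⟨hzV, hzN⟩ := hz hzS
        constructor
        · show z i - ρ z i = _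
          rw [h.tub.self z hzS, sub_self]
          refine (Finset.sum_eq_zero fun j _ => ?_).symm
          rw [(hp _).1 ((h.inv z).1 hzV) j, mul_zero]
        · ext v
          rw [hrd z hzV, ← hzN, (hfd i z hzS).fderiv, flat_eq, mulVec_sub, mulVec_smul,
            h.conormal_single hzS ht, smul_zero, sub_zero, conormal_mulVec]
          rfl)
    refine ⟨_, F, hr, hF, fun a ha ha0 => hF1 a ⟨ha, ha0⟩, fun a ha => ⟨?_, fun v => ?_⟩⟩
    · rw [(hF2 a ha).1]
      show a i - ρ a i = 0
      rw [h.tub.self a ha, sub_self]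
    · rw [(hF2 a ha).2 (fun e => e), (hfd i a ha).fderiv, conormal_mulVec]
      rfl
  choose r F hr hF hFr hFS using this
  refine ⟨fun z i => F i z, contDiff_pi.2 hF, fun a ha => ⟨_root_.funext fun i => (hFS i a ha).1,
    fun v => ?_⟩, fun i => ⟨r i, hr i, hFr i⟩⟩
  rw [fderiv_pi fun i => (hF i).differentiable infty_ne_zero' a]
  ext i
  exact (hFS i a ha).2 v

/-- A smooth map on a spine which is regular over `ℚ` on the rational part of the base, composed
with the stereographic projection, extends from the base to a smooth map which is rational
near the rational part of the base. -/
theorem exists_stereo_extension (h : IsSpine t₀ c S V ρ) {q : ℕ} {φ : (ι → ℝ) → Fin q → ℝ}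
    (hφ : ContDiffOn ℝ (⊤ : ℕ∞) φ S) (hφQ : IsQRegularMap {z | z ∈ V ∧ z t₀ = 0} φ) :
    ∃ σ : (ι → ℝ) → Option (Fin q) → ℝ, ContDiff ℝ (⊤ : ℕ∞) σ ∧
      (∀ a ∈ S, σ a ∈ stereo '' (φ '' S)) ∧ (∀ a ∈ S, a t₀ = 0 → σ a = stereo (φ a)) ∧
      ∀ o, ∃ r, IsQR r ∧ ∀ a ∈ V, a t₀ = 0 → ∀ᶠ z in 𝓝 a, σ z o = r z := by
  obtain ⟨b, hb, hb0, hb1, hbI⟩ := exists_contDiff_bump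
    (s := Metric.closedBall (0 : ℝ) (1 / 4)) (t := (Metric.ball (0 : ℝ) (1 / 2))ᶜ)
    Metric.isClosed_closedBall Metric.isOpen_ball.isClosed_compl
    (Set.disjoint_compl_right_iff_subset.2 (Metric.closedBall_subset_ball (by norm_num)))
  rw [eventually_nhdsSet_iff_forall] at hb0 hb1
  let K : (ι → ℝ) → ι → ℝ := fun z => flat t₀ z + (z t₀ * b (z t₀)) • Pi.single t₀ 1
  have hK : ContDiff ℝ (⊤ : ℕ∞) K := (flat t₀).contDiff.add
    (((contDiff_apply ℝ ℝ t₀).mul (hb.comp (contDiff_apply ℝ ℝ t₀))).smul contDiff_const)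
  have hKS : ∀ z ∈ S, K z ∈ S := fun z hz => by
    by_cases ht : |z t₀| < 1 / 2
    · have h1 : flat t₀ z ∈ S := (h.cyl z (by linarith)).1 hz
      have h2 : K z t₀ = z t₀ * b (z t₀) := by simp [K]
      have h3 : |K z t₀| < 1 := by
        rw [h2, abs_mul, abs_of_nonneg (hbI _).1]
        nlinarith [(hbI (z t₀)).1, (hbI (z t₀)).2, abs_nonneg (z t₀)]
      rw [h.cyl _ h3]
      simpa only [K, flat_add_single, flat_flat] using h1
    · have : b (z t₀) = 1 := (hb1 _ (by simpa using ht)).self_of_nhds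
      have e : K z = z := by simp only [K, this, flat_eq, mul_one]; abel
      rwa [e]
  have hK0 : ∀ z : ι → ℝ, |z t₀| ≤ 1 / 4 → K z = flat t₀ z := fun z hz => by
    have : b (z t₀) = 0 := (hb0 _ (by simpa using hz)).self_of_nhds
    simp only [K, this, mul_zero, zero_smul, add_zero]
  have hρS : ∀ a ∈ S, ∀ᶠ z in 𝓝 a, ρ z ∈ S := fun a ha => by
    have h1 : Tendsto (fun z => (ρ z, z)) (𝓝 a) (𝓝 (a, a)) := by
      have := (h.tub.smooth a ha).self_of_nhds.continuousAt.tendsto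
      rw [h.tub.self a ha] at this
      exact this.prodMk_nhds tendsto_id
    filter_upwards [h1.eventually (h.tub.rel a ha)] with z hz
    exact (hz.2 rfl).1
  have hsm : ∀ a ∈ S, SmoothNear (fun z => stereo (φ (K (ρ z)))) a := fun a ha => by
    filter_upwards [(hρS a ha).eventually_nhds, h.tub.smooth a ha] with z h1 h2
    have h3 : ContDiffAt ℝ (⊤ : ℕ∞) (fun z => K (ρ z)) z := hK.contDiffAt.comp z h2
    have h4 : ContDiffWithinAt ℝ (⊤ : ℕ∞) φ S (K (ρ z)) := hφ _ (hKS _ h1.self_of_nhds)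
    have h5 : ContDiffWithinAt ℝ (⊤ : ℕ∞) (fun z => φ (K (ρ z))) {z | ρ z ∈ S} z :=
      h4.comp z h3.contDiffWithinAt fun w hw => hKS _ hw
    exact contDiff_stereo.contDiffAt.comp z (h5.contDiffAt h1)
  have hreg : ∀ i, ∃ r, IsQR r ∧ ∀ z ∈ V, r z = φ (flat t₀ z) i := fun i => by
    obtain ⟨P, Q, hQ, hPQ⟩ := hφQ i
    obtain ⟨r, hr, hrV⟩ := h.exists_isQR (IsQP.aeval P) (IsQP.aeval Q) fun z hz h0 => hQ z ⟨hz, h0⟩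
    exact ⟨r, hr, fun z hz => by rw [hrV z hz, hPQ _ ⟨(h.inv z).1 hz, by simp⟩]⟩
  choose r hr hrV using hreg
  have hden : IsQR fun z => 1 + ∑ i, r i z ^ 2 := by
    refine IsQP.one.isQR.add (IsQR.sum fun i _ => ?_)
    simp only [pow_two]
    exact (hr i).mul (hr i)
  have hst : ∀ o, IsQR fun z => stereo (fun i => r i z) o := fun o => by
    refine IsQR.div ?_ hden fun z => (stereo_den_pos fun i => r i z).ne'
    cases o with
    | none => exact IsQP.one.isQR
    | some i => exact hr i
  have : ∀ o, ∃ F : (ι → ℝ) → ℝ, ContDiff ℝ (⊤ : ℕ∞) F ∧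
      (∀ a ∈ V, a t₀ = 0 → ∀ᶠ z in 𝓝 a, F z = stereo (fun i => r i z) o) ∧
      ∀ a ∈ S, F a = stereo (φ (K (ρ a))) o := fun o => by
    obtain ⟨F, hF, hF1, hF2⟩ := exists_glue h.compact h.isCompact_base (P := fun _ => True)
      (fun a ha => (hsm a ha).apply o) (hst o).contDiff
      (fun a ha => by
        filter_upwards [h.loc a ha.1 ha.2, eventually_abs_lt ha.2 (r := 1 / 4) (by norm_num)]
          with z hz ht hzS
        refine ⟨?_, trivial⟩
        rw [h.tub.self z hzS, hK0 z ht.le]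
        congr 1
        exact _root_.funext fun i => (hrV i z (hz hzS)).symm)
    exact ⟨F, hF, fun a ha ha0 => hF1 a ⟨ha, ha0⟩, fun a ha => (hF2 a ha).1⟩
  choose F hF hFr hFS using this
  have hFK : ∀ a ∈ S, (fun o => F o a) = stereo (φ (K a)) := fun a ha => _root_.funext fun o => by
    rw [hFS o a ha, h.tub.self a ha]
  refine ⟨fun z o => F o z, contDiff_pi.2 hF, fun a ha => ?_, fun a ha h0 => ?_,
    fun o => ⟨_, hst o, hFr o⟩⟩
  · exact ⟨_, ⟨K a, hKS a ha, rfl⟩, (hFK a ha).symm⟩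
  · show (fun o => F o a) = _
    rw [hFK a ha, hK0 a (by rw [h0]; norm_num), flat_eq_iff.2 h0]

end IsSpine

end SpineBase

section Uniform

open Filter Topology Metric

theorem IsCompact.exists_uniform {X : Type*} [PseudoMetricSpace X] {K : Set X} (hK : IsCompact K)
    {Q : ℕ → X → Prop} (h : ∀ a ∈ K, ∀ᶠ p in (atTop : Filter ℕ) ×ˢ 𝓝 a, Q p.1 p.2) :
    ∃ δ > 0, ∀ᶠ k in atTop, ∀ a ∈ K, ∀ z, dist z a < δ → Q k z := by
  refine hK.induction_on (p := fun s => ∃ δ > 0, ∀ᶠ k in atTop, ∀ a ∈ s, ∀ z, dist z a < δ → Q k z)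
    ⟨1, one_pos, by simp⟩ ?_ ?_ fun a ha => ?_
  · rintro s t hst ⟨δ, hδ, h⟩
    exact ⟨δ, hδ, h.mono fun k hk a ha => hk a (hst ha)⟩
  · rintro s t ⟨δ, hδ, h⟩ ⟨δ', hδ', h'⟩
    refine ⟨min δ δ', lt_min hδ hδ', ?_⟩
    filter_upwards [h, h'] with k hk hk' a ha z hz
    rcases ha with ha | ha
    · exact hk a ha z (hz.trans_le (min_le_left _ _))
    · exact hk' a ha z (hz.trans_le (min_le_right _ _))
  · obtain ⟨pa, hpa, pb, hpb, hab⟩ := eventually_prod_iff.1 (h a ha)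
    obtain ⟨ε, hε, hball⟩ := Metric.eventually_nhds_iff.1 hpb
    refine ⟨ball a (ε / 2), mem_nhdsWithin_of_mem_nhds (ball_mem_nhds a (half_pos hε)), ε / 2,
      half_pos hε, ?_⟩
    filter_upwards [hpa] with k hk b hb z hz
    refine hab hk (hball ?_)
    have := dist_triangle z b a
    rw [mem_ball] at hb
    linarith

variable {E : Type*} [NormedAddCommGroup E] [NormedSpace ℝ E] [CompleteSpace E]

theorem exists_preimage_of_contracting {f : E → E} {a : E} {r : ℝ} (hr : 0 ≤ r)
    (hf : ∀ z ∈ closedBall a r, ∀ w ∈ closedBall a r, ‖f z - f w - (z - w)‖ ≤ ‖z - w‖ / 2)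
    (ha : ‖f a - a‖ ≤ r / 2) : ∃ z ∈ closedBall a r, f z = a := by
  let g : E → E := fun z => z - f z + a
  have hg : Set.MapsTo g (closedBall a r) (closedBall a r) := fun z hz => by
    have h1 := hf z hz a (mem_closedBall_self hr)
    rw [mem_closedBall, dist_eq_norm] at hz ⊢
    have h2 : g z - a = -(f z - f a - (z - a)) - (f a - a) := by simp only [g]; abel
    rw [h2]
    have h3 := norm_sub_le (-(f z - f a - (z - a))) (f a - a)
    rw [norm_neg] at h3
    linarith
  have hc : ContractingWith (1 / 2) (hg.restrict g _ _) := by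
    refine ⟨by rw [← NNReal.coe_lt_coe]; norm_num, LipschitzWith.of_dist_le_mul fun z w => ?_⟩
    have h1 := hf z z.2 w w.2
    rw [Subtype.dist_eq, Subtype.dist_eq, dist_eq_norm, dist_eq_norm]
    have h2 : g z - g w = -(f z - f w - (z - w)) := by simp only [g]; abel
    show ‖g z - g w‖ ≤ _
    rw [h2, norm_neg]
    push_cast
    linarith
  obtain ⟨z, hz, hfz, -⟩ := hc.exists_fixedPoint' isClosed_closedBall.isComplete hg
    (mem_closedBall_self hr) (edist_ne_top _ _)
  refine ⟨z, hz, ?_⟩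
  have : z - f z + a = z := hfz
  have h2 : f z - a = z - (z - f z + a) := by abel
  rwa [this, sub_self, sub_eq_zero] at h2

/-- A sequence of maps converging to the identity, in the `C¹` sense, near a compact set. -/
theorem exists_thickening_of_hasC1Lim_id [FiniteDimensional ℝ E] {K : Set E} (hK : IsCompact K)
    {Θ : ℕ → E → E}
    (h : ∀ a ∈ K, HasC1Lim Θ a a (ContinuousLinearMap.id ℝ E)) {r₀ : ℝ} (hr₀ : 0 < r₀) :
    ∃ r > 0, r ≤ r₀ ∧ ∀ᶠ k in atTop, (∀ z ∈ thickening r K, SmoothNear (Θ k) z ∧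
      Function.Injective (fderiv ℝ (Θ k) z)) ∧ Set.InjOn (Θ k) (thickening r K) ∧
      ∀ a ∈ K, ∃ z, dist z a < r ∧ Θ k z = a := by
  have h1 : ∀ a ∈ K, ∀ᶠ p in (atTop : Filter ℕ) ×ˢ 𝓝 a, SmoothNear (Θ p.1) p.2 ∧
      ‖fderiv ℝ (Θ p.1) p.2 - ContinuousLinearMap.id ℝ E‖ < 1 / 2 := fun a ha => by
    obtain ⟨e1, -, e2⟩ := h a ha
    have e3 := ((e2.sub_const (ContinuousLinearMap.id ℝ E)).norm).eventually
      (gt_mem_nhds (b := ‖ContinuousLinearMap.id ℝ E - ContinuousLinearMap.id ℝ E‖) (a := 1 / 2)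
        (by rw [sub_self, norm_zero]; norm_num))
    exact (eventually_prod_nhds (P := fun k z => ContDiffAt ℝ (⊤ : ℕ∞) (Θ k) z) e1).and e3
  obtain ⟨δ, hδ, hU⟩ := hK.exists_uniform (Q := fun k z => SmoothNear (Θ k) z ∧
      ‖fderiv ℝ (Θ k) z - ContinuousLinearMap.id ℝ E‖ < 1 / 2) h1
  set r := min (δ / 4) r₀ with hrdef
  have hr : 0 < r := lt_min (by linarith) hr₀
  have hrδ : 4 * r ≤ δ := by have := min_le_left (δ / 4) r₀; linarith
  have h2 : ∀ a ∈ K, ∀ᶠ p in (atTop : Filter ℕ) ×ˢ 𝓝 (a, a), dist (Θ p.1 p.2.1) p.2.2 < r / 8 :=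
    fun a ha => by
      have e1 : Tendsto (fun p : ℕ × E × E => (p.1, p.2.1)) (atTop ×ˢ 𝓝 (a, a)) (atTop ×ˢ 𝓝 a) :=
        tendsto_fst.prodMk ((continuous_fst.tendsto (a, a)).comp tendsto_snd)
      have e2 : Tendsto (fun p : ℕ × E × E => Θ p.1 p.2.1) (atTop ×ˢ 𝓝 (a, a)) (𝓝 a) :=
        (h a ha).tendsto.comp e1
      have e3 : Tendsto (fun p : ℕ × E × E => p.2.2) ((atTop : Filter ℕ) ×ˢ 𝓝 (a, a)) (𝓝 a) :=
        (continuous_snd.tendsto (a, a)).comp tendsto_snd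
      exact (e2.dist e3).eventually (gt_mem_nhds (by rw [dist_self]; linarith))
  obtain ⟨δ', hδ', hU'⟩ := (hK.image (f := fun a => (a, a)) (by fun_prop)).exists_uniform
    (Q := fun k w => dist (Θ k w.1) w.2 < r / 8) (by rintro _ ⟨a, ha, rfl⟩; exact h2 a ha)
  refine ⟨r, hr, min_le_right _ _, ?_⟩
  filter_upwards [hU, hU'] with k hk hk'
  have hfix : ∀ a ∈ K, ‖Θ k a - a‖ < r / 8 := fun a ha => by
    rw [← dist_eq_norm]
    exact hk' _ ⟨a, ha, rfl⟩ (a, a) (by rw [dist_self]; exact hδ')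
  have hlip : ∀ a ∈ K, ∀ z ∈ ball a (4 * r), ∀ w ∈ ball a (4 * r),
      ‖Θ k z - Θ k w - (z - w)‖ ≤ ‖z - w‖ / 2 := fun a ha z hz w hw => by
    have e := (convex_ball a (4 * r)).norm_image_sub_le_of_norm_hasFDerivWithin_le'
      (f := Θ k) (f' := fderiv ℝ (Θ k)) (φ := ContinuousLinearMap.id ℝ E) (C := 1 / 2)
      (fun x hx => ((hk a ha x ((mem_ball.1 hx).trans_le hrδ)).1.self_of_nhds.differentiableAt
        infty_ne_zero').hasFDerivAt.hasFDerivWithinAt)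
      (fun x hx => (hk a ha x ((mem_ball.1 hx).trans_le hrδ)).2.le) hw hz
    simp only [ContinuousLinearMap.id_apply] at e
    linarith
  have hmove : ∀ a ∈ K, ∀ z, dist z a < r → ‖Θ k z - z‖ < r := fun a ha z hz => by
    have e1 := hlip a ha z (mem_ball.2 (by linarith)) a (mem_ball_self (by linarith))
    have e2 := hfix a ha
    have e3 : Θ k z - z = (Θ k z - Θ k a - (z - a)) + (Θ k a - a) := by abel
    rw [e3]
    rw [dist_eq_norm] at hz
    have := norm_add_le (Θ k z - Θ k a - (z - a)) (Θ k a - a)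
    linarith
  refine ⟨fun z hz => ?_, fun z hz w hw hzw => ?_, fun a ha => ?_⟩
  · obtain ⟨a, ha, hza⟩ := mem_thickening_iff.1 hz
    obtain ⟨e1, e2⟩ := hk a ha z (by linarith)
    refine ⟨e1, (injective_iff_map_eq_zero _).2 fun v hv => ?_⟩
    have e3 := (fderiv ℝ (Θ k) z - ContinuousLinearMap.id ℝ E).le_opNorm v
    rw [_root_.sub_apply, hv, zero_sub, norm_neg, ContinuousLinearMap.id_apply] at e3
    have := norm_nonneg v
    exact norm_eq_zero.1 (by nlinarith)
  · obtain ⟨a, ha, hza⟩ := mem_thickening_iff.1 hz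
    obtain ⟨b, hb, hwb⟩ := mem_thickening_iff.1 hw
    have e1 := hmove a ha z hza
    have e2 := hmove b hb w hwb
    have e3 : ‖z - w‖ < 2 * r := by
      have e4 : z - w = (Θ k w - w) - (Θ k z - z) := by rw [hzw]; abel
      rw [e4]
      have := norm_sub_le (Θ k w - w) (Θ k z - z)
      linarith
    have e5 : dist w a < 4 * r := by
      have e6 := dist_triangle w z a
      rw [dist_comm w z, dist_eq_norm z w] at e6
      linarith
    have e7 := hlip a ha z (mem_ball.2 (by linarith)) w (mem_ball.2 e5)
    rw [hzw, sub_self, zero_sub, norm_neg] at e7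
    have := norm_nonneg (z - w)
    exact sub_eq_zero.1 (norm_eq_zero.1 (by linarith))
  · obtain ⟨z, hz, hza⟩ := exists_preimage_of_contracting (f := Θ k) (a := a) (r := r / 2)
      (by linarith) (fun z hz w hw => hlip a ha z (mem_ball.2 ((mem_closedBall.1 hz).trans_lt
        (by linarith))) w (mem_ball.2 ((mem_closedBall.1 hw).trans_lt (by linarith))))
      (by have := hfix a ha; linarith)
    exact ⟨z, (mem_closedBall.1 hz).trans_lt (by linarith), hza⟩

end Uniform

section Core

open Filter Topology Matrix Metric

theorem HasC1Lim.mulVec {E ι κ : Type*} [NormedAddCommGroup E] [NormedSpace ℝ E] [Fintype ι]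
    [Fintype κ] {A : ℕ → E → Matrix κ ι ℝ} {A₀ : Matrix κ ι ℝ} {v : ℕ → E → ι → ℝ} {z : E}
    {v' : E →L[ℝ] ι → ℝ}
    (hA : ∀ i j, ∃ b', HasC1Lim (fun k z => A k z i j) z (A₀ i j) b') (hv : HasC1Lim v z 0 v') :
    HasC1Lim (fun k z => A k z *ᵥ v k z) z 0
      ((LinearMap.toContinuousLinearMap A₀.mulVecLin).comp v') := by
  choose b' hb' using hA
  refine HasC1Lim.pi fun i => ?_
  have h := HasC1Lim.sum (s := Finset.univ) (a := fun j k z => A k z i j * v k z j)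
    fun j _ => (hb' i j).mul (hv.clm (ContinuousLinearMap.proj j : (ι → ℝ) →L[ℝ] ℝ))
  convert h using 1
  · rfl
  · simp
  · ext u
    simp [_root_.sum_apply, Matrix.mulVec, dotProduct]

/-- Smooth data along a compact manifold `S`, with values in an algebraic target, that are rational
near the set of zeros of `pp`. -/
structure IsCore {ι κ J : Type*} [Fintype ι] [DecidableEq ι] [Fintype κ] [DecidableEq κ]
    (t₀ : ι) (c : ℕ) (S : Set (ι → ℝ)) (ρ : (ι → ℝ) → ι → ℝ) (pp kap : (ι → ℝ) → ℝ)
    (R : J → (κ → ℝ) → (κ → ℝ) → ℝ) (τ : (κ → ℝ) → κ → ℝ) (P : (κ → ℝ) → Matrix ι ι ℝ)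
    (Φ : (ι → ℝ) → κ → ℝ) (G : (ι → ℝ) → ι → ℝ) : Prop where
  compact : IsCompact S
  tub : IsTubular c S S ρ
  cyl : ∀ z : ι → ℝ, |z t₀| < 1 → (z ∈ S ↔ flat t₀ z ∈ S)
  target : IsTarget R (Φ '' S) τ
  isQP_P : ∀ i j, IsQP fun y => P y i j
  P_comp : ∀ a ∈ S, P (Φ a) = conormal ρ a
  P_mul_self : ∀ y x, (∀ j, R j y x = 0) → P y * P y = P y
  smooth_Φ : ContDiff ℝ (⊤ : ℕ∞) Φ
  smooth_G : ContDiff ℝ (⊤ : ℕ∞) G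
  G_zero : ∀ a ∈ S, G a = 0
  G_deriv : ∀ a ∈ S, ∀ v, fderiv ℝ G a v = conormal ρ a *ᵥ v
  isQP_pp : IsQP pp
  pp_mem : ∀ z, pp z = 0 → z ∈ S ∧ z t₀ = 0
  pp_loc : ∀ a, pp a = 0 → ∀ᶠ z in 𝓝 a, z ∈ S → z t₀ = 0 → pp z = 0
  Φ_rat : ∀ i, ∃ r, IsQR r ∧ ∀ a, pp a = 0 → ∀ᶠ z in 𝓝 a, Φ z i = r z
  G_rat : ∀ i, ∃ r, IsQR r ∧ ∀ a, pp a = 0 → ∀ᶠ z in 𝓝 a, G z i = r z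
  isQP_kap : IsQP kap
  kap_nonneg : ∀ z, 0 ≤ kap z
  kap_zero : ∀ z, pp z = 0 → kap z = 0
  kap_top : ∃ D T, 1 < D ∧ HasTop kap D T ∧ ∀ x, x ≠ 0 → 0 < T x

namespace IsCore

variable {ι κ J : Type*} [Fintype ι] [DecidableEq ι] [Fintype κ] [DecidableEq κ]
  {t₀ : ι} {c : ℕ} {S : Set (ι → ℝ)} {ρ : (ι → ℝ) → ι → ℝ} {pp kap : (ι → ℝ) → ℝ}
  {R : J → (κ → ℝ) → (κ → ℝ) → ℝ} {τ : (κ → ℝ) → κ → ℝ} {P : (κ → ℝ) → Matrix ι ι ℝ}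
  {Φ : (ι → ℝ) → κ → ℝ} {G : (ι → ℝ) → ι → ℝ}

theorem rel_self (h : IsCore t₀ c S ρ pp kap R τ P Φ G) {a : ι → ℝ} (ha : a ∈ S) (j : J) :
    R j (Φ a) (Φ a) = 0 :=
  ((h.target.rel _ ⟨a, ha, rfl⟩).self_of_nhds.2 (h.target.self _ ⟨a, ha, rfl⟩).symm) j

theorem conormal_mul_self (h : IsCore t₀ c S ρ pp kap R τ P Φ G) {a : ι → ℝ} (ha : a ∈ S) :
    conormal ρ a * conormal ρ a = conormal ρ a := by
  rw [← h.P_comp a ha]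
  exact h.P_mul_self _ _ (h.rel_self ha)

theorem smoothNear_P (h : IsCore t₀ c S ρ pp kap R τ P Φ G) (i j : ι) (y : κ → ℝ) :
    SmoothNear (fun y => P y i j) y :=
  ((h.isQP_P i j).contDiff (n := ((⊤ : ℕ∞) : WithTop ℕ∞))).smoothNear y

theorem hasC1Lim_target (h : IsCore t₀ c S ρ pp kap R τ P Φ G) {Φs : ℕ → (ι → ℝ) → κ → ℝ}
    {a : ι → ℝ} (ha : a ∈ S) {Φ' : (ι → ℝ) →L[ℝ] κ → ℝ} (hΦ : HasC1Lim Φs a (Φ a) Φ') :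
    HasC1Lim (fun k z => τ (Φs k z)) a (Φ a) ((fderiv ℝ τ (Φ a)).comp Φ') := by
  have := hΦ.comp (h.target.smooth _ ⟨a, ha, rfl⟩)
  rwa [h.target.self _ ⟨a, ha, rfl⟩] at this

theorem hasC1Lim_psi (h : IsCore t₀ c S ρ pp kap R τ P Φ G) {Φs : ℕ → (ι → ℝ) → κ → ℝ}
    {Gs : ℕ → (ι → ℝ) → ι → ℝ} {a : ι → ℝ} (ha : a ∈ S) {Φ' : (ι → ℝ) →L[ℝ] κ → ℝ}
    (hΦ : HasC1Lim Φs a (Φ a) Φ') (hG : HasC1Lim Gs a (G a) (fderiv ℝ G a)) :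
    HasC1Lim (fun k z => ρ z + conormal ρ (ρ z) *ᵥ (P (τ (Φs k z)) *ᵥ Gs k z)) a a
      (ContinuousLinearMap.id ℝ (ι → ℝ)) := by
  have hρ := h.tub.smooth a ha
  have hρa := h.tub.self a ha
  rw [h.G_zero a ha] at hG
  have h1 := HasC1Lim.mulVec (A := fun k z => P (τ (Φs k z))) (A₀ := P (Φ a))
    (fun i j => ⟨_, (h.hasC1Lim_target ha hΦ).comp (h.smoothNear_P i j _)⟩) hG
  have h2 := HasC1Lim.mulVec (A := fun k z => conormal ρ (ρ z)) (A₀ := conormal ρ a)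
    (fun i j => ⟨_, by
      have := HasC1Lim.const (z := a) (SmoothNear.comp (f := ρ)
        (g := fun z => conormal ρ z i j) (by rw [hρa]; exact smoothNear_conormal hρ i j) hρ)
      simp only [hρa] at this
      exact this⟩) h1
  have h3 := (HasC1Lim.const hρ).add h2
  rw [hρa, add_zero] at h3
  convert h3 using 1
  ext1 v
  simp only [ContinuousLinearMap.id_apply, _root_.add_apply, ContinuousLinearMap.comp_apply,
    LinearMap.coe_toContinuousLinearMap', Matrix.mulVecLin_apply, h.G_deriv a ha, h.P_comp a ha]
  rw [mulVec_mulVec, mulVec_mulVec, h.conormal_mul_self ha, h.conormal_mul_self ha,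
    conormal_mulVec]
  abel

theorem eventually_of_system (h : IsCore t₀ c S ρ pp kap R τ P Φ G) {a : ι → ℝ} (ha : a ∈ S) :
    ∀ᶠ w in 𝓝 (a, Φ a), (∀ j, R j w.2 (Φ w.1) = 0) → P w.2 *ᵥ G w.1 = 0 →
      w.1 ∈ S ∧ w.2 = Φ w.1 := by
  have h1 := h.hasC1Lim_psi ha (HasC1Lim.const (h.smooth_Φ.smoothNear a))
    (HasC1Lim.const (h.smooth_G.smoothNear a))
  obtain ⟨r, hr, -, h2⟩ := exists_thickening_of_hasC1Lim_id (isCompact_singleton (x := a))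
    (fun b hb => by rw [Set.mem_singleton_iff.1 hb]; exact h1) one_pos
  obtain ⟨-, -, hinj, -⟩ := h2.exists
  rw [thickening_singleton] at hinj
  have hρ := h.tub.smooth a ha
  have hρa := h.tub.self a ha
  have hc : Tendsto ρ (𝓝 a) (𝓝 a) := by
    have := hρ.self_of_nhds.continuousAt.tendsto
    rwa [hρa] at this
  have hb : ∀ᶠ z in 𝓝 a, z ∈ ball a r := ball_mem_nhds a hr
  have hrel : ∀ᶠ z in 𝓝 a, ρ z ∈ S := by
    have : Tendsto (fun z => (ρ z, z)) (𝓝 a) (𝓝 (a, a)) := hc.prodMk_nhds tendsto_id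
    filter_upwards [this.eventually (h.tub.rel a ha)] with z hz using (hz.2 rfl).1
  have hT : Tendsto (fun w : (ι → ℝ) × (κ → ℝ) => (w.2, Φ w.1)) (𝓝 (a, Φ a))
      (𝓝 (Φ a, Φ a)) :=
    (continuous_snd.prodMk (h.smooth_Φ.continuous.comp continuous_fst)).tendsto _
  filter_upwards [continuousAt_fst.eventually (p := fun z => z ∈ ball a r) hb,
    continuousAt_fst.eventually (p := fun z => ρ z ∈ ball a r) (hc.eventually hb),
    continuousAt_fst.eventually (p := fun z => ρ z ∈ S) hrel,
    hT.eventually (h.target.rel _ ⟨a, ha, rfl⟩)] with w h3 h4 h5 h6 h7 h8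
  have h9 := h6.1 h7
  have h10 : w.1 = ρ w.1 := by
    refine hinj h3 h4 ?_
    dsimp only at h9 ⊢
    rw [← h9, h8, h.tub.self _ h5, h.G_zero _ h5]
    simp
  have h11 : w.1 ∈ S := h10 ▸ h5
  exact ⟨h11, h9.trans (h.target.self _ ⟨_, h11, rfl⟩)⟩

end IsCore

end Core

section System

open Filter Topology Matrix Metric

theorem HasC1Lim.mul_sq {E : Type*} [NormedAddCommGroup E] [NormedSpace ℝ E] {f : E → ℝ}
    {u : ℕ → E → ℝ} {z : E} {u' : E →L[ℝ] ℝ} (hf : SmoothNear f z) (hu : HasC1Lim u z 0 u') :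
    HasC1Lim (fun k z => f z * u k z ^ 2) z 0 0 := by
  have := (HasC1Lim.const hf).mul (hu.mul hu)
  simpa [pow_two] using this

theorem isCompact_sum_sq_le {ι : Type*} [Fintype ι] (r : ℝ) :
    IsCompact {x : ι → ℝ | ∑ i, x i ^ 2 ≤ r} := by
  refine isCompact_of_isClosed_isBounded (isClosed_le (by fun_prop) continuous_const)
    ((isBounded_closedBall (x := 0) (r := 1 + r)).subset fun x hx => ?_)
  have hx : ∑ i, x i ^ 2 ≤ r := hx
  have h0 : 0 ≤ ∑ i, x i ^ 2 := Finset.sum_nonneg fun i _ => sq_nonneg _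
  rw [mem_closedBall_zero_iff]
  refine (pi_norm_le_iff_of_nonneg (by linarith)).2 fun i => ?_
  have h1 : x i ^ 2 ≤ ∑ i, x i ^ 2 :=
    Finset.single_le_sum (f := fun i => x i ^ 2) (fun i _ => sq_nonneg _) (Finset.mem_univ i)
  exact abs_le_of_sq_le_sq (by nlinarith) (by linarith)

theorem IsTarget.exists_bound {κ J : Type*} [Fintype κ] [DecidableEq κ]
    {R : J → (κ → ℝ) → (κ → ℝ) → ℝ} {K : Set (κ → ℝ)} {τ : (κ → ℝ) → κ → ℝ} (h : IsTarget R K τ) :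
    ∃ B : ℝ, ∀ y x, (∀ j, R j y x = 0) → ∑ i, y i ^ 2 ≤ B := by
  obtain ⟨L, hL⟩ := h.quad
  refine ⟨∑ i, (L i : ℝ) ^ 2, fun y x hR => ?_⟩
  have h1 := hL y x hR
  have h2 : ∑ i, (L i : ℝ) * y i ≤ ∑ i, ((L i : ℝ) ^ 2 + y i ^ 2) / 2 :=
    Finset.sum_le_sum fun i _ => by nlinarith [sq_nonneg ((L i : ℝ) - y i)]
  rw [← Finset.sum_div, Finset.sum_add_distrib] at h2
  linarith

theorem IsTarget.continuous {κ J : Type*} [Fintype κ] [DecidableEq κ]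
    {R : J → (κ → ℝ) → (κ → ℝ) → ℝ} {K : Set (κ → ℝ)} {τ : (κ → ℝ) → κ → ℝ} (h : IsTarget R K τ)
    (j : J) : Continuous fun w : (κ → ℝ) × (κ → ℝ) => R j w.1 w.2 := by
  obtain ⟨α, β, hα, hβ, e⟩ := h.affine j
  simp only [e]
  have := hα.continuous
  have := fun i => (hβ i).continuous
  fun_prop

/-- Algebraic equations `R j y (Φs k z) = 0`, `P y *ᵥ Gs k z = 0`, `γs k z y = 0` in `(z, y)`,
rational with rational coefficients, that approximate the graph of `Φ` over the spine of `S`. -/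
structure IsSystem {ι κ J : Type*} [Fintype ι] [DecidableEq ι] [Fintype κ] [DecidableEq κ]
    (t₀ : ι) (S : Set (ι → ℝ)) (pp : (ι → ℝ) → ℝ)
    (R : J → (κ → ℝ) → (κ → ℝ) → ℝ) (τ : (κ → ℝ) → κ → ℝ) (P : (κ → ℝ) → Matrix ι ι ℝ)
    (Φ : (ι → ℝ) → κ → ℝ) (G : (ι → ℝ) → ι → ℝ) (Φs : ℕ → (ι → ℝ) → κ → ℝ)
    (Gs : ℕ → (ι → ℝ) → ι → ℝ) (γs : ℕ → (ι → ℝ) → (κ → ℝ) → ℝ) : Prop where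
  isQR_Φ : ∀ k i, IsQR fun z => Φs k z i
  isQR_G : ∀ k i, IsQR fun z => Gs k z i
  isQP_γ : ∀ k, IsQP fun x : ι ⊕ κ → ℝ => γs k (x ∘ Sum.inl) (x ∘ Sum.inr)
  top_γ : ∀ k, ∃ D T, HasTop (fun x : ι ⊕ κ → ℝ => γs k (x ∘ Sum.inl) (x ∘ Sum.inr)) D T ∧
    ∀ x, 0 ≤ T x ∧ (x ∘ Sum.inl ≠ 0 → 0 < T x)
  lim_Φ : ∀ z, HasC1Lim Φs z (Φ z) (fderiv ℝ Φ z)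
  lim_G : ∀ z, HasC1Lim Gs z (G z) (fderiv ℝ G z)
  Φ_eq : ∀ k z, pp z = 0 → Φs k z = Φ z
  G_eq : ∀ k z, pp z = 0 → Gs k z = 0
  γ_eq : ∀ k z, pp z = 0 → γs k z (Φs k z) = 0
  lim_γ : ∀ a ∈ S, a t₀ = 0 → HasC1Lim (fun k z => γs k z (τ (Φs k z))) a 0
    (ContinuousLinearMap.proj t₀)
  concentrate : ∀ U : Set ((ι → ℝ) × (κ → ℝ)), IsOpen U → (∀ a ∈ S, a t₀ = 0 → (a, Φ a) ∈ U) →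
    ∀ᶠ k in atTop, ∀ z y, (∀ j, R j y (Φs k z) = 0) → P y *ᵥ Gs k z = 0 → γs k z y = 0 →
      (z, y) ∈ U

namespace IsCore

variable {ι κ J : Type*} [Fintype ι] [DecidableEq ι] [Fintype κ] [DecidableEq κ]
  {t₀ : ι} {c : ℕ} {S : Set (ι → ℝ)} {ρ : (ι → ℝ) → ι → ℝ} {pp kap : (ι → ℝ) → ℝ}
  {R : J → (κ → ℝ) → (κ → ℝ) → ℝ} {τ : (κ → ℝ) → κ → ℝ} {P : (κ → ℝ) → Matrix ι ι ℝ}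
  {Φ : (ι → ℝ) → κ → ℝ} {G : (ι → ℝ) → ι → ℝ}

theorem exists_rational_seq {κ' : Type*} [Fintype κ'] {F : (ι → ℝ) → κ' → ℝ}
    (hpp : IsQP pp) (hF : ContDiff ℝ (⊤ : ℕ∞) F)
    (hr : ∀ i, ∃ r, IsQR r ∧ ∀ a, pp a = 0 → ∀ᶠ z in 𝓝 a, F z i = r z) :
    ∃ (g : ℕ → κ' → (ι → ℝ) → ℝ) (Q : κ' → (ι → ℝ) → ℝ), (∀ k i, IsQP (g k i)) ∧
      (∀ i, IsQP (Q i)) ∧ (∀ i z, Q i z ≠ 0) ∧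
      (∀ k z, pp z = 0 → (fun i => g k i z / Q i z) = F z) ∧
      ∀ z, HasC1Lim (fun k z i => g k i z / Q i z) z (F z) (fderiv ℝ F z) := by
  choose r hr hrF using hr
  choose p Q hp hQ hQ0 hpQ using hr
  choose g hg hg0 hlim using fun i => exists_isQP_seq_rel (contDiff_pi.1 hF i) (hp i) (hQ i) hpp
    (hQ0 i) fun x hx => (hrF i x hx).mono fun z hz => hz.trans (hpQ i z)
  refine ⟨fun k i => g i k, Q, fun k i => hg i k, hQ, hQ0,
    fun k z hz => _root_.funext fun i => hg0 i k z hz, fun z => HasC1Lim.pi fun i => ?_⟩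
  convert hlim i z using 1
  rw [fderiv_apply (hF.differentiable (by simp) z)]

theorem exists_radius (h : IsCore t₀ c S ρ pp kap R τ P Φ G) : ∃ r : ℕ, 1 ≤ r ∧
    (∀ z, (r : ℝ) ≤ ∑ i, z i ^ 2 → 0 < z t₀ + kap z) ∧ ∀ z ∈ S, ∑ i, z i ^ 2 < (r : ℝ) := by
  obtain ⟨D, T, hD, hT, hT0⟩ := h.kap_top
  obtain ⟨r₁, -, h1⟩ := HasTop.exists_pos ((IsQP.proj t₀).add h.isQP_kap)
    ((((HasTop.proj t₀).lower hD).add hT).congr fun x => zero_add _) hT0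
  obtain ⟨r₂, h2⟩ := (h.compact.image_of_continuousOn (f := fun z : ι → ℝ => ∑ i, z i ^ 2)
    (by fun_prop)).bddAbove
  obtain ⟨r, hr⟩ := exists_nat_ge (max r₁ (r₂ + 1))
  refine ⟨max r 1, le_max_right _ _, fun z hz => h1 z ?_, fun z hz => ?_⟩
  · exact ((le_max_left _ _).trans hr).trans ((Nat.cast_le.2 (le_max_left _ _)).trans hz)
  · have e1 := h2 ⟨z, hz, rfl⟩
    have e2 := (le_max_right _ _).trans hr
    have e3 : (r : ℝ) ≤ (max r 1 : ℕ) := Nat.cast_le.2 (le_max_left _ _)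
    dsimp only at e1
    linarith

/-- The weight that forces solutions of the system towards the graph of `Φ` over `S`. -/
theorem exists_weight (h : IsCore t₀ c S ρ pp kap R τ P Φ G) {Q : κ → (ι → ℝ) → ℝ}
    (hQ : ∀ i, Continuous (Q i)) (hQ0 : ∀ i z, Q i z ≠ 0) (r : ℕ) (B : ℝ) :
    ∃ (C : ℕ) (H : (ι → ℝ) → ℝ), ContDiff ℝ (⊤ : ℕ∞) H ∧ (∀ᶠ z in nhdsSet S, H z = 0) ∧
      ∀ z y, ∑ i, z i ^ 2 ≤ (r : ℝ) → ∑ i, y i ^ 2 ≤ B →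
        z t₀ + C * (∑ i, Q i z ^ 2 * (y i - Φ z i) ^ 2 + H z ^ 2) ≤ 0 →
        (∀ j, R j y (Φ z) = 0) → P y *ᵥ G z = 0 → z ∈ S ∧ y = Φ z := by
  set N : Set ((ι → ℝ) × (κ → ℝ)) := interior {w | (∀ j, R j w.2 (Φ w.1) = 0) →
    P w.2 *ᵥ G w.1 = 0 → w.1 ∈ S ∧ w.2 = Φ w.1} with hN
  have hgc : Continuous fun z => (z, Φ z) := continuous_id.prodMk h.smooth_Φ.continuous
  have hU : IsOpen {z | (z, Φ z) ∈ N} := isOpen_interior.preimage hgc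
  have hSU : S ⊆ {z | (z, Φ z) ∈ N} := fun a ha =>
    mem_interior_iff_mem_nhds.2 (h.eventually_of_system ha)
  obtain ⟨H, hH, hH0, hH1, -⟩ := exists_contDiff_bump h.compact.isClosed hU.isClosed_compl
    (Set.disjoint_compl_right_iff_subset.2 hSU)
  set w : (ι → ℝ) × (κ → ℝ) → ℝ :=
    fun x => ∑ i, Q i x.1 ^ 2 * (x.2 i - Φ x.1 i) ^ 2 + H x.1 ^ 2 with hw
  have hwc : Continuous w := by
    have h1 := fun i => (continuous_apply i).comp h.smooth_Φ.continuous
    have h2 := hH.continuous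
    simp only [Function.comp_def] at h1
    fun_prop
  set K : Set ((ι → ℝ) × (κ → ℝ)) :=
    ({z | ∑ i, z i ^ 2 ≤ (r : ℝ)} ×ˢ {y | ∑ i, y i ^ 2 ≤ B}) \ N with hK
  have hKc : IsCompact K :=
    ((isCompact_sum_sq_le _).prod (isCompact_sum_sq_le _)).diff isOpen_interior
  have hpos : ∀ x ∈ K, 0 < w x := by
    intro x hx
    have h1 : 0 ≤ ∑ i, Q i x.1 ^ 2 * (x.2 i - Φ x.1 i) ^ 2 :=
      Finset.sum_nonneg fun i _ => by positivity
    by_contra! h2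
    have h3 : H x.1 ^ 2 = 0 := by
      have : w x = ∑ i, Q i x.1 ^ 2 * (x.2 i - Φ x.1 i) ^ 2 + H x.1 ^ 2 := rfl
      nlinarith [sq_nonneg (H x.1)]
    have h4 : ∑ i, Q i x.1 ^ 2 * (x.2 i - Φ x.1 i) ^ 2 = 0 := by
      have : w x = ∑ i, Q i x.1 ^ 2 * (x.2 i - Φ x.1 i) ^ 2 + H x.1 ^ 2 := rfl
      linarith
    have h5 : x.2 = Φ x.1 := _root_.funext fun i => by
      have := (Finset.sum_eq_zero_iff_of_nonneg fun i _ => by positivity).1 h4 i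
        (Finset.mem_univ i)
      rcases mul_eq_zero.1 this with h6 | h6
      · exact absurd (pow_eq_zero_iff two_ne_zero |>.1 h6) (hQ0 i _)
      · exact sub_eq_zero.1 (pow_eq_zero_iff two_ne_zero |>.1 h6)
    have h6 : x.1 ∈ {z | (z, Φ z) ∈ N} := by
      by_contra h7
      have := hH1.self_of_nhdsSet x.1 h7
      rw [pow_eq_zero_iff two_ne_zero |>.1 h3] at this
      exact zero_ne_one this
    exact hx.2 (by rw [show x = (x.1, Φ x.1) from Prod.ext rfl h5]; exact h6)
  obtain ⟨w₀, hw₀, hwK⟩ : ∃ w₀ > 0, ∀ x ∈ K, w₀ ≤ w x := by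
    rcases K.eq_empty_or_nonempty with h0 | h0
    · exact ⟨1, one_pos, fun x hx => by simp [h0] at hx⟩
    · obtain ⟨x, hx, hmin⟩ := hKc.exists_isMinOn h0 hwc.continuousOn
      exact ⟨w x, hpos x hx, fun y hy => hmin hy⟩
  obtain ⟨C, hC⟩ := exists_nat_gt ((r + 1) / w₀)
  refine ⟨C, H, hH, hH0, fun z y hz hy hle hR hP => ?_⟩
  by_cases hx : (z, y) ∈ N
  · exact interior_subset hx hR hP
  · have h1 := hwK (z, y) ⟨⟨hz, hy⟩, hx⟩
    have h2 : (r : ℝ) + 1 < C * w₀ := (div_lt_iff₀ hw₀).1 hC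
    have h3 : (C : ℝ) * w₀ ≤ C * w (z, y) := mul_le_mul_of_nonneg_left h1 (Nat.cast_nonneg _)
    have h4 : z t₀ ^ 2 ≤ ∑ i, z i ^ 2 :=
      Finset.single_le_sum (f := fun i => z i ^ 2) (fun i _ => sq_nonneg _) (Finset.mem_univ t₀)
    have h5 : z t₀ + C * w (z, y) ≤ 0 := hle
    nlinarith [sq_nonneg (z t₀ + 1)]

end IsCore

end System

section System

open Filter Topology Matrix Metric

namespace IsCore

variable {ι κ J : Type*} [Fintype ι] [DecidableEq ι] [Fintype κ] [DecidableEq κ]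
  {t₀ : ι} {c : ℕ} {S : Set (ι → ℝ)} {ρ : (ι → ℝ) → ι → ℝ} {pp kap : (ι → ℝ) → ℝ}
  {R : J → (κ → ℝ) → (κ → ℝ) → ℝ} {τ : (κ → ℝ) → κ → ℝ} {P : (κ → ℝ) → Matrix ι ι ℝ}
  {Φ : (ι → ℝ) → κ → ℝ} {G : (ι → ℝ) → ι → ℝ}

theorem hasTop_equation (h : IsCore t₀ c S ρ pp kap R τ P Φ G) {f : (ι ⊕ κ → ℝ) → ℝ} (hf : IsQP f)
    {r : ℕ} (hr : 1 ≤ r) : ∃ n, ∀ m, n ≤ m → ∃ D T,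
      HasTop (fun x : ι ⊕ κ → ℝ => f x +
        kap (x ∘ Sum.inl) * ((∑ i, (x ∘ Sum.inl) i ^ 2) / r) ^ m) D T ∧
      ∀ x, 0 ≤ T x ∧ (x ∘ Sum.inl ≠ 0 → 0 < T x) := by
  obtain ⟨n, hn⟩ := hf.hasTop_zero
  obtain ⟨D, T, hD, hT, hT0⟩ := h.kap_top
  refine ⟨n, fun m hm => ?_⟩
  have h1 : HasTop (fun x : ι ⊕ κ → ℝ => kap (x ∘ Sum.inl)) D (fun x => T (x ∘ Sum.inl)) :=
    hT.comp_linear (fun x => x ∘ Sum.inl) fun l x => rfl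
  have h2 : HasTop (fun x : ι ⊕ κ → ℝ => (∑ i, (x ∘ Sum.inl) i ^ 2) / (r : ℝ)) 2
      (fun x => (∑ i, (x ∘ Sum.inl) i ^ 2) / (r : ℝ)) := by
    have := (HasTop.sum (s := Finset.univ) fun (i : ι) _ =>
      (HasTop.proj (Sum.inl i : ι ⊕ κ)).pow 2).const_mul (r : ℝ)⁻¹
    simpa only [div_eq_inv_mul, one_mul, Function.comp_apply] using this
  have h3 := (hn (D + 2 * m) (by omega)).add (h1.mul (h2.pow m))
  have hT1 : ∀ x, 0 ≤ T x := fun x => by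
    rcases eq_or_ne x 0 with rfl | hx
    · have : Tendsto (fun l : ℝ => kap (l • (0 : ι → ℝ)) / l ^ D) atTop (𝓝 0) := by
        simp only [smul_zero]
        exact tendsto_const_nhds.div_atTop (tendsto_pow_atTop (by omega))
      exact (tendsto_nhds_unique (hT 0) this).ge
    · exact (hT0 x hx).le
  refine ⟨_, _, h3, fun x => ⟨?_, fun hx => ?_⟩⟩
  · rw [zero_add]
    have := hT1 (x ∘ Sum.inl)
    positivity
  · rw [zero_add]
    refine mul_pos (hT0 _ hx) (pow_pos (div_pos ?_ (Nat.cast_pos.2 hr)) _)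
    obtain ⟨i, hi⟩ := Function.ne_iff.1 hx
    exact Finset.sum_pos' (fun i _ => sq_nonneg _) ⟨i, Finset.mem_univ i, by
      have : (x ∘ Sum.inl) i ≠ 0 := hi
      positivity⟩

theorem exists_isSystem (h : IsCore t₀ c S ρ pp kap R τ P Φ G) :
    ∃ Φs Gs γs, IsSystem t₀ S pp R τ P Φ G Φs Gs γs := by
  obtain ⟨gΦ, QΦ, hgΦ, hQΦ, hQΦ0, hΦeq, hΦlim⟩ :=
    exists_rational_seq h.isQP_pp h.smooth_Φ h.Φ_rat
  obtain ⟨gG, QG, hgG, hQG, hQG0, hGeq, hGlim⟩ :=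
    exists_rational_seq h.isQP_pp h.smooth_G h.G_rat
  obtain ⟨r, hr1, hr, hrS⟩ := h.exists_radius
  obtain ⟨B, hB⟩ := h.target.exists_bound
  obtain ⟨C, H, hH, hH0, hC⟩ := h.exists_weight (fun i => (hQΦ i).continuous) hQΦ0 r B
  obtain ⟨gH, hgH, hHeq, hHlim⟩ := exists_isQP_seq_rel hH IsQP.zero IsQP.one h.isQP_pp
    (fun _ => one_ne_zero) fun x hx => by
      filter_upwards [hH0.filter_mono (nhds_le_nhdsSet (h.pp_mem x hx).1)] with z hz
      simpa using hz
  simp only [div_one] at hHeq hHlim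
  have hr0 : (0 : ℝ) < r := Nat.cast_pos.2 hr1
  set Φs : ℕ → (ι → ℝ) → κ → ℝ := fun k z i => gΦ k i z / QΦ i z with hΦs
  set Gs : ℕ → (ι → ℝ) → ι → ℝ := fun k z i => gG k i z / QG i z with hGs
  have hf : ∀ k, IsQP fun x : ι ⊕ κ → ℝ => x (Sum.inl t₀) + C * (∑ i,
      (QΦ i (x ∘ Sum.inl) * x (Sum.inr i) - gΦ k i (x ∘ Sum.inl)) ^ 2 +
        gH k (x ∘ Sum.inl) ^ 2) := fun k => by
    have hl : ∀ j, IsQP fun x : ι ⊕ κ → ℝ => (x ∘ Sum.inl) j := fun j => IsQP.proj _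
    exact (IsQP.proj _).add ((IsQP.nat C).mul ((IsQP.sum fun i _ =>
      ((((hQΦ i).comp hl).mul (IsQP.proj _)).sub ((hgΦ k i).comp hl)).pow 2).add
        (((hgH k).comp hl).pow 2)))
  choose n hn using fun k => h.hasTop_equation (hf k) hr1
  set m : ℕ → ℕ := fun k => max k (n k) with hm
  have hmt : Tendsto m atTop atTop := tendsto_atTop_mono (fun k => le_max_left _ _) tendsto_id
  set w : ℕ → (ι → ℝ) → (κ → ℝ) → ℝ := fun k z y =>
    ∑ i, QΦ i z ^ 2 * (y i - Φs k z i) ^ 2 + gH k z ^ 2 with hw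
  have hw0 : ∀ k z y, 0 ≤ w k z y := fun k z y =>
    add_nonneg (Finset.sum_nonneg fun i _ => by positivity) (sq_nonneg _)
  set γs : ℕ → (ι → ℝ) → (κ → ℝ) → ℝ := fun k z y =>
    (z t₀ + C * w k z y) + kap z * ((∑ i, z i ^ 2) / r) ^ m k with hγs
  have hγ : ∀ k (x : ι ⊕ κ → ℝ), γs k (x ∘ Sum.inl) (x ∘ Sum.inr) = (x (Sum.inl t₀) + C * (∑ i,
      (QΦ i (x ∘ Sum.inl) * x (Sum.inr i) - gΦ k i (x ∘ Sum.inl)) ^ 2 +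
        gH k (x ∘ Sum.inl) ^ 2)) +
        kap (x ∘ Sum.inl) * ((∑ i, (x ∘ Sum.inl) i ^ 2) / r) ^ m k := by
    intro k x
    simp only [hγs, hw, Function.comp_apply]
    congr 4
    refine Finset.sum_congr rfl fun i _ => ?_
    have := hQΦ0 i (x ∘ Sum.inl)
    simp only [hΦs]
    rw [← mul_pow, mul_sub, mul_div_cancel₀ _ this]
  have hpow : ∀ z, ∑ i, z i ^ 2 < (r : ℝ) →
      HasC1Lim (fun k (z : ι → ℝ) => kap z * ((∑ i, z i ^ 2) / r) ^ m k) z 0 0 := by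
    intro z hz
    have h0 : 0 ≤ (∑ i, z i ^ 2) / (r : ℝ) := by positivity
    have h1 := (HasC1Lim.pow_zero_of_abs_lt (z := z) (u := fun z : ι → ℝ => (∑ i, z i ^ 2) / (r : ℝ))
      (ContDiff.smoothNear (by fun_prop) z) (by
        rw [abs_of_nonneg h0]; exact (div_lt_one hr0).2 hz)).reindex hmt
    have h2 := (HasC1Lim.const ((h.isQP_kap.contDiff
      (n := ((⊤ : ℕ∞) : WithTop ℕ∞))).smoothNear z)).mul h1
    simpa using h2
  refine ⟨Φs, Gs, γs, ?_⟩
  constructor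
  · exact fun k i => ⟨_, _, hgΦ k i, hQΦ i, hQΦ0 i, fun z => rfl⟩
  · exact fun k i => ⟨_, _, hgG k i, hQG i, hQG0 i, fun z => rfl⟩
  · intro k
    simp only [hγ]
    have hl : ∀ j, IsQP fun x : ι ⊕ κ → ℝ => (x ∘ Sum.inl) j := fun j => IsQP.proj _
    refine (hf k).add ((h.isQP_kap.comp hl).mul (IsQP.pow ?_ _))
    have := (IsQP.sum (s := Finset.univ) fun i _ => (hl i).pow 2).mul (IsQP.rat (ι := ι ⊕ κ)
      ((r : ℚ)⁻¹))
    simpa [div_eq_mul_inv] using this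
  · intro k
    simp only [hγ]
    exact hn k _ (le_max_right _ _)
  · exact hΦlim
  · exact hGlim
  · exact hΦeq
  · exact fun k z hz => (hGeq k z hz).trans (h.G_zero z (h.pp_mem z hz).1)
  · intro k z hz
    have h1 := hHeq k z hz
    rw [(hH0.self_of_nhdsSet z (h.pp_mem z hz).1)] at h1
    simp [hγs, hw, h1, (h.pp_mem z hz).2, h.kap_zero z hz]
  · intro a ha ha0
    have h1 : HasC1Lim (fun _ (z : ι → ℝ) => z t₀) a 0 (ContinuousLinearMap.proj t₀) := by
      have := HasC1Lim.const ((ContinuousLinearMap.proj (R := ℝ) (φ := fun _ : ι => ℝ)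
        t₀).contDiff.smoothNear a)
      rw [ContinuousLinearMap.fderiv, ContinuousLinearMap.proj_apply, ha0] at this
      exact this
    have h2 : HasC1Lim (fun k z => w k z (τ (Φs k z))) a 0 0 := by
      have e1 := h.hasC1Lim_target ha (hΦlim a)
      have e2 : ∀ i ∈ Finset.univ, HasC1Lim
          (fun k z => QΦ i z ^ 2 * (τ (Φs k z) i - Φs k z i) ^ 2) a 0 0 := fun i _ => by
        obtain ⟨D, e3⟩ : ∃ D, HasC1Lim _ a _ D := ⟨_, (e1.add ((hΦlim a).clm (-ContinuousLinearMap.id ℝ _))).clm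
          (ContinuousLinearMap.proj (R := ℝ) (φ := fun _ : κ => ℝ) i)⟩
        refine HasC1Lim.mul_sq ((((hQΦ i).contDiff (n := ((⊤ : ℕ∞) : WithTop ℕ∞))).pow
          2).smoothNear a) (u' := D) ?_
        simpa [sub_eq_add_neg] using e3
      have e4 : HasC1Lim (fun k z => gH k z ^ 2) a 0 0 := by
        have e5 := hHlim a
        rw [hH0.self_of_nhdsSet a ha] at e5
        simpa using HasC1Lim.mul_sq ((contDiff_const (c := (1 : ℝ))).smoothNear a) e5
      simpa using (HasC1Lim.sum e2).add e4
    have h3 := (h1.add (h2.clm ((C : ℝ) • ContinuousLinearMap.id ℝ ℝ))).add (hpow a (hrS a ha))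
    simpa using h3
  · intro U hU hUS
    have key : ∀ x ∈ ({z : ι → ℝ | ∑ i, z i ^ 2 ≤ (r : ℝ)} ×ˢ {y : κ → ℝ | ∑ i, y i ^ 2 ≤ B}) \ U,
        ∀ᶠ p in (atTop : Filter ℕ) ×ˢ 𝓝 x, ¬ ((∀ j, R j p.2.2 (Φs p.1 p.2.1) = 0) ∧
          P p.2.2 *ᵥ Gs p.1 p.2.1 = 0 ∧ γs p.1 p.2.1 p.2.2 = 0) := by
      rintro ⟨z, y⟩ ⟨⟨hz, hy⟩, hxU⟩
      have hz : ∑ i, z i ^ 2 ≤ (r : ℝ) := hz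
      have hy : ∑ i, y i ^ 2 ≤ B := hy
      have hpr : Tendsto (fun p : ℕ × ((ι → ℝ) × (κ → ℝ)) => (p.1, p.2.1)) (atTop ×ˢ 𝓝 (z, y))
          (atTop ×ˢ 𝓝 z) := tendsto_fst.prodMk ((continuous_fst.tendsto _).comp tendsto_snd)
      have hy' : Tendsto (fun p : ℕ × ((ι → ℝ) × (κ → ℝ)) => p.2.2) (atTop ×ˢ 𝓝 (z, y))
          (𝓝 y) := (continuous_snd.tendsto _).comp tendsto_snd
      have hz' : Tendsto (fun p : ℕ × ((ι → ℝ) × (κ → ℝ)) => p.2.1) (atTop ×ˢ 𝓝 (z, y))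
          (𝓝 z) := (continuous_fst.tendsto _).comp tendsto_snd
      have hΦ' := (hΦlim z).tendsto.comp hpr
      have hG' := (hGlim z).tendsto.comp hpr
      have hH' := (hHlim z).tendsto.comp hpr
      simp only [Function.comp_def] at hΦ' hG' hH'
      by_cases hR : ∀ j, R j y (Φ z) = 0
      swap
      · obtain ⟨j, hj⟩ := not_forall.1 hR
        have h1 := ((h.target.continuous j).tendsto (y, Φ z)).comp (hy'.prodMk_nhds hΦ')
        filter_upwards [h1.eventually_ne hj] with p hp hc using hp (hc.1 j)
      by_cases hP : P y *ᵥ G z = 0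
      swap
      · have hPc : Continuous fun v : (κ → ℝ) × (ι → ℝ) => P v.1 *ᵥ v.2 := by
          refine Continuous.matrix_mulVec ?_ continuous_snd
          exact continuous_matrix fun i j => (h.isQP_P i j).continuous.comp continuous_fst
        have h1 := (hPc.tendsto (y, G z)).comp (hy'.prodMk_nhds hG')
        filter_upwards [h1.eventually_ne hP] with p hp hc using hp hc.2.1
      have hw' : Tendsto (fun p : ℕ × ((ι → ℝ) × (κ → ℝ)) => p.2.1 t₀ + C * w p.1 p.2.1 p.2.2)
          (atTop ×ˢ 𝓝 (z, y)) (𝓝 (z t₀ + C * (∑ i, QΦ i z ^ 2 * (y i - Φ z i) ^ 2 + H z ^ 2))) := by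
        refine ((tendsto_pi_nhds.1 hz') t₀).add (tendsto_const_nhds.mul
          ((tendsto_finsetSum _ fun i _ => ?_).add (hH'.pow 2)))
        exact ((((hQΦ i).continuous.tendsto z).comp hz').pow 2).mul
          (((tendsto_pi_nhds.1 hy' i).sub (tendsto_pi_nhds.1 hΦ' i)).pow 2)
      rcases lt_or_ge 0 (z t₀ + C * (∑ i, QΦ i z ^ 2 * (y i - Φ z i) ^ 2 + H z ^ 2)) with h0 | h0
      · filter_upwards [hw'.eventually (lt_mem_nhds h0)] with p hp hc
        have h1 := hc.2.2
        have h2 := h.kap_nonneg p.2.1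
        have h3 : 0 ≤ kap p.2.1 * ((∑ i, p.2.1 i ^ 2) / r) ^ m p.1 := by positivity
        simp only [hγs] at h1
        linarith
      · obtain ⟨hzS, rfl⟩ := hC z y hz hy h0 hR hP
        have h1 := hw'.add ((hpow z (hrS z hzS)).tendsto.comp hpr)
        simp only [sub_self, ne_eq, OfNat.ofNat_ne_zero, not_false_eq_true, zero_pow, mul_zero,
          Finset.sum_const_zero, hH0.self_of_nhdsSet z hzS, add_zero] at h1
        have h2 : z t₀ ≠ 0 := fun h3 => hxU (hUS z hzS h3)
        filter_upwards [h1.eventually_ne h2] with p hp hc using hp hc.2.2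
    obtain ⟨δ, hδ, hk⟩ := (((isCompact_sum_sq_le _).prod (isCompact_sum_sq_le _)).diff
      hU).exists_uniform (Q := fun k x => ¬ ((∀ j, R j x.2 (Φs k x.1) = 0) ∧
          P x.2 *ᵥ Gs k x.1 = 0 ∧ γs k x.1 x.2 = 0)) key
    filter_upwards [hk] with k hk z y h1 h2 h3
    by_contra hU'
    refine hk (z, y) ⟨⟨?_, hB _ _ h1⟩, hU'⟩ (z, y) (by simpa using hδ) ⟨h1, h2, h3⟩
    by_contra! h4
    have h4 : (r : ℝ) < ∑ i, z i ^ 2 := not_le.1 h4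
    have h5 := hr z h4.le
    have h6 : (1 : ℝ) ≤ ((∑ i, z i ^ 2) / r) ^ m k := one_le_pow₀ ((one_le_div hr0).2 h4.le)
    have h7 := mul_le_mul_of_nonneg_left h6 (h.kap_nonneg z)
    have h8 : 0 ≤ C * w k z y := mul_nonneg (Nat.cast_nonneg _) (hw0 k z y)
    simp only [hγs] at h3
    linarith

end IsCore

end System

section Level

open Filter Topology Matrix Metric

/-- The parametrization of the solutions of the algebraic system near the base of the spine. -/
noncomputable def levelMap {ι κ : Type*} [Fintype ι] [DecidableEq ι] (t₀ : ι)
    (ρ : (ι → ℝ) → ι → ℝ) (τ : (κ → ℝ) → κ → ℝ) (P : (κ → ℝ) → Matrix ι ι ℝ)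
    (φ : (ι → ℝ) → κ → ℝ) (g : (ι → ℝ) → ι → ℝ) (γ : (ι → ℝ) → (κ → ℝ) → ℝ) (z : ι → ℝ) : ι → ℝ :=
  flat t₀ (ρ z + conormal ρ (ρ z) *ᵥ (P (τ (φ z)) *ᵥ g z)) + γ z (τ (φ z)) • Pi.single t₀ 1

section

variable {ι κ J : Type*} [Fintype ι] [DecidableEq ι] [Fintype κ] [DecidableEq κ]
  {t₀ : ι} {c : ℕ} {S : Set (ι → ℝ)} {ρ : (ι → ℝ) → ι → ℝ} {pp kap : (ι → ℝ) → ℝ}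
  {R : J → (κ → ℝ) → (κ → ℝ) → ℝ} {τ : (κ → ℝ) → κ → ℝ} {P : (κ → ℝ) → Matrix ι ι ℝ}
  {Φ : (ι → ℝ) → κ → ℝ} {G : (ι → ℝ) → ι → ℝ} {Φs : ℕ → (ι → ℝ) → κ → ℝ}
  {Gs : ℕ → (ι → ℝ) → ι → ℝ} {γs : ℕ → (ι → ℝ) → (κ → ℝ) → ℝ}

theorem IsCore.hasC1Lim_levelMap (h : IsCore t₀ c S ρ pp kap R τ P Φ G)
    (hs : IsSystem t₀ S pp R τ P Φ G Φs Gs γs) {a : ι → ℝ} (ha : a ∈ S) (ht : a t₀ = 0) :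
    HasC1Lim (fun k => levelMap t₀ ρ τ P (Φs k) (Gs k) (γs k)) a a
      (ContinuousLinearMap.id ℝ (ι → ℝ)) := by
  have h1 := ((h.hasC1Lim_psi ha (hs.lim_Φ a) (hs.lim_G a)).clm (flat t₀)).add
    ((hs.lim_γ a ha ht).clm
      ((ContinuousLinearMap.id ℝ ℝ).smulRight (Pi.single t₀ 1 : ι → ℝ)))
  convert h1 using 1
  · rfl
  · simp [flat_eq_iff.2 ht]
  · ext1 v
    simp [flat_eq]

theorem IsCore.levelMap_eq_self (h : IsCore t₀ c S ρ pp kap R τ P Φ G)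
    (hs : IsSystem t₀ S pp R τ P Φ G Φs Gs γs) (k : ℕ) {a : ι → ℝ} (ha : pp a = 0) :
    levelMap t₀ ρ τ P (Φs k) (Gs k) (γs k) a = a := by
  obtain ⟨h1, h2⟩ := h.pp_mem a ha
  have h3 : τ (Φs k a) = Φs k a := by
    rw [hs.Φ_eq k a ha, h.target.self _ ⟨a, h1, rfl⟩]
  simp only [levelMap, h3, hs.G_eq k a ha, hs.γ_eq k a ha, h.tub.self a h1]
  simp [flat_eq_iff.2 h2]

theorem IsCore.eventually_system_iff (h : IsCore t₀ c S ρ pp kap R τ P Φ G)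
    (hs : IsSystem t₀ S pp R τ P Φ G Φs Gs γs) {a : ι → ℝ} (ha : a ∈ S) (ht : a t₀ = 0) :
    ∀ᶠ p in (atTop : Filter ℕ) ×ˢ 𝓝 (a, Φ a),
      ((∀ j, R j p.2.2 (Φs p.1 p.2.1) = 0) ∧ P p.2.2 *ᵥ Gs p.1 p.2.1 = 0 ∧
        γs p.1 p.2.1 p.2.2 = 0) ↔ p.2.2 = τ (Φs p.1 p.2.1) ∧
        levelMap t₀ ρ τ P (Φs p.1) (Gs p.1) (γs p.1) p.2.1 ∈ S ∧
        levelMap t₀ ρ τ P (Φs p.1) (Gs p.1) (γs p.1) p.2.1 t₀ = 0 := by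
  have hπ : Tendsto (fun p : ℕ × ((ι → ℝ) × (κ → ℝ)) => (p.1, p.2.1)) (atTop ×ˢ 𝓝 (a, Φ a))
      (atTop ×ˢ 𝓝 a) :=
    tendsto_fst.prodMk (continuousAt_fst.tendsto.comp tendsto_snd)
  have hz : Tendsto (fun p : ℕ × ((ι → ℝ) × (κ → ℝ)) => p.2.1) (atTop ×ˢ 𝓝 (a, Φ a)) (𝓝 a) :=
    continuousAt_fst.tendsto.comp tendsto_snd
  have hy : Tendsto (fun p : ℕ × ((ι → ℝ) × (κ → ℝ)) => p.2.2) (atTop ×ˢ 𝓝 (a, Φ a))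
      (𝓝 (Φ a)) := continuousAt_snd.tendsto.comp tendsto_snd
  have hΦ := (hs.lim_Φ a).tendsto.comp hπ
  have hψ := (h.hasC1Lim_psi ha (hs.lim_Φ a) (hs.lim_G a)).tendsto.comp hπ
  have hρ := h.tub.smooth a ha
  have hρa := h.tub.self a ha
  have hp : Tendsto (fun p : ℕ × ((ι → ℝ) × (κ → ℝ)) => ρ p.2.1) (atTop ×ˢ 𝓝 (a, Φ a)) (𝓝 a) := by
    have := hρ.self_of_nhds.continuousAt.tendsto.comp hz
    rwa [hρa] at this
  have hN : Tendsto (conormal ρ) (𝓝 a) (𝓝 (conormal ρ a)) :=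
    tendsto_pi_nhds.2 fun i => tendsto_pi_nhds.2 fun j =>
      (smoothNear_conormal hρ i j).self_of_nhds.continuousAt.tendsto
  have hP : Tendsto P (𝓝 (Φ a)) (𝓝 (conormal ρ a)) := by
    rw [← h.P_comp a ha]
    exact tendsto_pi_nhds.2 fun i => tendsto_pi_nhds.2 fun j =>
      ((h.isQP_P i j).continuous).continuousAt.tendsto
  have hdet : Tendsto (fun p : ℕ × ((ι → ℝ) × (κ → ℝ)) =>
      (1 - (P p.2.2 - conormal ρ (ρ p.2.1))).det) (atTop ×ˢ 𝓝 (a, Φ a)) (𝓝 1) := by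
    have h1 := (tendsto_const_nhds (x := (1 : Matrix ι ι ℝ))).sub
      ((hP.comp hy).sub (hN.comp hp))
    have h2 := ((continuous_id.matrix_det : Continuous fun A : Matrix ι ι ℝ => A.det).tendsto
      _).comp h1
    rw [sub_self, sub_zero, id, det_one] at h2
    exact h2
  have habs : ∀ᶠ z : ι → ℝ in 𝓝 a, |z t₀| < 1 := by
    refine ((continuous_apply t₀).abs.continuousAt (x := a)).eventually (gt_mem_nhds ?_)
    simp [ht]
  have hrel : ∀ᶠ z in 𝓝 a, ρ z ∈ S := by
    have h1 : Tendsto (fun z => (ρ z, z)) (𝓝 a) (𝓝 (a, a)) := by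
      have := hρ.self_of_nhds.continuousAt.tendsto
      rw [hρa] at this
      exact this.prodMk_nhds tendsto_id
    filter_upwards [h1.eventually (h.tub.rel a ha)] with z hz using (hz.2 rfl).1
  filter_upwards [(hy.prodMk_nhds hΦ).eventually (h.target.rel _ ⟨a, ha, rfl⟩),
    hz.eventually hrel, hp.eventually habs, hψ.eventually habs,
    hp.eventually (h.tub.normalAt_conormal ha),
    (hp.prodMk_nhds hψ).eventually (h.tub.rel a ha),
    hdet.eventually_ne one_ne_zero] with p h1 h2 h3 h4 h5 h6 h7
  obtain ⟨k, z, y⟩ := p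
  dsimp only [Function.comp_apply] at h1 h2 h3 h4 h5 h6 h7 ⊢
  have hflat : flat t₀ (ρ z) ∈ S := (h.cyl _ h3).1 h2
  constructor
  · rintro ⟨h8, h9, h10⟩
    have h11 := h1.1 h8
    refine ⟨h11, ?_⟩
    simp only [levelMap, ← h11, h9, h10]
    simpa using hflat
  · rintro ⟨h8, h9, h10⟩
    subst h8
    have h11 : ∀ j, R j (τ (Φs k z)) (Φs k z) = 0 := h1.2 rfl
    have h12 : γs k z (τ (Φs k z)) = 0 := by
      simpa [levelMap] using h10
    refine ⟨h11, ?_, h12⟩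
    rw [levelMap, h12, zero_smul, add_zero] at h9
    have h13 := (h.cyl _ h4).2 h9
    set v := P (τ (Φs k z)) *ᵥ Gs k z with hv
    have h14 : ρ z = ρ (ρ z + conormal ρ (ρ z) *ᵥ v) := by
      refine h6.1 ⟨h2, ?_⟩
      rw [add_sub_cancel_left]
      exact h5 h2 _
    rw [h.tub.self _ h13] at h14
    have h15 : conormal ρ (ρ z) *ᵥ v = 0 := by simpa using h14
    have h16 : P (τ (Φs k z)) *ᵥ v = v := by
      rw [hv, mulVec_mulVec, h.P_mul_self _ _ h11]
    refine Matrix.eq_zero_of_mulVec_eq_zero h7 ?_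
    rw [sub_mulVec, sub_mulVec, one_mulVec, h15, h16]
    simp

theorem IsTarget.exists_continuous_clm [Fintype J] {K : Set (κ → ℝ)} (h : IsTarget R K τ) :
    ∃ D : (κ → ℝ) × (κ → ℝ) → (κ → ℝ) →L[ℝ] J → ℝ, Continuous D ∧
      ∀ y x h j, D (y, x) h j = fderiv ℝ (fun y => R j y x) y h := by
  choose α β hα hβ hR using h.affine
  have hd : ∀ {f : (κ → ℝ) → ℝ}, IsQP f → ContDiff ℝ (1 : ℕ∞) f := fun hf => hf.contDiff
  have hdf : ∀ {f : (κ → ℝ) → ℝ}, IsQP f → Differentiable ℝ f := fun hf =>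
    (hd hf).differentiable (by simp)
  refine ⟨fun w => ContinuousLinearMap.pi fun j =>
    fderiv ℝ (α j) w.1 + ∑ i, w.2 i • fderiv ℝ (β j i) w.1, ?_, fun y x v j => ?_⟩
  · have hc : ∀ {f : (κ → ℝ) → ℝ}, IsQP f → Continuous fun w : (κ → ℝ) × (κ → ℝ) =>
        fderiv ℝ f w.1 := fun hf =>
      ((hd hf).continuous_fderiv (by simp)).comp continuous_fst
    have h1 : Continuous fun w : (κ → ℝ) × (κ → ℝ) => fun j =>
        fderiv ℝ (α j) w.1 + ∑ i, w.2 i • fderiv ℝ (β j i) w.1 :=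
      continuous_pi fun j => (hc (hα j)).add (continuous_finsetSum _ fun i _ =>
        ((continuous_apply i).comp continuous_snd).smul (hc (hβ j i)))
    exact ((ContinuousLinearMap.piEquivL ℝ (κ → ℝ) (fun _ : J => ℝ)).continuous).comp h1
  · have h1 : (fun y => R j y x) = fun y => α j y + ∑ i, x i * β j i y := by
      funext y
      rw [hR]
      simp only [mul_comm]
    have h2 : HasFDerivAt (fun y => α j y + ∑ i, x i * β j i y)
        (fderiv ℝ (α j) y + ∑ i, x i • fderiv ℝ (β j i) y) y :=
      (hdf (hα j) y).hasFDerivAt.add (HasFDerivAt.fun_sum fun i _ =>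
        (hdf (hβ j i) y).hasFDerivAt.const_mul (x i))
    rw [h1, h2.fderiv]
    rfl

theorem IsTarget.eventually_injective [Fintype J] {K : Set (κ → ℝ)} (h : IsTarget R K τ)
    {a : κ → ℝ} (ha : a ∈ K) : ∀ᶠ w in 𝓝 (a, a),
      ∀ v, (∀ j, fderiv ℝ (fun y => R j y w.2) w.1 v = 0) → v = 0 := by
  obtain ⟨D, hD, hDR⟩ := h.exists_continuous_clm
  have h1 : Function.Injective (D (a, a)) := by
    refine (injective_iff_map_eq_zero _).2 fun v hv => h.inj a ha v fun j => ?_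
    rw [← hDR, hv, Pi.zero_apply]
  filter_upwards [hD.continuousAt.eventually
    (ContinuousLinearMap.isOpen_injective.mem_nhds h1)] with w hw v hv
  refine (injective_iff_map_eq_zero _).1 hw v (_root_.funext fun j => ?_)
  rw [hDR, hv, Pi.zero_apply]

/-- Solutions of the algebraic system with data `φ`, `g`, `γ`, parametrized by the inverse of a
local diffeomorphism `Θ`. -/
structure IsLevel (t₀ : ι) (S : Set (ι → ℝ)) (ρ : (ι → ℝ) → ι → ℝ) (pp : (ι → ℝ) → ℝ)
    (R : J → (κ → ℝ) → (κ → ℝ) → ℝ) (P : (κ → ℝ) → Matrix ι ι ℝ) (φ : (ι → ℝ) → κ → ℝ)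
    (g : (ι → ℝ) → ι → ℝ) (γ : (ι → ℝ) → (κ → ℝ) → ℝ) (A : (ι → ℝ) → Matrix ι ι ℝ)
    (y : (ι → ℝ) → κ → ℝ) (Θ : (ι → ℝ) → ι → ℝ) (O : Set (ι → ℝ)) : Prop where
  isOpen : IsOpen O
  eq : ∀ z, Θ z = flat t₀ (ρ z + A z *ᵥ (P (y z) *ᵥ g z)) + γ z (y z) • Pi.single t₀ 1
  smooth : ∀ z ∈ O, SmoothNear Θ z
  inj : ∀ z ∈ O, Function.Injective (fderiv ℝ Θ z)
  injOn : Set.InjOn Θ O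
  surj : ∀ a ∈ S, a t₀ = 0 → ∃ z ∈ O, Θ z = a
  fix : ∀ a, pp a = 0 → a ∈ O ∧ Θ a = a
  smooth_y : ∀ z ∈ O, SmoothNear y z
  smooth_ρ : ∀ z ∈ O, SmoothNear ρ z
  smooth_A : ∀ z ∈ O, ∀ i j, SmoothNear (fun z => A z i j) z
  mem : ∀ z ∈ O, ρ z ∈ S ∧ |ρ z t₀| < 1
  rel : ∀ z ∈ O, ∀ j, R j (y z) (φ z) = 0
  inj_R : ∀ z ∈ O, ∀ v, (∀ j, fderiv ℝ (fun y => R j y (φ z)) (y z) v = 0) → v = 0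
  sol : ∀ z u, ((∀ j, R j u (φ z) = 0) ∧ P u *ᵥ g z = 0 ∧ γ z u = 0) ↔
    z ∈ O ∧ u = y z ∧ Θ z ∈ S ∧ Θ z t₀ = 0

theorem IsCore.exists_isLevel [Fintype J] (h : IsCore t₀ c S ρ pp kap R τ P Φ G)
    (hs : IsSystem t₀ S pp R τ P Φ G Φs Gs γs) {ε : ℝ} (hε : 0 < ε) :
    ∃ k A y Θ O, IsLevel t₀ S ρ pp R P (Φs k) (Gs k) (γs k) A y Θ O ∧
      ∀ z ∈ O, Θ z ∈ S → Θ z t₀ = 0 → dist z (Θ z) < ε ∧ dist (y z) (Φ (Θ z)) < ε := by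
  set E₀ : Set (ι → ℝ) := {a ∈ S | a t₀ = 0} with hE₀
  have hE : IsCompact E₀ :=
    h.compact.inter_right (isClosed_eq (continuous_apply t₀) continuous_const)
  set Θ : ℕ → (ι → ℝ) → ι → ℝ := fun k => levelMap t₀ ρ τ P (Φs k) (Gs k) (γs k) with hΘ
  set y : ℕ → (ι → ℝ) → κ → ℝ := fun k z => τ (Φs k z) with hy
  have hlim : ∀ a ∈ E₀, HasC1Lim y a (Φ a) ((fderiv ℝ τ (Φ a)).comp (fderiv ℝ Φ a)) :=
    fun a ha => h.hasC1Lim_target ha.1 (hs.lim_Φ a)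
  -- solutions near the graph
  have hgr : IsCompact ((fun a => (a, Φ a)) '' E₀) :=
    hE.image (continuous_id.prodMk h.smooth_Φ.continuous)
  obtain ⟨δ₁, hδ₁, hsol⟩ := hgr.exists_uniform
    (Q := fun k w => ((∀ j, R j w.2 (Φs k w.1) = 0) ∧ P w.2 *ᵥ Gs k w.1 = 0 ∧
        γs k w.1 w.2 = 0) ↔ w.2 = y k w.1 ∧ Θ k w.1 ∈ S ∧ Θ k w.1 t₀ = 0)
    (by
      rintro _ ⟨a, ha, rfl⟩
      exact h.eventually_system_iff hs ha.1 ha.2)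
  -- closeness of the second component
  have hdg : IsCompact ((fun a => (a, a)) '' E₀) := hE.image (continuous_id.prodMk continuous_id)
  obtain ⟨δ₂, hδ₂, hclose⟩ := hdg.exists_uniform
    (Q := fun k (w : (ι → ℝ) × (ι → ℝ)) => dist (y k w.1) (Φ w.2) < min ε δ₁)
    (by
      rintro _ ⟨a, ha, rfl⟩
      have h1 : Tendsto (fun p : ℕ × ((ι → ℝ) × (ι → ℝ)) => (p.1, p.2.1)) (atTop ×ˢ 𝓝 (a, a))
          (atTop ×ˢ 𝓝 a) :=
        tendsto_fst.prodMk (continuousAt_fst.tendsto.comp tendsto_snd)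
      have h2 : Tendsto (fun p : ℕ × ((ι → ℝ) × (ι → ℝ)) => Φ p.2.2) (atTop ×ˢ 𝓝 (a, a))
          (𝓝 (Φ a)) :=
        (h.smooth_Φ.continuous.tendsto a).comp (continuousAt_snd.tendsto.comp tendsto_snd)
      have h3 := ((hlim a ha).tendsto.comp h1).dist h2
      rw [dist_self] at h3
      exact h3.eventually (gt_mem_nhds (lt_min hε hδ₁)))
  -- local properties
  obtain ⟨δ₃, hδ₃, hloc⟩ := hE.exists_uniform
    (Q := fun k z => SmoothNear (y k) z ∧ SmoothNear ρ z ∧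
      (∀ i j, SmoothNear (fun z => conormal ρ (ρ z) i j) z) ∧ (ρ z ∈ S ∧ |ρ z t₀| < 1) ∧
      (∀ j, R j (y k z) (Φs k z) = 0) ∧
      ∀ v, (∀ j, fderiv ℝ (fun y => R j y (Φs k z)) (y k z) v = 0) → v = 0)
    (by
      intro a ha
      have hρ := h.tub.smooth a ha.1
      have hρa := h.tub.self a ha.1
      have hp : Tendsto ρ (𝓝 a) (𝓝 a) := by
        have := hρ.self_of_nhds.continuousAt.tendsto
        rwa [hρa] at this
      have habs : ∀ᶠ z : ι → ℝ in 𝓝 a, |z t₀| < 1 := by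
        refine ((continuous_apply t₀).abs.continuousAt (x := a)).eventually (gt_mem_nhds ?_)
        simp [ha.2]
      have hrel : ∀ᶠ z in 𝓝 a, ρ z ∈ S := by
        have h1 : Tendsto (fun z => (ρ z, z)) (𝓝 a) (𝓝 (a, a)) := hp.prodMk_nhds tendsto_id
        filter_upwards [h1.eventually (h.tub.rel a ha.1)] with z hz using (hz.2 rfl).1
      have hA : ∀ᶠ z in 𝓝 a, ∀ i j, SmoothNear (fun z => conormal ρ (ρ z) i j) z := by
        refine eventually_all.2 fun i => eventually_all.2 fun j => ?_
        refine SmoothNear.eventually (SmoothNear.comp (f := ρ)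
          (g := fun z => conormal ρ z i j) ?_ hρ)
        rw [hρa]
        exact smoothNear_conormal hρ i j
      have hΦy := (hlim a ha).tendsto.prodMk_nhds (hs.lim_Φ a).tendsto
      filter_upwards [eventually_prod_nhds (P := fun k z => ContDiffAt ℝ (⊤ : ℕ∞) (y k) z)
          (hlim a ha).1, tendsto_snd.eventually hρ.eventually, tendsto_snd.eventually hA,
        tendsto_snd.eventually hrel, tendsto_snd.eventually (hp.eventually habs),
        hΦy.eventually (h.target.rel _ ⟨a, ha.1, rfl⟩),
        hΦy.eventually (h.target.eventually_injective ⟨a, ha.1, rfl⟩)] with p h1 h2 h3 h4 h5 h6 h7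
      exact ⟨h1, h2, h3, ⟨h4, h5⟩, h6.2 rfl, h7⟩)
  obtain ⟨r, hr, hr₀, hthick⟩ := exists_thickening_of_hasC1Lim_id hE (Θ := Θ)
    (fun a ha => h.hasC1Lim_levelMap hs ha.1 ha.2)
    (r₀ := min (min ε δ₁) (min δ₂ δ₃)) (by positivity)
  have hrε : r ≤ ε := hr₀.trans ((min_le_left _ _).trans (min_le_left _ _))
  have hr1 : r ≤ δ₁ := hr₀.trans ((min_le_left _ _).trans (min_le_right _ _))
  have hr2 : r ≤ δ₂ := hr₀.trans ((min_le_right _ _).trans (min_le_left _ _))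
  have hr3 : r ≤ δ₃ := hr₀.trans ((min_le_right _ _).trans (min_le_right _ _))
  obtain ⟨k, hk1, hk2, hk3, ⟨hk4, hk5, hk6⟩, hk7⟩ := (hsol.and (hclose.and (hloc.and (hthick.and
    (hs.concentrate (thickening r ((fun a => (a, Φ a)) '' E₀)) isOpen_thickening
      fun a ha ht => self_subset_thickening hr _ ⟨a, ⟨ha, ht⟩, rfl⟩))))).exists
  have hO : ∀ z ∈ thickening r E₀, ∃ a ∈ E₀, dist z a < r := fun z hz => mem_thickening_iff.1 hz
  have hyc : ∀ a ∈ E₀, ∀ z, dist z a < r → dist (y k z) (Φ a) < min ε δ₁ := fun a ha z hz =>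
    hk2 _ ⟨a, ha, rfl⟩ (z, a) (by
      rw [Prod.dist_eq, dist_self]
      exact max_lt (hz.trans_le hr2) hδ₂)
  refine ⟨k, fun z => conormal ρ (ρ z), y k, Θ k, thickening r E₀, ⟨isOpen_thickening,
    fun z => rfl, fun z hz => (hk4 z hz).1, fun z hz => (hk4 z hz).2, hk5, fun a ha ht => ?_,
    fun a ha => ⟨self_subset_thickening hr _ (h.pp_mem a ha), h.levelMap_eq_self hs k ha⟩,
    ?_, ?_, ?_, ?_, ?_, ?_, fun z u => ⟨fun hzu => ?_, fun hzu => ?_⟩⟩, fun z hz h1 h2 => ?_⟩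
  · obtain ⟨z, h1, h2⟩ := hk6 a ⟨ha, ht⟩
    exact ⟨z, mem_thickening_iff.2 ⟨a, ⟨ha, ht⟩, h1⟩, h2⟩
  all_goals first
    | intro z hz
      obtain ⟨a, ha, hza⟩ := hO z hz
      obtain ⟨h1, h2, h3, h4, h5, h6⟩ := hk3 a ha z (hza.trans_le hr3)
      assumption
    | skip
  · obtain ⟨w, ⟨a, ha, rfl⟩, hw⟩ := mem_thickening_iff.1 (hk7 z u hzu.1 hzu.2.1 hzu.2.2)
    refine ⟨mem_thickening_iff.2 ⟨a, ha, ?_⟩,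
      (hk1 _ ⟨a, ha, rfl⟩ (z, u) (hw.trans_le hr1)).1 hzu⟩
    rw [Prod.dist_eq] at hw
    exact (le_max_left _ _).trans_lt hw
  · obtain ⟨h1, h2⟩ := hzu
    obtain ⟨a, ha, hza⟩ := hO z h1
    refine (hk1 _ ⟨a, ha, rfl⟩ (z, u) ?_).2 h2
    rw [Prod.dist_eq]
    refine max_lt (hza.trans_le hr1) ?_
    rw [h2.1]
    exact (hyc a ha z hza).trans_le (min_le_right _ _)
  · obtain ⟨w, hw1, hw2⟩ := hk6 (Θ k z) ⟨h1, h2⟩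
    have hwz : w = z := hk5 (mem_thickening_iff.2 ⟨_, ⟨h1, h2⟩, hw1⟩) hz hw2
    rw [hwz] at hw1
    exact ⟨hw1.trans_le hrε, (hyc _ ⟨h1, h2⟩ z hw1).trans_le (min_le_left _ _)⟩

end

end Level

section Level

open Filter Topology Matrix Metric

theorem IsTubular.finrank_range_flat {ι : Type*} [Fintype ι] [DecidableEq ι] {t₀ : ι} {c : ℕ}
    {S : Set (ι → ℝ)} {ρ : (ι → ℝ) → ι → ℝ} (h : IsTubular c S S ρ)
    (hcyl : ∀ z : ι → ℝ, |z t₀| < 1 → (z ∈ S ↔ flat t₀ z ∈ S)) {a : ι → ℝ} (ha : a ∈ S)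
    (ht : a t₀ = 0) :
    Module.finrank ℝ (LinearMap.range (((flat t₀).comp ((fderiv ℝ ρ a).comp (flat t₀)) :
      (ι → ℝ) →L[ℝ] ι → ℝ) : (ι → ℝ) →ₗ[ℝ] ι → ℝ)) = Fintype.card ι - (c + 1) := by
  set D := fderiv ℝ ρ a with hD
  set T : (ι → ℝ) →L[ℝ] ι → ℝ := (flat t₀).comp (D.comp (flat t₀)) with hT
  have he : D (Pi.single t₀ 1) = Pi.single t₀ 1 := by
    have := h.conormal_single hcyl ha (by simp [ht])
    rw [conormal_mulVec, sub_eq_zero] at this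
    exact this.symm
  have hTv : ∀ v, T v = flat t₀ (D v) := fun v => by
    have h1 : flat t₀ (Pi.single t₀ (1 : ℝ)) = 0 := by simp [flat_eq]
    simp only [hT, ContinuousLinearMap.comp_apply]
    rw [flat_eq t₀ v, map_sub, map_smul, he, map_sub, map_smul, h1, smul_zero, sub_zero]
  have hne : (Pi.single t₀ (1 : ℝ) : ι → ℝ) ≠ 0 := fun h0 => by
    have := congrFun h0 t₀
    simp at this
  have hker : LinearMap.ker (T : (ι → ℝ) →ₗ[ℝ] ι → ℝ) =
      LinearMap.ker (D : (ι → ℝ) →ₗ[ℝ] ι → ℝ) ⊔ Submodule.span ℝ {Pi.single t₀ (1 : ℝ)} := by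
    ext v
    rw [LinearMap.mem_ker, ContinuousLinearMap.coe_coe, hTv, Submodule.mem_sup]
    constructor
    · intro hv
      rw [flat_eq, sub_eq_zero] at hv
      refine ⟨v - (D v t₀) • Pi.single t₀ 1, ?_, (D v t₀) • Pi.single t₀ 1,
        Submodule.smul_mem _ _ (Submodule.mem_span_singleton_self _), sub_add_cancel _ _⟩
      rw [LinearMap.mem_ker, ContinuousLinearMap.coe_coe, map_sub, map_smul, he, sub_eq_zero]
      exact hv
    · rintro ⟨u, hu, w, hw, rfl⟩
      obtain ⟨r, rfl⟩ := Submodule.mem_span_singleton.1 hw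
      rw [LinearMap.mem_ker, ContinuousLinearMap.coe_coe] at hu
      rw [map_add, hu, map_smul, he]
      simp [flat_eq]
  have hinf : LinearMap.ker (D : (ι → ℝ) →ₗ[ℝ] ι → ℝ) ⊓
      Submodule.span ℝ {Pi.single t₀ (1 : ℝ)} = ⊥ := by
    refine (Submodule.eq_bot_iff _).2 fun v hv => ?_
    obtain ⟨r, rfl⟩ := Submodule.mem_span_singleton.1 hv.2
    have := hv.1
    rwa [SetLike.mem_coe, LinearMap.mem_ker, ContinuousLinearMap.coe_coe, map_smul, he] at this
  have h1 := Submodule.finrank_sup_add_finrank_inf_eq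
    (LinearMap.ker (D : (ι → ℝ) →ₗ[ℝ] ι → ℝ)) (Submodule.span ℝ {Pi.single t₀ (1 : ℝ)})
  rw [← hker, hinf, finrank_bot, finrank_span_singleton hne,
    (h.rank a ha).self_of_nhds ha] at h1
  have h2 := LinearMap.finrank_range_add_finrank_ker (T : (ι → ℝ) →ₗ[ℝ] ι → ℝ)
  rw [Module.finrank_fintype_fun_eq_card] at h2
  omega

section

variable {ι κ J : Type*} [Fintype ι] [DecidableEq ι] [Fintype κ] [DecidableEq κ] [Fintype J]
  {t₀ : ι} {c : ℕ} {S : Set (ι → ℝ)} {ρ : (ι → ℝ) → ι → ℝ} {pp : (ι → ℝ) → ℝ}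
  {R : J → (κ → ℝ) → (κ → ℝ) → ℝ} {P : (κ → ℝ) → Matrix ι ι ℝ}
  {φ : (ι → ℝ) → κ → ℝ} {g : (ι → ℝ) → ι → ℝ} {γ : (ι → ℝ) → (κ → ℝ) → ℝ}
  {A : (ι → ℝ) → Matrix ι ι ℝ} {y : (ι → ℝ) → κ → ℝ} {Θ : (ι → ℝ) → ι → ℝ} {O : Set (ι → ℝ)}

theorem SmoothNear.graph {z : ι → ℝ} (hy : SmoothNear y z) :
    SmoothNear (fun z => Sum.elim z (y z)) z := by
  refine smoothNear_pi fun i => ?_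
  cases i with
  | inl i => exact ContDiff.smoothNear (contDiff_apply ℝ ℝ i) z
  | inr j => exact hy.apply j

theorem fderiv_graph {z : ι → ℝ} (hy : SmoothNear y z) (w : ι → ℝ) :
    fderiv ℝ (fun z => Sum.elim z (y z)) z w = Sum.elim w (fderiv ℝ y z w) := by
  have hd := hy.graph.self_of_nhds.differentiableAt infty_ne_zero'
  have hdy := hy.self_of_nhds.differentiableAt infty_ne_zero'
  funext i
  have h1 := congrArg (fun L => L w) (_root_.fderiv_apply hd i)
  cases i with
  | inl i =>
    simp only [Sum.elim_inl] at h1 ⊢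
    have h2 : HasFDerivAt (fun z : ι → ℝ => z i)
      (ContinuousLinearMap.proj (R := ℝ) (φ := fun _ : ι => ℝ) i) z :=
      (ContinuousLinearMap.proj (R := ℝ) (φ := fun _ : ι => ℝ) i).hasFDerivAt
    rw [h2.fderiv] at h1
    exact h1.symm
  | inr j =>
    simp only [Sum.elim_inr] at h1 ⊢
    have h2 := congrArg (fun L => L w) (_root_.fderiv_apply hdy j)
    rw [h2] at h1
    exact h1.symm

/-- The solution set of the system with data `φ`, `g`, `γ`. -/
def levelSet (R : J → (κ → ℝ) → (κ → ℝ) → ℝ) (P : (κ → ℝ) → Matrix ι ι ℝ) (φ : (ι → ℝ) → κ → ℝ)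
    (g : (ι → ℝ) → ι → ℝ) (γ : (ι → ℝ) → (κ → ℝ) → ℝ) : Set (ι ⊕ κ → ℝ) :=
  {x | (∀ j, R j (x ∘ Sum.inr) (φ (x ∘ Sum.inl)) = 0) ∧
    P (x ∘ Sum.inr) *ᵥ g (x ∘ Sum.inl) = 0 ∧ γ (x ∘ Sum.inl) (x ∘ Sum.inr) = 0}

theorem IsLevel.mem_levelSet (h : IsLevel t₀ S ρ pp R P φ g γ A y Θ O) {x : ι ⊕ κ → ℝ} :
    x ∈ levelSet R P φ g γ ↔ ∃ z ∈ O, x = Sum.elim z (y z) ∧ Θ z ∈ S ∧ Θ z t₀ = 0 := by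
  constructor
  · intro hx
    obtain ⟨h1, h2, h3⟩ := (h.sol _ _).1 hx
    refine ⟨_, h1, ?_, h3⟩
    rw [← h2, Sum.elim_comp_inl_inr]
  · rintro ⟨z, h1, rfl, h2⟩
    exact (h.sol z (y z)).2 ⟨h1, rfl, h2⟩

/-- The differential of `Θ` on the kernel of the linearized system. -/
theorem IsLevel.fderiv_apply_of_kernel (h : IsLevel t₀ S ρ pp R P φ g γ A y Θ O) {z : ι → ℝ}
    (hz : z ∈ O) (hg : P (y z) *ᵥ g z = 0) {w : ι → ℝ}
    (hgw : ∀ i, ∃ L : (ι → ℝ) →L[ℝ] ℝ,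
      HasFDerivAt (fun z => (P (y z) *ᵥ g z) i) L z ∧ L w = 0)
    (hγw : ∃ L : (ι → ℝ) →L[ℝ] ℝ, HasFDerivAt (fun z => γ z (y z)) L z ∧ L w = 0) :
    fderiv ℝ Θ z w = flat t₀ (fderiv ℝ ρ z w) := by
  choose L hL hLw using hgw
  obtain ⟨M, hM, hMw⟩ := hγw
  have hA : ∀ i j, HasFDerivAt (fun z => A z i j) (fderiv ℝ (fun z => A z i j) z) z := fun i j =>
    ((h.smooth_A z hz i j).self_of_nhds.differentiableAt infty_ne_zero').hasFDerivAt
  have hρ : HasFDerivAt ρ (fderiv ℝ ρ z) z :=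
    ((h.smooth_ρ z hz).self_of_nhds.differentiableAt infty_ne_zero').hasFDerivAt
  have h1 : ∃ K : (ι → ℝ) →L[ℝ] ι → ℝ,
      HasFDerivAt (fun z => A z *ᵥ (P (y z) *ᵥ g z)) K z ∧ K w = 0 := by
    refine ⟨_, hasFDerivAt_pi.2 fun i => HasFDerivAt.fun_sum fun j _ => (hA i j).mul (hL j), ?_⟩
    funext i
    simp [_root_.sum_apply, hg, hLw]
  obtain ⟨K, hK, hKw⟩ := h1
  have h2 := ((flat t₀).hasFDerivAt.comp z (hρ.add hK)).add
    (hM.smul_const (Pi.single t₀ 1 : ι → ℝ))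
  have h3 : HasFDerivAt Θ _ z := h2.congr_of_eventuallyEq (Eventually.of_forall h.eq)
  rw [h3.fderiv]
  simp [hKw, hMw]

/-- The linearized system has no more solutions than the tangent space of its solution set. -/
theorem IsLevel.eq_graph_of_kernel (h : IsLevel t₀ S ρ pp R P φ g γ A y Θ O)
    (hR : ∀ j, IsQR fun x : ι ⊕ κ → ℝ => R j (x ∘ Sum.inr) (φ (x ∘ Sum.inl)))
    {z : ι → ℝ} (hz : z ∈ O) {v : ι ⊕ κ → ℝ}
    (hv : ∀ j, fderiv ℝ (fun x : ι ⊕ κ → ℝ => R j (x ∘ Sum.inr) (φ (x ∘ Sum.inl)))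
      (Sum.elim z (y z)) v = 0) :
    v = fderiv ℝ (fun z => Sum.elim z (y z)) z (v ∘ Sum.inl) := by
  have hy := h.smooth_y z hz
  have hdΓ := (hy.graph.self_of_nhds.differentiableAt infty_ne_zero').hasFDerivAt
  have hdf : ∀ j, HasFDerivAt (fun x : ι ⊕ κ → ℝ => R j (x ∘ Sum.inr) (φ (x ∘ Sum.inl)))
      (fderiv ℝ (fun x : ι ⊕ κ → ℝ => R j (x ∘ Sum.inr) (φ (x ∘ Sum.inl))) (Sum.elim z (y z)))
      (Sum.elim z (y z)) := fun j =>
    (((hR j).contDiff (n := 1)).differentiable one_ne_zero _).hasFDerivAt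
  let E : (κ → ℝ) →L[ℝ] ι ⊕ κ → ℝ := ContinuousLinearMap.pi
    (Sum.elim (fun _ => (0 : (κ → ℝ) →L[ℝ] ℝ))
      fun j => ContinuousLinearMap.proj (R := ℝ) (φ := fun _ : κ => ℝ) j)
  have hE : ∀ u, E u = Sum.elim (0 : ι → ℝ) u := fun u => by
    funext i
    cases i <;> rfl
  have hEd : HasFDerivAt (fun u : κ → ℝ => Sum.elim z u) E (y z) := by
    refine hasFDerivAt_pi'.2 fun i => ?_
    cases i with
    | inl i => exact hasFDerivAt_const _ _
    | inr j => exact (ContinuousLinearMap.proj (R := ℝ) (φ := fun _ : κ => ℝ) j).hasFDerivAt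
  have hw : v = fderiv ℝ (fun z => Sum.elim z (y z)) z (v ∘ Sum.inl) +
      E (v ∘ Sum.inr - fderiv ℝ y z (v ∘ Sum.inl)) := by
    rw [fderiv_graph hy, hE]
    funext i
    cases i <;> simp
  have h0 : v ∘ Sum.inr - fderiv ℝ y z (v ∘ Sum.inl) = 0 := by
    refine h.inj_R z hz _ fun j => ?_
    have h1 := (hdf j).comp (y z) hEd
    have h2 : HasFDerivAt (fun u => R j u (φ z)) _ (y z) := h1
    rw [h2.fderiv, ContinuousLinearMap.comp_apply]
    have h3 := (hdf j).comp z hdΓ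
    have h4 : HasFDerivAt (fun _ : ι → ℝ => (0 : ℝ)) _ z := h3.congr_of_eventuallyEq (by
      filter_upwards [h.isOpen.mem_nhds hz] with x hx
      exact (h.rel x hx j).symm)
    have h5 := congrArg (fun L => L (v ∘ Sum.inl)) (h4.unique (hasFDerivAt_const (0 : ℝ) z))
    have h6 := hv j
    rw [hw, map_add] at h6
    simp only [ContinuousLinearMap.comp_apply] at h5
    rw [h5] at h6
    simpa using h6
  rw [h0, map_zero, add_zero] at hw
  exact hw

theorem IsLevel.isQRegAt (h : IsLevel t₀ S ρ pp R P φ g γ A y Θ O) (htub : IsTubular c S S ρ)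
    (hcyl : ∀ z : ι → ℝ, |z t₀| < 1 → (z ∈ S ↔ flat t₀ z ∈ S))
    (hR : ∀ j, IsQR fun x : ι ⊕ κ → ℝ => R j (x ∘ Sum.inr) (φ (x ∘ Sum.inl)))
    (hP : ∀ i, IsQR fun x : ι ⊕ κ → ℝ => (P (x ∘ Sum.inr) *ᵥ g (x ∘ Sum.inl)) i)
    (hγ : IsQR fun x : ι ⊕ κ → ℝ => γ (x ∘ Sum.inl) (x ∘ Sum.inr))
    {b : ι ⊕ κ → ℝ} (hb : b ∈ levelSet R P φ g γ) :
    IsQRegAt (Fintype.card (ι ⊕ κ) - (Fintype.card ι - (c + 1))) (levelSet R P φ g γ) b := by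
  obtain ⟨z, hz, rfl, hS, ht⟩ := h.mem_levelSet.1 hb
  have hy := h.smooth_y z hz
  have hΘ := h.smooth z hz
  obtain ⟨Jn, hJ, hJl, hJr⟩ := hΘ.exists_localInverse (h.inj z hz) rfl
  have hJz : Jn (Θ z) = z := hJl.self_of_nhds
  have hfl : flat t₀ (Θ z) = Θ z := flat_eq_iff.2 ht
  have hρu := htub.smooth _ hS
  have hρself := htub.self _ hS
  have hΓ := hy.graph
  -- the retraction onto the base
  set r₀ : (ι → ℝ) → ι → ℝ := fun u => flat t₀ (ρ (flat t₀ u)) with hr₀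
  have hr₀z : r₀ (Θ z) = Θ z := by simp only [hr₀, hfl, hρself]
  have hr₀s : SmoothNear r₀ (Θ z) := by
    refine SmoothNear.comp (g := flat t₀) ((flat t₀).contDiff.smoothNear _)
      (SmoothNear.comp (f := flat t₀) (g := ρ) ?_ ((flat t₀).contDiff.smoothNear _))
    rwa [hfl]
  have hflt : Tendsto (flat t₀) (𝓝 (Θ z)) (𝓝 (Θ z)) := by
    have := (flat t₀).continuous.tendsto (Θ z)
    rwa [hfl] at this
  have hρt : Tendsto ρ (𝓝 (Θ z)) (𝓝 (Θ z)) := by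
    have := hρu.self_of_nhds.continuousAt.tendsto
    rwa [hρself] at this
  have habs : ∀ᶠ u : ι → ℝ in 𝓝 (Θ z), |u t₀| < 1 := by
    refine ((continuous_apply t₀).abs.continuousAt (x := Θ z)).eventually (gt_mem_nhds ?_)
    simp [ht]
  have hr₀mem : ∀ᶠ u in 𝓝 (Θ z), r₀ u ∈ S := by
    have h1 : Tendsto (fun u => (ρ u, u)) (𝓝 (Θ z)) (𝓝 (Θ z, Θ z)) := hρt.prodMk_nhds tendsto_id
    filter_upwards [hflt.eventually (h1.eventually (htub.rel _ hS)),
      hflt.eventually (hρt.eventually habs)] with u h2 h3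
    exact (hcyl _ h3).1 (h2.2 rfl).1
  -- the retraction
  have hΘt := hΘ.self_of_nhds.continuousAt
  have hJt : Tendsto Jn (𝓝 (Θ z)) (𝓝 z) := by
    have := hJ.self_of_nhds.continuousAt.tendsto
    rwa [hJz] at this
  let pr : (ι ⊕ κ → ℝ) →L[ℝ] ι → ℝ := ContinuousLinearMap.pi fun i =>
    ContinuousLinearMap.proj (R := ℝ) (φ := fun _ : ι ⊕ κ => ℝ) (Sum.inl i)
  have hpr : ∀ x, pr x = x ∘ Sum.inl := fun x => rfl
  have hprb : pr (Sum.elim z (y z)) = z := rfl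
  have hprt : Tendsto pr (𝓝 (Sum.elim z (y z))) (𝓝 z) := by
    have := pr.continuous.tendsto (Sum.elim z (y z))
    rwa [hprb] at this
  set DΓ := fderiv ℝ (fun z => Sum.elim z (y z)) z with hDΓ
  set DJ := fderiv ℝ Jn (Θ z) with hDJ
  set D₀ := fderiv ℝ r₀ (Θ z) with hD₀
  set DΘ := fderiv ℝ Θ z with hDΘ
  have sΓ : HasStrictFDerivAt (fun z => Sum.elim z (y z)) DΓ z :=
    hΓ.self_of_nhds.hasStrictFDerivAt infty_ne_zero'
  have sJ : HasStrictFDerivAt Jn DJ (Θ z) := hJ.self_of_nhds.hasStrictFDerivAt infty_ne_zero'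
  have s₀ : HasStrictFDerivAt r₀ D₀ (Θ z) := hr₀s.self_of_nhds.hasStrictFDerivAt infty_ne_zero'
  have sΘ : HasStrictFDerivAt Θ DΘ z := hΘ.self_of_nhds.hasStrictFDerivAt infty_ne_zero'
  have s1 : HasStrictFDerivAt (fun x => Θ (pr x)) (DΘ.comp pr) (Sum.elim z (y z)) := by
    have := pr.hasStrictFDerivAt (x := Sum.elim z (y z))
    exact HasStrictFDerivAt.comp _ (by rw [hprb]; exact sΘ) this
  have s2 : HasStrictFDerivAt (fun x => r₀ (Θ (pr x))) (D₀.comp (DΘ.comp pr))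
      (Sum.elim z (y z)) := HasStrictFDerivAt.comp _ (by rw [hprb]; exact s₀) s1
  have s3 : HasStrictFDerivAt (fun x => Jn (r₀ (Θ (pr x)))) (DJ.comp (D₀.comp (DΘ.comp pr)))
      (Sum.elim z (y z)) := HasStrictFDerivAt.comp _ (by rw [hprb, hr₀z]; exact sJ) s2
  have s4 : HasStrictFDerivAt (fun x => Sum.elim (Jn (r₀ (Θ (pr x)))) (y (Jn (r₀ (Θ (pr x))))))
      (DΓ.comp (DJ.comp (D₀.comp (DΘ.comp pr)))) (Sum.elim z (y z)) :=
    HasStrictFDerivAt.comp (g := fun z => Sum.elim z (y z)) _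
      (by rw [hprb, hr₀z, hJz]; exact sΓ) s3
  have hJΘ : ∀ w, DJ (DΘ w) = w := fun w => by
    have h1 := sJ.hasFDerivAt.comp z sΘ.hasFDerivAt
    have h2 : HasFDerivAt (fun x : ι → ℝ => x) _ z := h1.congr_of_eventuallyEq (by
      filter_upwards [hJl] with x hx using hx.symm)
    exact congrArg (fun L => L w) (h2.unique (hasFDerivAt_id z))
  have hr₀t : Tendsto r₀ (𝓝 (Θ z)) (𝓝 (Θ z)) := by
    have := hr₀s.self_of_nhds.continuousAt.tendsto
    rwa [hr₀z] at this
  have hD₀' : D₀ = (flat t₀).comp ((fderiv ℝ ρ (Θ z)).comp (flat t₀)) := by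
    have e1 : HasFDerivAt ρ (fderiv ℝ ρ (Θ z)) (flat t₀ (Θ z)) := by
      rw [hfl]
      exact (hρu.self_of_nhds.differentiableAt infty_ne_zero').hasFDerivAt
    exact ((flat t₀).hasFDerivAt.comp (Θ z) (e1.comp (Θ z) (flat t₀).hasFDerivAt)).fderiv
  have hDJ : Function.Injective DJ :=
    (LinearMap.injective_iff_surjective (f := (DJ : (ι → ℝ) →ₗ[ℝ] ι → ℝ))).2
      fun w => ⟨DΘ w, hJΘ w⟩
  have hDΘs : Function.Surjective DΘ :=
    (LinearMap.injective_iff_surjective (f := (DΘ : (ι → ℝ) →ₗ[ℝ] ι → ℝ))).1 (h.inj z hz)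
  have hDΓi : Function.Injective DΓ := fun w w' hw => by
    rw [hDΓ, fderiv_graph hy, fderiv_graph hy] at hw
    exact congrArg (fun x => x ∘ Sum.inl) hw
  have hrank : Module.finrank ℝ (LinearMap.range (DΓ.comp (DJ.comp (D₀.comp (DΘ.comp pr))) :
      (ι ⊕ κ → ℝ) →ₗ[ℝ] ι ⊕ κ → ℝ)) = Fintype.card ι - (c + 1) := by
    have e1 : LinearMap.range (DΓ.comp (DJ.comp (D₀.comp (DΘ.comp pr))) :
        (ι ⊕ κ → ℝ) →ₗ[ℝ] ι ⊕ κ → ℝ) = (LinearMap.range (D₀ : (ι → ℝ) →ₗ[ℝ] ι → ℝ)).map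
        ((DΓ.comp DJ : (ι → ℝ) →L[ℝ] ι ⊕ κ → ℝ) : (ι → ℝ) →ₗ[ℝ] ι ⊕ κ → ℝ) := by
      ext x
      simp only [LinearMap.mem_range, Submodule.mem_map]
      constructor
      · rintro ⟨v, rfl⟩
        exact ⟨_, ⟨DΘ (pr v), rfl⟩, rfl⟩
      · rintro ⟨_, ⟨w, rfl⟩, rfl⟩
        obtain ⟨u, rfl⟩ := hDΘs w
        exact ⟨Sum.elim u 0, rfl⟩
    have e2 : Function.Injective ((DΓ.comp DJ : (ι → ℝ) →L[ℝ] ι ⊕ κ → ℝ) :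
        (ι → ℝ) →ₗ[ℝ] ι ⊕ κ → ℝ) := hDΓi.comp hDJ
    rw [e1, ← htub.finrank_range_flat hcyl hS ht, ← hD₀']
    exact (LinearEquiv.finrank_eq (Submodule.equivMapOfInjective _ e2 _)).symm
  rw [← hrank]
  refine isQRegAt_of_retraction hb s4 ?_ ?_ ?_
  · filter_upwards [(hprt.eventually (hΘt.eventually hr₀mem)),
      hprt.eventually (hΘt.eventually (hr₀t.eventually (hJt.eventually (h.isOpen.mem_nhds hz)))),
      hprt.eventually (hΘt.eventually (hr₀t.eventually hJr))] with x h1 h2 h3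
    refine h.mem_levelSet.2 ⟨_, h2, rfl, ?_⟩
    rw [h3]
    exact ⟨h1, flat_self _ _⟩
  · filter_upwards [hprt.eventually hJl] with x h1 h2
    obtain ⟨w, hw, rfl, hS', ht'⟩ := h.mem_levelSet.1 h2
    have h3 : pr (Sum.elim w (y w)) = w := rfl
    rw [h3] at h1 ⊢
    have h4 : r₀ (Θ w) = Θ w := by
      simp only [hr₀, flat_eq_iff.2 ht', htub.self _ hS']
    rw [h4, h1]
  · intro v hv
    have hz0 : ∀ {f : (ι ⊕ κ → ℝ) → ℝ}, IsQR f → (∀ x ∈ levelSet R P φ g γ, f x = 0) →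
        fderiv ℝ f (Sum.elim z (y z)) v = 0 := fun hf hA => hf.fderiv_eq_zero hA hb hv
    have hvΓ := h.eq_graph_of_kernel hR hz fun j => hz0 (hR j) fun x hx => hx.1 j
    have hz1 : ∀ {f : (ι ⊕ κ → ℝ) → ℝ}, IsQR f → (∀ x ∈ levelSet R P φ g γ, f x = 0) →
        ∃ L : (ι → ℝ) →L[ℝ] ℝ, HasFDerivAt (fun z => f (Sum.elim z (y z))) L z ∧
          L (v ∘ Sum.inl) = 0 := fun {f} hf hA => by
      refine ⟨_, HasFDerivAt.comp z
        ((hf.contDiff (n := 1)).differentiable one_ne_zero _).hasFDerivAt sΓ.hasFDerivAt, ?_⟩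
      rw [ContinuousLinearMap.comp_apply, ← hvΓ]
      exact hz0 hf hA
    have h1 := h.fderiv_apply_of_kernel hz hb.2.1 (w := v ∘ Sum.inl)
      (fun i => hz1 (hP i) fun x hx => by rw [hx.2.1]; rfl) (hz1 hγ fun x hx => hx.2.2)
    have hΘz : Θ z = flat t₀ (ρ z) := by
      have h2 : P (y z) *ᵥ g z = 0 := hb.2.1
      have h3 : γ z (y z) = 0 := hb.2.2
      rw [h.eq, h2, h3]
      simp
    have h2 : D₀ (flat t₀ (fderiv ℝ ρ z (v ∘ Sum.inl))) =
        flat t₀ (fderiv ℝ ρ z (v ∘ Sum.inl)) := by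
      have e1 : HasFDerivAt (fun x => flat t₀ (ρ x)) ((flat t₀).comp (fderiv ℝ ρ z)) z :=
        (flat t₀).hasFDerivAt.comp z
          ((h.smooth_ρ z hz).self_of_nhds.differentiableAt infty_ne_zero').hasFDerivAt
      have e2 : HasFDerivAt (fun x => r₀ (flat t₀ (ρ x)))
          (D₀.comp ((flat t₀).comp (fderiv ℝ ρ z))) z :=
        HasFDerivAt.comp (g := r₀) (f := fun x => flat t₀ (ρ x)) z
          (show HasFDerivAt r₀ D₀ (flat t₀ (ρ z)) by rw [← hΘz]; exact s₀.hasFDerivAt) e1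
      have e3 := e2.congr_of_eventuallyEq (f₁ := fun x => flat t₀ (ρ x)) (by
        filter_upwards [h.isOpen.mem_nhds hz] with x hx
        simp only [hr₀, flat_flat]
        rw [htub.self _ ((hcyl _ (h.mem x hx).2).1 (h.mem x hx).1), flat_flat])
      exact congrArg (fun L => L (v ∘ Sum.inl)) (e3.unique e1)
    simp only [ContinuousLinearMap.comp_apply, hpr]
    rw [h1, h2, ← h1, hJΘ]
    exact hvΓ.symm

end

end Level

section Output

open Filter Topology Matrix Metric

theorem IsQRegAt.mono {ι : Type*} [Fintype ι] [DecidableEq ι] {c : ℕ} {V V' : Set (ι → ℝ)}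
    {a : ι → ℝ} (h : IsQRegAt c V a) (hV : V' ⊆ V) (hloc : ∀ᶠ x in 𝓝 a, x ∈ V → x ∈ V') :
    IsQRegAt c V' a := by
  obtain ⟨q, hq, hli, U, hU, haU, hVU⟩ := h
  obtain ⟨O, hO, hOo, haO⟩ := _root_.eventually_nhds_iff.1 hloc
  refine ⟨q, fun j x hx => hq j x (hV hx), hli, U ∩ O, hU.inter hOo, ⟨haU, haO⟩, ?_⟩
  ext x
  constructor
  · rintro ⟨hx, hxU⟩
    exact ⟨hxU, fun j => hq j x (hV hx)⟩
  · rintro ⟨hxU, hx⟩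
    have : x ∈ V ∩ U := hVU ▸ ⟨hxU.1, hx⟩
    exact ⟨hO x hxU.2 this.1, hxU⟩

/-- A `ℚ`-algebraic set on which a polynomial of positive top form in some of the coordinates and
a quadric in the remaining ones vanish is the zero set of one polynomial with definite top form. -/
theorem IsQAlgebraicSet.exists_hasTop {ι κ : Type*} [Fintype ι] [DecidableEq ι] [Fintype κ]
    [DecidableEq κ] {B : Set (ι ⊕ κ → ℝ)} (hB : IsQAlgebraicSet B) {f : (ι ⊕ κ → ℝ) → ℝ}
    (hf : IsQP f) (hfB : ∀ x ∈ B, f x = 0) {D : ℕ} {T : (ι ⊕ κ → ℝ) → ℝ} (hT : HasTop f D T)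
    (hT0 : ∀ x, 0 ≤ T x ∧ (x ∘ Sum.inl ≠ 0 → 0 < T x)) {L : κ → ℚ}
    (hL : ∀ x ∈ B, ∑ i, x (Sum.inr i) ^ 2 = ∑ i, (L i : ℝ) * x (Sum.inr i)) :
    ∃ F D T, IsQP F ∧ B = {x | F x = 0} ∧ HasTop F D T ∧ ∀ x, x ≠ 0 → T x ≠ 0 := by
  classical
  obtain ⟨s, hs⟩ := hB
  have hg : IsQP fun x : ι ⊕ κ → ℝ => ∑ p ∈ s, aeval x p ^ 2 :=
    IsQP.sum fun p _ => (IsQP.aeval p).pow 2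
  obtain ⟨n, hn⟩ := hg.hasTop_zero
  set f' : (ι ⊕ κ → ℝ) → ℝ := fun x => f x * ∑ i, x (Sum.inl i) ^ 2 with hf'
  have hf'Q : IsQP f' := hf.mul (IsQP.sum fun i _ => (IsQP.proj _).pow 2)
  have hf'T : HasTop f' (D + 1 * 2) fun x => T x * ∑ i, x (Sum.inl i) ^ 2 :=
    hT.mul (HasTop.sum fun i _ => (HasTop.proj (Sum.inl i : ι ⊕ κ)).pow 2)
  set o : (ι ⊕ κ → ℝ) → ℝ := fun x =>
    ∑ i, x (Sum.inr i) ^ 2 + ∑ i, ((-L i : ℚ) : ℝ) * x (Sum.inr i) with ho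
  have hoQ : IsQP o := (IsQP.sum fun i _ => (IsQP.proj _).pow 2).add
    (IsQP.sum fun i _ => (IsQP.rat _).mul (IsQP.proj _))
  have hoT : HasTop o (1 * 2) fun x => ∑ i, x (Sum.inr i) ^ 2 := by
    have h1 : HasTop (fun x : ι ⊕ κ → ℝ => ∑ i, ((-L i : ℚ) : ℝ) * x (Sum.inr i)) 1 _ :=
      HasTop.sum fun i _ => (HasTop.proj (Sum.inr i : ι ⊕ κ)).const_mul _
    have h2 : HasTop (fun x : ι ⊕ κ → ℝ => ∑ i, x (Sum.inr i) ^ 2) (1 * 2) _ :=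
      HasTop.sum fun i _ => (HasTop.proj (Sum.inr i : ι ⊕ κ)).pow 2
    exact (h2.add (h1.lower (by norm_num))).congr fun x => add_zero _
  have hfp : HasTop (fun x => f' x ^ 4) ((D + 1 * 2) * 4) _ := hf'T.pow 4
  have hop : HasTop (fun x => o x ^ (2 * (D + 1 * 2))) (1 * 2 * (2 * (D + 1 * 2))) _ :=
    hoT.pow (2 * (D + 1 * 2))
  rw [show 1 * 2 * (2 * (D + 1 * 2)) = (D + 1 * 2) * 4 by ring] at hop
  have hΩT := (hfp.add hop).pow (n + 1)
  have hFT := hΩT.add (hn ((D + 1 * 2) * 4 * (n + 1)) (by nlinarith))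
  have hpos : ∀ x, 0 ≤ o x ^ (2 * (D + 1 * 2)) := fun x => (even_two_mul _).pow_nonneg _
  refine ⟨_, _, _, (((hf'Q.pow 4).add (hoQ.pow _)).pow (n + 1)).add hg, ?_, hFT,
    fun x hx h0 => ?_⟩
  · rw [hs]
    ext x
    constructor
    · intro hx
      have h1 : f' x = 0 := by
        simp only [hf', hfB x (hs ▸ hx), zero_mul]
      have h2 : o x = 0 := by
        simp only [ho, hL x (hs ▸ hx), Rat.cast_neg, neg_mul, Finset.sum_neg_distrib, add_neg_cancel]
      have h3 : ∑ p ∈ s, (aeval (x : ι ⊕ κ → ℝ) p : ℝ) ^ 2 = 0 :=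
        Finset.sum_eq_zero fun p hp => by rw [hx p hp]; norm_num
      show (f' x ^ 4 + o x ^ (2 * (D + 1 * 2))) ^ (n + 1) + _ = 0
      rw [h1, h2, h3]
      norm_num
    · intro hx
      have h1 : (f' x ^ 4 + o x ^ (2 * (D + 1 * 2))) ^ (n + 1) +
        ∑ p ∈ s, (aeval (x : ι ⊕ κ → ℝ) p : ℝ) ^ 2 = 0 := hx
      have h2 : 0 ≤ ∑ p ∈ s, (aeval (x : ι ⊕ κ → ℝ) p : ℝ) ^ 2 :=
        Finset.sum_nonneg fun p _ => sq_nonneg _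
      have h3 : 0 ≤ (f' x ^ 4 + o x ^ (2 * (D + 1 * 2))) ^ (n + 1) :=
        pow_nonneg (add_nonneg (by positivity) (hpos x)) _
      have h4 := (Finset.sum_eq_zero_iff_of_nonneg fun p _ => sq_nonneg _).1
        (show ∑ p ∈ s, (aeval (x : ι ⊕ κ → ℝ) p : ℝ) ^ 2 = 0 by linarith)
      exact fun p hp => by simpa using h4 p hp
  · have h1 : ((T x * ∑ i, x (Sum.inl i) ^ 2) ^ 4 +
      (∑ i, x (Sum.inr i) ^ 2) ^ (2 * (D + 1 * 2))) ^ (n + 1) + 0 = 0 := h0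
    rw [add_zero] at h1
    have h2 := eq_zero_of_pow_eq_zero h1
    have h3 : 0 ≤ (T x * ∑ i, x (Sum.inl i) ^ 2) ^ 4 := by positivity
    have h4 : 0 ≤ (∑ i, x (Sum.inr i) ^ 2) ^ (2 * (D + 1 * 2)) := by positivity
    have h5 : x ∘ Sum.inl = 0 := by
      by_contra hne
      have h6 := eq_zero_of_pow_eq_zero
        (show (T x * ∑ i, x (Sum.inl i) ^ 2) ^ 4 = 0 by linarith)
      rcases mul_eq_zero.1 h6 with h7 | h7
      · exact ((hT0 x).2 hne).ne' h7
      · refine hne ?_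
        rw [Finset.sum_eq_zero_iff_of_nonneg fun p _ => sq_nonneg _] at h7
        funext i
        simpa using h7 i (Finset.mem_univ _)
    have h6 := eq_zero_of_pow_eq_zero
      (show (∑ i, x (Sum.inr i) ^ 2) ^ (2 * (D + 1 * 2)) = 0 by linarith)
    rw [Finset.sum_eq_zero_iff_of_nonneg fun p _ => sq_nonneg _] at h6
    refine hx ?_
    funext i
    cases i with
    | inl i => exact congrFun h5 i
    | inr i => simpa using h6 i (Finset.mem_univ _)

section

variable {ι κ J : Type*} [Fintype ι] [DecidableEq ι] [Fintype κ] [DecidableEq κ] [Fintype J]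
  {t₀ : ι} {c : ℕ} {S : Set (ι → ℝ)} {ρ : (ι → ℝ) → ι → ℝ} {pp : (ι → ℝ) → ℝ}
  {R : J → (κ → ℝ) → (κ → ℝ) → ℝ} {P : (κ → ℝ) → Matrix ι ι ℝ}
  {φ : (ι → ℝ) → κ → ℝ} {g : (ι → ℝ) → ι → ℝ} {γ : (ι → ℝ) → (κ → ℝ) → ℝ}
  {A : (ι → ℝ) → Matrix ι ι ℝ} {y : (ι → ℝ) → κ → ℝ} {Θ : (ι → ℝ) → ι → ℝ} {O : Set (ι → ℝ)}

theorem IsLevel.pp_eq_zero_iff (h : IsLevel t₀ S ρ pp R P φ g γ A y Θ O) {z : ι → ℝ}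
    (hz : z ∈ O) : pp z = 0 ↔ pp (Θ z) = 0 := by
  constructor
  · intro h0
    rwa [(h.fix z h0).2]
  · intro h0
    have h1 := h.fix _ h0
    rwa [h.injOn h1.1 hz h1.2] at h0

theorem IsLevel.eventually_pp_eq_zero (h : IsLevel t₀ S ρ pp R P φ g γ A y Θ O)
    (hpp : ∀ a, pp a = 0 → ∀ᶠ z in 𝓝 a, z ∈ S → z t₀ = 0 → pp z = 0) {b : ι ⊕ κ → ℝ}
    (hb : pp (b ∘ Sum.inl) = 0) :
    ∀ᶠ x in 𝓝 b, x ∈ levelSet R P φ g γ → pp (x ∘ Sum.inl) = 0 := by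
  obtain ⟨hO, hΘ⟩ := h.fix _ hb
  have h1 : Tendsto (fun x : ι ⊕ κ → ℝ => x ∘ Sum.inl) (𝓝 b) (𝓝 (b ∘ Sum.inl)) :=
    Continuous.tendsto (by fun_prop) b
  have h2 := (h.smooth _ hO).self_of_nhds.continuousAt.tendsto
  rw [hΘ] at h2
  filter_upwards [h1.eventually (h2.eventually (hpp _ hb))] with x hx hxB
  obtain ⟨w, hw, rfl, hS, ht⟩ := h.mem_levelSet.1 hxB
  exact (h.pp_eq_zero_iff hw).2 (hx hS ht)

theorem IsLevel.smoothNear_invFunOn (h : IsLevel t₀ S ρ pp R P φ g γ A y Θ O) {z : ι → ℝ}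
    (hz : z ∈ O) : SmoothNear (Function.invFunOn Θ O) (Θ z) := by
  obtain ⟨J', hJ, hJl, hJr⟩ := (h.smooth z hz).exists_localInverse (h.inj z hz) rfl
  have hJt := hJ.self_of_nhds.continuousAt.tendsto
  rw [hJl.self_of_nhds] at hJt
  refine hJ.congr ?_
  filter_upwards [hJr, hJt.eventually (h.isOpen.mem_nhds hz)] with u h1 h2
  have h3 : ∃ w ∈ O, Θ w = u := ⟨_, h2, h1⟩
  exact h.injOn (Function.invFunOn_mem h3) h2 ((Function.invFunOn_eq h3).trans h1.symm)

end

theorem IsCore.exists_approx {ι κ J : Type*} [Fintype ι] [DecidableEq ι] [Fintype κ]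
    [DecidableEq κ] [Fintype J] {t₀ : ι} {c : ℕ} {S : Set (ι → ℝ)} {ρ : (ι → ℝ) → ι → ℝ}
    {pp kap : (ι → ℝ) → ℝ} {R : J → (κ → ℝ) → (κ → ℝ) → ℝ} {τ : (κ → ℝ) → κ → ℝ}
    {P : (κ → ℝ) → Matrix ι ι ℝ} {Φ : (ι → ℝ) → κ → ℝ} {G : (ι → ℝ) → ι → ℝ}
    (h : IsCore t₀ c S ρ pp kap R τ P Φ G) {ε : ℝ} (hε : 0 < ε) :
    ∃ (B : Set (ι ⊕ κ → ℝ)) (H : (ι → ℝ) → ι ⊕ κ → ℝ) (K : (ι ⊕ κ → ℝ) → ι → ℝ),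
      IsQAlgebraicSet B ∧
      (∀ b ∈ B, IsQRegAt (Fintype.card (ι ⊕ κ) - (Fintype.card ι - (c + 1))) B b) ∧
      (∃ F D T, IsQP F ∧ B = {x | F x = 0} ∧ HasTop F D T ∧ ∀ x, x ≠ 0 → T x ≠ 0) ∧
      Set.BijOn H {a ∈ S | a t₀ = 0 ∧ pp a ≠ 0} B ∧
      Set.InvOn K H {a ∈ S | a t₀ = 0 ∧ pp a ≠ 0} B ∧
      (∀ a ∈ S, a t₀ = 0 → SmoothNear H a) ∧ (∀ b ∈ B, SmoothNear K b) ∧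
      (∀ a ∈ S, a t₀ = 0 → dist (H a ∘ Sum.inl) a < ε ∧ dist (H a ∘ Sum.inr) (Φ a) < ε) ∧
      ∀ b ∈ B, ∃ x, ∀ j, R j (b ∘ Sum.inr) x = 0 := by
  obtain ⟨Φs, Gs, γs, hs⟩ := h.exists_isSystem
  obtain ⟨k, A, y, Θ, O, hl, hd⟩ := h.exists_isLevel hs hε
  have hinl : ∀ i, IsQP fun x : ι ⊕ κ → ℝ => (x ∘ Sum.inl) i := fun i => IsQP.proj _
  have hinr : ∀ i, IsQP fun x : ι ⊕ κ → ℝ => (x ∘ Sum.inr) i := fun i => IsQP.proj _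
  have hR : ∀ j, IsQR fun x : ι ⊕ κ → ℝ => R j (x ∘ Sum.inr) (Φs k (x ∘ Sum.inl)) := fun j => by
    obtain ⟨α, β, hα, hβ, hj⟩ := h.target.affine j
    simp only [hj]
    exact (hα.comp hinr).isQR.add (IsQR.sum fun i _ =>
      ((hβ i).comp hinr).isQR.mul ((hs.isQR_Φ k i).comp hinl))
  have hP : ∀ i, IsQR fun x : ι ⊕ κ → ℝ => (P (x ∘ Sum.inr) *ᵥ Gs k (x ∘ Sum.inl)) i := fun i => by
    simp only [mulVec, dotProduct]
    exact IsQR.sum fun j _ => ((h.isQP_P i j).comp hinr).isQR.mul ((hs.isQR_G k j).comp hinl)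
  have hγ := (hs.isQP_γ k).isQR
  set B₀ := levelSet R P (Φs k) (Gs k) (γs k) with hB₀
  have hreg := fun b (hb : b ∈ B₀) => hl.isQRegAt h.tub h.cyl hR hP hγ hb
  have hB₀Q : IsQAlgebraicSet B₀ := by
    have := IsQR.isQAlgebraicSet (J := J ⊕ ι ⊕ Unit) (f := fun j x => j.elim
      (fun j => R j (x ∘ Sum.inr) (Φs k (x ∘ Sum.inl))) fun j => j.elim
      (fun i => (P (x ∘ Sum.inr) *ᵥ Gs k (x ∘ Sum.inl)) i)
      fun _ => γs k (x ∘ Sum.inl) (x ∘ Sum.inr)) (by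
        rintro (j | i | _)
        · exact hR j
        · exact hP i
        · exact hγ)
    convert this using 1
    ext x
    simp only [hB₀, levelSet, Sum.forall, Sum.elim_inl, Sum.elim_inr, forall_const]
    exact and_congr_right fun _ => and_congr_left fun _ => funext_iff
  obtain ⟨q, hq⟩ : IsQP fun x : ι ⊕ κ → ℝ => pp (x ∘ Sum.inl) := h.isQP_pp.comp hinl
  have hev : ∀ b ∈ B₀, pp (b ∘ Sum.inl) = 0 → ∀ᶠ x in 𝓝 b, x ∈ B₀ → pp (x ∘ Sum.inl) = 0 :=
    fun b _ hb => hl.eventually_pp_eq_zero h.pp_loc hb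
  set B : Set (ι ⊕ κ → ℝ) := {x ∈ B₀ | pp (x ∘ Sum.inl) ≠ 0} with hB
  have hBQ : IsQAlgebraicSet B := by
    have := hB₀Q.diff_zeros q (fun a ha _ => hreg a ha) (by simpa only [← hq] using hev)
    simpa only [← hq] using this
  have hmem : ∀ x ∈ B, ∃ z ∈ O, x = Sum.elim z (y z) ∧ Θ z ∈ S ∧ Θ z t₀ = 0 ∧ pp (Θ z) ≠ 0 := by
    rintro x ⟨hx, hxp⟩
    obtain ⟨z, hz, rfl, hS, ht⟩ := hl.mem_levelSet.1 hx
    exact ⟨z, hz, rfl, hS, ht, fun h0 => hxp ((hl.pp_eq_zero_iff hz).2 h0)⟩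
  set H : (ι → ℝ) → ι ⊕ κ → ℝ := fun a =>
    Sum.elim (Function.invFunOn Θ O a) (y (Function.invFunOn Θ O a)) with hH
  set K : (ι ⊕ κ → ℝ) → ι → ℝ := fun x => Θ (x ∘ Sum.inl) with hK
  have hHm : Set.MapsTo H {a ∈ S | a t₀ = 0 ∧ pp a ≠ 0} B := by
    rintro a ⟨hS, ht, hp⟩
    have h1 := hl.surj a hS ht
    have h2 := Function.invFunOn_mem h1
    have h3 := Function.invFunOn_eq h1
    refine ⟨hl.mem_levelSet.2 ⟨_, h2, rfl, by rwa [h3], by rwa [h3]⟩, fun h0 => hp ?_⟩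
    rw [← h3]
    exact (hl.pp_eq_zero_iff h2).1 h0
  have hKm : Set.MapsTo K B {a ∈ S | a t₀ = 0 ∧ pp a ≠ 0} := by
    intro b hb
    obtain ⟨z, hz, rfl, h1⟩ := hmem b hb
    exact h1
  have hinv : Set.InvOn K H {a ∈ S | a t₀ = 0 ∧ pp a ≠ 0} B := by
    constructor
    · rintro a ⟨hS, ht, hp⟩
      exact Function.invFunOn_eq (hl.surj a hS ht)
    · intro b hb
      obtain ⟨z, hz, rfl, h1⟩ := hmem b hb
      have h2 : Function.invFunOn Θ O (Θ z) = z := hl.injOn.leftInvOn_invFunOn hz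
      show Sum.elim (Function.invFunOn Θ O (Θ z)) (y (Function.invFunOn Θ O (Θ z))) = _
      rw [h2]
  refine ⟨B, H, K, hBQ, fun b hb => ?_, ?_, hinv.bijOn hHm hKm, hinv, fun a hS ht => ?_,
    fun b hb => ?_, fun a hS ht => ?_, fun b hb => ⟨_, hb.1.1⟩⟩
  · refine (hreg b hb.1).mono (fun x hx => hx.1) ?_
    have h1 : Continuous fun x : ι ⊕ κ → ℝ => pp (x ∘ Sum.inl) :=
      h.isQP_pp.continuous.comp (by fun_prop)
    filter_upwards [h1.continuousAt.eventually_ne hb.2] with x hx hx0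
    exact ⟨hx0, hx⟩
  · obtain ⟨D, T, hT, hT0⟩ := hs.top_γ k
    obtain ⟨L, hL⟩ := h.target.quad
    exact hBQ.exists_hasTop (hs.isQP_γ k) (fun x hx => hx.1.2.2) hT hT0
      fun x hx => hL (x ∘ Sum.inr) _ hx.1.1
  · obtain ⟨z, hz, rfl⟩ := hl.surj a hS ht
    have h1 := hl.smoothNear_invFunOn hz
    have h2 : Function.invFunOn Θ O (Θ z) = z := hl.injOn.leftInvOn_invFunOn hz
    exact SmoothNear.comp (g := fun z => Sum.elim z (y z)) (f := Function.invFunOn Θ O)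
      (by rw [h2]; exact (hl.smooth_y z hz).graph) h1
  · obtain ⟨z, hz, rfl, -⟩ := hmem b hb
    let pr : (ι ⊕ κ → ℝ) →L[ℝ] ι → ℝ := ContinuousLinearMap.pi fun i =>
      ContinuousLinearMap.proj (R := ℝ) (φ := fun _ : ι ⊕ κ => ℝ) (Sum.inl i)
    exact SmoothNear.comp (g := Θ) (f := pr) (hl.smooth z hz) (pr.contDiff.smoothNear _)
  · obtain ⟨z, hz, rfl⟩ := hl.surj a hS ht
    have h2 : Function.invFunOn Θ O (Θ z) = z := hl.injOn.leftInvOn_invFunOn hz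
    simp only [hH, h2, Sum.elim_comp_inl, Sum.elim_comp_inr]
    exact hd z hz hS ht

end Output

section Spine

open Filter Topology Matrix Metric

variable {ι : Type*} [Fintype ι] [DecidableEq ι] {t₀ : ι} {c : ℕ} {S V : Set (ι → ℝ)}
  {ρ : (ι → ℝ) → ι → ℝ}

theorem IsSpine.exists_isCore (h : IsSpine t₀ c S V ρ) {q e : ℕ} {W : Set (Fin q → ℝ)}
    (hW : IsQNonsingular e W) {φ : (ι → ℝ) → Fin q → ℝ} (hφ : ContDiffOn ℝ (⊤ : ℕ∞) φ S)
    (hφW : Set.MapsTo φ S W) (hφQ : IsQRegularMap {z | z ∈ V ∧ z t₀ = 0} φ)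
    {pp kap : (ι → ℝ) → ℝ} (hpp : IsQP pp) (hppV : ∀ z, pp z = 0 ↔ z ∈ V ∧ z t₀ = 0)
    (hkap : IsQP kap) (hkap0 : ∀ z, 0 ≤ kap z) (hkapV : ∀ z, pp z = 0 → kap z = 0)
    (hkapT : ∃ D T, 1 < D ∧ HasTop kap D T ∧ ∀ x, x ≠ 0 → 0 < T x) :
    ∃ (m : ℕ) (R : (Fin m ⊕ Option (Fin q)) ⊕ (ι × ι) × Fin 3 →
        (Option (Fin q) ⊕ ι × ι → ℝ) → (Option (Fin q) ⊕ ι × ι → ℝ) → ℝ)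
      (τ : (Option (Fin q) ⊕ ι × ι → ℝ) → Option (Fin q) ⊕ ι × ι → ℝ)
      (P : (Option (Fin q) ⊕ ι × ι → ℝ) → Matrix ι ι ℝ)
      (Φ : (ι → ℝ) → Option (Fin q) ⊕ ι × ι → ℝ) (G : (ι → ℝ) → ι → ℝ),
      IsCore t₀ c S ρ pp kap R τ P Φ G ∧
      (∀ a ∈ S, a t₀ = 0 → Φ a ∘ Sum.inl = stereo (φ a)) ∧
      ∀ y x, (∀ j, R j y x = 0) → y (Sum.inl none) ≠ 0 →
        (fun i => y (Sum.inl (some i)) / y (Sum.inl none)) ∈ W := by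
  obtain ⟨N, hN, hNS, hNr⟩ := h.exists_normal_field
  obtain ⟨G, hG, hGS, hGr⟩ := h.exists_displacement
  obtain ⟨σ, hσ, hσS, hσφ, hσr⟩ := h.exists_stereo_extension hφ hφQ
  obtain ⟨m, R₁, τ₁, hT₁, hR₁⟩ := exists_isTarget_stereo hW
    (h.compact.image_of_continuousOn hφ.continuousOn) (Set.image_subset_iff.2 hφW)
  obtain ⟨τ₂, hT₂⟩ := exists_isTarget_projEq (K := N '' S) (h.compact.image hN.continuous) (by
    rintro _ ⟨a, ha, rfl⟩
    rw [hNS a ha, toMat_ofMat]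
    have hs := (h.tub.symm a ha).self_of_nhds ha
    have hi := (h.tub.idem a ha).self_of_nhds ha
    refine ⟨?_, (h.tub.conormal_transpose ha).self_of_nhds ha⟩
    refine Matrix.toLin'.injective (LinearMap.ext fun v => ?_)
    rw [Matrix.toLin'_mul, LinearMap.comp_apply, Matrix.toLin'_apply, Matrix.toLin'_apply,
      conormal_mulVec, conormal_mulVec, map_sub, hi, sub_self, sub_zero])
  have hT := hT₁.sum hT₂ (K'' := (fun a => Sum.elim (σ a) (N a)) '' S)
    (by rintro _ ⟨a, ha, rfl⟩; exact hσS a ha) (by rintro _ ⟨a, ha, rfl⟩; exact ⟨a, ha, rfl⟩)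
  refine ⟨m, _, _, fun y => toMat (y ∘ Sum.inr), fun a => Sum.elim (σ a) (N a), G, ⟨h.compact,
    h.tub, h.cyl, hT, fun i j => IsQP.proj _, fun a ha => ?_, fun y x hyx => ?_, ?_, hG,
    fun a ha => (hGS a ha).1, fun a ha => (hGS a ha).2, hpp, fun z hz => ?_, fun a ha => ?_, ?_,
    fun i => ?_, hkap, hkap0, hkapV, hkapT⟩, fun a ha ht => hσφ a ha ht, fun y x hyx hy => ?_⟩
  · rw [Sum.elim_comp_inr, hNS a ha, toMat_ofMat]
  · exact (projEq_eq_zero.1 fun j => hyx (Sum.inr j)).1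
  · refine contDiff_pi.2 fun i => ?_
    cases i with
    | inl i => exact contDiff_pi.1 hσ i
    | inr i => exact contDiff_pi.1 hN i
  · have := (hppV z).1 hz
    exact ⟨h.sub z this.1 this.2, this.2⟩
  · have := (hppV a).1 ha
    filter_upwards [h.loc a this.1 this.2] with z hz hzS hzt
    exact (hppV z).2 ⟨hz hzS, hzt⟩
  · rintro (i | i)
    · obtain ⟨r, hr, hr'⟩ := hσr i
      exact ⟨r, hr, fun a ha => hr' a ((hppV a).1 ha).1 ((hppV a).1 ha).2⟩
    · obtain ⟨r, hr, hr'⟩ := hNr i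
      exact ⟨r, hr, fun a ha => hr' a ((hppV a).1 ha).1 ((hppV a).1 ha).2⟩
  · obtain ⟨r, hr, hr'⟩ := hGr i
    exact ⟨r, hr, fun a ha => hr' a ((hppV a).1 ha).1 ((hppV a).1 ha).2⟩
  · exact hR₁ (y ∘ Sum.inl) (x ∘ Sum.inl) (fun j => hyx (Sum.inl j)) hy

/-- Approximation along a spine, in coordinates adapted to the construction. -/
theorem IsSpine.exists_approx (h : IsSpine t₀ c S V ρ) {q e : ℕ} {W : Set (Fin q → ℝ)}
    (hW : IsQNonsingular e W) {φ : (ι → ℝ) → Fin q → ℝ} (hφ : ContDiffOn ℝ (⊤ : ℕ∞) φ S)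
    (hφW : Set.MapsTo φ S W) (hφQ : IsQRegularMap {z | z ∈ V ∧ z t₀ = 0} φ)
    {pp kap : (ι → ℝ) → ℝ} (hpp : IsQP pp) (hppV : ∀ z, pp z = 0 ↔ z ∈ V ∧ z t₀ = 0)
    (hkap : IsQP kap) (hkap0 : ∀ z, 0 ≤ kap z) (hkapV : ∀ z, pp z = 0 → kap z = 0)
    (hkapT : ∃ D T, 1 < D ∧ HasTop kap D T ∧ ∀ x, x ≠ 0 → 0 < T x) {ε : ℝ} (hε : 0 < ε) :
    ∃ (B : Set (ι ⊕ (Option (Fin q) ⊕ ι × ι) → ℝ))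
      (H : (ι → ℝ) → ι ⊕ (Option (Fin q) ⊕ ι × ι) → ℝ)
      (K : (ι ⊕ (Option (Fin q) ⊕ ι × ι) → ℝ) → ι → ℝ) (C : ℝ),
      IsQAlgebraicSet B ∧
      (∀ b ∈ B, IsQRegAt (Fintype.card (ι ⊕ (Option (Fin q) ⊕ ι × ι)) -
        (Fintype.card ι - (c + 1))) B b) ∧
      (∃ F D T, IsQP F ∧ B = {x | F x = 0} ∧ HasTop F D T ∧ ∀ x, x ≠ 0 → T x ≠ 0) ∧
      Set.BijOn H {a ∈ S | a t₀ = 0 ∧ a ∉ V} B ∧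
      Set.InvOn K H {a ∈ S | a t₀ = 0 ∧ a ∉ V} B ∧
      (∀ a ∈ S, a t₀ = 0 → SmoothNear H a) ∧ (∀ b ∈ B, SmoothNear K b) ∧
      (∀ a ∈ S, a t₀ = 0 → dist (H a ∘ Sum.inl) a < ε ∧ (∀ j, |H a (Sum.inr j)| ≤ C) ∧
        dist (fun i => H a (Sum.inr (Sum.inl (some i))) / H a (Sum.inr (Sum.inl none))) (φ a) < ε) ∧
      ∀ b ∈ B, b (Sum.inr (Sum.inl none)) ≠ 0 ∧
        (fun i => b (Sum.inr (Sum.inl (some i))) / b (Sum.inr (Sum.inl none))) ∈ W := by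
  obtain ⟨m, R, τ, P, Φ, G, hcore, hΦ, hRW⟩ :=
    h.exists_isCore hW hφ hφW hφQ hpp hppV hkap hkap0 hkapV hkapT
  have hE : IsCompact {a ∈ S | a t₀ = 0} :=
    h.compact.inter_right (isClosed_eq (continuous_apply t₀) continuous_const)
  obtain ⟨C₀, hC₀⟩ := (hE.image hcore.smooth_Φ.continuous).isBounded.exists_norm_le
  obtain ⟨δ, hδ, hδE⟩ : ∃ δ > 0, ∀ a ∈ S, a t₀ = 0 → ∀ u, dist u (Φ a) < δ →
      u (Sum.inl none) ≠ 0 ∧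
        dist (fun i => u (Sum.inl (some i)) / u (Sum.inl none)) (φ a) < ε := by
    have hc := hE.image hcore.smooth_Φ.continuous
    have hpos : ∀ u ∈ Φ '' {a ∈ S | a t₀ = 0}, u (Sum.inl none) ≠ 0 := by
      rintro _ ⟨a, ⟨ha, ht⟩, rfl⟩
      have : Φ a (Sum.inl none) = stereo (φ a) none := congrFun (hΦ a ha ht) none
      rw [this]
      exact (stereo_none_pos _).ne'
    obtain ⟨δ₁, hδ₁, h1⟩ := hc.exists_thickening_subset_open
      (isOpen_ne_fun (continuous_apply (Sum.inl none)) continuous_const) hpos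
    have h2 := hc.uniformContinuousAt_of_continuousAt
      (fun u : Option (Fin q) ⊕ ι × ι → ℝ => fun i => u (Sum.inl (some i)) / u (Sum.inl none))
      (fun u hu => continuousAt_pi.2 fun i => (continuous_apply _).continuousAt.div
        (continuous_apply _).continuousAt (hpos u hu)) (dist_mem_uniformity hε)
    obtain ⟨δ₂, hδ₂, h3⟩ := mem_uniformity_dist.1 h2
    refine ⟨min δ₁ δ₂, lt_min hδ₁ hδ₂, fun a ha ht u hu => ?_⟩
    have ha' : Φ a ∈ Φ '' {a ∈ S | a t₀ = 0} := ⟨a, ⟨ha, ht⟩, rfl⟩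
    have hφa : (fun i => Φ a (Sum.inl (some i)) / Φ a (Sum.inl none)) = φ a := by
      rw [← stereo_div (φ a), ← hΦ a ha ht]
      rfl
    refine ⟨h1 (mem_thickening_iff.2 ⟨_, ha', hu.trans_le (min_le_left _ _)⟩), ?_⟩
    have h4 : dist (fun i => Φ a (Sum.inl (some i)) / Φ a (Sum.inl none))
      (fun i => u (Sum.inl (some i)) / u (Sum.inl none)) < ε :=
        h3 ((dist_comm _ _).trans_lt (hu.trans_le (min_le_right _ _))) ha'
    rwa [hφa, dist_comm] at h4
  obtain ⟨B, H, K, hBQ, hreg, htop, hbij, hinv, hH, hK, hd, hR⟩ :=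
    hcore.exists_approx (lt_min hε (lt_min hδ one_pos))
  have hset : {a ∈ S | a t₀ = 0 ∧ pp a ≠ 0} = {a ∈ S | a t₀ = 0 ∧ a ∉ V} := by
    ext a
    refine and_congr_right fun _ => and_congr_right fun ht => not_congr ?_
    rw [hppV, and_iff_left ht]
  rw [hset] at hbij hinv
  refine ⟨B, H, K, C₀ + 1, hBQ, hreg, htop, hbij, hinv, hH, hK, fun a ha ht => ?_, fun b hb => ?_⟩
  · obtain ⟨h1, h2⟩ := hd a ha ht
    rw [lt_min_iff, lt_min_iff] at h1 h2
    refine ⟨h1.1, fun j => ?_, (hδE a ha ht _ h2.2.1).2⟩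
    have h3 := hC₀ _ ⟨a, ⟨ha, ht⟩, rfl⟩
    have h4 := (dist_le_pi_dist (H a ∘ Sum.inr) (Φ a) j).trans_lt h2.2.2
    have h5 := (norm_le_pi_norm (Φ a) j).trans h3
    rw [Real.dist_eq] at h4
    rw [Real.norm_eq_abs] at h5
    have h6 := abs_sub_abs_le_abs_sub (H a (Sum.inr j)) (Φ a j)
    have h7 : |(H a ∘ Sum.inr) j - Φ a j| = |H a (Sum.inr j) - Φ a j| := rfl
    linarith
  · obtain ⟨a, ⟨ha, ht, -⟩, rfl⟩ := hbij.surjOn hb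
    obtain ⟨h1, h2⟩ := hd a ha ht
    rw [lt_min_iff, lt_min_iff] at h1 h2
    have h3 := (hδE a ha ht _ h2.2.1).1
    obtain ⟨x, hx⟩ := hR _ hb
    exact ⟨h3, hRW _ x hx h3⟩

end Spine

section Pullback

open Filter Topology Matrix Metric

variable {α β : Type*} [Fintype α] [DecidableEq α] [Fintype β] [DecidableEq β]

theorem IsQAlgebraicSet.preimage {B : Set (α → ℝ)} (hB : IsQAlgebraicSet B)
    {T : (β → ℝ) → α → ℝ} (hT : ∀ a, IsQP fun z => T z a) : IsQAlgebraicSet {z | T z ∈ B} := by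
  obtain ⟨s, rfl⟩ := hB
  have := isQAlgebraicSet_of_isQP (J := s) (f := fun p z => aeval (T z) p.1)
    fun p => (IsQP.aeval p.1).comp hT
  convert this using 3 with z
  exact ⟨fun h j => h j.1 j.2, fun h p hp => h ⟨p, hp⟩⟩

theorem IsQRegAt.preimage {c : ℕ} {B : Set (α → ℝ)} {T : (β → ℝ) →L[ℝ] α → ℝ}
    (hT : ∀ a, IsQP fun z => T z a) (hTs : Function.Surjective T) {z : β → ℝ}
    (h : IsQRegAt c B (T z)) : IsQRegAt c {z | T z ∈ B} z := by
  obtain ⟨q, hq, hli, U, hU, haU, hVU⟩ := h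
  choose q' hq' using fun j => (IsQP.aeval (q j)).comp hT
  refine ⟨q', fun j x hx => by rw [← hq']; exact hq j _ hx, ?_, T ⁻¹' U,
    hU.preimage T.continuous, haU, ?_⟩
  · rw [Fintype.linearIndependent_iff] at hli ⊢
    intro g hg
    refine hli g ?_
    have hd : ∀ j v, polyGradQ (q' j) z ⬝ᵥ v = polyGradQ (q j) (T z) ⬝ᵥ T v := fun j v => by
      have h1 := (hasStrictFDerivAt_aeval (q' j) z).hasFDerivAt
      have h2 : HasFDerivAt (fun x => (aeval (T x) (q j) : ℝ))
          ((dotL (polyGradQ (q j) (T z))).comp T) z :=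
        HasFDerivAt.comp (g := fun y => (aeval y (q j) : ℝ)) z
          (hasStrictFDerivAt_aeval (q j) (T z)).hasFDerivAt T.hasFDerivAt
      have h3 : (fun x => (aeval (T x) (q j) : ℝ)) = fun x => aeval x (q' j) :=
        _root_.funext (hq' j)
      rw [h3] at h2
      have h4 := congrArg (fun L => L v) (h1.unique h2)
      simpa only [ContinuousLinearMap.comp_apply, dotL_apply] using h4
    refine dotProduct_eq_zero _ fun w => ?_
    obtain ⟨v, rfl⟩ := hTs w
    have h5 := congrArg (fun u => u ⬝ᵥ v) hg
    simpa only [sum_dotProduct, smul_dotProduct, zero_dotProduct, hd] using h5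
  · ext x
    have := Set.ext_iff.1 hVU (T x)
    refine ⟨fun hx => ⟨hx.2, fun j => ?_⟩, fun hx => this.2 ⟨hx.1, fun j => ?_⟩⟩
    · exact (hq' j x).symm.trans ((this.1 hx).2 j)
    · exact (hq' j x).trans (hx.2 j)

end Pullback

section Base

open Filter Topology Matrix Metric

variable {n d s : ℕ}

theorem inclZero_last (hns : n ≤ s) (hnt : n ≤ s + 1) (x : Fin n → ℝ) :
    inclZero hnt x (Fin.last s) = 0 := by
  simp [inclZero, hns]

theorem eq_inclZero_of_castSucc (hns : n ≤ s) (hnt : n ≤ s + 1) {x : Fin n → ℝ}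
    {z : Fin (s + 1) → ℝ} (hz : (fun j : Fin s => z j.castSucc) = inclZero hns x)
    (ht : z (Fin.last s) = 0) : z = inclZero hnt x := by
  funext j
  refine Fin.lastCases ?_ (fun i => ?_) j
  · rw [ht, inclZero_last hns]
  · exact congrFun hz i

theorem inclZero_castLE {m : ℕ} (hnm : n ≤ m) (x : Fin n → ℝ) (i : Fin n) :
    inclZero hnm x (Fin.castLE hnm i) = x i := by
  simp [inclZero]

theorem isQP_inclZero {m : ℕ} (hnm : n ≤ m) (j : Fin m) :
    IsQP fun x : Fin n → ℝ => inclZero hnm x j := by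
  unfold inclZero
  split_ifs with h
  · exact IsQP.proj _
  · exact IsQP.zero

theorem contDiff_inclZero {m : ℕ} (hnm : n ≤ m) :
    ContDiff ℝ (⊤ : ℕ∞) (inclZero hnm : (Fin n → ℝ) → Fin m → ℝ) :=
  contDiff_pi.2 fun j => (isQP_inclZero hnm j).contDiff

theorem IsSmoothSubmanifold.lt_of_isCompact {S : Set (Fin (s + 1) → ℝ)} (hS : IsCompact S)
    (hSm : IsSmoothSubmanifold (d + 1) S) (hne : S.Nonempty) : d < s := by
  by_contra! hds
  have hop : IsOpen S := isOpen_iff_mem_nhds.2 fun a ha => by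
    obtain ⟨U, f, hU, haU, -, -, hSU⟩ := hSm a ha
    refine mem_of_superset (hU.mem_nhds haU) fun x hx => ?_
    have : x ∈ S ∩ U := by
      rw [hSU]
      refine ⟨hx, _root_.funext fun i => absurd i.2 ?_⟩
      simp only [Fintype.card_fin]
      omega
    exact this.1
  have huniv : S = Set.univ := IsClopen.eq_univ ⟨hS.isClosed, hop⟩ hne
  rw [huniv] at hS
  exact noncompact_univ _ hS

/-- The cylinder over an affine algebraic base of a spine. -/
theorem isSpine_of_cylinder {M : Set (Fin n → ℝ)} (hns : n ≤ s) (hMc : IsCompact M)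
    {Y : Set (Fin s → ℝ)} (hY : IsQNonsingular d Y) (hMY : Disjoint (inclZero hns '' M) Y)
    {S : Set (Fin (s + 1) → ℝ)} (hSc : IsCompact S)
    (hspine : ∀ z : Fin (s + 1) → ℝ, |z (Fin.last s)| < 1 →
      (z ∈ S ↔ (fun j : Fin s => z j.castSucc) ∈ inclZero hns '' M ∪ Y))
    {ρ : (Fin (s + 1) → ℝ) → Fin (s + 1) → ℝ} (hρ : IsTubular (s - d) S S ρ) :
    IsSpine (Fin.last s) (s - d) S {z | (fun j : Fin s => z j.castSucc) ∈ Y} ρ := by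
  let T : (Fin (s + 1) → ℝ) →L[ℝ] Fin s → ℝ := ContinuousLinearMap.pi fun j =>
    ContinuousLinearMap.proj (R := ℝ) (φ := fun _ : Fin (s + 1) => ℝ) j.castSucc
  have hT : ∀ j, IsQP fun z => T z j := fun j => IsQP.proj _
  have hTs : Function.Surjective T := fun x => ⟨Fin.snoc x 0, by
    funext j
    simp [T]⟩
  have hflat : ∀ z : Fin (s + 1) → ℝ, T (flat (Fin.last s) z) = T z := fun z => by
    funext j
    have h1 : j.castSucc ≠ Fin.last s := (Fin.castSucc_lt_last j).ne
    simp [T, flat_eq, h1]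
  have hMcl : IsClosed (inclZero hns '' M) :=
    (hMc.image (contDiff_inclZero hns).continuous).isClosed
  refine ⟨hSc, hρ, fun z hz => ?_, hY.1.preimage hT, fun z => ?_, fun z hz ht => ?_,
    fun a ha ht => ?_, fun a ha _ => ?_⟩
  · rw [hspine z hz, hspine _ (by simp [flat_self])]
    exact iff_of_eq (congrArg (· ∈ inclZero hns '' M ∪ Y) (hflat z).symm)
  · exact iff_of_eq (congrArg (· ∈ Y) (hflat z).symm)
  · exact (hspine z (by simp [ht])).2 (Or.inr hz)
  · have h1 : ∀ᶠ z : Fin (s + 1) → ℝ in 𝓝 a, |z (Fin.last s)| < 1 := by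
      refine ((continuous_apply (Fin.last s)).abs.continuousAt (x := a)).eventually
        (gt_mem_nhds ?_)
      simp [ht]
    have h2 : ∀ᶠ z in 𝓝 a, T z ∉ inclZero hns '' M :=
      T.continuous.continuousAt.eventually
        (hMcl.isOpen_compl.mem_nhds (hMY.notMem_of_mem_right ha))
    filter_upwards [h1, h2] with z hz1 hz2 hzS
    exact ((hspine z hz1).1 hzS).resolve_left hz2
  · have := hY.2.2 (T a) ha
    rw [Fintype.card_fin] at this
    exact IsQRegAt.preimage hT hTs this

theorem IsProjQClosed.exists_equation {Y : Set (Fin s → ℝ)} (hY : IsProjQClosed Y) :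
    ∃ pp kap : (Fin (s + 1) → ℝ) → ℝ, IsQP pp ∧
      (∀ z, pp z = 0 ↔ z ∈ {z : Fin (s + 1) → ℝ | (fun j : Fin s => z j.castSucc) ∈ Y} ∧
        z (Fin.last s) = 0) ∧
      IsQP kap ∧ (∀ z, 0 ≤ kap z) ∧ (∀ z, pp z = 0 → kap z = 0) ∧
      ∃ D T, 1 < D ∧ HasTop kap D T ∧ ∀ x, x ≠ 0 → 0 < T x := by
  obtain ⟨f, T, D, hf, hfY, hT, hT0⟩ := hY.exists_hasTop
  have hc : ∀ j : Fin s, IsQP fun z : Fin (s + 1) → ℝ => z j.castSucc := fun j => IsQP.proj _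
  set f' : (Fin (s + 1) → ℝ) → ℝ := fun z => f fun j => z j.castSucc with hf'
  have hf'Q : IsQP f' := hf.comp hc
  have hf'T : HasTop f' D fun z => T fun j => z j.castSucc :=
    hT.comp_linear (fun z j => z j.castSucc) fun l z => rfl
  have hf'0 : ∀ z, f' z = 0 ↔ (fun j : Fin s => z j.castSucc) ∈ Y := fun z => by
    rw [hfY]
    rfl
  have hppV : ∀ z : Fin (s + 1) → ℝ, f' z ^ 2 + z (Fin.last s) ^ 2 = 0 ↔
      f' z = 0 ∧ z (Fin.last s) = 0 := fun z => by
    rw [add_eq_zero_iff_of_nonneg (sq_nonneg _) (sq_nonneg _), sq_eq_zero_iff, sq_eq_zero_iff]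
  have hN : HasTop (fun z : Fin (s + 1) → ℝ => 1 + ∑ j : Fin s, z j.castSucc ^ 2) (1 * 2)
      fun z => 0 + ∑ j : Fin s, z j.castSucc ^ 2 := by
    refine HasTop.add (HasTop.lower (D := 0) (T := fun _ => 1) (fun x => ?_) (by norm_num))
      (HasTop.sum fun j _ => (HasTop.proj _).pow 2)
    simp
  refine ⟨fun z => f' z ^ 2 + z (Fin.last s) ^ 2, fun z =>
    f' z ^ 2 * (1 + ∑ j : Fin s, z j.castSucc ^ 2) + z (Fin.last s) ^ (2 * (D + 1)),
    (hf'Q.pow 2).add ((IsQP.proj _).pow 2), fun z => ?_,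
    ((hf'Q.pow 2).mul (IsQP.one.add (IsQP.sum fun j _ => (hc j).pow 2))).add
      ((IsQP.proj _).pow _), fun z => ?_, fun z hz => ?_, D * 2 + 1 * 2, fun x =>
    (T fun j => x j.castSucc) ^ 2 * (0 + ∑ j : Fin s, x j.castSucc ^ 2) +
      x (Fin.last s) ^ (2 * (D + 1)), by omega,
    ((hf'T.pow 2).mul hN).add ?_, fun x hx => ?_⟩
  · exact (hppV z).trans (and_congr_left' (hf'0 z))
  · have : 0 ≤ ∑ j : Fin s, z j.castSucc ^ 2 := Finset.sum_nonneg fun _ _ => sq_nonneg _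
    have h2 : 0 ≤ z (Fin.last s) ^ (2 * (D + 1)) := (even_two_mul _).pow_nonneg _
    show 0 ≤ f' z ^ 2 * (1 + ∑ j : Fin s, z j.castSucc ^ 2) + z (Fin.last s) ^ (2 * (D + 1))
    positivity
  · obtain ⟨h1, h2⟩ := (hppV z).1 hz
    show f' z ^ 2 * (1 + ∑ j : Fin s, z j.castSucc ^ 2) + z (Fin.last s) ^ (2 * (D + 1)) = 0
    rw [h1, h2]
    norm_num
  · have := (HasTop.proj (Fin.last s)).pow (2 * (D + 1))
    rwa [show 1 * (2 * (D + 1)) = D * 2 + 1 * 2 by ring] at this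
  · have h0 : 0 ≤ ∑ j : Fin s, x j.castSucc ^ 2 := Finset.sum_nonneg fun _ _ => sq_nonneg _
    have h2 : 0 ≤ x (Fin.last s) ^ (2 * (D + 1)) := (even_two_mul _).pow_nonneg _
    beta_reduce
    rw [zero_add]
    by_cases hx0 : (fun j : Fin s => x j.castSucc) = 0
    · have h3 : x (Fin.last s) ≠ 0 := fun h3 => hx <| by
        funext j
        exact Fin.lastCases h3 (fun i => congrFun hx0 i) j
      have h4 : 0 < x (Fin.last s) ^ (2 * (D + 1)) := (even_two_mul _).pow_pos h3
      positivity
    · have h3 := hT0 _ hx0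
      have h4 : 0 < ∑ j : Fin s, x j.castSucc ^ 2 := by
        refine h0.lt_of_ne fun h4 => hx0 ?_
        funext j
        simpa using (Finset.sum_eq_zero_iff_of_nonneg fun _ _ => sq_nonneg _).1 h4.symm j
          (Finset.mem_univ _)
      have h5 : 0 < T (fun j : Fin s => x j.castSucc) ^ 2 := by positivity
      positivity

end Base

section Rescale

open Filter Topology Metric

variable {α β : Type*} [Fintype α] [DecidableEq α] [Fintype β] [DecidableEq β]

/-- Relabelling the coordinates along `E`, followed by scaling with the weights `w`. -/
noncomputable def rescale (E : α ≃ β) (w : α → ℚ) : (β → ℝ) →L[ℝ] α → ℝ :=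
  ContinuousLinearMap.pi fun a =>
    (w a : ℝ) • ContinuousLinearMap.proj (R := ℝ) (φ := fun _ : β => ℝ) (E a)

theorem rescale_apply (E : α ≃ β) (w : α → ℚ) (z : β → ℝ) (a : α) :
    rescale E w z a = w a * z (E a) := rfl

theorem isQP_rescale (E : α ≃ β) (w : α → ℚ) (a : α) : IsQP fun z => rescale E w z a :=
  (IsQP.rat (w a)).mul (IsQP.proj (E a))

/-- The inverse of `rescale`. -/
noncomputable def unscale (E : α ≃ β) (w : α → ℚ) (b : α → ℝ) : β → ℝ :=
  fun j => (w (E.symm j) : ℝ)⁻¹ * b (E.symm j)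

theorem rescale_unscale {E : α ≃ β} {w : α → ℚ} (hw : ∀ a, w a ≠ 0) (b : α → ℝ) :
    rescale E w (unscale E w b) = b := by
  funext a
  have : (w a : ℝ) ≠ 0 := by exact_mod_cast hw a
  simp [rescale_apply, unscale, this]

theorem unscale_rescale {E : α ≃ β} {w : α → ℚ} (hw : ∀ a, w a ≠ 0) (z : β → ℝ) :
    unscale E w (rescale E w z) = z := by
  funext j
  have : (w (E.symm j) : ℝ) ≠ 0 := by exact_mod_cast hw _
  simp [rescale_apply, unscale, this]

theorem contDiff_unscale (E : α ≃ β) (w : α → ℚ) :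
    ContDiff ℝ (⊤ : ℕ∞) (unscale E w) :=
  contDiff_pi.2 fun _ => contDiff_const.mul (contDiff_apply _ _ _)

theorem IsQRegularMap.empty {κ : Type*} [Fintype κ] (g : (α → ℝ) → κ → ℝ) :
    IsQRegularMap ∅ g :=
  fun _ => ⟨0, 0, fun _ h => h.elim, fun _ h => h.elim⟩

theorem isQAlgebraicSet_empty : IsQAlgebraicSet (∅ : Set (α → ℝ)) :=
  ⟨{1}, by ext x; simp⟩

theorem isQNonsingular_empty {d : ℕ} : IsQNonsingular d (∅ : Set (α → ℝ)) :=
  ⟨isQAlgebraicSet_empty, fun _ h => h.elim, fun _ h => h.elim⟩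

theorem isProjQClosed_empty : IsProjQClosed (∅ : Set (α → ℝ)) := by
  refine isProjQClosed_of_hasTop (f := fun _ => 1) (T := fun _ => 1) (D := 0) IsQP.one
    (by ext x; simp) (fun x => by simp) fun _ _ => one_ne_zero

theorem isSmoothDiffeoOn_empty {κ : Type*} [Fintype κ] (f : (α → ℝ) → κ → ℝ) :
    IsSmoothDiffeoOn f ∅ ∅ :=
  ⟨⟨fun _ h => h.elim, fun _ h => h.elim, fun _ h => h.elim⟩, fun _ h => h.elim,
    fun _ _ => 0, fun _ h => h.elim, fun _ h => h.elim, fun _ h => h.elim⟩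

end Rescale

/-- **`ℚ`-algebraic approximation along a spine with values in a `ℚ`-nonsingular
target.** -/
theorem q_algebraic_approximation_along_spine
    {n d s q e : ℕ} (hns : n ≤ s)
    (M : Set (Fin n → ℝ)) (hMc : IsCompact M) (hM : IsSmoothSubmanifold d M)
    (Y : Set (Fin s → ℝ)) (hY1 : IsProjQClosed Y) (hY2 : IsQNonsingular d Y)
    (hMY : Disjoint (inclZero hns '' M) Y)
    (S : Set (Fin (s + 1) → ℝ)) (hSc : IsCompact S)
    (hSm : IsSmoothSubmanifold (d + 1) S)
    (hspine : ∀ z : Fin (s + 1) → ℝ, |z (Fin.last s)| < 1 →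
      (z ∈ S ↔ (fun j : Fin s => z j.castSucc) ∈ inclZero hns '' M ∪ Y))
    (W : Set (Fin q → ℝ)) (hW : IsQNonsingular e W)
    (φ : (Fin (s + 1) → ℝ) → Fin q → ℝ)
    (hφ : ContDiffOn ℝ (⊤ : ℕ∞) φ S) (hφW : Set.MapsTo φ S W)
    (hφQ : IsQRegularMap
      {z : Fin (s + 1) → ℝ | (fun j : Fin s => z j.castSucc) ∈ Y ∧ z (Fin.last s) = 0} φ)
    (ε : ℝ) (hε : 0 < ε) :
    ∃ (k : ℕ) (Z : Set (Fin (s + 1 + k) → ℝ)) (dZ : ℕ)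
      (M' : Set (Fin (s + 1 + k) → ℝ))
      (h : (Fin n → ℝ) → Fin (s + 1 + k) → ℝ)
      (η : (Fin (s + 1 + k) → ℝ) → Fin q → ℝ),
      IsQNonsingular dZ Z ∧
      IsProjQClosed M' ∧ IsQNonsingular d M' ∧ M' ⊆ Z ∧
      IsSmoothDiffeoOn h M M' ∧
      IsQRegularMap Z η ∧ Set.MapsTo η Z W ∧
      ∀ x ∈ M, dist (h x) (inclZero (by omega : n ≤ s + 1 + k) x) < ε ∧
        dist (η (h x)) (φ (inclZero (by omega : n ≤ s + 1) x)) < ε := by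
  rcases M.eq_empty_or_nonempty with rfl | ⟨x₀, hx₀⟩
  · exact ⟨0, ∅, 0, ∅, 0, 0, isQNonsingular_empty, isProjQClosed_empty, isQNonsingular_empty,
      subset_rfl, isSmoothDiffeoOn_empty _, IsQRegularMap.empty _, fun _ h => h.elim,
      fun _ h => h.elim⟩
  have hnt : n ≤ s + 1 := by omega
  have hMS : ∀ x ∈ M, inclZero hnt x ∈ S := fun x hx =>
    (hspine _ (by simp [inclZero_last hns])).2 (Or.inl ⟨x, hx, rfl⟩)
  have hds : d < s := hSm.lt_of_isCompact hSc ⟨_, hMS x₀ hx₀⟩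
  obtain ⟨ρ, hρ⟩ := exists_isTubular (c := s - d) hSc subset_rfl fun a ha => by
    have := hSm.isLocallyCut ha
    rwa [Fintype.card_fin, Nat.add_sub_add_right] at this
  have hsp := isSpine_of_cylinder hns hMc hY2 hMY hSc hspine hρ
  obtain ⟨pp, kap, hpp, hppV, hkap, hkap0, hkapV, hkapT⟩ := hY1.exists_equation
  obtain ⟨B, H, K, C, hB, hBreg, ⟨F, D, T, hF, hBF, hFT, hT0⟩, hbij, hinv, hHs, hKs, hHa, hBW⟩ :=
    hsp.exists_approx hW hφ hφW hφQ hpp hppV hkap hkap0 hkapV hkapT hε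
  have hbase : {a ∈ S | a (Fin.last s) = 0 ∧ a ∉ {z : Fin (s + 1) → ℝ | (fun j : Fin s => z j.castSucc) ∈ Y}}
      = inclZero hnt '' M := by
    ext a
    constructor
    · rintro ⟨haS, hat, haY⟩
      obtain ⟨x, hx, hxa⟩ := ((hspine a (by rw [hat]; simp)).1 haS).resolve_right haY
      exact ⟨x, hx, (eq_inclZero_of_castSucc hns hnt hxa.symm hat).symm⟩
    · rintro ⟨x, hx, rfl⟩
      exact ⟨hMS x hx, inclZero_last hns hnt x, hMY.notMem_of_mem_left ⟨x, hx, rfl⟩⟩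
  rw [hbase] at hbij hinv
  obtain ⟨N, hN⟩ := exists_nat_gt (|C| / ε)
  have hN0 : (0 : ℝ) < N := (by positivity : 0 ≤ |C| / ε).trans_lt hN
  let κ₀ := Option (Fin q) ⊕ Fin (s + 1) × Fin (s + 1)
  let E : Fin (s + 1) ⊕ κ₀ ≃ Fin (s + 1 + Fintype.card κ₀) :=
    (Equiv.sumCongr (Equiv.refl _) (Fintype.equivFin κ₀)).trans finSumFinEquiv
  let w : Fin (s + 1) ⊕ κ₀ → ℚ := Sum.elim (fun _ => 1) fun _ => N
  have hw : ∀ a, w a ≠ 0 := by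
    rintro (a | a)
    · exact one_ne_zero
    · exact Nat.cast_ne_zero.2 fun h0 => hN0.ne' (by rw [h0, Nat.cast_zero])
  set Λ := unscale E w with hΛ
  set R := rescale E w with hR
  have hRΛ : ∀ b, R (Λ b) = b := rescale_unscale hw
  have hΛR : ∀ z, Λ (R z) = z := unscale_rescale hw
  have hcard : Fintype.card (Fin (s + 1 + Fintype.card κ₀)) - d =
      Fintype.card (Fin (s + 1) ⊕ κ₀) - (Fintype.card (Fin (s + 1)) - (s - d + 1)) := by
    simp only [Fintype.card_fin, Fintype.card_sum]
    omega
  have hZ : IsQNonsingular d {z | R z ∈ B} := by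
    refine isQNonsingular_of_isQRegAt (hB.preimage (isQP_rescale E w)) fun a ha => ?_
    rw [hcard]
    exact (hBreg _ ha).preimage (isQP_rescale E w) fun b => ⟨Λ b, hRΛ b⟩
  have hZc : IsProjQClosed {z | R z ∈ B} := by
    refine isProjQClosed_of_hasTop (f := fun z => F (R z)) (T := fun z => T (R z)) (D := D)
      (hF.comp (isQP_rescale E w)) (by rw [hBF]; rfl)
      (hFT.comp_linear R fun l x => R.map_smul l x) fun x hx => hT0 _ fun h0 => hx ?_
    rw [← hΛR x, h0, ← R.map_zero, hΛR]
  have hnm : n ≤ s + 1 + Fintype.card κ₀ := by omega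
  have hinj : Function.Injective (inclZero hnt) := fun x y hxy => by
    funext i
    have := congrFun hxy (Fin.castLE hnt i)
    rwa [inclZero_castLE, inclZero_castLE] at this
  refine ⟨Fintype.card κ₀, {z | R z ∈ B}, d, {z | R z ∈ B}, fun x => Λ (H (inclZero hnt x)),
    fun z i => z (E (Sum.inr (Sum.inl (some i)))) / z (E (Sum.inr (Sum.inl none))),
    hZ, hZc, hZ, subset_rfl, ⟨⟨?_, ?_, ?_⟩, ?_, fun z i => K (R z) (Fin.castLE hnt i), ?_, ?_, ?_⟩,
    ?_, ?_, ?_⟩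
  · intro x hx
    show R (Λ _) ∈ B
    rw [hRΛ]
    exact hbij.1 ⟨x, hx, rfl⟩
  · intro x hx y hy hxy
    refine hinj (hbij.2.1 ⟨x, hx, rfl⟩ ⟨y, hy, rfl⟩ ?_)
    rw [← hRΛ (H (inclZero hnt x)), ← hRΛ (H (inclZero hnt y))]
    exact congrArg R hxy
  · intro z hz
    obtain ⟨a, ⟨x, hx, rfl⟩, hxz⟩ := hbij.2.2 hz
    exact ⟨x, hx, by show Λ (H _) = z; rw [hxz, hΛR]⟩
  · intro x hx
    have h1 := (hHs _ (hMS x hx) (inclZero_last hns hnt x)).self_of_nhds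
    exact ((contDiff_unscale E w).contDiffAt.comp x
      (h1.comp x (contDiff_inclZero hnt).contDiffAt)).contDiffWithinAt
  · intro z hz
    have h1 := (hKs _ hz).self_of_nhds.comp z R.contDiff.contDiffAt
    exact (contDiffAt_pi.2 fun i => contDiffAt_pi.1 h1 _).contDiffWithinAt
  · intro x hx
    funext i
    show K (R (Λ _)) _ = _
    rw [hRΛ, hinv.1 ⟨x, hx, rfl⟩, inclZero_castLE]
  · intro z hz
    obtain ⟨a, ⟨x, hx, rfl⟩, hxz⟩ := hbij.2.2 hz
    have h1 : (fun i => K (R z) (Fin.castLE hnt i)) = x := by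
      funext i
      rw [← hxz, hinv.1 ⟨x, hx, rfl⟩, inclZero_castLE]
    show Λ (H (inclZero hnt fun i => K (R z) (Fin.castLE hnt i))) = z
    rw [h1, hxz, hΛR]
  · intro i
    refine ⟨X (E (Sum.inr (Sum.inl (some i)))), X (E (Sum.inr (Sum.inl none))), fun z hz => ?_,
      fun z hz => by simp⟩
    have h1 := (hBW _ hz).1
    rw [hR, rescale_apply] at h1
    simpa using right_ne_zero_of_mul h1
  · intro z hz
    have h1 := (hBW _ hz).2
    convert h1 using 2 with i
    exact (mul_div_mul_left _ _ hN0.ne').symm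
  · intro x hx
    obtain ⟨h1, h2, h3⟩ := hHa _ (hMS x hx) (inclZero_last hns hnt x)
    constructor
    · rw [dist_pi_lt_iff hε] at h1 ⊢
      intro j
      beta_reduce
      obtain ⟨a | a, rfl⟩ := E.surjective j
      · have h4 : Λ (H (inclZero hnt x)) (E (Sum.inl a)) = H (inclZero hnt x) (Sum.inl a) := by
          simp [hΛ, unscale, w]
        have h5 : inclZero hnm x (E (Sum.inl a)) = inclZero hnt x a := by
          simp [inclZero, E]
        rw [h4, h5]
        exact h1 a
      · have h4 : Λ (H (inclZero hnt x)) (E (Sum.inr a)) =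
            (N : ℝ)⁻¹ * H (inclZero hnt x) (Sum.inr a) := by
          simp [hΛ, unscale, w]
        have h5 : inclZero hnm x (E (Sum.inr a)) = 0 := by
          have : ¬ ((E (Sum.inr a) : Fin _) : ℕ) < n := by
            simp only [E, Equiv.trans_apply, Equiv.sumCongr_apply, Sum.map_inr,
              finSumFinEquiv_apply_right, Fin.val_natAdd]
            omega
          exact dif_neg this
        rw [h4, h5, Real.dist_eq, sub_zero, abs_mul, abs_inv, abs_of_pos hN0,
          inv_mul_lt_iff₀ hN0]
        rw [div_lt_iff₀ hε] at hN
        exact ((h2 a).trans (le_abs_self C)).trans_lt hN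
    · convert h3 using 2
      funext i
      have h4 : ∀ a, Λ (H (inclZero hnt x)) (E (Sum.inr a)) =
          (N : ℝ)⁻¹ * H (inclZero hnt x) (Sum.inr a) := fun a => by
        simp [hΛ, unscale, w]
      beta_reduce
      rw [h4, h4]
      exact mul_div_mul_left _ _ (inv_ne_zero hN0.ne')
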